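/- Suppose |1−χ| = O(ε), Re < Re₀ and ε ≤ ε₂. Then there exists a positive constant N₂ depending only on Re, Pr, μ′/μ and γ such that if N̂ ≤ N₂, then for all t ∈ [0,T]: ε⁴A₅(t) ≤ C(ε⁴A₅(0) + ε²A₃(0) + ε²A₄(0) + A₁(0) + A₂(0) + ε⁻²A₀(0)), where C depends only on Re, Pr, μ′/μ and γ. -/

import Mathlib

noncomputable section

open MeasureTheory Real Filter Topology

namespace Couette

/-- The periodic cell of the horizontally periodic layer `Ω = 𝕊¹ × (0,1)`. -/
def Ω : Set (ℝ × ℝ) := {x : ℝ × ℝ | x.1 ∈ Set.Ioo 0 (2 * π) ∧ x.2 ∈ Set.Ioo 0 1}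

variable {F : Type*} [NormedAddCommGroup F] [NormedSpace ℝ F]

/-- Partial derivative in the horizontal direction `x₁`. -/
def d1 (f : ℝ × ℝ → F) (x : ℝ × ℝ) : F := fderiv ℝ f x (1, 0)

/-- Partial derivative in the vertical direction `x₂`. -/
def d2 (f : ℝ × ℝ → F) (x : ℝ × ℝ) : F := fderiv ℝ f x (0, 1)

/-- Time derivative of a time-dependent field. -/
def dt (f : ℝ → ℝ × ℝ → F) (t : ℝ) (x : ℝ × ℝ) : F := deriv (fun s => f s x) t

/-- Divergence of a (two-dimensional) vector field. -/
def divv (v : ℝ × ℝ → ℝ × ℝ) (x : ℝ × ℝ) : ℝ :=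
  d1 (fun y => (v y).1) x + d2 (fun y => (v y).2) x

/-- Gradient of a scalar field. -/
def grad (f : ℝ × ℝ → ℝ) (x : ℝ × ℝ) : ℝ × ℝ := (d1 f x, d2 f x)

/-- Laplacian. -/
def lap (f : ℝ × ℝ → F) (x : ℝ × ℝ) : F := d1 (d1 f) x + d2 (d2 f) x

/-- Euclidean inner product on `ℝ²`. -/
def dot (a b : ℝ × ℝ) : ℝ := a.1 * b.1 + a.2 * b.2

/-- The contraction `𝔇(v) : 𝔇(w)` of deformation tensors, where
`𝔇(v) = (∇v + (∇v)ᵀ)/2`. -/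
def defContract (v w : ℝ × ℝ → ℝ × ℝ) (x : ℝ × ℝ) : ℝ :=
  d1 (fun y => (v y).1) x * d1 (fun y => (w y).1) x
    + d2 (fun y => (v y).2) x * d2 (fun y => (w y).2) x
    + 2 * ((d1 (fun y => (v y).2) x + d2 (fun y => (v y).1) x) / 2)
        * ((d1 (fun y => (w y).2) x + d2 (fun y => (w y).1) x) / 2)

/-- Squared `L²(Ω)` norm of the `j`-th spatial derivative. -/
def dSq (j : ℕ) (f : ℝ × ℝ → F) : ℝ := ∫ x in Ω, ‖iteratedFDeriv ℝ j f x‖ ^ 2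

/-- Squared `L²(Ω)` norm. -/
def L2Sq (f : ℝ × ℝ → F) : ℝ := dSq 0 f

/-- Squared `Hᵏ(Ω)` norm. -/
def HSq (k : ℕ) (f : ℝ × ℝ → F) : ℝ := ∑ j ∈ Finset.range (k + 1), dSq j f

/-- `L∞(Ω)` (sup) norm. -/
def LinfSup (f : ℝ × ℝ → F) : ℝ := ⨆ x ∈ Ω, ‖f x‖

/-- Membership in the Sobolev space `Hᵏ(Ω)`. -/
def MemH (k : ℕ) (f : ℝ × ℝ → F) : Prop :=
  ∀ j ≤ k, IntegrableOn (fun x => ‖iteratedFDeriv ℝ j f x‖ ^ 2) Ω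

/-- Continuity in time, with values in `Hᵏ(Ω)`, on the time set `s`. -/
def ContInH (k : ℕ) (f : ℝ → ℝ × ℝ → F) (s : Set ℝ) : Prop :=
  (∀ t ∈ s, MemH k (f t)) ∧
    ∀ t₀ ∈ s, Tendsto (fun t => HSq k (fun x => f t x - f t₀ x)) (nhdsWithin t₀ s) (nhds 0)

/-- Square integrability in time, with values in `Hᵏ(Ω)`, on the time set `s`. -/
def L2InH (k : ℕ) (f : ℝ → ℝ × ℝ → F) (s : Set ℝ) : Prop :=
  IntegrableOn (fun t => HSq k (f t)) s

/-- Temperature `𝒯̃` of the non-dimensional plane Couette flow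
(here `C_p = γ/(γ-1)`, the gas constant being normalized to `R = 1`). -/
def tT (γ Pr ε χ : ℝ) (x : ℝ × ℝ) : ℝ :=
  χ + (1 - χ) * x.2 - ε ^ 2 * Pr / (2 * (γ / (γ - 1))) * (x.2 ^ 2 - x.2)

/-- Density `ρ̃ = 𝒯̃⁻¹` of the plane Couette flow. -/
def tρ (γ Pr ε χ : ℝ) (x : ℝ × ℝ) : ℝ := (tT γ Pr ε χ x)⁻¹

/-- Velocity `ũ = (x₂, 0)` of the plane Couette flow. -/
def tu (x : ℝ × ℝ) : ℝ × ℝ := (x.2, 0)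

/-- Total density `ρ = ρ̃ + φ`. -/
def pρ (γ Pr ε χ : ℝ) (φ : ℝ → ℝ × ℝ → ℝ) (t : ℝ) (x : ℝ × ℝ) : ℝ := tρ γ Pr ε χ x + φ t x

/-- Total temperature `𝒯 = 𝒯̃ + θ`. -/
def pT (γ Pr ε χ : ℝ) (θ : ℝ → ℝ × ℝ → ℝ) (t : ℝ) (x : ℝ × ℝ) : ℝ := tT γ Pr ε χ x + θ t x

/-- Total velocity `u = ũ + ψ`. -/
def pu (ψ : ℝ → ℝ × ℝ → ℝ × ℝ) (t : ℝ) (x : ℝ × ℝ) : ℝ × ℝ := tu x + ψ t x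

/-- A classical solution `(φ, ψ, θ) = (ρ - ρ̃, u - ũ, 𝒯 - 𝒯̃)` of the perturbation
system around the plane Couette flow on `Ω × [0,T]`, with non-slip and isothermal
boundary conditions and periodicity in `x₁`.  Here `μ = 1/Re`, `μ' = r·μ`
(`r = μ'/μ = ν'/ν`), and `κ = C_p/(Re·Pr)` with `C_p = γ/(γ-1)`. -/
structure PerturbSol (γ Pr r Re ε χ T : ℝ) where
  φ : ℝ → ℝ × ℝ → ℝ
  ψ : ℝ → ℝ × ℝ → ℝ × ℝ
  θ : ℝ → ℝ × ℝ → ℝ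
  mass_eq : ∀ t ∈ Set.Icc (0 : ℝ) T, ∀ x ∈ Ω,
    dt φ t x + dot (pu ψ t x) (grad (φ t) x) + pρ γ Pr ε χ φ t x * divv (ψ t) x
      + dot (ψ t x) (grad (tρ γ Pr ε χ) x) = 0
  mom_eq1 : ∀ t ∈ Set.Icc (0 : ℝ) T, ∀ x ∈ Ω,
    pρ γ Pr ε χ φ t x * ((dt ψ t x).1 + dot (pu ψ t x) (grad (fun y => (ψ t y).1) x)
        + dot (ψ t x) (grad (fun y => (tu y).1) x))
      + (ε ^ 2)⁻¹ * d1 (fun y => pρ γ Pr ε χ φ t y * pT γ Pr ε χ θ t y) x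
      - Re⁻¹ * lap (fun y => (ψ t y).1) x
      - (Re⁻¹ + r * Re⁻¹) * d1 (divv (ψ t)) x = 0
  mom_eq2 : ∀ t ∈ Set.Icc (0 : ℝ) T, ∀ x ∈ Ω,
    pρ γ Pr ε χ φ t x * ((dt ψ t x).2 + dot (pu ψ t x) (grad (fun y => (ψ t y).2) x)
        + dot (ψ t x) (grad (fun y => (tu y).2) x))
      + (ε ^ 2)⁻¹ * d2 (fun y => pρ γ Pr ε χ φ t y * pT γ Pr ε χ θ t y) x
      - Re⁻¹ * lap (fun y => (ψ t y).2) x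
      - (Re⁻¹ + r * Re⁻¹) * d2 (divv (ψ t)) x = 0
  energy_eq : ∀ t ∈ Set.Icc (0 : ℝ) T, ∀ x ∈ Ω,
    pρ γ Pr ε χ φ t x / (γ - 1) * (dt θ t x + dot (pu ψ t x) (grad (θ t) x)
        + dot (ψ t x) (grad (tT γ Pr ε χ) x))
      + pρ γ Pr ε χ φ t x * pT γ Pr ε χ θ t x * divv (ψ t) x
      - γ / (γ - 1) / (Re * Pr) * lap (θ t) x
      = ε ^ 2 * (2 * Re⁻¹ * defContract (ψ t) (ψ t) x
          + 4 * Re⁻¹ * defContract tu (ψ t) x + r * Re⁻¹ * (divv (ψ t) x) ^ 2)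
  bc_ψ : ∀ t ∈ Set.Icc (0 : ℝ) T, ∀ x : ℝ × ℝ, (x.2 = 0 ∨ x.2 = 1) → ψ t x = 0
  bc_θ : ∀ t ∈ Set.Icc (0 : ℝ) T, ∀ x : ℝ × ℝ, (x.2 = 0 ∨ x.2 = 1) → θ t x = 0
  periodic_φ : ∀ t x, φ t (x.1 + 2 * π, x.2) = φ t x
  periodic_ψ : ∀ t x, ψ t (x.1 + 2 * π, x.2) = ψ t x
  periodic_θ : ∀ t x, θ t (x.1 + 2 * π, x.2) = θ t x

/-- Smoothness (in time and space) of a solution of the perturbation system. -/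
def SmoothSol {γ Pr r Re ε χ T : ℝ} (S : PerturbSol γ Pr r Re ε χ T) : Prop :=
  ContDiff ℝ (⊤ : ℕ∞) (Function.uncurry S.φ) ∧ ContDiff ℝ (⊤ : ℕ∞) (Function.uncurry S.ψ) ∧
    ContDiff ℝ (⊤ : ℕ∞) (Function.uncurry S.θ)

/-- Standing hypotheses on a solution of the perturbation system: initial regularity
`(φ₀, ψ₀, θ₀) ∈ H³`, zero average of the initial density perturbation, and the
compatibility conditions `∂tψ(0) = ∂tθ(0) = 0` on `∂Ω`. -/
def StdHyp {γ Pr r Re ε χ T : ℝ} (S : PerturbSol γ Pr r Re ε χ T) : Prop :=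
  MemH 3 (S.φ 0) ∧ MemH 3 (S.ψ 0) ∧ MemH 3 (S.θ 0) ∧
    (∫ x in Ω, S.φ 0 x) = 0 ∧
    ∀ x : ℝ × ℝ, (x.2 = 0 ∨ x.2 = 1) → dt S.ψ 0 x = 0 ∧ dt S.θ 0 x = 0

/-- The energy functional `A₀`. -/
def A0 (ε : ℝ) (φ : ℝ → ℝ × ℝ → ℝ) (ψ : ℝ → ℝ × ℝ → ℝ × ℝ) (θ : ℝ → ℝ × ℝ → ℝ)
    (t : ℝ) : ℝ :=
  (⨆ s ∈ Set.Icc (0 : ℝ) t,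
      (L2Sq (ψ s) + (ε ^ 2)⁻¹ * L2Sq (φ s) + (ε ^ 2)⁻¹ * L2Sq (θ s)))
    + ∫ s in (0 : ℝ)..t, (HSq 1 (ψ s) + (ε ^ 2)⁻¹ * HSq 1 (θ s))

/-- The energy functional `A₁`. -/
def A1 (ε : ℝ) (φ : ℝ → ℝ × ℝ → ℝ) (ψ : ℝ → ℝ × ℝ → ℝ × ℝ) (θ : ℝ → ℝ × ℝ → ℝ)
    (t : ℝ) : ℝ :=
  (⨆ s ∈ Set.Icc (0 : ℝ) t, (dSq 1 (ψ s) + (ε ^ 2)⁻¹ * dSq 1 (θ s)))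
    + ∫ s in (0 : ℝ)..t, (L2Sq (dt ψ s) + (ε ^ 2)⁻¹ * L2Sq (dt θ s))

/-- The energy functional `A₂`. -/
def A2 (ε : ℝ) (φ : ℝ → ℝ × ℝ → ℝ) (ψ : ℝ → ℝ × ℝ → ℝ × ℝ) (θ : ℝ → ℝ × ℝ → ℝ)
    (t : ℝ) : ℝ :=
  (ε ^ 2)⁻¹ * (⨆ s ∈ Set.Icc (0 : ℝ) t, dSq 1 (φ s))
    + (∫ s in (0 : ℝ)..t, ((ε ^ 4)⁻¹ * HSq 1 (φ s) + (ε ^ 2)⁻¹ * L2Sq (dt φ s)))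
    + ∫ s in (0 : ℝ)..t, (HSq 2 (ψ s) + (ε ^ 2)⁻¹ * HSq 2 (θ s))

/-- The energy functional `A₃`. -/
def A3 (ε : ℝ) (φ : ℝ → ℝ × ℝ → ℝ) (ψ : ℝ → ℝ × ℝ → ℝ × ℝ) (θ : ℝ → ℝ × ℝ → ℝ)
    (t : ℝ) : ℝ :=
  (⨆ s ∈ Set.Icc (0 : ℝ) t,
      ((ε ^ 2)⁻¹ * L2Sq (dt φ s) + L2Sq (dt ψ s) + (ε ^ 2)⁻¹ * L2Sq (dt θ s)))
    + ∫ s in (0 : ℝ)..t, (dSq 1 (dt ψ s) + (ε ^ 2)⁻¹ * dSq 1 (dt θ s))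

/-- The energy functional `A₄`. -/
def A4 (ε : ℝ) (φ : ℝ → ℝ × ℝ → ℝ) (ψ : ℝ → ℝ × ℝ → ℝ × ℝ) (θ : ℝ → ℝ × ℝ → ℝ)
    (t : ℝ) : ℝ :=
  (⨆ s ∈ Set.Icc (0 : ℝ) t,
      ((ε ^ 2)⁻¹ * dSq 2 (φ s) + dSq 2 (ψ s) + (ε ^ 2)⁻¹ * dSq 2 (θ s)))
    + ∫ s in (0 : ℝ)..t, ((ε ^ 4)⁻¹ * HSq 2 (φ s) + HSq 3 (ψ s) + (ε ^ 2)⁻¹ * HSq 3 (θ s))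

/-- The energy functional `A₅`. -/
def A5 (ε : ℝ) (φ : ℝ → ℝ × ℝ → ℝ) (ψ : ℝ → ℝ × ℝ → ℝ × ℝ) (θ : ℝ → ℝ × ℝ → ℝ)
    (t : ℝ) : ℝ :=
  (⨆ s ∈ Set.Icc (0 : ℝ) t,
      ((ε ^ 2)⁻¹ * dSq 3 (φ s) + (dSq 3 (ψ s) + dSq 1 (dt ψ s))
        + (ε ^ 2)⁻¹ * (dSq 3 (θ s) + dSq 1 (dt θ s))))
    + ∫ s in (0 : ℝ)..t, (L2Sq (dt (dt ψ) s) + (ε ^ 2)⁻¹ * L2Sq (dt (dt θ) s))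

/-- The total weighted energy functional `N(t)`. -/
def Nfun (ε : ℝ) (φ : ℝ → ℝ × ℝ → ℝ) (ψ : ℝ → ℝ × ℝ → ℝ × ℝ) (θ : ℝ → ℝ × ℝ → ℝ)
    (t : ℝ) : ℝ :=
  (ε ^ 2)⁻¹ * A0 ε φ ψ θ t + A1 ε φ ψ θ t + A2 ε φ ψ θ t
    + ε ^ 2 * A3 ε φ ψ θ t + ε ^ 2 * A4 ε φ ψ θ t + ε ^ 4 * A5 ε φ ψ θ t

/-- The relative entropy
`η = (ε²ρ/𝒯̃)|ψ|² + (ρ/(γ-1))(𝒯/𝒯̃ - ln(𝒯/𝒯̃) - 1) + ρ(τ/τ̃ - ln(τ/τ̃) - 1)`,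
where `τ = 1/ρ`, `τ̃ = 1/ρ̃`. -/
def relEnt (γ Pr ε χ : ℝ) (φ θ : ℝ → ℝ × ℝ → ℝ) (ψ : ℝ → ℝ × ℝ → ℝ × ℝ)
    (t : ℝ) (x : ℝ × ℝ) : ℝ :=
  ε ^ 2 * pρ γ Pr ε χ φ t x / tT γ Pr ε χ x * ‖ψ t x‖ ^ 2
    + pρ γ Pr ε χ φ t x / (γ - 1) *
        (pT γ Pr ε χ θ t x / tT γ Pr ε χ x
          - Real.log (pT γ Pr ε χ θ t x / tT γ Pr ε χ x) - 1)
    + pρ γ Pr ε χ φ t x *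
        ((pρ γ Pr ε χ φ t x)⁻¹ / (tρ γ Pr ε χ x)⁻¹
          - Real.log ((pρ γ Pr ε χ φ t x)⁻¹ / (tρ γ Pr ε χ x)⁻¹) - 1)

/-- A classical solution `(ρ, u, 𝒯)` of the non-dimensional full compressible
Navier–Stokes system on `Ω × (0,∞)`, with non-slip and isothermal boundary
conditions and periodicity in `x₁`. -/
structure FullSol (γ Pr r Re ε χ : ℝ) where
  rho : ℝ → ℝ × ℝ → ℝ
  vel : ℝ → ℝ × ℝ → ℝ × ℝ
  temp : ℝ → ℝ × ℝ → ℝ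
  mass_eq : ∀ t ∈ Set.Ioi (0 : ℝ), ∀ x ∈ Ω,
    dt rho t x + divv (fun y => rho t y • vel t y) x = 0
  mom_eq1 : ∀ t ∈ Set.Ioi (0 : ℝ), ∀ x ∈ Ω,
    rho t x * ((dt vel t x).1 + dot (vel t x) (grad (fun y => (vel t y).1) x))
      + (ε ^ 2)⁻¹ * d1 (fun y => rho t y * temp t y) x
      = Re⁻¹ * lap (fun y => (vel t y).1) x + (Re⁻¹ + r * Re⁻¹) * d1 (divv (vel t)) x
  mom_eq2 : ∀ t ∈ Set.Ioi (0 : ℝ), ∀ x ∈ Ω,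
    rho t x * ((dt vel t x).2 + dot (vel t x) (grad (fun y => (vel t y).2) x))
      + (ε ^ 2)⁻¹ * d2 (fun y => rho t y * temp t y) x
      = Re⁻¹ * lap (fun y => (vel t y).2) x + (Re⁻¹ + r * Re⁻¹) * d2 (divv (vel t)) x
  energy_eq : ∀ t ∈ Set.Ioi (0 : ℝ), ∀ x ∈ Ω,
    rho t x / (γ - 1) * (dt temp t x + dot (vel t x) (grad (temp t) x))
      + rho t x * temp t x * divv (vel t) x
      = γ / (γ - 1) / (Re * Pr) * lap (temp t) x
        + ε ^ 2 * (2 * Re⁻¹ * defContract (vel t) (vel t) x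
            + r * Re⁻¹ * (divv (vel t) x) ^ 2)
  bc_top : ∀ t ∈ Set.Ioi (0 : ℝ), ∀ x : ℝ × ℝ, x.2 = 1 →
    vel t x = (1, 0) ∧ temp t x = 1
  bc_bot : ∀ t ∈ Set.Ioi (0 : ℝ), ∀ x : ℝ × ℝ, x.2 = 0 →
    vel t x = 0 ∧ temp t x = χ
  periodic_rho : ∀ t x, rho t (x.1 + 2 * π, x.2) = rho t x
  periodic_vel : ∀ t x, vel t (x.1 + 2 * π, x.2) = vel t x
  periodic_temp : ∀ t x, temp t (x.1 + 2 * π, x.2) = temp t x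

/-- `∂tφ(0)`, defined from the initial data by taking `t = 0` in the mass equation
of the perturbation system. -/
def dtφ0 (γ Pr ε χ : ℝ) (φ₀ : ℝ × ℝ → ℝ) (ψ₀ : ℝ × ℝ → ℝ × ℝ) (x : ℝ × ℝ) : ℝ :=
  -(dot (tu x + ψ₀ x) (grad φ₀ x) + (tρ γ Pr ε χ x + φ₀ x) * divv ψ₀ x
      + dot (ψ₀ x) (grad (tρ γ Pr ε χ) x))

/-- `∂tψ(0)`, defined from the initial data by taking `t = 0` in the momentum
equation of the perturbation system. -/
def dtψ0 (γ Pr r Re ε χ : ℝ) (φ₀ θ₀ : ℝ × ℝ → ℝ) (ψ₀ : ℝ × ℝ → ℝ × ℝ)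
    (x : ℝ × ℝ) : ℝ × ℝ :=
  ((tρ γ Pr ε χ x + φ₀ x)⁻¹ *
      (Re⁻¹ * lap (fun y => (ψ₀ y).1) x + (Re⁻¹ + r * Re⁻¹) * d1 (divv ψ₀) x
        - (ε ^ 2)⁻¹ * d1 (fun y => (tρ γ Pr ε χ y + φ₀ y) * (tT γ Pr ε χ y + θ₀ y)) x)
      - dot (tu x + ψ₀ x) (grad (fun y => (ψ₀ y).1) x)
      - dot (ψ₀ x) (grad (fun y => (tu y).1) x),
   (tρ γ Pr ε χ x + φ₀ x)⁻¹ *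
      (Re⁻¹ * lap (fun y => (ψ₀ y).2) x + (Re⁻¹ + r * Re⁻¹) * d2 (divv ψ₀) x
        - (ε ^ 2)⁻¹ * d2 (fun y => (tρ γ Pr ε χ y + φ₀ y) * (tT γ Pr ε χ y + θ₀ y)) x)
      - dot (tu x + ψ₀ x) (grad (fun y => (ψ₀ y).2) x)
      - dot (ψ₀ x) (grad (fun y => (tu y).2) x))

/-- `∂tθ(0)`, defined from the initial data by taking `t = 0` in the temperature
equation of the perturbation system. -/
def dtθ0 (γ Pr r Re ε χ : ℝ) (φ₀ θ₀ : ℝ × ℝ → ℝ) (ψ₀ : ℝ × ℝ → ℝ × ℝ)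
    (x : ℝ × ℝ) : ℝ :=
  (γ - 1) * (tρ γ Pr ε χ x + φ₀ x)⁻¹ *
      (γ / (γ - 1) / (Re * Pr) * lap θ₀ x
        - (tρ γ Pr ε χ x + φ₀ x) * (tT γ Pr ε χ x + θ₀ x) * divv ψ₀ x
        + ε ^ 2 * (2 * Re⁻¹ * defContract ψ₀ ψ₀ x + 4 * Re⁻¹ * defContract tu ψ₀ x
            + r * Re⁻¹ * (divv ψ₀ x) ^ 2))
    - dot (tu x + ψ₀ x) (grad θ₀ x) - dot (ψ₀ x) (grad (tT γ Pr ε χ) x)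


end Couette

namespace Couette

namespace Pf

/-- smooth functions of `(t,x,y)` that are periodic in `x`. -/
def AlgS : Subalgebra ℝ (ℝ × ℝ × ℝ → ℝ) where
  carrier := {f | ContDiff ℝ (⊤ : ℕ∞) f ∧ ∀ t x y, f (t, x + 2 * π, y) = f (t, x, y)}
  mul_mem' := by
    rintro f g ⟨hf, hf'⟩ ⟨hg, hg'⟩
    exact ⟨hf.mul hg, fun t x y => by simp [hf', hg']⟩
  add_mem' := by
    rintro f g ⟨hf, hf'⟩ ⟨hg, hg'⟩
    exact ⟨hf.add hg, fun t x y => by simp [hf', hg']⟩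
  algebraMap_mem' := fun r => ⟨contDiff_const, fun t x y => rfl⟩

def Alg : Type := AlgS
instance : CommRing Alg := inferInstanceAs (CommRing AlgS)
instance : Algebra ℝ Alg := inferInstanceAs (Algebra ℝ AlgS)

/-- evaluation -/
def ev (f : Alg) : ℝ × ℝ × ℝ → ℝ := Subtype.val (p := fun x => x ∈ AlgS) f

@[simp] lemma ev_add (f g : Alg) (p) : ev (f + g) p = ev f p + ev g p := rfl
@[simp] lemma ev_mul (f g : Alg) (p) : ev (f * g) p = ev f p * ev g p := rfl
@[simp] lemma ev_sub (f g : Alg) (p) : ev (f - g) p = ev f p - ev g p := rfl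
@[simp] lemma ev_neg (f : Alg) (p) : ev (-f) p = - ev f p := rfl
@[simp] lemma ev_zero (p) : ev 0 p = 0 := rfl
@[simp] lemma ev_one (p) : ev 1 p = 1 := rfl
@[simp] lemma ev_smul (c : ℝ) (f : Alg) (p) : ev (c • f) p = c * ev f p := rfl
lemma ev_ext {f g : Alg} (h : ∀ p, ev f p = ev g p) : f = g := Subtype.ext (funext h)

lemma ev_smooth (f : Alg) : ContDiff ℝ (⊤ : ℕ∞) (ev f) :=
  (Subtype.property (p := fun x => x ∈ AlgS) f).1
lemma ev_per (f : Alg) (t x y : ℝ) : ev f (t, x + 2 * π, y) = ev f (t, x, y) :=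
  (Subtype.property (p := fun x => x ∈ AlgS) f).2 t x y
lemma ev_cont (f : Alg) : Continuous (ev f) := (ev_smooth f).continuous
lemma ev_diff (f : Alg) : Differentiable ℝ (ev f) := (ev_smooth f).differentiable (by simp)

def mkA (f : ℝ × ℝ × ℝ → ℝ) (h : ContDiff ℝ (⊤ : ℕ∞) f)
    (h' : ∀ t x y, f (t, x + 2 * π, y) = f (t, x, y)) : Alg :=
  (⟨f, h, h'⟩ : AlgS)
@[simp] lemma ev_mkA (f h h' p) : ev (mkA f h h') p = f p := rfl

/-- directional derivative -/
def dd (v : ℝ × ℝ × ℝ) (f : Alg) : Alg :=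
  mkA (fun p => fderiv ℝ (ev f) p v)
    (by
      have := (ev_smooth f).fderiv_right (m := (⊤ : ℕ∞)) (by simp)
      exact this.clm_apply contDiff_const)
    (by
      intro t x y
      have h : ev f = fun p => ev f (p + (0, 2 * π, 0)) := by
        funext p; obtain ⟨t, x, y⟩ := p; simp [ev_per]
      conv_rhs => rw [h]
      rw [fderiv_comp_add_right]
      simp)

lemma ev_dd (v f p) : ev (dd v f) p = fderiv ℝ (ev f) p v := rfl

lemma dd_add (v f g) : dd v (f + g) = dd v f + dd v g := by
  apply ev_ext; intro p
  rw [ev_add, ev_dd, ev_dd, ev_dd]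
  have : ev (f + g) = ev f + ev g := rfl
  rw [this, fderiv_add (ev_diff f p) (ev_diff g p)]; rfl
lemma dd_smul (v) (c : ℝ) (f) : dd v (c • f) = c • dd v f := by
  apply ev_ext; intro p
  rw [ev_smul, ev_dd, ev_dd]
  have : ev (c • f) = c • ev f := rfl
  rw [this, fderiv_const_smul (ev_diff f p)]; rfl
lemma dd_mul (v f g) : dd v (f * g) = dd v f * g + f * dd v g := by
  apply ev_ext; intro p
  rw [ev_add, ev_mul, ev_mul, ev_dd, ev_dd, ev_dd]
  have : ev (f * g) = ev f * ev g := rfl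
  rw [this, fderiv_mul (ev_diff f p) (ev_diff g p)]
  simp; ring
lemma dd_smul_left (c : ℝ) (v f) : dd (c • v) f = c • dd v f := by
  apply ev_ext; intro p
  rw [ev_smul, ev_dd, ev_dd, map_smul]; rfl
lemma dd_comm (v w f) : dd v (dd w f) = dd w (dd v f) := by
  apply ev_ext; intro p
  have key : ∀ v w, ev (dd v (dd w f)) p = fderiv ℝ (fderiv ℝ (ev f)) p v w := by
    intro v w
    rw [ev_dd]
    have : ev (dd w f) = fun q => fderiv ℝ (ev f) q w := rfl
    rw [this]
    have hd : DifferentiableAt ℝ (fderiv ℝ (ev f)) p :=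
      (((ev_smooth f).fderiv_right (m := (⊤ : ℕ∞)) (by simp)).differentiable (by simp)) p
    rw [fderiv_clm_apply hd (by fun_prop)]
    simp
  rw [key, key]
  have h := ((ev_smooth f).contDiffAt (x := p)).isSymmSndFDerivAt
    (by simpa using (WithTop.coe_le_coe.2 le_top : ((2:ℕ∞) : WithTop ℕ∞) ≤ ((⊤:ℕ∞) : WithTop ℕ∞)))
  exact h v w
lemma dd_neg (v f) : dd v (-f) = - dd v f := by
  have := dd_smul v (-1) f; simpa using this
lemma dd_sub (v f g) : dd v (f - g) = dd v f - dd v g := by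
  rw [sub_eq_add_neg, dd_add, dd_neg, ← sub_eq_add_neg]
lemma dd_alg (v) (c : ℝ) : dd v (algebraMap ℝ Alg c) = 0 := by
  apply ev_ext; intro p
  rw [ev_dd]
  have : ev (algebraMap ℝ Alg c) = fun _ => c := rfl
  rw [this]; simp

/-- one-dimensional slices -/
lemma hasDeriv_t (f : Alg) (t x y : ℝ) :
    HasDerivAt (fun t => ev f (t, x, y)) (ev (dd (1, 0, 0) f) (t, x, y)) t := by
  have := (ev_diff f (t, x, y)).hasFDerivAt.comp_hasDerivAt t
    ((hasDerivAt_id t).prodMk ((hasDerivAt_const t x).prodMk (hasDerivAt_const t y)))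
  exact this
lemma hasDeriv_x (f : Alg) (t x y : ℝ) :
    HasDerivAt (fun x => ev f (t, x, y)) (ev (dd (0, 1, 0) f) (t, x, y)) x := by
  have := (ev_diff f (t, x, y)).hasFDerivAt.comp_hasDerivAt x
    ((hasDerivAt_const x t).prodMk ((hasDerivAt_id x).prodMk (hasDerivAt_const x y)))
  exact this
lemma hasDeriv_y (f : Alg) (t x y : ℝ) :
    HasDerivAt (fun y => ev f (t, x, y)) (ev (dd (0, 0, 1) f) (t, x, y)) y := by
  have := (ev_diff f (t, x, y)).hasFDerivAt.comp_hasDerivAt y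
    ((hasDerivAt_const y t).prodMk ((hasDerivAt_const y x).prodMk (hasDerivAt_id y)))
  exact this

lemma Ω_eq : Ω = Set.Ioo 0 (2 * π) ×ˢ Set.Ioo (0:ℝ) 1 := by
  ext p; simp [Ω]
lemma Ω_open : IsOpen Ω := by rw [Ω_eq]; exact isOpen_Ioo.prod isOpen_Ioo
lemma Ω_meas : MeasurableSet Ω := Ω_open.measurableSet
def Box : Set (ℝ × ℝ) := Set.Icc 0 (2 * π) ×ˢ Set.Icc (0:ℝ) 1
lemma Box_cpt : IsCompact Box := isCompact_Icc.prod isCompact_Icc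
lemma Ω_sub : Ω ⊆ Box := by
  rw [Ω_eq]; exact Set.prod_mono Set.Ioo_subset_Icc_self Set.Ioo_subset_Icc_self
lemma Ω_fin : volume Ω < ⊤ := lt_of_le_of_lt (measure_mono Ω_sub) Box_cpt.measure_lt_top
instance : IsFiniteMeasure (volume.restrict Ω) := ⟨by simpa using Ω_fin⟩

lemma intOn {g : ℝ × ℝ → ℝ} (hg : Continuous g) : IntegrableOn g Ω :=
  (hg.continuousOn.integrableOn_compact Box_cpt).mono_set Ω_sub

/-- plain integral over the cell -/
def J (t : ℝ) (f : Alg) : ℝ := ∫ p in Ω, ev f (t, p)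

lemma ev_slice (f : Alg) (t : ℝ) : Continuous fun p : ℝ × ℝ => ev f (t, p) :=
  (ev_cont f).comp (by fun_prop)

lemma J_add (t f g) : J t (f + g) = J t f + J t g :=
  integral_add (intOn (ev_slice f t)) (intOn (ev_slice g t))
lemma J_smul (t) (c : ℝ) (f) : J t (c • f) = c * J t f := integral_const_mul _ _
lemma J_mono {t : ℝ} {f g : Alg} (h : ∀ p ∈ Ω, ev f (t, p) ≤ ev g (t, p)) : J t f ≤ J t g :=
  setIntegral_mono_on (intOn (ev_slice f t)) (intOn (ev_slice g t)) Ω_meas h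
lemma J_congr {t : ℝ} {f g : Alg} (h : ∀ p ∈ Ω, ev f (t, p) = ev g (t, p)) : J t f = J t g :=
  setIntegral_congr_fun Ω_meas h
lemma J_nonneg {t : ℝ} {f : Alg} (h : ∀ p ∈ Ω, 0 ≤ ev f (t, p)) : 0 ≤ J t f :=
  setIntegral_nonneg Ω_meas h

lemma fub {g : ℝ × ℝ → ℝ} (hg : Continuous g) :
    ∫ p in Ω, g p = ∫ x in (0:ℝ)..(2 * π), ∫ y in (0:ℝ)..1, g (x, y) := by
  have h2 : (0:ℝ) ≤ 2 * π := by positivity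
  have e : (volume : Measure (ℝ × ℝ)) = volume.prod volume := rfl
  rw [Ω_eq, e, setIntegral_prod _ (by rw [← e, ← Ω_eq]; exact intOn hg),
    intervalIntegral.integral_of_le h2, integral_Ioc_eq_integral_Ioo]
  congr 1; funext x
  rw [intervalIntegral.integral_of_le zero_le_one, integral_Ioc_eq_integral_Ioo]

lemma fub' {g : ℝ × ℝ → ℝ} (hg : Continuous g) :
    ∫ p in Ω, g p = ∫ y in (0:ℝ)..1, ∫ x in (0:ℝ)..(2 * π), g (x, y) := by
  rw [fub hg]
  have h2 : (0:ℝ) ≤ 2 * π := by positivity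
  simp_rw [intervalIntegral.integral_of_le (zero_le_one (α := ℝ))]
  apply intervalIntegral_integral_swap
  rw [Set.uIoc_of_le h2]
  rw [Measure.prod_restrict]
  change IntegrableOn _ _ _
  exact (hg.continuousOn.integrableOn_compact Box_cpt).mono_set
    (Set.prod_mono Set.Ioc_subset_Icc_self Set.Ioc_subset_Icc_self)

lemma J_dx (t f) : J t (dd (0, 1, 0) f) = 0 := by
  unfold J
  rw [fub' (ev_slice _ t)]
  have : ∀ y, ∫ x in (0:ℝ)..(2 * π), ev (dd (0, 1, 0) f) (t, x, y) = 0 := by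
    intro y
    rw [intervalIntegral.integral_eq_sub_of_hasDerivAt (fun x _ => hasDeriv_x f t x y)]
    · have := ev_per f t 0 y
      simp at this
      simp [this]
    · exact ((ev_cont _).comp (by fun_prop : Continuous fun x : ℝ => (t, x, y))).intervalIntegrable _ _
  simp [this]

lemma J_dy (t f) (h0 : ∀ x, ev f (t, x, 0) = 0) (h1 : ∀ x, ev f (t, x, 1) = 0) :
    J t (dd (0, 0, 1) f) = 0 := by
  unfold J
  rw [fub (ev_slice _ t)]
  have : ∀ x, ∫ y in (0:ℝ)..1, ev (dd (0, 0, 1) f) (t, x, y) = 0 := by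
    intro x
    rw [intervalIntegral.integral_eq_sub_of_hasDerivAt (fun y _ => hasDeriv_y f t x y)]
    · simp [h0, h1]
    · exact ((ev_cont _).comp (by fun_prop : Continuous fun y : ℝ => (t, x, y))).intervalIntegrable _ _
  simp [this]

lemma J_dt (f : Alg) (t : ℝ) : HasDerivAt (fun t => J t f) (J t (dd (1, 0, 0) f)) t := by
  obtain ⟨C, hC⟩ := (isCompact_Icc.prod Box_cpt : IsCompact (Set.Icc (t - 1) (t + 1) ×ˢ Box)).exists_bound_of_continuousOn
    (ev_cont (dd (1, 0, 0) f)).continuousOn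
  refine (hasDerivAt_integral_of_dominated_loc_of_deriv_le (μ := volume.restrict Ω)
    (F := fun t p => ev f (t, p)) (F' := fun t p => ev (dd (1, 0, 0) f) (t, p))
    (bound := fun _ => C) (s := Set.Icc (t - 1) (t + 1)) (x₀ := t)
    (Icc_mem_nhds (by linarith) (by linarith)) ?_ ?_ ?_ ?_ ?_ ?_).2
  · exact Eventually.of_forall fun s => (ev_slice f s).aestronglyMeasurable
  · exact intOn (ev_slice f t)
  · exact (ev_slice _ t).aestronglyMeasurable
  · filter_upwards [ae_restrict_mem Ω_meas] with p hp s hs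
    exact hC (s, p) ⟨hs, Ω_sub hp⟩
  · exact integrable_const C
  · exact Eventually.of_forall fun p s _ => hasDeriv_t f s p.1 p.2

end Pf

namespace Pf

section oneD
variable {h h' : ℝ → ℝ} {L : ℝ}

lemma int_sub_le {g : ℝ → ℝ} (hg : Continuous g) (h0 : ∀ x, 0 ≤ g x) {a b : ℝ} (ha : 0 ≤ a)
    (hab : a ≤ b) (hb : b ≤ L) : ∫ x in a..b, g x ≤ ∫ x in (0:ℝ)..L, g x :=
  intervalIntegral.integral_mono_interval ha hab hb (ae_of_all _ h0) (hg.intervalIntegrable _ _)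

lemma osc1 (hd : ∀ x, HasDerivAt h (h' x) x) (hc : Continuous h') (hL : 0 < L)
    {x z : ℝ} (hx : x ∈ Set.Icc 0 L) (hz : z ∈ Set.Icc 0 L) :
    (h x - h z) ^ 2 ≤ L * ∫ s in (0:ℝ)..L, h' s ^ 2 := by
  wlog hzx : z ≤ x generalizing x z
  · have := this hz hx (le_of_not_ge hzx)
    nlinarith
  have h1 : ∫ s in z..x, h' s = h x - h z :=
    intervalIntegral.integral_eq_sub_of_hasDerivAt (fun s _ => hd s) (hc.intervalIntegrable _ _)
  set m := h x - h z
  have h2 : 0 ≤ ∫ s in z..x, (L * h' s - m) ^ 2 :=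
    intervalIntegral.integral_nonneg hzx fun s _ => sq_nonneg _
  have h3 : ∫ s in z..x, (L * h' s - m) ^ 2
      = L ^ 2 * (∫ s in z..x, h' s ^ 2) - 2 * L * m * (∫ s in z..x, h' s) + (x - z) * m ^ 2 := by
    have : ∀ s, (L * h' s - m) ^ 2 = (L ^ 2 * h' s ^ 2 - 2 * L * m * h' s) + m ^ 2 := fun s => by ring
    simp_rw [this]
    rw [intervalIntegral.integral_add (by apply Continuous.intervalIntegrable; fun_prop)
      (by apply Continuous.intervalIntegrable; fun_prop),
      intervalIntegral.integral_sub (by apply Continuous.intervalIntegrable; fun_prop)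
      (by apply Continuous.intervalIntegrable; fun_prop)]
    simp
  have h4 : ∫ s in z..x, h' s ^ 2 ≤ ∫ s in (0:ℝ)..L, h' s ^ 2 :=
    int_sub_le (by fun_prop) (fun s => sq_nonneg _) hz.1 hzx hx.2
  rw [h3, h1] at h2
  have h5 : (x - z) * m ^ 2 ≤ L * m ^ 2 := by
    apply mul_le_mul_of_nonneg_right _ (sq_nonneg _); linarith [hx.2, hz.1]
  have h6 : L * m ^ 2 ≤ L * (L * ∫ s in (0:ℝ)..L, h' s ^ 2) := by
    have : L ^ 2 * (∫ s in z..x, h' s ^ 2) ≤ L ^ 2 * ∫ s in (0:ℝ)..L, h' s ^ 2 :=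
      mul_le_mul_of_nonneg_left h4 (sq_nonneg _)
    nlinarith
  exact le_of_mul_le_mul_left h6 hL

lemma wirt1 (hd : ∀ x, HasDerivAt h (h' x) x) (hc : Continuous h') (hL : 0 < L) :
    ∫ s in (0:ℝ)..L, h s ^ 2 ≤ L⁻¹ * (∫ s in (0:ℝ)..L, h s) ^ 2
      + L ^ 2 * ∫ s in (0:ℝ)..L, h' s ^ 2 := by
  have hch : Continuous h := continuous_iff_continuousAt.2 fun x => (hd x).continuousAt
  set M := ∫ s in (0:ℝ)..L, h' s ^ 2
  set A := ∫ s in (0:ℝ)..L, h s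
  set B := ∫ s in (0:ℝ)..L, h s ^ 2
  have hM : 0 ≤ M := intervalIntegral.integral_nonneg hL.le fun s _ => sq_nonneg _
  have h1 : ∀ x ∈ Set.Icc 0 L, L * h x ^ 2 - 2 * A * h x + B ≤ L * (L * M) := by
    intro x hx
    have e1 : ∫ z in (0:ℝ)..L, (h x - h z) ^ 2 = L * h x ^ 2 - 2 * A * h x + B := by
      have : ∀ s, (h x - h s) ^ 2 = (h x ^ 2 - 2 * h x * h s) + h s ^ 2 := fun s => by ring
      simp_rw [this]
      rw [intervalIntegral.integral_add (by apply Continuous.intervalIntegrable; fun_prop)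
        (by apply Continuous.intervalIntegrable; fun_prop),
        intervalIntegral.integral_sub (by apply Continuous.intervalIntegrable; fun_prop)
        (by apply Continuous.intervalIntegrable; fun_prop)]
      simp [A, B]; ring
    have e2 : ∫ z in (0:ℝ)..L, (h x - h z) ^ 2 ≤ ∫ z in (0:ℝ)..L, L * M := by
      apply intervalIntegral.integral_mono_on hL.le (by apply Continuous.intervalIntegrable; fun_prop)
        (by apply Continuous.intervalIntegrable; fun_prop)
      intro z hz
      exact osc1 hd hc hL hx hz
    rw [e1] at e2
    simpa using e2
  have h2 : ∫ x in (0:ℝ)..L, (L * h x ^ 2 - 2 * A * h x + B) ≤ ∫ x in (0:ℝ)..L, L * (L * M) :=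
    intervalIntegral.integral_mono_on hL.le (by apply Continuous.intervalIntegrable; fun_prop)
        (by apply Continuous.intervalIntegrable; fun_prop) h1
  rw [intervalIntegral.integral_add (by apply Continuous.intervalIntegrable; fun_prop)
        (by apply Continuous.intervalIntegrable; fun_prop),
        intervalIntegral.integral_sub (by apply Continuous.intervalIntegrable; fun_prop)
        (by apply Continuous.intervalIntegrable; fun_prop)] at h2
  simp only [intervalIntegral.integral_const_mul, intervalIntegral.integral_const, smul_eq_mul,
    sub_zero] at h2
  change L * B - 2 * A * A + L * B ≤ _ at h2
  have h3 : L * B ≤ L * (L⁻¹ * A ^ 2 + L ^ 2 * M) := by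
    have : L * (L⁻¹ * A ^ 2 + L ^ 2 * M) = A ^ 2 + L ^ 3 * M := by field_simp
    rw [this]
    have : 0 ≤ L ^ 3 * M := by positivity
    nlinarith
  exact le_of_mul_le_mul_left h3 hL

lemma sob1 (hd : ∀ x, HasDerivAt h (h' x) x) (hc : Continuous h') (hL : 1 ≤ L)
    {e : ℝ} (he : 0 < e) (he1 : e ≤ 1) {x : ℝ} (hx : x ∈ Set.Icc 0 L) :
    h x ^ 2 ≤ 2 * e⁻¹ * ∫ s in (0:ℝ)..L, (h s ^ 2 + (e * h' s) ^ 2) := by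
  have hch : Continuous h := continuous_iff_continuousAt.2 fun x => (hd x).continuousAt
  have hL0 : 0 < L := by linarith
  set A := ∫ s in (0:ℝ)..L, (h s ^ 2 + (e * h' s) ^ 2)
  set B := ∫ s in (0:ℝ)..L, h s ^ 2
  have hBA : B ≤ A := intervalIntegral.integral_mono_on hL0.le
    (by apply Continuous.intervalIntegrable; fun_prop)
    (by apply Continuous.intervalIntegrable; fun_prop) (fun s _ => by nlinarith [sq_nonneg (e * h' s)])
  have hB0 : 0 ≤ B := intervalIntegral.integral_nonneg hL0.le fun s _ => sq_nonneg _
  have hA0 : 0 ≤ A := hB0.trans hBA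
  have main : ∀ z ∈ Set.Icc 0 L, h x ^ 2 - h z ^ 2 ≤ e⁻¹ * A := by
    intro z hz
    have h1 : ∫ s in z..x, 2 * h s * h' s = h x ^ 2 - h z ^ 2 := by
      apply intervalIntegral.integral_eq_sub_of_hasDerivAt (f := fun s => h s ^ 2)
      · intro s _
        have := (hd s).pow 2
        simp at this
        exact this
      · apply Continuous.intervalIntegrable; fun_prop
    have hp : ∀ s, |2 * h s * h' s| ≤ e⁻¹ * (h s ^ 2 + (e * h' s) ^ 2) := by
      intro s
      rw [inv_mul_eq_div, le_div_iff₀ he]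
      have : |2 * h s * h' s| * e = |2 * h s * (e * h' s)| := by
        rw [abs_mul, abs_mul (2 * h s), abs_mul e, abs_of_pos he]; ring
      rw [this, abs_le]
      constructor <;> nlinarith [sq_nonneg (h s + e * h' s), sq_nonneg (h s - e * h' s)]
    have hcs : Continuous fun s => e⁻¹ * (h s ^ 2 + (e * h' s) ^ 2) := by fun_prop
    have hn : ∀ s, 0 ≤ e⁻¹ * (h s ^ 2 + (e * h' s) ^ 2) := fun s => by positivity
    have hA : ∫ s in (0:ℝ)..L, e⁻¹ * (h s ^ 2 + (e * h' s) ^ 2) = e⁻¹ * A :=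
      intervalIntegral.integral_const_mul _ _
    rw [← h1, ← hA]
    refine le_trans (le_abs_self _) ?_
    refine le_trans (intervalIntegral.norm_integral_le_integral_norm_uIoc (f := fun s => 2 * h s * h' s)) ?_
    simp only [Real.norm_eq_abs]
    rw [intervalIntegral.integral_of_le hL0.le]
    have hsub : Set.uIoc z x ⊆ Set.Ioc 0 L := by
      intro s hs
      rw [Set.mem_uIoc] at hs
      rcases hs with hs | hs
      · exact ⟨lt_of_le_of_lt hz.1 hs.1, hs.2.trans hx.2⟩
      · exact ⟨lt_of_le_of_lt hx.1 hs.1, hs.2.trans hz.2⟩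
    have hi : ∀ {g : ℝ → ℝ}, Continuous g → IntegrableOn g (Set.Ioc 0 L) := fun hg =>
      (hg.continuousOn.integrableOn_compact (isCompact_Icc (a := 0) (b := L))).mono_set
        Set.Ioc_subset_Icc_self
    calc ∫ s in Set.uIoc z x, |2 * h s * h' s|
        ≤ ∫ s in Set.Ioc 0 L, |2 * h s * h' s| :=
          setIntegral_mono_set (hi (by fun_prop)) (ae_of_all _ fun s => abs_nonneg _)
            (Eventually.of_forall hsub)
      _ ≤ _ := setIntegral_mono (hi (by fun_prop)) (hi hcs) hp
  have h2 : ∫ z in (0:ℝ)..L, (h x ^ 2 - h z ^ 2) ≤ ∫ z in (0:ℝ)..L, e⁻¹ * A :=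
    intervalIntegral.integral_mono_on hL0.le (by apply Continuous.intervalIntegrable; fun_prop)
        (by apply Continuous.intervalIntegrable; fun_prop) main
  rw [intervalIntegral.integral_sub (by apply Continuous.intervalIntegrable; fun_prop)
        (by apply Continuous.intervalIntegrable; fun_prop)] at h2
  simp only [intervalIntegral.integral_const, smul_eq_mul, sub_zero] at h2
  change L * h x ^ 2 - B ≤ _ at h2
  have he' : 1 ≤ e⁻¹ := (one_le_inv₀ he).2 he1
  have h3 : L * h x ^ 2 ≤ L * (2 * e⁻¹ * A) := by
    have : B ≤ L * (e⁻¹ * A) := by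
      have : A ≤ e⁻¹ * A := by nlinarith
      have : e⁻¹ * A ≤ L * (e⁻¹ * A) := by
        have : 0 ≤ e⁻¹ * A := by positivity
        nlinarith
      linarith
    nlinarith
  exact le_of_mul_le_mul_left h3 hL0
end oneD

/-- scaled directions -/
def vec (e : ℝ) : Fin 3 → ℝ × ℝ × ℝ := ![(e ^ 2, 0, 0), (0, e, 0), (0, 0, e)]
def Dm (e : ℝ) (i : Fin 3) (f : Alg) : Alg := dd (vec e i) f
def In (e t : ℝ) (f : Alg) : ℝ := (e ^ 2)⁻¹ * J t f

lemma Dm0 (e f) : Dm e 0 f = (e ^ 2) • dd (1, 0, 0) f := by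
  rw [← dd_smul_left]; simp [Dm, vec]
lemma Dm1 (e f) : Dm e 1 f = e • dd (0, 1, 0) f := by
  rw [← dd_smul_left]; simp [Dm, vec]
lemma Dm2 (e f) : Dm e 2 f = e • dd (0, 0, 1) f := by
  rw [← dd_smul_left]; simp [Dm, vec]

lemma c_x (f : Alg) (t y : ℝ) : Continuous fun x : ℝ => ev f (t, x, y) :=
  (ev_cont f).comp (by fun_prop)
lemma c_y (f : Alg) (t x : ℝ) : Continuous fun y : ℝ => ev f (t, x, y) :=
  (ev_cont f).comp (by fun_prop)
lemma ci_x (f : Alg) (t : ℝ) : Continuous fun y : ℝ => ∫ x in (0:ℝ)..(2 * π), ev f (t, x, y) := by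
  apply intervalIntegral.continuous_parametric_intervalIntegral_of_continuous'
  exact (ev_cont f).comp (by fun_prop : Continuous fun p : ℝ × ℝ => (t, p.2, p.1))
lemma ci_y (f : Alg) (t : ℝ) : Continuous fun x : ℝ => ∫ y in (0:ℝ)..1, ev f (t, x, y) := by
  apply intervalIntegral.continuous_parametric_intervalIntegral_of_continuous'
  exact (ev_cont f).comp (by fun_prop : Continuous fun p : ℝ × ℝ => (t, p.1, p.2))

lemma one_le_2pi : (1:ℝ) ≤ 2 * π := by linarith [Real.pi_gt_three]

lemma slice_x (f : Alg) {e t x y : ℝ} (he : 0 < e) (he1 : e ≤ 1) (hx : x ∈ Set.Icc 0 (2 * π)) :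
    ev f (t, x, y) ^ 2 ≤ 2 * e⁻¹ * ∫ x in (0:ℝ)..(2 * π), ev (f * f + Dm e 1 f * Dm e 1 f) (t, x, y) := by
  have := sob1 (h := fun x => ev f (t, x, y)) (fun x => hasDeriv_x f t x y) (c_x _ t y)
    one_le_2pi he he1 hx
  refine this.trans (le_of_eq ?_)
  congr 2
  funext s; rw [Dm1]; simp only [ev_add, ev_mul, ev_smul]; ring

lemma slice_y (f : Alg) {e t x y : ℝ} (he : 0 < e) (he1 : e ≤ 1) (hy : y ∈ Set.Icc (0:ℝ) 1) :
    ev f (t, x, y) ^ 2 ≤ 2 * e⁻¹ * ∫ y in (0:ℝ)..1, ev (f * f + Dm e 2 f * Dm e 2 f) (t, x, y) := by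
  have := sob1 (h := fun y => ev f (t, x, y)) (fun y => hasDeriv_y f t x y) (c_y _ t x)
    le_rfl he he1 hy
  refine this.trans (le_of_eq ?_)
  congr 2
  funext s; rw [Dm2]; simp only [ev_add, ev_mul, ev_smul]; ring

lemma supA (f : Alg) {e t : ℝ} (he : 0 < e) (he1 : e ≤ 1) {p : ℝ × ℝ} (hp : p ∈ Ω) :
    ev f (t, p) ^ 2 ≤ 4 * In e t ((f * f + Dm e 1 f * Dm e 1 f)
      + (Dm e 2 f * Dm e 2 f + Dm e 1 (Dm e 2 f) * Dm e 1 (Dm e 2 f))) := by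
  obtain ⟨x, y⟩ := p
  have hb := Ω_sub hp
  refine (slice_y f he he1 hb.2).trans ?_
  have he' : 0 < e⁻¹ := inv_pos.2 he
  have key : ∫ y in (0:ℝ)..1, ev (f * f + Dm e 2 f * Dm e 2 f) (t, x, y) ≤
      ∫ y in (0:ℝ)..1, 2 * e⁻¹ * ∫ x in (0:ℝ)..(2 * π), ev ((f * f + Dm e 1 f * Dm e 1 f)
      + (Dm e 2 f * Dm e 2 f + Dm e 1 (Dm e 2 f) * Dm e 1 (Dm e 2 f))) (t, x, y) := by
    apply intervalIntegral.integral_mono_on zero_le_one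
    · exact (c_y _ t x).intervalIntegrable _ _
    · exact (continuous_const.mul (ci_x _ t)).intervalIntegrable _ _
    · intro y _
      have h1 := slice_x f (t := t) (y := y) he he1 hb.1
      have h2 := slice_x (Dm e 2 f) (t := t) (y := y) he he1 hb.1
      have : ∀ x, ev ((f * f + Dm e 1 f * Dm e 1 f)
        + (Dm e 2 f * Dm e 2 f + Dm e 1 (Dm e 2 f) * Dm e 1 (Dm e 2 f))) (t, x, y)
        = ev (f * f + Dm e 1 f * Dm e 1 f) (t, x, y)
          + ev (Dm e 2 f * Dm e 2 f + Dm e 1 (Dm e 2 f) * Dm e 1 (Dm e 2 f)) (t, x, y) := fun x => rfl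
      simp_rw [this]
      rw [intervalIntegral.integral_add ((c_x _ t y).intervalIntegrable _ _)
        ((c_x _ t y).intervalIntegrable _ _), mul_add]
      have e3 : ev (f * f + Dm e 2 f * Dm e 2 f) (t, x, y)
        = ev f (t, x, y) ^ 2 + ev (Dm e 2 f) (t, x, y) ^ 2 := by
        simp only [ev_add, ev_mul]; ring
      rw [e3]
      exact add_le_add h1 h2
  rw [intervalIntegral.integral_const_mul, ← fub' (ev_slice _ t)] at key
  calc _ ≤ 2 * e⁻¹ * (2 * e⁻¹ * _) := mul_le_mul_of_nonneg_left key (by positivity)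
    _ = _ := by unfold In J; field_simp; ring

lemma sq_nn (f : Alg) (p) : 0 ≤ ev (f * f) p := mul_self_nonneg _

lemma prodA (a b : Alg) {e t : ℝ} (he : 0 < e) (he1 : e ≤ 1) :
    In e t ((a * b) * (a * b)) ≤ 4 * In e t (a * a + Dm e 1 a * Dm e 1 a)
      * In e t (b * b + Dm e 2 b * Dm e 2 b) := by
  set A := fun y => ∫ x in (0:ℝ)..(2 * π), ev (a * a + Dm e 1 a * Dm e 1 a) (t, x, y) with hA
  set B := fun x => ∫ y in (0:ℝ)..1, ev (b * b + Dm e 2 b * Dm e 2 b) (t, x, y) with hB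
  have cA : Continuous A := ci_x _ t
  have cB : Continuous B := ci_y _ t
  have he' : 0 < e⁻¹ := inv_pos.2 he
  have h1 : J t ((a * b) * (a * b)) ≤ ∫ p in Ω, 4 * (e⁻¹) ^ 2 * (B p.1 * A p.2) := by
    apply setIntegral_mono_on (intOn (ev_slice _ t)) (intOn (by fun_prop)) Ω_meas
    rintro ⟨x, y⟩ hp
    have hb := Ω_sub hp
    have e1 := slice_x a (t := t) (y := y) he he1 hb.1
    have e2 := slice_y b (t := t) (x := x) he he1 hb.2
    calc ev ((a * b) * (a * b)) (t, x, y) = ev a (t, x, y) ^ 2 * ev b (t, x, y) ^ 2 := by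
          simp only [ev_mul]; ring
      _ ≤ (2 * e⁻¹ * A y) * (2 * e⁻¹ * B x) := mul_le_mul e1 e2 (sq_nonneg _)
          ((sq_nonneg _).trans e1)
      _ = _ := by ring
  rw [fub (by fun_prop)] at h1
  simp only [intervalIntegral.integral_const_mul, intervalIntegral.integral_mul_const] at h1
  have iA : ∫ y in (0:ℝ)..1, A y = J t (a * a + Dm e 1 a * Dm e 1 a) := (fub' (ev_slice _ t)).symm
  have iB : ∫ x in (0:ℝ)..(2 * π), B x = J t (b * b + Dm e 2 b * Dm e 2 b) :=
    (fub (ev_slice _ t)).symm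
  rw [iA, iB] at h1
  unfold In
  calc _ ≤ (e ^ 2)⁻¹ * _ := mul_le_mul_of_nonneg_left h1 (by positivity)
    _ = _ := by field_simp

/-- Poincaré, zero boundary values at `y=0`. -/
lemma poinA (f : Alg) {e t : ℝ} (he : 0 < e) (h0 : ∀ x, ev f (t, x, 0) = 0) :
    In e t ((e • f) * (e • f)) ≤ In e t (Dm e 2 f * Dm e 2 f) := by
  unfold In
  apply mul_le_mul_of_nonneg_left _ (by positivity)
  have h1 : J t ((e • f) * (e • f)) ≤ ∫ p in Ω, ∫ y in (0:ℝ)..1, ev (Dm e 2 f * Dm e 2 f) (t, p.1, y) := by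
    have cc : Continuous fun p : ℝ × ℝ => ∫ y in (0:ℝ)..1, ev (Dm e 2 f * Dm e 2 f) (t, p.1, y) :=
      (ci_y _ t).comp continuous_fst
    apply setIntegral_mono_on (intOn (ev_slice _ t)) (intOn cc) Ω_meas
    rintro ⟨x, y⟩ hp
    have hb := Ω_sub hp
    have := osc1 (h := fun y => ev f (t, x, y)) (fun y => hasDeriv_y f t x y) (c_y _ t x) zero_lt_one
      hb.2 (⟨le_rfl, zero_le_one⟩ : (0:ℝ) ∈ Set.Icc (0:ℝ) 1)
    simp only [h0, sub_zero, one_mul] at this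
    have e2 : ∫ y in (0:ℝ)..1, ev (Dm e 2 f * Dm e 2 f) (t, x, y)
        = e ^ 2 * ∫ y in (0:ℝ)..1, ev (dd (0, 0, 1) f) (t, x, y) ^ 2 := by
      rw [← intervalIntegral.integral_const_mul]
      congr 1; funext s; rw [Dm2]; simp only [ev_mul, ev_smul]; ring
    rw [e2]; simp only [ev_mul, ev_smul]
    nlinarith [sq_nonneg e]
  refine h1.trans (le_of_eq ?_)
  have cc : Continuous fun p : ℝ × ℝ => ∫ y in (0:ℝ)..1, ev (Dm e 2 f * Dm e 2 f) (t, p.1, y) :=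
      (ci_y _ t).comp continuous_fst
  rw [fub cc]
  simp only [intervalIntegral.integral_const, sub_zero, one_smul]
  exact (fub (ev_slice _ t)).symm

/-- Poincaré, mean zero. -/
lemma poinM (f : Alg) {e t : ℝ} (he : 0 < e) (h0 : J t f = 0) :
    In e t ((e • f) * (e • f)) ≤ 40 * (In e t (Dm e 1 f * Dm e 1 f) + In e t (Dm e 2 f * Dm e 2 f)) := by
  set m := fun x => ∫ y in (0:ℝ)..1, ev f (t, x, y) with hm
  set m' := fun x => ∫ y in (0:ℝ)..1, ev (dd (0, 1, 0) f) (t, x, y) with hm'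
  have hmd : ∀ x, HasDerivAt m (m' x) x := by
    intro x
    obtain ⟨C, hC⟩ := (isCompact_Icc.prod isCompact_Icc :
      IsCompact (Set.Icc (x - 1) (x + 1) ×ˢ Set.Icc (0:ℝ) 1)).exists_bound_of_continuousOn
      (ev_slice (dd (0, 1, 0) f) t).continuousOn
    refine (intervalIntegral.hasDerivAt_integral_of_dominated_loc_of_deriv_le
      (F := fun x y => ev f (t, x, y)) (F' := fun x y => ev (dd (0, 1, 0) f) (t, x, y))
      (bound := fun _ => C) (s := Set.Icc (x - 1) (x + 1)) (x₀ := x)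
      (Icc_mem_nhds (by linarith) (by linarith)) ?_ ?_ ?_ ?_ ?_ ?_).2
    · exact Eventually.of_forall fun s => (c_y f t s).aestronglyMeasurable
    · exact (c_y f t x).intervalIntegrable _ _
    · exact (c_y _ t x).aestronglyMeasurable
    · refine ae_of_all _ fun y hy s hs => ?_
      rw [Set.uIoc_of_le zero_le_one] at hy
      exact hC (s, y) ⟨hs, Set.Ioc_subset_Icc_self hy⟩
    · exact intervalIntegrable_const
    · exact ae_of_all _ fun y _ s _ => hasDeriv_x f t s y
  have cm' : Continuous m' := ci_y _ t
  have cm : Continuous m := ci_y _ t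
  have hp : (0:ℝ) < 2 * π := by positivity
  have w := wirt1 hmd cm' hp
  have : ∫ s in (0:ℝ)..(2 * π), m s = 0 :=
    (fub (ev_slice f t)).symm.trans h0
  rw [this] at w
  have h1 : ∀ x, m' x ^ 2 ≤ ∫ y in (0:ℝ)..1, ev (dd (0, 1, 0) f * dd (0, 1, 0) f) (t, x, y) := by
    intro x
    have h2 : 0 ≤ ∫ y in (0:ℝ)..1, (ev (dd (0, 1, 0) f) (t, x, y) - m' x) ^ 2 :=
      intervalIntegral.integral_nonneg zero_le_one fun s _ => sq_nonneg _
    have : ∀ y, (ev (dd (0, 1, 0) f) (t, x, y) - m' x) ^ 2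
      = (ev (dd (0, 1, 0) f * dd (0, 1, 0) f) (t, x, y) - 2 * m' x * ev (dd (0, 1, 0) f) (t, x, y))
        + m' x ^ 2 := fun y => by simp only [ev_mul]; ring
    simp_rw [this] at h2
    have c1 := c_y (dd (0, 1, 0) f * dd (0, 1, 0) f) t x
    have c2 := c_y (dd (0, 1, 0) f) t x
    rw [intervalIntegral.integral_add (by apply Continuous.intervalIntegrable; fun_prop)
      (by apply Continuous.intervalIntegrable; fun_prop),
      intervalIntegral.integral_sub (by apply Continuous.intervalIntegrable; fun_prop)
      (by apply Continuous.intervalIntegrable; fun_prop),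
      intervalIntegral.integral_const_mul] at h2
    simp only [intervalIntegral.integral_const, sub_zero, one_smul] at h2
    change 0 ≤ _ - 2 * m' x * m' x + m' x ^ 2 at h2
    nlinarith
  have h2 : ∫ x in (0:ℝ)..(2 * π), m' x ^ 2 ≤ J t (dd (0, 1, 0) f * dd (0, 1, 0) f) := by
    unfold J
    rw [fub (ev_slice _ t)]
    exact intervalIntegral.integral_mono_on hp.le ((cm'.pow 2).intervalIntegrable _ _)
      ((ci_y _ t).intervalIntegrable _ _) fun x _ => h1 x
  have h3 : J t (f * f) ≤ (∫ x in (0:ℝ)..(2 * π), m x ^ 2) + J t (dd (0, 0, 1) f * dd (0, 0, 1) f) := by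
    unfold J
    have cm2 : Continuous fun x => m x ^ 2 := cm.pow 2
    rw [fub (ev_slice _ t), fub (ev_slice _ t), ← intervalIntegral.integral_add
      (cm2.intervalIntegrable _ _) ((ci_y _ t).intervalIntegrable _ _)]
    apply intervalIntegral.integral_mono_on hp.le ((ci_y _ t).intervalIntegrable _ _)
      ((cm2.add (ci_y _ t)).intervalIntegrable _ _)
    intro x _
    have := wirt1 (h := fun y => ev f (t, x, y)) (fun y => hasDeriv_y f t x y) (c_y _ t x) zero_lt_one
    simp only [inv_one, one_mul, one_pow] at this
    simp only [ev_mul]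
    simpa [pow_two] using this
  have hpi : (2 * π) ^ 2 ≤ 40 := by nlinarith [Real.pi_lt_d2, Real.pi_pos]
  have h4 : J t (f * f) ≤ 40 * J t (dd (0, 1, 0) f * dd (0, 1, 0) f)
      + 40 * J t (dd (0, 0, 1) f * dd (0, 0, 1) f) := by
    have n1 : 0 ≤ J t (dd (0, 1, 0) f * dd (0, 1, 0) f) := J_nonneg fun p _ => sq_nn _ _
    have n2 : 0 ≤ J t (dd (0, 0, 1) f * dd (0, 0, 1) f) := J_nonneg fun p _ => sq_nn _ _
    have n3 : 0 ≤ ∫ x in (0:ℝ)..(2 * π), m' x ^ 2 :=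
      intervalIntegral.integral_nonneg hp.le fun s _ => sq_nonneg _
    nlinarith
  have s0 : J t ((e • f) * (e • f)) = e ^ 2 * J t (f * f) := by
    rw [← J_smul]; congr 1; apply ev_ext; intro p; simp only [ev_mul, ev_smul]; ring
  have s1 : J t (Dm e 1 f * Dm e 1 f) = e ^ 2 * J t (dd (0, 1, 0) f * dd (0, 1, 0) f) := by
    rw [← J_smul, Dm1]; congr 1; apply ev_ext; intro p; simp only [ev_mul, ev_smul]; ring
  have s2 : J t (Dm e 2 f * Dm e 2 f) = e ^ 2 * J t (dd (0, 0, 1) f * dd (0, 0, 1) f) := by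
    rw [← J_smul, Dm2]; congr 1; apply ev_ext; intro p; simp only [ev_mul, ev_smul]; ring
  unfold In
  rw [s0, s1, s2]
  have : (e ^ 2)⁻¹ * (e ^ 2 * J t (f * f)) = J t (f * f) := by field_simp
  rw [this]
  have : (e ^ 2)⁻¹ * (e ^ 2 * J t (dd (0, 1, 0) f * dd (0, 1, 0) f)) = J t (dd (0, 1, 0) f * dd (0, 1, 0) f) := by field_simp
  rw [this]
  have : (e ^ 2)⁻¹ * (e ^ 2 * J t (dd (0, 0, 1) f * dd (0, 0, 1) f)) = J t (dd (0, 0, 1) f * dd (0, 0, 1) f) := by field_simp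
  rw [this]
  linarith

/-- vertical dilation -/
def dil (a l : ℝ) (f : Alg) : Alg :=
  mkA (fun p => ev f (p.1, p.2.1, a + l * p.2.2))
    ((ev_smooth f).comp (by fun_prop)) (fun t x y => ev_per f _ _ _)
lemma dil_sub (a l f g) : dil a l (f - g) = dil a l f - dil a l g := rfl
lemma dil_dd1 (a l f) : dd (0, 1, 0) (dil a l f) = dil a l (dd (0, 1, 0) f) := by
  apply ev_ext; rintro ⟨t, x, y⟩
  exact (hasDeriv_x (dil a l f) t x y).unique (hasDeriv_x f t x (a + l * y))
lemma dil_dd2 (a l f) : dd (0, 0, 1) (dil a l f) = l • dil a l (dd (0, 0, 1) f) := by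
  apply ev_ext; rintro ⟨t, x, y⟩
  refine (hasDeriv_y (dil a l f) t x y).unique ?_
  have h1 : HasDerivAt (fun y : ℝ => a + l * y) l y := by
    simpa using ((hasDerivAt_id y).const_mul l).const_add a
  have := (hasDeriv_y f t x (a + l * y)).comp y h1
  rw [mul_comm] at this
  exact this
lemma dil_n (a l : ℝ) (f : Alg) (e t) (ha : 0 ≤ a) (hl : 0 < l) (hal : a + l ≤ 1) :
    In e t (dil a l f * dil a l f) ≤ l⁻¹ * In e t (f * f) := by
  have : J t (dil a l f * dil a l f) ≤ l⁻¹ * J t (f * f) := by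
    unfold J
    rw [fub (ev_slice _ t), fub (ev_slice _ t), ← intervalIntegral.integral_const_mul]
    apply intervalIntegral.integral_mono_on (by positivity) ((ci_y _ t).intervalIntegrable _ _)
      ((continuous_const.mul (ci_y _ t)).intervalIntegrable _ _)
    intro x _
    have : ∫ y in (0:ℝ)..1, ev (dil a l f * dil a l f) (t, x, y)
        = ∫ y in (0:ℝ)..1, (fun y => ev (f * f) (t, x, y)) (a + l * y) := rfl
    rw [this, intervalIntegral.integral_comp_add_mul (fun y => ev (f * f) (t, x, y)) hl.ne' a]
    simp only [mul_zero, add_zero, mul_one, smul_eq_mul]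
    apply mul_le_mul_of_nonneg_left _ (by positivity)
    exact int_sub_le (c_y _ t x) (fun y => sq_nn _ _) ha (by linarith) hal
  unfold In
  calc _ ≤ (e ^ 2)⁻¹ * _ := mul_le_mul_of_nonneg_left this (by positivity)
    _ = _ := by ring

end Pf

set_option linter.unusedVariables false
namespace Pf

def Eqv (T : ℝ) (f g : Alg) : Prop := ∀ t ∈ Set.Ioo 0 T, ∀ p ∈ Ω, ev f (t, p) = ev g (t, p)
def Bd (T : ℝ) (f : Alg) : Prop := ∀ t ∈ Set.Ioo 0 T, ∀ x, ev f (t, x, 0) = 0 ∧ ev f (t, x, 1) = 0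

/-- vertical coordinate -/
def X : Alg := mkA (fun p => p.2.2) (by fun_prop) (fun _ _ _ => rfl)

def Nm (e t : ℝ) : ℕ → Alg → ℝ
  | 0, f => In e t (f * f)
  | k + 1, f => Nm e t k f + Nm e t k (Dm e 1 f) + Nm e t k (Dm e 2 f)

structure Par where
  μ : ℝ
  lam : ℝ
  κ : ℝ
  g : ℝ
  K : ℝ
  hlam : 0 < lam
  hg : 0 < g
  hK : 0 ≤ K
  hμ : 1 + (1 + g) * K ≤ μ
  hκ : 1 + (1 + g) * K ≤ κ

lemma Par.μ0 (P : Par) : 0 < P.μ := by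
  have := P.hμ; have := mul_nonneg (by linarith [P.hg] : 0 ≤ 1 + P.g) P.hK; linarith
lemma Par.κ0 (P : Par) : 0 < P.κ := by
  have := P.hκ; have := mul_nonneg (by linarith [P.hg] : 0 ≤ 1 + P.g) P.hK; linarith

/-- constants -/
abbrev ca (r : ℝ) : Alg := algebraMap ℝ Alg r

structure Setup (P : Par) where
  e : ℝ
  δ : ℝ
  T : ℝ
  he : 0 < e
  heδ : e ≤ δ
  hδ : δ ≤ 1
  Φ : Alg
  Ψ1 : Alg
  Ψ2 : Alg
  Θ : Alg
  s : Alg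
  τ : Alg
  ϑ : Alg
  tp : Alg
  A : ℝ
  B : ℝ
  hA : |A| ≤ P.K
  hB : |B| ≤ P.K
  hsτ : s * τ = 1
  hτ : τ = 1 + ca e * ϑ
  hϑ0 : Dm e 0 ϑ = 0
  hϑ1 : Dm e 1 ϑ = 0
  hϑ2 : Dm e 2 ϑ = ca e * tp
  htp : Eqv T tp (ca A + ca B * X)
  sB : ∀ t ∈ Set.Ioo 0 T, ∀ p ∈ Ω, |ev s (t, p)| ≤ 2
  sP : ∀ t ∈ Set.Ioo 0 T, ∀ p ∈ Ω, 0 < ev s (t, p)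
  ϑB : ∀ t ∈ Set.Ioo 0 T, ∀ p ∈ Ω, |ev ϑ (t, p)| ≤ P.K
  tpB : ∀ t ∈ Set.Ioo 0 T, ∀ p ∈ Ω, |ev tp (t, p)| ≤ P.K
  bΨ1 : Bd T Ψ1
  bΨ2 : Bd T Ψ2
  bΘ : Bd T Θ
  mean : ∀ t ∈ Set.Ioo 0 T, J t Φ = 0
  small : ∀ t ∈ Set.Ioo 0 T, Nm e t 3 Φ + Nm e t 3 Ψ1 + Nm e t 3 Ψ2 + Nm e t 3 Θ ≤ δ ^ 2
  mass : Eqv T (Dm e 0 Φ + (ca e * (X + Ψ1) * Dm e 1 Φ + ca e * Ψ2 * Dm e 2 Φ)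
    + (s + ca e * Φ) * (Dm e 1 Ψ1 + Dm e 2 Ψ2) + Ψ2 * Dm e 2 s) 0
  mom1 : Eqv T ((s + ca e * Φ) * (Dm e 0 Ψ1 + (ca e * (X + Ψ1) * Dm e 1 Ψ1 + ca e * Ψ2 * Dm e 2 Ψ1)
      + ca e * (ca e * Ψ2)) + Dm e 1 (s * Θ + τ * Φ + ca e * Φ * Θ)
      - ca P.μ * (Dm e 1 (Dm e 1 Ψ1) + Dm e 2 (Dm e 2 Ψ1))
      - ca P.lam * Dm e 1 (Dm e 1 Ψ1 + Dm e 2 Ψ2)) 0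
  mom2 : Eqv T ((s + ca e * Φ) * (Dm e 0 Ψ2 + (ca e * (X + Ψ1) * Dm e 1 Ψ2 + ca e * Ψ2 * Dm e 2 Ψ2))
      + Dm e 2 (s * Θ + τ * Φ + ca e * Φ * Θ)
      - ca P.μ * (Dm e 1 (Dm e 1 Ψ2) + Dm e 2 (Dm e 2 Ψ2))
      - ca P.lam * Dm e 2 (Dm e 1 Ψ1 + Dm e 2 Ψ2)) 0
  energy : Eqv T (ca P.g * (s + ca e * Φ) * (Dm e 0 Θ
        + (ca e * (X + Ψ1) * Dm e 1 Θ + ca e * Ψ2 * Dm e 2 Θ) + Ψ2 * Dm e 2 τ)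
      + (s + ca e * Φ) * (τ + ca e * Θ) * (Dm e 1 Ψ1 + Dm e 2 Ψ2)
      - ca P.κ * (Dm e 1 (Dm e 1 Θ) + Dm e 2 (Dm e 2 Θ))
      - (ca e * (ca (2 * P.μ) * (Dm e 1 Ψ1 * Dm e 1 Ψ1 + Dm e 2 Ψ2 * Dm e 2 Ψ2)
          + ca P.μ * ((Dm e 1 Ψ2 + Dm e 2 Ψ1) * (Dm e 1 Ψ2 + Dm e 2 Ψ1))
          + ca (P.lam - P.μ) * ((Dm e 1 Ψ1 + Dm e 2 Ψ2) * (Dm e 1 Ψ1 + Dm e 2 Ψ2)))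
        + ca (2 * P.μ) * (ca e * (ca e * (Dm e 1 Ψ2 + Dm e 2 Ψ1))))) 0

/-- good space-time parameter -/
structure Pt (P : Par) where
  S : Setup P
  t : ℝ
  ht : t ∈ Set.Ioo 0 S.T

variable {P : Par}

def Fld (P : Par) : Type := Setup P → Alg
instance : CommRing (Fld P) := inferInstanceAs (CommRing (Setup P → Alg))
@[simp] lemma F_add (f g : Fld P) (S) : (f + g) S = f S + g S := rfl
@[simp] lemma F_mul (f g : Fld P) (S) : (f * g) S = f S * g S := rfl
@[simp] lemma F_sub (f g : Fld P) (S) : (f - g) S = f S - g S := rfl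
@[simp] lemma F_neg (f : Fld P) (S) : (-f) S = -f S := rfl
@[simp] lemma F_zero (S) : (0 : Fld P) S = 0 := rfl
@[simp] lemma F_one (S) : (1 : Fld P) S = 1 := rfl

def cS (r : Setup P → ℝ) : Fld P := fun S => ca (r S)
def cc (r : ℝ) : Fld P := cS fun _ => r
def ee : Fld P := cS fun S => S.e

def D (i : Fin 3) (f : Fld P) : Fld P := fun S => Dm S.e i (f S)

section Drules
variable (i j : Fin 3) (f g : Fld P)
lemma D_add : D i (f + g) = D i f + D i g := funext fun S => dd_add _ _ _
lemma D_sub : D i (f - g) = D i f - D i g := funext fun S => dd_sub _ _ _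
lemma D_neg : D i (-f) = - D i f := funext fun S => dd_neg _ _
lemma D_mul : D i (f * g) = D i f * g + f * D i g := funext fun S => dd_mul _ _ _
lemma D_cS (r : Setup P → ℝ) : D i (cS r) = 0 := funext fun S => dd_alg _ _
lemma D_cc (r : ℝ) : D i (cc r : Fld P) = 0 := D_cS i _
lemma D_ee : D i (ee : Fld P) = 0 := D_cS i _
lemma D_cSmul (r : Setup P → ℝ) : D i (cS r * f) = cS r * D i f := by rw [D_mul, D_cS]; ring
lemma D_ccmul (r : ℝ) : D i (cc r * f) = cc r * D i f := D_cSmul i f _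
lemma D_eemul : D i (ee * f) = ee * D i f := D_cSmul i f _
lemma D_comm : D i (D j f) = D j (D i f) := funext fun S => dd_comm _ _ _
lemma D_zero : D i (0 : Fld P) = 0 := by have := D_sub i (0 : Fld P) 0; simpa using this
lemma D10 : D 1 (D 0 f) = D 0 (D 1 f) := D_comm _ _ _
lemma D20 : D 2 (D 0 f) = D 0 (D 2 f) := D_comm _ _ _
lemma D21 : D 2 (D 1 f) = D 1 (D 2 f) := D_comm _ _ _
end Drules

lemma cc_add (a b : ℝ) : (cc (a + b) : Fld P) = cc a + cc b := funext fun S => map_add _ _ _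
lemma cc_sub (a b : ℝ) : (cc (a - b) : Fld P) = cc a - cc b := funext fun S => map_sub _ _ _
lemma cc_mul (a b : ℝ) : (cc (a * b) : Fld P) = cc a * cc b := funext fun S => map_mul _ _ _
lemma cc_one : (cc 1 : Fld P) = 1 := funext fun S => map_one _
lemma cc_two : (cc 2 : Fld P) = 2 := by
  have : (2:ℝ) = 1 + 1 := by norm_num
  rw [this, cc_add, cc_one]; norm_num
lemma cc_neg (a : ℝ) : (cc (-a) : Fld P) = - cc a := funext fun S => map_neg _ _

/-- real functionals -/
abbrev Fn (P : Par) := Pt P → ℝ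

def I (f : Fld P) : Fn P := fun p => In p.S.e p.t (f p.S)

lemma In_add (e t f g) : In e t (f + g) = In e t f + In e t g := by unfold In; rw [J_add]; ring
lemma In_smul (e t) (c : ℝ) (f) : In e t (ca c * f) = c * In e t f := by
  unfold In
  rw [show ca c * f = c • f from (Algebra.smul_def c f).symm, J_smul]; ring

section Irules
variable (f g : Fld P) (p : Pt P)
lemma I_add : I (f + g) p = I f p + I g p := In_add _ _ _ _
lemma I_cS (r : Setup P → ℝ) : I (cS r * f) p = r p.S * I f p := In_smul _ _ _ _
lemma I_cc (r : ℝ) : I (cc r * f) p = r * I f p := In_smul _ _ _ _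
lemma I_ee : I (ee * f) p = p.S.e * I f p := In_smul _ _ _ _
lemma I_neg : I (-f) p = - I f p := by
  have := I_cc f p (-1); rw [cc_neg, cc_one] at this; simpa using this
lemma I_sub : I (f - g) p = I f p - I g p := by rw [sub_eq_add_neg, I_add, I_neg]; ring
lemma I_zero : I (0 : Fld P) p = 0 := by have := I_sub (0 : Fld P) 0 p; simpa using this
lemma I_two : I (2 * f) p = 2 * I f p := by rw [← cc_two, I_cc]
lemma I_D1 : I (D 1 f) p = 0 := by
  show In _ _ (Dm _ 1 _) = 0
  rw [Dm1]; unfold In; rw [J_smul, J_dx]; simp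
lemma e2pos : 0 ≤ (p.S.e ^ 2)⁻¹ := by positivity
lemma I_sq : 0 ≤ I (f * f) p := mul_nonneg (e2pos p) (J_nonneg fun _ _ => sq_nn _ _)
end Irules

def BD (f : Fld P) : Prop := ∀ S : Setup P, Bd S.T (f S)
def EQ (f g : Fld P) : Prop := ∀ S : Setup P, Eqv S.T (f S) (g S)

lemma I_D2 {f : Fld P} (h : BD f) (p : Pt P) : I (D 2 f) p = 0 := by
  show In _ _ (Dm _ 2 _) = 0
  rw [Dm2]; unfold In
  rw [J_smul, J_dy _ _ (fun x => (h p.S p.t p.ht x).1) (fun x => (h p.S p.t p.ht x).2)]; simp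

section BDrules
variable {f g : Fld P}
lemma BD.add (hf : BD f) (hg : BD g) : BD (f + g) := fun S t ht x => by
  simp [(hf S t ht x).1, (hf S t ht x).2, (hg S t ht x).1, (hg S t ht x).2]
lemma BD.sub (hf : BD f) (hg : BD g) : BD (f - g) := fun S t ht x => by
  simp [(hf S t ht x).1, (hf S t ht x).2, (hg S t ht x).1, (hg S t ht x).2]
lemma BD.mul_right (hf : BD f) (g : Fld P) : BD (f * g) := fun S t ht x => by
  simp [(hf S t ht x).1, (hf S t ht x).2]
lemma BD.mul_left (hf : BD f) (g : Fld P) : BD (g * f) := fun S t ht x => by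
  simp [(hf S t ht x).1, (hf S t ht x).2]
lemma Bd_D1 {T : ℝ} {f : Alg} (e : ℝ) (hf : Bd T f) : Bd T (Dm e 1 f) := by
  intro t ht x
  rw [Dm1]; simp only [ev_smul]
  constructor
  · have h := hasDeriv_x f t x 0
    have h0 : (fun x => ev f (t, x, 0)) = fun _ => 0 := funext fun x => (hf t ht x).1
    rw [h0] at h; rw [h.unique (hasDerivAt_const x 0)]; simp
  · have h := hasDeriv_x f t x 1
    have h0 : (fun x => ev f (t, x, 1)) = fun _ => 0 := funext fun x => (hf t ht x).2
    rw [h0] at h; rw [h.unique (hasDerivAt_const x 0)]; simp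
lemma BD.D1 (hf : BD f) : BD (D 1 f) := fun S => Bd_D1 _ (hf S)
lemma Bd_D0 {T : ℝ} {f : Alg} (e : ℝ) (hf : Bd T f) : Bd T (Dm e 0 f) := by
  intro t ht x
  rw [Dm0]; simp only [ev_smul]
  have hn : Set.Ioo 0 T ∈ 𝓝 t := isOpen_Ioo.mem_nhds ht
  constructor
  · have h := hasDeriv_t f t x 0
    have h0 : (fun t => ev f (t, x, 0)) =ᶠ[𝓝 t] fun _ => 0 := by
      filter_upwards [hn] with s hs using (hf s hs x).1
    rw [h.unique ((hasDerivAt_const t (0:ℝ)).congr_of_eventuallyEq h0)]; simp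
  · have h := hasDeriv_t f t x 1
    have h0 : (fun t => ev f (t, x, 1)) =ᶠ[𝓝 t] fun _ => 0 := by
      filter_upwards [hn] with s hs using (hf s hs x).2
    rw [h.unique ((hasDerivAt_const t (0:ℝ)).congr_of_eventuallyEq h0)]; simp
lemma BD.D0 (hf : BD f) : BD (D 0 f) := fun S => Bd_D0 _ (hf S)
end BDrules

lemma Eqv.dd {T : ℝ} {f g : Alg} (h : Eqv T f g) (v) : Eqv T (dd v f) (dd v g) := by
  intro t ht p hp
  rw [ev_dd, ev_dd]
  have : ev f =ᶠ[𝓝 (t, p)] ev g := by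
    have ho : IsOpen (Set.Ioo 0 T ×ˢ Ω) := isOpen_Ioo.prod Ω_open
    filter_upwards [ho.mem_nhds ⟨ht, hp⟩] with q hq using h q.1 hq.1 q.2 hq.2
  rw [this.fderiv_eq]
section EQrules
variable {f g h k : Fld P}
lemma EQ.refl (f : Fld P) : EQ f f := fun _ _ _ _ _ => rfl
lemma EQ.symm (a : EQ f g) : EQ g f := fun S t ht p hp => (a S t ht p hp).symm
lemma EQ.D (a : EQ f g) (i) : EQ (D i f) (D i g) := fun S => (a S).dd _
lemma EQ.mul (a : EQ f g) (b : EQ h k) : EQ (f * h) (g * k) := fun S t ht p hp => by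
  simp [a S t ht p hp, b S t ht p hp]
lemma EQ.add (a : EQ f g) (b : EQ h k) : EQ (f + h) (g + k) := fun S t ht p hp => by
  simp [a S t ht p hp, b S t ht p hp]
lemma EQ.of_sub (a : EQ (f - g) 0) : EQ f g := fun S t ht p hp => by
  have := a S t ht p hp; simp at this; linarith
lemma I_congr (a : EQ f g) (p) : I f p = I g p := by
  show (_)⁻¹ * _ = (_)⁻¹ * _
  rw [J_congr fun q hq => a p.S p.t p.ht q hq]
end EQrules

def N (k : ℕ) (f : Fld P) : Fn P := fun p => Nm p.S.e p.t k (f p.S)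
lemma N_zero (f : Fld P) (p) : N 0 f p = I (f * f) p := rfl
lemma N_succ (k) (f : Fld P) (p) : N (k + 1) f p = N k f p + N k (D 1 f) p + N k (D 2 f) p := rfl
lemma N_nn (k) (f : Fld P) (p) : 0 ≤ N k f p := by
  induction k generalizing f with
  | zero => exact I_sq f p
  | succ k ih => rw [N_succ]; linarith [ih f, ih (D 1 f), ih (D 2 f)]
lemma N_congr {f g : Fld P} (a : EQ f g) (k) (p) : N k f p = N k g p := by
  induction k generalizing f g with
  | zero => exact I_congr (a.mul a) p
  | succ k ih => rw [N_succ, N_succ, ih a, ih (a.D 1), ih (a.D 2)]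
lemma N_le_succ (k) (f : Fld P) (p) : N k f p ≤ N (k + 1) f p := by
  rw [N_succ]; linarith [N_nn k (D 1 f) p, N_nn k (D 2 f) p]
lemma N_mono {k l} (h : k ≤ l) (f : Fld P) (p) : N k f p ≤ N l f p := by
  induction h with
  | refl => exact le_rfl
  | step _ ih => exact ih.trans (N_le_succ _ _ _)
lemma N_D1 (k) (f : Fld P) (p) : N k (D 1 f) p ≤ N (k + 1) f p := by
  rw [N_succ]; linarith [N_nn k f p, N_nn k (D 2 f) p]
lemma N_D2 (k) (f : Fld P) (p) : N k (D 2 f) p ≤ N (k + 1) f p := by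
  rw [N_succ]; linarith [N_nn k f p, N_nn k (D 1 f) p]
lemma N_cS (k) (r : Setup P → ℝ) (f : Fld P) (p) : N k (cS r * f) p = r p.S ^ 2 * N k f p := by
  induction k generalizing f with
  | zero =>
    rw [N_zero, N_zero, show cS r * f * (cS r * f) = cS r * (cS r * (f * f)) by ring, I_cS, I_cS]; ring
  | succ k ih => rw [N_succ, N_succ, D_cSmul, D_cSmul, ih, ih, ih]; ring
lemma N_cc (k) (r : ℝ) (f : Fld P) (p) : N k (cc r * f) p = r ^ 2 * N k f p := N_cS k _ f p
lemma N_ee (k) (f : Fld P) (p) : N k (ee * f) p = p.S.e ^ 2 * N k f p := N_cS k _ f p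
lemma N_neg (k) (f : Fld P) (p) : N k (-f) p = N k f p := by
  have := N_cc k (-1) f p; rw [cc_neg, cc_one] at this; simpa using this

lemma young (f g : Fld P) (p) {η : ℝ} (hη : 0 < η) :
    I (f * g) p ≤ η * N 0 f p + (4 * η)⁻¹ * N 0 g p := by
  have h := I_sq (cc (2 * η) * f - g) p
  have e1 : (cc (2 * η) * f - g) * (cc (2 * η) * f - g)
    = cc (2 * η) * (cc (2 * η) * (f * f)) - cc (2 * η) * (2 * (f * g)) + g * g := by ring
  rw [e1, I_add, I_sub, I_cc, I_cc, I_cc, I_two] at h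
  rw [N_zero, N_zero]
  have : I (f * g) p * (4 * η) ≤ (η * I (f * f) p + (4 * η)⁻¹ * I (g * g) p) * (4 * η) := by
    have : (η * I (f * f) p + (4 * η)⁻¹ * I (g * g) p) * (4 * η)
      = 4 * η ^ 2 * I (f * f) p + I (g * g) p := by field_simp
    rw [this]; nlinarith
  exact le_of_mul_le_mul_right this (by linarith)
lemma young_abs (f g : Fld P) (p) {η : ℝ} (hη : 0 < η) :
    |I (f * g) p| ≤ η * N 0 f p + (4 * η)⁻¹ * N 0 g p := by
  rw [abs_le]; constructor
  · have := young (-f) g p hη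
    rw [N_neg, show -f * g = -(f * g) by ring, I_neg] at this; linarith
  · exact young f g p hη

lemma N0_add (f g : Fld P) (p) : N 0 (f + g) p ≤ 2 * N 0 f p + 2 * N 0 g p := by
  have h := I_sq (f - g) p
  rw [N_zero, N_zero, N_zero]
  rw [show (f - g) * (f - g) = f * f + g * g - 2 * (f * g) by ring, I_sub, I_add, I_two] at h
  rw [show (f + g) * (f + g) = f * f + g * g + 2 * (f * g) by ring, I_add, I_add, I_two]
  linarith
lemma N_add (k) (f g : Fld P) (p) : N k (f + g) p ≤ 2 * N k f p + 2 * N k g p := by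
  induction k generalizing f g with
  | zero => exact N0_add f g p
  | succ k ih =>
    rw [N_succ, N_succ, N_succ, D_add, D_add]
    linarith [ih f g, ih (D 1 f) (D 1 g), ih (D 2 f) (D 2 g)]

/-! relation -/
def Le (a b : Fn P) : Prop := ∃ C, 0 ≤ C ∧ ∀ p, a p ≤ C * b p
infix:50 "≼" => Le

section LeRules
variable {a b c d : Fn P}
lemma Le.of (h : ∀ p, a p ≤ b p) : a ≼ b := ⟨1, zero_le_one, fun p => by simpa using h p⟩
lemma Le.ofC (C : ℝ) (hC : 0 ≤ C) (h : ∀ p, a p ≤ C * b p) : a ≼ b := ⟨C, hC, h⟩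
lemma Le.rfl : a ≼ a := Le.of fun _ => le_rfl
lemma Le.trans (h : a ≼ b) (h' : b ≼ c) : a ≼ c := by
  obtain ⟨C, hC, h⟩ := h; obtain ⟨C', hC', h'⟩ := h'
  exact ⟨C * C', by positivity, fun p => (h p).trans (by
    rw [mul_assoc]; exact mul_le_mul_of_nonneg_left (h' p) hC)⟩
lemma Le.add (h : a ≼ c) (h' : b ≼ c) : a + b ≼ c := by
  obtain ⟨C, hC, h⟩ := h; obtain ⟨C', hC', h'⟩ := h'
  exact ⟨C + C', by positivity, fun p => by
    have := h p; have := h' p; simp only [Pi.add_apply]; linarith⟩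
lemma Le.mul_left (h : a ≼ b) (hc : ∀ p, 0 ≤ c p) : c * a ≼ c * b := by
  obtain ⟨C, hC, h⟩ := h
  exact ⟨C, hC, fun p => by
    simp only [Pi.mul_apply]
    calc c p * a p ≤ c p * (C * b p) := mul_le_mul_of_nonneg_left (h p) (hc p)
      _ = _ := by ring⟩
end LeRules

section Nrules
variable {k : ℕ} {f g : Fld P} {B : Fn P}
lemma Nle_add (hf : N k f ≼ B) (hg : N k g ≼ B) : N k (f + g) ≼ B := by
  refine (Le.ofC 2 (by norm_num) fun p => ?_ : N k (f + g) ≼ N k f + N k g).trans (hf.add hg)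
  have := N_add k f g p; simp only [Pi.add_apply]; linarith
lemma Nle_neg (hf : N k f ≼ B) : N k (-f) ≼ B := (Le.of fun p => (N_neg k f p).le).trans hf
lemma Nle_sub (hf : N k f ≼ B) (hg : N k g ≼ B) : N k (f - g) ≼ B := by
  rw [sub_eq_add_neg]; exact Nle_add hf (Nle_neg hg)
lemma Nle_cc (r : ℝ) (hf : N k f ≼ B) : N k (cc r * f) ≼ B :=
  (Le.ofC (r ^ 2) (sq_nonneg r) fun p => (N_cc k r f p).le).trans hf
lemma Nle_congr (h : EQ f g) (hg : N k g ≼ B) : N k f ≼ B :=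
  (Le.of fun p => (N_congr h k p).le).trans hg
lemma Nle_D1 (hf : N (k + 1) f ≼ B) : N k (D 1 f) ≼ B := (Le.of fun p => N_D1 k f p).trans hf
lemma Nle_D2 (hf : N (k + 1) f ≼ B) : N k (D 2 f) ≼ B := (Le.of fun p => N_D2 k f p).trans hf
lemma Nle_down {l} (h : k ≤ l) (hf : N l f ≼ B) : N k f ≼ B := (Le.of fun p => N_mono h f p).trans hf
lemma Nle_succ (h0 : N k f ≼ B) (h1 : N k (D 1 f) ≼ B) (h2 : N k (D 2 f) ≼ B) : N (k + 1) f ≼ B :=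
  (Le.of fun p => (N_succ k f p).le : N (k + 1) f ≼ N k f + N k (D 1 f) + N k (D 2 f)).trans
    ((h0.add h1).add h2)
end Nrules

end Pf

set_option linter.unusedVariables false
namespace Pf
variable {P : Par}

lemma pe1 (p : Pt P) : p.S.e ≤ 1 := p.S.heδ.trans p.S.hδ
lemma pd0 (p : Pt P) : 0 ≤ p.S.δ := p.S.he.le.trans p.S.heδ

lemma I_le {f g : Fld P} {p : Pt P} (h : ∀ q ∈ Ω, ev (f p.S) (p.t, q) ≤ ev (g p.S) (p.t, q)) :
    I f p ≤ I g p := mul_le_mul_of_nonneg_left (J_mono h) (e2pos p)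

lemma prod0 (a b : Fld P) (p) : N 0 (a * b) p ≤ 4 * N 1 a p * N 1 b p := by
  have h := prodA (a p.S) (b p.S) (t := p.t) p.S.he (pe1 p)
  have h1 : In p.S.e p.t (a p.S * a p.S + Dm p.S.e 1 (a p.S) * Dm p.S.e 1 (a p.S)) ≤ N 1 a p := by
    rw [In_add, N_succ]; exact (add_le_add le_rfl le_rfl).trans (le_add_of_nonneg_right (N_nn 0 (D 2 a) p))
  have h2 : In p.S.e p.t (b p.S * b p.S + Dm p.S.e 2 (b p.S) * Dm p.S.e 2 (b p.S)) ≤ N 1 b p := by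
    rw [In_add, N_succ]
    have := N_nn 0 (D 1 b) p
    have e1 : N 0 b p = In p.S.e p.t (b p.S * b p.S) := rfl
    have e2 : N 0 (D 2 b) p = In p.S.e p.t (Dm p.S.e 2 (b p.S) * Dm p.S.e 2 (b p.S)) := rfl
    linarith
  have h3 : 0 ≤ In p.S.e p.t (b p.S * b p.S + Dm p.S.e 2 (b p.S) * Dm p.S.e 2 (b p.S)) := by
    rw [In_add]; exact add_nonneg (I_sq b p) (I_sq (D 2 b) p)
  refine h.trans (mul_le_mul (by linarith) h2 h3 (by have := N_nn 1 a p; positivity))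

lemma sup2 (a : Fld P) (p : Pt P) {q} (hq : q ∈ Ω) : ev (a p.S) (p.t, q) ^ 2 ≤ 4 * N 2 a p := by
  refine (supA (a p.S) p.S.he (pe1 p) hq).trans ?_
  rw [In_add, In_add, In_add]
  have e1 : N 0 a p = In p.S.e p.t (a p.S * a p.S) := rfl
  have e2 : N 0 (D 2 a) p = In p.S.e p.t (Dm p.S.e 2 (a p.S) * Dm p.S.e 2 (a p.S)) := rfl
  have e3 : N 0 (D 1 a) p = In p.S.e p.t (Dm p.S.e 1 (a p.S) * Dm p.S.e 1 (a p.S)) := rfl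
  have e4 : N 0 (D 1 (D 2 a)) p = In p.S.e p.t (Dm p.S.e 1 (Dm p.S.e 2 (a p.S)) * Dm p.S.e 1 (Dm p.S.e 2 (a p.S))) := rfl
  rw [← e1, ← e2, ← e3, ← e4]
  have h1 := N_succ 1 a p
  have h2 := N_succ 0 a p
  have h3 := N_succ 0 (D 2 a) p
  linarith [N_nn 1 (D 1 a) p, N_nn 0 (D 2 a) p, N_nn 0 (D 2 (D 2 a)) p]

lemma mul_sup0 (a b : Fld P) (p : Pt P) (C : ℝ) (h : ∀ q ∈ Ω, ev (a p.S) (p.t, q) ^ 2 ≤ C) :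
    N 0 (a * b) p ≤ C * N 0 b p := by
  rw [N_zero, N_zero, ← I_cc]
  apply I_le
  intro q hq
  have := h q hq
  have e : ev ((cc C * (b * b) : Fld P) p.S) (p.t, q) = C * (ev (b p.S) (p.t, q) * ev (b p.S) (p.t, q)) := by
    show ev (ca C * (b p.S * b p.S)) _ = _
    rw [show ca C * (b p.S * b p.S) = C • (b p.S * b p.S) from (Algebra.smul_def _ _).symm]; simp
  rw [e]
  simp only [F_mul, ev_mul]
  nlinarith [mul_self_nonneg (ev (b p.S) (p.t, q))]

lemma prodN0 (a b : Fld P) (p) : N 0 (a * b) p ≤ 4 * N 2 a p * N 0 b p :=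
  mul_sup0 a b p _ fun q hq => sup2 a p hq
lemma prodN1 (a b : Fld P) (p) : N 1 (a * b) p ≤ 40 * N 2 a p * N 1 b p := by
  have hb := N_succ 0 b p
  have ha := N_succ 1 a p
  have n1 := N_nn 0 b p; have n2 := N_nn 0 (D 1 b) p; have n3 := N_nn 0 (D 2 b) p
  have m1 := N_nn 1 a p; have m2 := N_nn 1 (D 1 a) p; have m3 := N_nn 1 (D 2 a) p
  have n4 := N_nn 1 b p
  rw [N_succ, D_mul, D_mul]
  have h0 := prodN0 a b p
  have h1 := prodN0 a (D 1 b) p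
  have h2 := prodN0 a (D 2 b) p
  have k1 := prod0 (D 1 a) b p
  have k2 := prod0 (D 2 a) b p
  have l1 := N_add 0 (D 1 a * b) (a * D 1 b) p
  have l2 := N_add 0 (D 2 a * b) (a * D 2 b) p
  have i1 : N 1 (D 1 a) p * N 1 b p ≤ N 2 a p * N 1 b p := mul_le_mul_of_nonneg_right (by linarith) n4
  have i2 : N 1 (D 2 a) p * N 1 b p ≤ N 2 a p * N 1 b p := mul_le_mul_of_nonneg_right (by linarith) n4
  have : N 2 a p * N 0 b p + N 2 a p * N 0 (D 1 b) p + N 2 a p * N 0 (D 2 b) p = N 2 a p * N 1 b p := by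
    rw [hb]; ring
  have n5 : 0 ≤ N 2 a p * N 0 b p := mul_nonneg (by linarith) n1
  nlinarith
lemma prodN2 (a b : Fld P) (p) : N 2 (a * b) p ≤ 400 * N 2 a p * N 2 b p := by
  have hb := N_succ 1 b p
  have ha := N_succ 1 a p
  have n1 := N_nn 1 b p; have n2 := N_nn 1 (D 1 b) p; have n3 := N_nn 1 (D 2 b) p
  have m1 := N_nn 1 a p; have m2 := N_nn 1 (D 1 a) p; have m3 := N_nn 1 (D 2 a) p
  have n4 := N_nn 2 b p; have m4 := N_nn 2 a p
  rw [N_succ 1 (a * b), D_mul, D_mul]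
  have h0 := prodN1 a b p
  have h1 := prodN1 a (D 1 b) p
  have h2 := prodN1 a (D 2 b) p
  have k1 := prodN1 b (D 1 a) p
  have k2 := prodN1 b (D 2 a) p
  rw [mul_comm b] at k1 k2
  have l1 := N_add 1 (D 1 a * b) (a * D 1 b) p
  have l2 := N_add 1 (D 2 a * b) (a * D 2 b) p
  have i0 : N 2 a p * N 1 b p ≤ N 2 a p * N 2 b p := mul_le_mul_of_nonneg_left (by linarith) m4
  have i1 : N 2 a p * N 1 (D 1 b) p ≤ N 2 a p * N 2 b p := mul_le_mul_of_nonneg_left (by linarith) m4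
  have i2 : N 2 a p * N 1 (D 2 b) p ≤ N 2 a p * N 2 b p := mul_le_mul_of_nonneg_left (by linarith) m4
  have j1 : N 2 b p * N 1 (D 1 a) p ≤ N 2 b p * N 2 a p := mul_le_mul_of_nonneg_left (by linarith) n4
  have j2 : N 2 b p * N 1 (D 2 a) p ≤ N 2 b p * N 2 a p := mul_le_mul_of_nonneg_left (by linarith) n4
  have : 0 ≤ N 2 a p * N 2 b p := mul_nonneg m4 n4
  nlinarith

/-- multipliers of weight `w` -/
def Mu (w : Fn P) (k : ℕ) (a : Fld P) : Prop :=
  ∃ C, 0 ≤ C ∧ ∀ j ≤ k, ∀ b p, N j (a * b) p ≤ C * (w p * N j b p)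

section Mu
variable {w w' : Fn P} {k : ℕ} {a b : Fld P}
lemma Mu.add (ha : Mu w k a) (hb : Mu w k b) : Mu w k (a + b) := by
  obtain ⟨C, hC, h⟩ := ha; obtain ⟨C', hC', h'⟩ := hb
  refine ⟨2 * C + 2 * C', by positivity, fun j hj f p => ?_⟩
  rw [add_mul]
  have := N_add j (a * f) (b * f) p
  have := h j hj f p; have := h' j hj f p
  linarith
lemma Mu.mul (ha : Mu w k a) (hw : ∀ p, 0 ≤ w p) (hb : Mu w' k b) : Mu (w * w') k (a * b) := by
  obtain ⟨C, hC, h⟩ := ha; obtain ⟨C', hC', h'⟩ := hb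
  refine ⟨C * C', by positivity, fun j hj f p => ?_⟩
  rw [mul_assoc]
  refine (h j hj _ p).trans ?_
  have := mul_le_mul_of_nonneg_left (h' j hj f p) (mul_nonneg hC (hw p))
  simp only [Pi.mul_apply]; linarith
lemma Mu.congr (ha : Mu w k a) (h : EQ b a) : Mu w k b := by
  obtain ⟨C, hC, h'⟩ := ha
  exact ⟨C, hC, fun j hj f p => by rw [N_congr (h.mul (EQ.refl f))]; exact h' j hj f p⟩
lemma Mu.wmono (ha : Mu w k a) (h : ∀ p, w p ≤ w' p) : Mu w' k a := by
  obtain ⟨C, hC, h'⟩ := ha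
  exact ⟨C, hC, fun j hj f p => (h' j hj f p).trans
    (mul_le_mul_of_nonneg_left (mul_le_mul_of_nonneg_right (h p) (N_nn _ _ _)) hC)⟩
lemma Mu.down {l} (hk : l ≤ k) (ha : Mu w k a) : Mu w l a := by
  obtain ⟨C, hC, h'⟩ := ha
  exact ⟨C, hC, fun j hj => h' j (hj.trans hk)⟩
lemma Mu_zero (C : ℝ) (hC : 0 ≤ C) (h : ∀ p : Pt P, ∀ q ∈ Ω, ev (a p.S) (p.t, q) ^ 2 ≤ C * w p) : Mu w 0 a :=
  ⟨C, hC, fun j hj b p => by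
    obtain rfl : j = 0 := by omega
    rw [← mul_assoc]; exact mul_sup0 a b p _ (h p)⟩
lemma Mu_succ (ha : Mu w k a) (hw : ∀ p, 0 ≤ w p) (h1 : Mu w k (D 1 a)) (h2 : Mu w k (D 2 a)) : Mu w (k + 1) a := by
  obtain ⟨C, hC, h⟩ := ha; obtain ⟨C1, hC1, h1⟩ := h1; obtain ⟨C2, hC2, h2⟩ := h2
  refine ⟨3 * C + 2 * C1 + 2 * C2, by positivity, fun j hj b p => ?_⟩
  rcases j with _ | j
  · refine (h 0 (by omega) b p).trans (mul_le_mul_of_nonneg_right (by linarith) (mul_nonneg (hw p) (N_nn _ _ _)))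
  have hj : j ≤ k := by omega
  rw [N_succ, N_succ, D_mul, D_mul]
  have l1 := N_add j (D 1 a * b) (a * D 1 b) p
  have l2 := N_add j (D 2 a * b) (a * D 2 b) p
  have q0 := h j hj b p; have q1 := h j hj (D 1 b) p; have q2 := h j hj (D 2 b) p
  have r1 := h1 j hj b p; have r2 := h2 j hj b p
  set W := w p
  have hW : 0 ≤ W := hw p
  have n1 : 0 ≤ W * N j b p := mul_nonneg hW (N_nn _ _ _)
  have n2 : 0 ≤ W * N j (D 1 b) p := mul_nonneg hW (N_nn _ _ _)
  have n3 : 0 ≤ W * N j (D 2 b) p := mul_nonneg hW (N_nn _ _ _)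
  have e : (3 * C + 2 * C1 + 2 * C2) * (W * (N j b p + N j (D 1 b) p + N j (D 2 b) p))
    = (3 * C + 2 * C1 + 2 * C2) * (W * N j b p) + (3 * C + 2 * C1 + 2 * C2) * (W * N j (D 1 b) p)
      + (3 * C + 2 * C1 + 2 * C2) * (W * N j (D 2 b) p) := by ring
  rw [e]
  nlinarith [mul_nonneg hC n1, mul_nonneg hC n2, mul_nonneg hC n3, mul_nonneg hC1 n1, mul_nonneg hC1 n2,
    mul_nonneg hC1 n3, mul_nonneg hC2 n1, mul_nonneg hC2 n2, mul_nonneg hC2 n3]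
lemma Mu_cS (r : Setup P → ℝ) (C : ℝ) (hC : 0 ≤ C) (h : ∀ p : Pt P, r p.S ^ 2 ≤ C * w p) : Mu w k (cS r) :=
  ⟨C, hC, fun j _ b p => by
    rw [N_cS, ← mul_assoc]; exact mul_le_mul_of_nonneg_right (h p) (N_nn _ _ _)⟩
lemma Mu_sob (C : ℝ) (hC : 0 ≤ C) (h : ∀ p, N 2 a p ≤ C * w p) : Mu w 2 a := by
  refine ⟨400 * C, by positivity, fun j hj b p => ?_⟩
  have hb := N_nn j b p
  have hp := h p
  have ha := N_nn 2 a p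
  have key : N j (a * b) p ≤ 400 * N 2 a p * N j b p := by
    interval_cases j
    · exact (prodN0 a b p).trans (by nlinarith [mul_nonneg ha hb])
    · exact (prodN1 a b p).trans (by nlinarith [mul_nonneg ha hb])
    · exact prodN2 a b p
  refine key.trans ?_
  have := mul_le_mul_of_nonneg_right hp hb
  linarith
end Mu

def d2f : Fn P := fun p => p.S.δ ^ 2
lemma d2f_nn (p : Pt P) : 0 ≤ d2f p := sq_nonneg _
lemma d2f_le (p : Pt P) : d2f p ≤ 1 := by
  have := p.S.hδ; have := pd0 p; unfold d2f; nlinarith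
/-- bounded multipliers -/
def Bm (a : Fld P) : Prop := ∀ k, k ≤ 2 → Mu 1 k a
/-- small multipliers -/
def SM (a : Fld P) : Prop := Mu d2f 2 a

section BmSM
variable {a b : Fld P}
lemma Bm.of (h : Mu 1 2 a) : Bm a := fun k hk => h.down hk
lemma Bm.two (h : Bm a) : Mu 1 2 a := h 2 le_rfl
lemma SM.bm (h : SM a) : Bm a := Bm.of (Mu.wmono h d2f_le)
lemma Bm.add (ha : Bm a) (hb : Bm b) : Bm (a + b) := Bm.of (ha.two.add hb.two)
lemma SM.add (ha : SM a) (hb : SM b) : SM (a + b) := Mu.add ha hb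
lemma Bm.mul (ha : Bm a) (hb : Bm b) : Bm (a * b) := by
  have := ha.two.mul (fun _ => zero_le_one) hb.two
  exact Bm.of (by simpa using this)
lemma SM.mulB (ha : SM a) (hb : Bm b) : SM (a * b) := by
  have := Mu.mul ha d2f_nn hb.two
  unfold SM; simpa using this
lemma SM.Bmul (ha : SM a) (hb : Bm b) : SM (b * a) := mul_comm a b ▸ ha.mulB hb
lemma Bm_cc (r : ℝ) : Bm (cc r : Fld P) :=
  Bm.of (Mu_cS _ (r ^ 2) (sq_nonneg r) fun p => by simp)
lemma Bm_one : Bm (1 : Fld P) := cc_one (P := P) ▸ Bm_cc 1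
lemma Bm.neg (ha : Bm a) : Bm (-a) := by
  have := (Bm_cc (P := P) (-1)).mul ha
  rw [cc_neg, cc_one] at this; simpa using this
lemma SM.neg (ha : SM a) : SM (-a) := by
  have := ha.Bmul (Bm_cc (P := P) (-1))
  rw [cc_neg, cc_one] at this; simpa using this
lemma Bm.sub (ha : Bm a) (hb : Bm b) : Bm (a - b) := by rw [sub_eq_add_neg]; exact ha.add hb.neg
lemma SM.sub (ha : SM a) (hb : SM b) : SM (a - b) := by rw [sub_eq_add_neg]; exact ha.add hb.neg
lemma SM_ee : SM (ee : Fld P) := Mu_cS _ 1 zero_le_one fun p => by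
  rw [one_mul]; exact pow_le_pow_left₀ p.S.he.le p.S.heδ 2
lemma SM.congr (ha : SM a) (h : EQ b a) : SM b := Mu.congr ha h
lemma SM_of (h : N 2 a ≼ d2f) : SM a := by
  obtain ⟨C, hC, h⟩ := h; exact Mu_sob C hC h
lemma SM.le {k} {f : Fld P} {B : Fn P} (ha : SM a) (hf : N k f ≼ B) (hk : k ≤ 2 := by norm_num) :
    N k (a * f) ≼ d2f * B := by
  obtain ⟨C, hC, h⟩ := ha
  exact Le.trans (⟨C, hC, fun p => by simpa using h k hk f p⟩ : N k (a * f) ≼ d2f * N k f)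
    (hf.mul_left d2f_nn)
lemma Bm.le {k} {f : Fld P} {B : Fn P} (ha : Bm a) (hf : N k f ≼ B) (hk : k ≤ 2 := by norm_num) :
    N k (a * f) ≼ B := by
  obtain ⟨C, hC, h⟩ := ha k hk
  exact Le.trans (⟨C, hC, fun p => by simpa using h k le_rfl f p⟩ : N k (a * f) ≼ N k f) hf
end BmSM

/-! basic fields -/
def fΦ : Fld P := fun S => S.Φ
def fΨ1 : Fld P := fun S => S.Ψ1
def fΨ2 : Fld P := fun S => S.Ψ2
def fΘ : Fld P := fun S => S.Θ
def fs : Fld P := fun S => S.s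
def fτ : Fld P := fun S => S.τ
def fϑ : Fld P := fun S => S.ϑ
def ftp : Fld P := fun S => S.tp
def fX : Fld P := fun _ => X

lemma sτ : (fs * fτ : Fld P) = 1 := funext fun S => S.hsτ
lemma τeq : (fτ : Fld P) = 1 + ee * fϑ := funext fun S => S.hτ
lemma D0ϑ : D 0 (fϑ : Fld P) = 0 := funext fun S => S.hϑ0
lemma D1ϑ : D 1 (fϑ : Fld P) = 0 := funext fun S => S.hϑ1
lemma D2ϑ : D 2 (fϑ : Fld P) = ee * ftp := funext fun S => S.hϑ2
lemma D_one (i) : D i (1 : Fld P) = 0 := cc_one (P := P) ▸ D_cc i 1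
lemma D0τ : D 0 (fτ : Fld P) = 0 := by rw [τeq, D_add, D_one, D_eemul, D0ϑ]; ring
lemma D1τ : D 1 (fτ : Fld P) = 0 := by rw [τeq, D_add, D_one, D_eemul, D1ϑ]; ring
lemma D2τ : D 2 (fτ : Fld P) = ee * (ee * ftp) := by rw [τeq, D_add, D_one, D_eemul, D2ϑ]; ring
lemma Ds (i) : D i (fs : Fld P) = -(fs * fs * D i fτ) := by
  have h := congrArg (D i) (sτ (P := P))
  rw [D_mul, D_one] at h
  have h2 := sτ (P := P)
  linear_combination fs * h - D i fs * h2
lemma D0s : D 0 (fs : Fld P) = 0 := by rw [Ds, D0τ]; ring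
lemma D1s : D 1 (fs : Fld P) = 0 := by rw [Ds, D1τ]; ring
lemma D2s : D 2 (fs : Fld P) = -(ee * (ee * (fs * fs * ftp))) := by rw [Ds, D2τ]; ring
lemma s_sub : (fs - 1 : Fld P) = -(ee * (fs * fϑ)) := by
  have := sτ (P := P); rw [τeq] at this; linear_combination this
lemma D0X : D 0 (fX : Fld P) = 0 := by
  funext S; show Dm _ 0 X = 0
  rw [Dm0]
  have : dd (1, 0, 0) X = 0 := by
    apply ev_ext; rintro ⟨t, x, y⟩
    exact ((hasDeriv_t X t x y).unique (hasDerivAt_const t y)).trans rfl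
  rw [this, smul_zero]
lemma D1X : D 1 (fX : Fld P) = 0 := by
  funext S; show Dm _ 1 X = 0
  rw [Dm1]
  have : dd (0, 1, 0) X = 0 := by
    apply ev_ext; rintro ⟨t, x, y⟩
    exact ((hasDeriv_x X t x y).unique (hasDerivAt_const x y)).trans rfl
  rw [this, smul_zero]
lemma D2X : D 2 (fX : Fld P) = ee := by
  funext S; show Dm _ 2 X = ca S.e
  rw [Dm2]
  have : dd (0, 0, 1) X = 1 := by
    apply ev_ext; rintro ⟨t, x, y⟩
    exact ((hasDeriv_y X t x y).unique (hasDerivAt_id y)).trans rfl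
  rw [this, Algebra.smul_def, mul_one]
def cA : Fld P := cS fun S => S.A
def cB : Fld P := cS fun S => S.B
lemma tp_eq : EQ (ftp : Fld P) (cA + cB * fX) := fun S => S.htp
lemma D0tp : EQ (D 0 (ftp : Fld P)) 0 := by
  have := (tp_eq (P := P)).D 0
  rwa [D_add, cA, cB, D_cSmul, D_cS, D0X, mul_zero, add_zero] at this
lemma D1tp : EQ (D 1 (ftp : Fld P)) 0 := by
  have := (tp_eq (P := P)).D 1
  rwa [D_add, cA, cB, D_cSmul, D_cS, D1X, mul_zero, add_zero] at this
lemma D2tp : EQ (D 2 (ftp : Fld P)) (cB * ee) := by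
  have := (tp_eq (P := P)).D 2
  rwa [D_add, cA, cB, D_cSmul, D_cS, D2X, zero_add] at this

lemma one_nn (p : Pt P) : (0:ℝ) ≤ (1 : Fn P) p := zero_le_one
lemma Mu_sup {a : Fld P} (C : ℝ) (h : ∀ S : Setup P, ∀ t ∈ Set.Ioo 0 S.T, ∀ q ∈ Ω, |ev (a S) (t, q)| ≤ C) :
    Mu 1 0 a := Mu_zero (C ^ 2) (sq_nonneg C) fun p q hq => by
  have := h p.S p.t p.ht q hq
  rw [Pi.one_apply, mul_one, ← sq_abs]; exact pow_le_pow_left₀ (abs_nonneg _) this 2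
lemma Bm_c {r : Setup P → ℝ} (h : ∀ S, |r S| ≤ P.K) : Bm (cS r) :=
  Bm.of (Mu_cS _ (P.K ^ 2) (sq_nonneg _) fun p => by
    rw [Pi.one_apply, mul_one, ← sq_abs]; exact pow_le_pow_left₀ (abs_nonneg _) (h _) 2)
lemma Bm_A : Bm (cA : Fld P) := Bm_c fun S => S.hA
lemma Bm_B : Bm (cB : Fld P) := Bm_c fun S => S.hB
lemma Bm_e : Bm (ee : Fld P) := SM_ee.bm
lemma Bm_zero : Bm (0 : Fld P) := by have := (Bm_one (P := P)).sub Bm_one; rwa [sub_self] at this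
lemma Bm_X : Bm (fX : Fld P) := by
  have h0 : Mu 1 0 (fX : Fld P) := Mu_sup 1 fun S t ht q hq => by
    show |q.2| ≤ 1
    rw [abs_le]; have := hq.2; exact ⟨by linarith [this.1], this.2.le⟩
  have h1 : Mu 1 1 (fX : Fld P) := Mu_succ h0 one_nn (by rw [D1X]; exact Bm_zero 0 (by omega))
    (by rw [D2X]; exact Bm_e 0 (by omega))
  exact Bm.of (Mu_succ h1 one_nn (by rw [D1X]; exact Bm_zero 1 (by omega))
    (by rw [D2X]; exact Bm_e 1 (by omega)))
lemma Bm.congr {a b : Fld P} (ha : Bm a) (h : EQ b a) : Bm b := fun k hk => (ha k hk).congr h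
lemma Bm_tp : Bm (ftp : Fld P) := (Bm_A.add (Bm_B.mul Bm_X)).congr tp_eq
lemma Mu1_mul {a b : Fld P} {k} (ha : Mu 1 k a) (hb : Mu 1 k b) : Mu 1 k (a * b) := by
  have := ha.mul one_nn hb; rwa [one_mul] at this
lemma Bm_ϑ : Bm (fϑ : Fld P) := by
  have h0 : Mu 1 0 (fϑ : Fld P) := Mu_sup P.K fun S => S.ϑB
  have hh : Bm (D 2 (fϑ : Fld P)) := by rw [D2ϑ]; exact Bm_e.mul Bm_tp
  have h1 : Mu 1 1 (fϑ : Fld P) := Mu_succ h0 one_nn (by rw [D1ϑ]; exact Bm_zero 0 (by omega)) (hh 0 (by omega))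
  exact Bm.of (Mu_succ h1 one_nn (by rw [D1ϑ]; exact Bm_zero 1 (by omega)) (hh 1 (by omega)))
lemma Bm_s : Bm (fs : Fld P) := by
  have h0 : Mu 1 0 (fs : Fld P) := Mu_sup 2 fun S => S.sB
  have hh : ∀ k ≤ 2, Mu 1 k (fs : Fld P) → Mu 1 k (D 2 (fs : Fld P)) := by
    intro k hk h
    rw [show D 2 (fs : Fld P) = -(ee * ee * ftp) * (fs * fs) by rw [D2s]; ring]
    exact Mu1_mul (((Bm_e.mul Bm_e).mul Bm_tp).neg k hk) (Mu1_mul h h)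
  have h1 : Mu 1 1 (fs : Fld P) := Mu_succ h0 one_nn (by rw [D1s]; exact Bm_zero 0 (by omega)) (hh 0 (by omega) h0)
  exact Bm.of (Mu_succ h1 one_nn (by rw [D1s]; exact Bm_zero 1 (by omega)) (hh 1 (by omega) h1))
lemma Bm_τ : Bm (fτ : Fld P) := by rw [τeq]; exact Bm_one.add (Bm_e.mul Bm_ϑ)
lemma SM_s1 : SM (fs - 1 : Fld P) := by rw [s_sub]; exact (SM_ee.mulB (Bm_s.mul Bm_ϑ)).neg
lemma SM_τ1 : SM (fτ - 1 : Fld P) := by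
  rw [τeq, add_sub_cancel_left]; exact SM_ee.mulB Bm_ϑ

section small
lemma sm3 (p : Pt P) : N 3 fΦ p + N 3 fΨ1 p + N 3 fΨ2 p + N 3 fΘ p ≤ d2f p := p.S.small p.t p.ht
lemma s3Φ : N 3 (fΦ : Fld P) ≼ d2f := Le.of fun p => by
  linarith [sm3 p, N_nn 3 fΨ1 p, N_nn 3 fΨ2 p, N_nn 3 fΘ p]
lemma s3Ψ1 : N 3 (fΨ1 : Fld P) ≼ d2f := Le.of fun p => by
  linarith [sm3 p, N_nn 3 fΦ p, N_nn 3 fΨ2 p, N_nn 3 fΘ p]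
lemma s3Ψ2 : N 3 (fΨ2 : Fld P) ≼ d2f := Le.of fun p => by
  linarith [sm3 p, N_nn 3 fΨ1 p, N_nn 3 fΦ p, N_nn 3 fΘ p]
lemma s3Θ : N 3 (fΘ : Fld P) ≼ d2f := Le.of fun p => by
  linarith [sm3 p, N_nn 3 fΨ1 p, N_nn 3 fΨ2 p, N_nn 3 fΦ p]
variable {f : Fld P}
lemma smA (h : N 3 f ≼ d2f) : SM f := SM_of (Nle_down (by norm_num) h)
lemma smB (h : N 3 f ≼ d2f) : SM (D 1 f) := SM_of (Nle_D1 h)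
lemma smC (h : N 3 f ≼ d2f) : SM (D 2 f) := SM_of (Nle_D2 h)
end small

lemma SM_Φ : SM (fΦ : Fld P) := smA s3Φ
lemma SM_Ψ1 : SM (fΨ1 : Fld P) := smA s3Ψ1
lemma SM_Ψ2 : SM (fΨ2 : Fld P) := smA s3Ψ2
lemma SM_Θ : SM (fΘ : Fld P) := smA s3Θ

lemma bdΨ1 : BD (fΨ1 : Fld P) := fun S => S.bΨ1
lemma bdΨ2 : BD (fΨ2 : Fld P) := fun S => S.bΨ2
lemma bdΘ : BD (fΘ : Fld P) := fun S => S.bΘ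

/-- velocity components, density deviation -/
def V1 : Fld P := ee * (fX + fΨ1)
def V2 : Fld P := ee * fΨ2
def r1 : Fld P := fs - 1 + ee * fΦ
def q1 : Fld P := ee * fΦ * fτ + fs * (ee * fΘ) + ee * fΦ * (ee * fΘ)
lemma SM_V1 : SM (V1 : Fld P) := SM_ee.mulB (Bm_X.add SM_Ψ1.bm)
lemma SM_V2 : SM (V2 : Fld P) := SM_ee.mulB SM_Ψ2.bm
lemma SM_r1 : SM (r1 : Fld P) := SM_s1.add (SM_ee.mulB SM_Φ.bm)
lemma SM_q1 : SM (q1 : Fld P) :=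
  ((SM_ee.mulB SM_Φ.bm).mulB Bm_τ |>.add ((SM_ee.mulB SM_Θ.bm).Bmul Bm_s)).add
    ((SM_ee.mulB SM_Φ.bm).mulB (SM_ee.mulB SM_Θ.bm).bm)

end Pf

set_option linter.unusedVariables false
namespace Pf
variable {P : Par}

def cμ : Fld P := cc P.μ
def cl : Fld P := cc P.lam
def cg : Fld P := cc P.g
def cκ : Fld P := cc P.κ
lemma D_cμ (i) (f : Fld P) : D i (cμ * f) = cμ * D i f := D_ccmul _ _ _
lemma D_cl (i) (f : Fld P) : D i (cl * f) = cl * D i f := D_ccmul _ _ _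
lemma D_cg (i) (f : Fld P) : D i (cg * f) = cg * D i f := D_ccmul _ _ _
lemma D_cκ (i) (f : Fld P) : D i (cκ * f) = cκ * D i f := D_ccmul _ _ _

def dv (a b : Fld P) : Fld P := D 1 a + D 2 b
def Lp (a : Fld P) : Fld P := D 1 (D 1 a) + D 2 (D 2 a)
def R0 (f a b : Fld P) : Fld P := D 0 f + dv a b
def R1 (f a b h : Fld P) : Fld P := D 0 a + D 1 f + D 1 h - cμ * Lp a - cl * D 1 (dv a b)
def R2 (f a b h : Fld P) : Fld P := D 0 b + D 2 f + D 2 h - cμ * Lp b - cl * D 2 (dv a b)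
def R3 (a b h : Fld P) : Fld P := cg * D 0 h + dv a b - cκ * Lp h
lemma D_dv (i) (a b : Fld P) : D i (dv a b) = dv (D i a) (D i b) := by
  unfold dv; rw [D_add, D_comm i 1, D_comm i 2]
lemma D_Lp (i) (a : Fld P) : D i (Lp a) = Lp (D i a) := by
  unfold Lp; rw [D_add, D_comm i 1, D_comm i 2, D_comm i 1, D_comm i 2]
lemma D_R0 (i) (f a b : Fld P) : D i (R0 f a b) = R0 (D i f) (D i a) (D i b) := by
  unfold R0; rw [D_add, D_dv, D_comm i 0]
lemma D_R1 (i) (f a b h : Fld P) : D i (R1 f a b h) = R1 (D i f) (D i a) (D i b) (D i h) := by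
  unfold R1; rw [D_sub, D_sub, D_add, D_add, D_cμ, D_cl, D_Lp, D_comm i 1, D_comm i 1, D_comm i 1, D_dv, D_comm i 0]
lemma D_R2 (i) (f a b h : Fld P) : D i (R2 f a b h) = R2 (D i f) (D i a) (D i b) (D i h) := by
  unfold R2; rw [D_sub, D_sub, D_add, D_add, D_cμ, D_cl, D_Lp, D_comm i 2, D_comm i 2, D_comm i 2, D_dv, D_comm i 0]
lemma D_R3 (i) (a b h : Fld P) : D i (R3 a b h) = R3 (D i a) (D i b) (D i h) := by
  unfold R3; rw [D_sub, D_add, D_cg, D_cκ, D_Lp, D_dv, D_comm i 0]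

def F0 : Fld P := R0 fΦ fΨ1 fΨ2
def F1 : Fld P := R1 fΦ fΨ1 fΨ2 fΘ
def F2 : Fld P := R2 fΦ fΨ1 fΨ2 fΘ
def F3 : Fld P := R3 fΨ1 fΨ2 fΘ

def k1 : Fld P := ee * (fs * fs * ftp)
def k2 : Fld P := ee * ftp
def r2 : Fld P := 1 + r1
def G0 : Fld P := -(V1 * D 1 fΦ + V2 * D 2 fΦ) - r1 * dv fΨ1 fΨ2 + k1 * (ee * fΨ2)
def T1 : Fld P := V1 * D 1 fΨ1 + V2 * D 2 fΨ1 + ee * (ee * fΨ2)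
def T2 : Fld P := V1 * D 1 fΨ2 + V2 * D 2 fΨ2
def T3 : Fld P := V1 * D 1 fΘ + V2 * D 2 fΘ + k2 * (ee * fΨ2)
def G1 : Fld P := -(r1 * D 0 fΨ1) - r2 * T1 - (fs - 1) * D 1 fΘ - (fτ - 1) * D 1 fΦ
  - ee * (fΘ * D 1 fΦ) - ee * (fΦ * D 1 fΘ)
def G2 : Fld P := -(r1 * D 0 fΨ2) - r2 * T2 - (fs - 1) * D 2 fΘ - (fτ - 1) * D 2 fΦ
  + k1 * (ee * fΘ) - k2 * (ee * fΦ) - ee * (fΘ * D 2 fΦ) - ee * (fΦ * D 2 fΘ)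
def G3 : Fld P := -(cg * (r1 * D 0 fΘ)) - cg * (r2 * T3) - q1 * dv fΨ1 fΨ2
  + ee * (cc (2 * P.μ) * (D 1 fΨ1 * D 1 fΨ1 + D 2 fΨ2 * D 2 fΨ2)
          + cc P.μ * ((D 1 fΨ2 + D 2 fΨ1) * (D 1 fΨ2 + D 2 fΨ1))
          + cc (P.lam - P.μ) * (dv fΨ1 fΨ2 * dv fΨ1 fΨ2))
  + cc (2 * P.μ) * (ee * (ee * (D 1 fΨ2 + D 2 fΨ1)))

lemma F0_eq : EQ (F0 : Fld P) G0 := by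
  apply EQ.of_sub
  have h : EQ (D 0 (fΦ : Fld P) + (ee * (fX + fΨ1) * D 1 fΦ + ee * fΨ2 * D 2 fΦ)
    + (fs + ee * fΦ) * (D 1 fΨ1 + D 2 fΨ2) + fΨ2 * D 2 fs) 0 := fun S => S.mass
  convert h using 1
  rw [D2s]; simp only [F0, R0, G0, V1, V2, r1, k1, dv]; ring
lemma F1_eq : EQ (F1 : Fld P) G1 := by
  apply EQ.of_sub
  have h : EQ ((fs + ee * fΦ) * (D 0 fΨ1 + (ee * (fX + fΨ1) * D 1 fΨ1 + ee * fΨ2 * D 2 fΨ1)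
      + ee * (ee * fΨ2)) + D 1 (fs * fΘ + fτ * fΦ + ee * fΦ * fΘ)
      - cc P.μ * (D 1 (D 1 fΨ1) + D 2 (D 2 fΨ1))
      - cc P.lam * D 1 (D 1 fΨ1 + D 2 fΨ2) : Fld P) 0 := fun S => S.mom1
  convert h using 1
  simp only [D_add, D_mul, D1s, D1τ, D_ee, F1, R1, G1, V1, V2, r1, r2, T1, dv, Lp, cμ, cl]; ring
lemma F2_eq : EQ (F2 : Fld P) G2 := by
  apply EQ.of_sub
  have h : EQ ((fs + ee * fΦ) * (D 0 fΨ2 + (ee * (fX + fΨ1) * D 1 fΨ2 + ee * fΨ2 * D 2 fΨ2))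
      + D 2 (fs * fΘ + fτ * fΦ + ee * fΦ * fΘ)
      - cc P.μ * (D 1 (D 1 fΨ2) + D 2 (D 2 fΨ2))
      - cc P.lam * D 2 (D 1 fΨ1 + D 2 fΨ2) : Fld P) 0 := fun S => S.mom2
  convert h using 1
  simp only [D_add, D_mul, D2s, D2τ, D_ee, F2, R2, G2, V1, V2, r1, r2, T2, dv, Lp, cμ, cl, k1, k2]; ring
lemma F3_eq : EQ (F3 : Fld P) G3 := by
  apply EQ.of_sub
  have h : EQ (cc P.g * (fs + ee * fΦ) * (D 0 fΘ
        + (ee * (fX + fΨ1) * D 1 fΘ + ee * fΨ2 * D 2 fΘ) + fΨ2 * D 2 fτ)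
      + (fs + ee * fΦ) * (fτ + ee * fΘ) * (D 1 fΨ1 + D 2 fΨ2)
      - cc P.κ * (D 1 (D 1 fΘ) + D 2 (D 2 fΘ))
      - (ee * (cc (2 * P.μ) * (D 1 fΨ1 * D 1 fΨ1 + D 2 fΨ2 * D 2 fΨ2)
          + cc P.μ * ((D 1 fΨ2 + D 2 fΨ1) * (D 1 fΨ2 + D 2 fΨ1))
          + cc (P.lam - P.μ) * ((D 1 fΨ1 + D 2 fΨ2) * (D 1 fΨ1 + D 2 fΨ2)))
        + cc (2 * P.μ) * (ee * (ee * (D 1 fΨ2 + D 2 fΨ1)))) : Fld P) 0 := fun S => S.energy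
  convert h using 1
  simp only [D2τ, F3, R3, G3, V1, V2, r1, r2, q1, T3, dv, Lp, cg, cκ, k2]
  have := sτ (P := P)
  linear_combination (-(D 1 fΨ1 + D 2 fΨ2) : Fld P) * this

lemma SM_k1 : SM (k1 : Fld P) := SM_ee.mulB ((Bm_s.mul Bm_s).mul Bm_tp)
lemma SM_k2 : SM (k2 : Fld P) := SM_ee.mulB Bm_tp
lemma Bm_r2 : Bm (r2 : Fld P) := Bm_one.add SM_r1.bm
lemma SM_dv : SM (dv fΨ1 fΨ2 : Fld P) := (smB s3Ψ1).add (smC s3Ψ2)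

section bounds
variable {k : ℕ} {B : Fn P}
/-- list of base bounds -/
structure Bs (k : ℕ) (B : Fn P) : Prop where
  a1 : N k (D 1 fΦ) ≼ B
  a2 : N k (D 2 fΦ) ≼ B
  b1 : N k (D 1 fΨ1) ≼ B
  b2 : N k (D 2 fΨ1) ≼ B
  c1 : N k (D 1 fΨ2) ≼ B
  c2 : N k (D 2 fΨ2) ≼ B
  d1 : N k (D 1 fΘ) ≼ B
  d2 : N k (D 2 fΘ) ≼ B
  b0 : N k (D 0 fΨ1) ≼ B
  c0 : N k (D 0 fΨ2) ≼ B
  d0 : N k (D 0 fΘ) ≼ B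
  ea : N k (ee * fΦ) ≼ B
  eb : N k (ee * fΨ1) ≼ B
  ec : N k (ee * fΨ2) ≼ B
  ed : N k (ee * fΘ) ≼ B

lemma G0_le (hk : k ≤ 2) (a1 : N k (D 1 fΦ) ≼ B) (a2 : N k (D 2 fΦ) ≼ B) (b1 : N k (D 1 fΨ1) ≼ B)
    (c2 : N k (D 2 fΨ2) ≼ B) (ec : N k (ee * fΨ2) ≼ B) : N k (F0 : Fld P) ≼ d2f * B := by
  refine Nle_congr F0_eq ?_
  exact Nle_add (Nle_sub (Nle_neg (Nle_add (SM_V1.le a1 hk) (SM_V2.le a2 hk)))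
    (SM_r1.le (Nle_add b1 c2) hk)) (SM_k1.le ec hk)
lemma G1_le (hk : k ≤ 2) (h : Bs k B) : N k (F1 : Fld P) ≼ d2f * B := by
  refine Nle_congr F1_eq ?_
  exact Nle_sub (Nle_sub (Nle_sub (Nle_sub (Nle_sub (Nle_neg (SM_r1.le h.b0 hk))
    (Bm_r2.le (Nle_add (Nle_add (SM_V1.le h.b1 hk) (SM_V2.le h.b2 hk)) (SM_ee.le h.ec hk)) hk))
    (SM_s1.le h.d1 hk)) (SM_τ1.le h.a1 hk)) (Bm_e.le (SM_Θ.le h.a1 hk) hk)) (Bm_e.le (SM_Φ.le h.d1 hk) hk)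
lemma G2_le (hk : k ≤ 2) (h : Bs k B) : N k (F2 : Fld P) ≼ d2f * B := by
  refine Nle_congr F2_eq ?_
  exact Nle_sub (Nle_sub (Nle_sub (Nle_add (Nle_sub (Nle_sub (Nle_sub (Nle_neg (SM_r1.le h.c0 hk))
    (Bm_r2.le (Nle_add (SM_V1.le h.c1 hk) (SM_V2.le h.c2 hk)) hk))
    (SM_s1.le h.d2 hk)) (SM_τ1.le h.a2 hk)) (SM_k1.le h.ed hk)) (SM_k2.le h.ea hk))
    (Bm_e.le (SM_Θ.le h.a2 hk) hk)) (Bm_e.le (SM_Φ.le h.d2 hk) hk)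
lemma G3_le (hk : k ≤ 2) (h : Bs k B) : N k (F3 : Fld P) ≼ d2f * B := by
  refine Nle_congr F3_eq ?_
  exact Nle_add (Nle_add (Nle_sub (Nle_sub (Nle_neg (Nle_cc _ (SM_r1.le h.d0 hk)))
    (Nle_cc _ (Bm_r2.le (Nle_add (Nle_add (SM_V1.le h.d1 hk) (SM_V2.le h.d2 hk)) (SM_k2.le h.ec hk)) hk)))
    (SM_q1.le (Nle_add h.b1 h.c2) hk))
    (Bm_e.le (Nle_add (Nle_add (Nle_cc _ (Nle_add ((smB s3Ψ1).le h.b1 hk) ((smC s3Ψ2).le h.c2 hk)))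
      (Nle_cc _ (((smB s3Ψ2).add (smC s3Ψ1)).le (Nle_add h.c1 h.b2) hk)))
      (Nle_cc _ (SM_dv.le (Nle_add h.b1 h.c2) hk))) hk))
    (Nle_cc _ (SM_ee.le (Bm_e.le (Nle_add h.c1 h.b2) hk) hk))
end bounds

lemma Le_one : (d2f : Fn P) ≼ 1 := Le.of d2f_le
lemma SM_D0Φ : SM (D 0 (fΦ : Fld P)) := by
  apply SM_of
  have h : N 2 (F0 : Fld P) ≼ d2f * 1 := G0_le le_rfl ((Nle_D1 s3Φ).trans Le_one) ((Nle_D2 s3Φ).trans Le_one)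
    ((Nle_D1 s3Ψ1).trans Le_one) ((Nle_D2 s3Ψ2).trans Le_one)
    (Bm_e.le (Nle_down (by norm_num) s3Ψ2 |>.trans Le_one))
  rw [mul_one] at h
  have e : D 0 (fΦ : Fld P) = F0 - (D 1 fΨ1 + D 2 fΨ2) := by simp only [F0, R0, dv]; ring
  rw [e]; exact Nle_sub h (Nle_add (Nle_D1 s3Ψ1) (Nle_D2 s3Ψ2))

/-! the full dissipation -/
def Dl : List (Fn P) := [N 2 (D 1 fΦ), N 2 (D 2 fΦ), N 2 (D 0 fΦ), N 0 (ee * fΦ),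
  N 3 (D 1 fΨ1), N 3 (D 2 fΨ1), N 2 (D 0 fΨ1), N 0 (D 0 (D 0 fΨ1)), N 0 (ee * fΨ1),
  N 3 (D 1 fΨ2), N 3 (D 2 fΨ2), N 2 (D 0 fΨ2), N 0 (D 0 (D 0 fΨ2)), N 0 (ee * fΨ2),
  N 3 (D 1 fΘ), N 3 (D 2 fΘ), N 2 (D 0 fΘ), N 0 (D 0 (D 0 fΘ)), N 0 (ee * fΘ)]
def 𝒟 : Fn P := Dl.sum
lemma list_nn (l : List (Fn P)) (h : ∀ f ∈ l, ∀ p, 0 ≤ f p) (p) : 0 ≤ l.sum p := by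
  induction l with
  | nil => simp
  | cons a l ih =>
    rw [List.sum_cons, Pi.add_apply]
    exact add_nonneg (h a (by simp) p) (ih fun f hf => h f (by simp [hf]))
lemma list_mem (l : List (Fn P)) (h : ∀ f ∈ l, ∀ p, 0 ≤ f p) {f} (hf : f ∈ l) (p) : f p ≤ l.sum p := by
  induction l with
  | nil => simp at hf
  | cons a l ih =>
    rw [List.sum_cons, Pi.add_apply]
    rcases List.mem_cons.1 hf with rfl | hf
    · linarith [list_nn l (fun f hf => h f (by simp [hf])) p]
    · linarith [ih (fun f hf => h f (by simp [hf])) hf, h a (by simp) p]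
lemma Dl_nn : ∀ f ∈ (Dl : List (Fn P)), ∀ p, 0 ≤ f p := by
  intro f hf p
  simp only [Dl, List.mem_cons, List.not_mem_nil, or_false] at hf
  rcases hf with h | h | h | h | h | h | h | h | h | h | h | h | h | h | h | h | h | h | h <;> (rw [h]; exact N_nn _ _ _)
lemma 𝒟_nn (p : Pt P) : 0 ≤ 𝒟 p := list_nn _ Dl_nn p
lemma Dmem {f : Fn P} (hf : f ∈ (Dl : List (Fn P))) : f ≼ 𝒟 := Le.of fun p => list_mem _ Dl_nn hf p

section mems
lemma mΦ1 : N 2 (D 1 (fΦ : Fld P)) ≼ 𝒟 := Dmem (by simp [Dl])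
lemma mΦ2 : N 2 (D 2 (fΦ : Fld P)) ≼ 𝒟 := Dmem (by simp [Dl])
lemma mΦ0 : N 2 (D 0 (fΦ : Fld P)) ≼ 𝒟 := Dmem (by simp [Dl])
lemma mΦe : N 0 (ee * (fΦ : Fld P)) ≼ 𝒟 := Dmem (by simp [Dl])
/-- the parabolic unknowns -/
def Par3 (a : Fld P) : Prop := a = fΨ1 ∨ a = fΨ2 ∨ a = fΘ
lemma p1 : Par3 (fΨ1 : Fld P) := Or.inl rfl
lemma p2 : Par3 (fΨ2 : Fld P) := Or.inr (Or.inl rfl)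
lemma p3 : Par3 (fΘ : Fld P) := Or.inr (Or.inr rfl)
variable {a : Fld P}
lemma Par3.m1 (h : Par3 a) : N 3 (D 1 a) ≼ 𝒟 := by
  rcases h with rfl | rfl | rfl <;> exact Dmem (by simp [Dl])
lemma Par3.m2 (h : Par3 a) : N 3 (D 2 a) ≼ 𝒟 := by
  rcases h with rfl | rfl | rfl <;> exact Dmem (by simp [Dl])
lemma Par3.m0 (h : Par3 a) : N 2 (D 0 a) ≼ 𝒟 := by
  rcases h with rfl | rfl | rfl <;> exact Dmem (by simp [Dl])
lemma Par3.m00 (h : Par3 a) : N 0 (D 0 (D 0 a)) ≼ 𝒟 := by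
  rcases h with rfl | rfl | rfl <;> exact Dmem (by simp [Dl])
lemma Par3.me (h : Par3 a) : N 0 (ee * a) ≼ 𝒟 := by
  rcases h with rfl | rfl | rfl <;> exact Dmem (by simp [Dl])
lemma Par3.bd (h : Par3 a) : BD a := by
  rcases h with rfl | rfl | rfl
  exacts [bdΨ1, bdΨ2, bdΘ]
lemma Par3.s (h : Par3 a) : N 3 a ≼ d2f := by
  rcases h with rfl | rfl | rfl
  exacts [s3Ψ1, s3Ψ2, s3Θ]
lemma e_lift {k} {f : Fld P} {B : Fn P} (hk : k ≤ 2) (h0 : N 0 (ee * f) ≼ B) (h1 : N k (D 1 f) ≼ B)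
    (h2 : N k (D 2 f) ≼ B) : N (k + 1) (ee * f) ≼ B := by
  induction k with
  | zero => exact Nle_succ h0 (by rw [D_eemul]; exact Bm_e.le h1) (by rw [D_eemul]; exact Bm_e.le h2)
  | succ k ih =>
    refine Nle_succ (ih (by omega) (Nle_down (by omega) h1) (Nle_down (by omega) h2)) ?_ ?_
    · rw [D_eemul]; exact Bm_e.le h1 (by omega)
    · rw [D_eemul]; exact Bm_e.le h2 (by omega)
lemma Par3.me3 (h : Par3 a) : N 3 (ee * a) ≼ 𝒟 :=
  e_lift le_rfl h.me (Nle_down (by norm_num) h.m1) (Nle_down (by norm_num) h.m2)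
lemma mΦe3 : N 3 (ee * (fΦ : Fld P)) ≼ 𝒟 := e_lift le_rfl mΦe mΦ1 mΦ2
end mems

lemma Bs2 : Bs 2 (𝒟 : Fn P) :=
  ⟨mΦ1, mΦ2, Nle_down (by norm_num) p1.m1, Nle_down (by norm_num) p1.m2, Nle_down (by norm_num) p2.m1,
   Nle_down (by norm_num) p2.m2, Nle_down (by norm_num) p3.m1, Nle_down (by norm_num) p3.m2,
   p1.m0, p2.m0, p3.m0, Nle_down (by norm_num) mΦe3, Nle_down (by norm_num) p1.me3,
   Nle_down (by norm_num) p2.me3, Nle_down (by norm_num) p3.me3⟩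
lemma F0_le : N 2 (F0 : Fld P) ≼ d2f * 𝒟 := G0_le le_rfl Bs2.a1 Bs2.a2 Bs2.b1 Bs2.c2 Bs2.ec
lemma F1_le : N 2 (F1 : Fld P) ≼ d2f * 𝒟 := G1_le le_rfl Bs2
lemma F2_le : N 2 (F2 : Fld P) ≼ d2f * 𝒟 := G2_le le_rfl Bs2
lemma F3_le : N 2 (F3 : Fld P) ≼ d2f * 𝒟 := G3_le le_rfl Bs2

/-! time derivative of the residuals -/
section D0F
/-- good terms -/
def Gt (f : Fld P) : Prop := N 0 f ≼ d2f * 𝒟 ∧ N 0 (D 0 f) ≼ d2f * 𝒟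
def Dt (f : Fld P) : Prop := N 0 f ≼ 𝒟 ∧ N 0 (D 0 f) ≼ 𝒟
variable {a f g : Fld P}
lemma Gt.add (hf : Gt f) (hg : Gt g) : Gt (f + g) := ⟨Nle_add hf.1 hg.1, by rw [D_add]; exact Nle_add hf.2 hg.2⟩
lemma Gt.neg (hf : Gt f) : Gt (-f) := ⟨Nle_neg hf.1, by rw [D_neg]; exact Nle_neg hf.2⟩
lemma Gt.sub (hf : Gt f) (hg : Gt g) : Gt (f - g) := by rw [sub_eq_add_neg]; exact hf.add hg.neg
lemma Gt.cc (r : ℝ) (hf : Gt f) : Gt (cc r * f) := ⟨Nle_cc r hf.1, by rw [D_ccmul]; exact Nle_cc r hf.2⟩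
lemma Gt.mul (ha : Bm a) (ha' : Bm (D 0 a)) (hf : Gt f) : Gt (a * f) :=
  ⟨ha.le hf.1, by rw [D_mul]; exact Nle_add (ha'.le hf.1) (ha.le hf.2)⟩
lemma Gt.r1 (ha : SM a) (ha' : SM (D 0 a)) (hf : Dt f) : Gt (a * f) :=
  ⟨ha.le hf.1, by rw [D_mul]; exact Nle_add (ha'.le hf.1) (ha.le hf.2)⟩
lemma Gt.r2 (ha : SM a) (hf' : SM f) (ha' : N 0 (D 0 a) ≼ 𝒟) (hf : Dt f) : Gt (a * f) :=
  ⟨ha.le hf.1, by rw [D_mul, mul_comm (D 0 a)]; exact Nle_add (hf'.le ha') (ha.le hf.2)⟩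
lemma Dt.add (hf : Dt f) (hg : Dt g) : Dt (f + g) := ⟨Nle_add hf.1 hg.1, by rw [D_add]; exact Nle_add hf.2 hg.2⟩
lemma SM_zero : SM (0 : Fld P) := by
  have := (SM_ee (P := P)).sub SM_ee; rwa [sub_self] at this
lemma d0 (h : Par3 a) : Dt (D 0 a) := ⟨Nle_down (by norm_num) h.m0, h.m00⟩
lemma d1 (h : Par3 a) : Dt (D 1 a) :=
  ⟨Nle_down (by norm_num) h.m1, by rw [D_comm]; exact Nle_D1 (Nle_down (by norm_num) h.m0)⟩
lemma d2 (h : Par3 a) : Dt (D 2 a) :=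
  ⟨Nle_down (by norm_num) h.m2, by rw [D_comm]; exact Nle_D2 (Nle_down (by norm_num) h.m0)⟩
lemma de (h : Par3 a) : Dt (ee * a) :=
  ⟨h.me, by rw [D_eemul]; exact Bm_e.le (Nle_down (by norm_num) h.m0)⟩
lemma dΦ1 : Dt (D 1 (fΦ : Fld P)) :=
  ⟨Nle_down (by norm_num) mΦ1, by rw [D_comm]; exact Nle_D1 (Nle_down (by norm_num) mΦ0)⟩
lemma dΦ2 : Dt (D 2 (fΦ : Fld P)) :=
  ⟨Nle_down (by norm_num) mΦ2, by rw [D_comm]; exact Nle_D2 (Nle_down (by norm_num) mΦ0)⟩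
lemma dΦe : Dt (ee * (fΦ : Fld P)) :=
  ⟨mΦe, by rw [D_eemul]; exact Bm_e.le (Nle_down (by norm_num) mΦ0)⟩
lemma D0V1 : D 0 (V1 : Fld P) = ee * D 0 fΨ1 := by rw [V1, D_eemul, D_add, D0X, zero_add]
lemma D0V2 : D 0 (V2 : Fld P) = ee * D 0 fΨ2 := by rw [V2, D_eemul]
lemma D0r1 : D 0 (r1 : Fld P) = ee * D 0 fΦ := by rw [r1, D_add, D_sub, D0s, D_one, D_eemul]; ring
lemma nD0 (h : Par3 a) : N 0 (D 0 a) ≼ 𝒟 := Nle_down (by norm_num) h.m0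
lemma nV1 : N 0 (D 0 (V1 : Fld P)) ≼ 𝒟 := by rw [D0V1]; exact Bm_e.le (nD0 p1)
lemma nV2 : N 0 (D 0 (V2 : Fld P)) ≼ 𝒟 := by rw [D0V2]; exact Bm_e.le (nD0 p2)
lemma sD0r1 : SM (D 0 (r1 : Fld P)) := by rw [D0r1]; exact SM_ee.mulB SM_D0Φ.bm
lemma D0k2 : EQ (D 0 (k2 : Fld P)) 0 := by
  have := (EQ.refl (ee : Fld P)).mul D0tp; rw [mul_zero] at this; rwa [k2, D_eemul]
lemma D0k1 : EQ (D 0 (k1 : Fld P)) 0 := by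
  have := (EQ.refl (ee * (fs * fs) : Fld P)).mul D0tp; rw [mul_zero] at this
  convert this using 1; rw [k1, D_eemul, D_mul, D_mul, D0s]; ring
lemma sD0k1 : SM (D 0 (k1 : Fld P)) := SM_zero.congr D0k1
lemma sD0k2 : SM (D 0 (k2 : Fld P)) := SM_zero.congr D0k2
lemma bD0r2 : Bm (D 0 (r2 : Fld P)) := by rw [r2, D_add, D_one, zero_add]; exact sD0r1.bm
lemma bD0e : Bm (D 0 (ee : Fld P)) := by rw [D_ee]; exact Bm_zero
lemma tr_par (h : Par3 a) : Gt (V1 * D 1 a + V2 * D 2 a) :=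
  (Gt.r2 SM_V1 (smB h.s) nV1 (d1 h)).add (Gt.r2 SM_V2 (smC h.s) nV2 (d2 h))
lemma sD0s1 : SM (D 0 (fs - 1 : Fld P)) := by rw [D_sub, D0s, D_one, sub_zero]; exact SM_zero
lemma sD0τ1 : SM (D 0 (fτ - 1 : Fld P)) := by rw [D_sub, D0τ, D_one, sub_zero]; exact SM_zero

lemma Gt_congr (h : EQ f g) (hg : Gt g) : N 0 (D 0 f) ≼ d2f * 𝒟 := Nle_congr (h.D 0) hg.2

lemma D0F0_le : N 0 (D 0 (F0 : Fld P)) ≼ d2f * 𝒟 := by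
  refine Gt_congr F0_eq ?_
  exact ((((Gt.r2 SM_V1 (smB s3Φ) nV1 dΦ1).add (Gt.r2 SM_V2 (smC s3Φ) nV2 dΦ2)).neg).sub
    (Gt.r1 SM_r1 sD0r1 ((d1 p1).add (d2 p2)))).add (Gt.r1 SM_k1 sD0k1 (de p2))
lemma D0F1_le : N 0 (D 0 (F1 : Fld P)) ≼ d2f * 𝒟 := by
  refine Gt_congr F1_eq ?_
  exact ((((((Gt.r1 SM_r1 sD0r1 (d0 p1)).neg).sub (Gt.mul Bm_r2 bD0r2 ((tr_par p1).add
    (Gt.r1 SM_ee (by rw [D_ee]; exact SM_zero) (de p2))))).sub (Gt.r1 SM_s1 sD0s1 (d1 p3))).sub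
    (Gt.r1 SM_τ1 sD0τ1 dΦ1)).sub (Gt.mul Bm_e bD0e (Gt.r2 SM_Θ (smB s3Φ) (nD0 p3) dΦ1))).sub
    (Gt.mul Bm_e bD0e (Gt.r1 SM_Φ SM_D0Φ (d1 p3)))
lemma D0F2_le : N 0 (D 0 (F2 : Fld P)) ≼ d2f * 𝒟 := by
  refine Gt_congr F2_eq ?_
  exact ((((((((Gt.r1 SM_r1 sD0r1 (d0 p2)).neg).sub (Gt.mul Bm_r2 bD0r2 (tr_par p2))).sub
    (Gt.r1 SM_s1 sD0s1 (d2 p3))).sub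
    (Gt.r1 SM_τ1 sD0τ1 dΦ2)).add (Gt.r1 SM_k1 sD0k1 (de p3))).sub (Gt.r1 SM_k2 sD0k2 dΦe)).sub
    (Gt.mul Bm_e bD0e (Gt.r2 SM_Θ (smC s3Φ) (nD0 p3) dΦ2))).sub
    (Gt.mul Bm_e bD0e (Gt.r1 SM_Φ SM_D0Φ (d2 p3)))
lemma nq1 : N 0 (D 0 (q1 : Fld P)) ≼ 𝒟 := by
  rw [show D 0 (q1 : Fld P) = ee * fτ * D 0 fΦ + ee * fs * D 0 fΘ + (ee * ee * fΘ * D 0 fΦ + ee * ee * fΦ * D 0 fΘ) by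
    simp only [q1, D_add, D_mul, D0s, D0τ, D_ee]; ring]
  have h0 : N 0 (D 0 (fΦ : Fld P)) ≼ 𝒟 := Nle_down (by norm_num) mΦ0
  exact Nle_add (Nle_add ((Bm_e.mul Bm_τ).le h0) ((Bm_e.mul Bm_s).le (nD0 p3)))
    (Nle_add (((Bm_e.mul Bm_e).mul SM_Θ.bm).le h0) (((Bm_e.mul Bm_e).mul SM_Φ.bm).le (nD0 p3)))
lemma D0F3_le : N 0 (D 0 (F3 : Fld P)) ≼ d2f * 𝒟 := by
  refine Gt_congr F3_eq ?_
  have hd := (d1 (P := P) p1).add (d2 p2)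
  have hh := (d1 (P := P) p2).add (d2 p1)
  have hs := (smB (P := P) s3Ψ2).add (smC s3Ψ1)
  exact (((((Gt.r1 SM_r1 sD0r1 (d0 p3)).cc _).neg.sub ((Gt.mul Bm_r2 bD0r2 ((tr_par p3).add
    (Gt.r1 SM_k2 sD0k2 (de p2)))).cc _)).sub (Gt.r2 SM_q1 SM_dv nq1 hd)).add
    (Gt.mul Bm_e bD0e (((((Gt.r2 (smB s3Ψ1) (smB s3Ψ1) (d1 p1).2 (d1 p1)).add
      (Gt.r2 (smC s3Ψ2) (smC s3Ψ2) (d2 p2).2 (d2 p2))).cc _).add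
      ((Gt.r2 hs hs hh.2 hh).cc _)).add ((Gt.r2 SM_dv SM_dv hd.2 hd).cc _)))).add
    ((Gt.mul Bm_e bD0e (Gt.r1 SM_ee (by rw [D_ee]; exact SM_zero) hh)).cc _)
end D0F

/-! absorbable terms -/
def Ab (h : Fld P) : Prop := ∃ C, 0 ≤ C ∧ ∀ p, |I h p| ≤ C * (p.S.δ * 𝒟 p)
section Ab
variable {f g : Fld P}
lemma Ab.add (hf : Ab f) (hg : Ab g) : Ab (f + g) := by
  obtain ⟨C, hC, h⟩ := hf; obtain ⟨C', hC', h'⟩ := hg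
  refine ⟨C + C', by positivity, fun p => ?_⟩
  rw [I_add, add_mul]; exact (abs_add_le _ _).trans (add_le_add (h p) (h' p))
lemma Ab.neg (hf : Ab f) : Ab (-f) := by
  obtain ⟨C, hC, h⟩ := hf
  exact ⟨C, hC, fun p => by rw [I_neg, abs_neg]; exact h p⟩
lemma Ab.sub (hf : Ab f) (hg : Ab g) : Ab (f - g) := by rw [sub_eq_add_neg]; exact hf.add hg.neg
lemma Ab.of_eq (hf : Ab f) (h : ∀ p, I g p = I f p) : Ab g := by
  obtain ⟨C, hC, h'⟩ := hf
  exact ⟨C, hC, fun p => by rw [h]; exact h' p⟩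
lemma Ab.congr (hf : Ab f) (h : EQ g f) : Ab g := hf.of_eq (I_congr h)
lemma Ab.cc (r : ℝ) (hf : Ab f) : Ab (cc r * f) := by
  obtain ⟨C, hC, h⟩ := hf
  refine ⟨|r| * C, by positivity, fun p => ?_⟩
  rw [I_cc, abs_mul, mul_assoc]; exact mul_le_mul_of_nonneg_left (h p) (abs_nonneg r)
lemma pdpos (p : Pt P) : 0 < p.S.δ := p.S.he.trans_le p.S.heδ
lemma Ab.of (hf : N 0 f ≼ d2f * 𝒟) (hg : N 0 g ≼ 𝒟) : Ab (f * g) := by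
  obtain ⟨C, hC, h⟩ := hf; obtain ⟨C', hC', h'⟩ := hg
  refine ⟨C + C', by positivity, fun p => ?_⟩
  have hδ := pdpos p
  refine (young_abs f g p (inv_pos.2 hδ)).trans ?_
  have a1 : p.S.δ⁻¹ * N 0 f p ≤ C * (p.S.δ * 𝒟 p) := by
    rw [inv_mul_le_iff₀ hδ]
    refine (h p).trans (le_of_eq ?_); simp only [Pi.mul_apply, d2f]; ring
  have a2 : (4 * p.S.δ⁻¹)⁻¹ * N 0 g p ≤ C' * (p.S.δ * 𝒟 p) := by
    rw [mul_inv, inv_inv]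
    have h1 := mul_le_mul_of_nonneg_left (h' p) hδ.le
    have h2 : 0 ≤ p.S.δ * N 0 g p := mul_nonneg hδ.le (N_nn _ _ _)
    linarith
  linarith
lemma Ab.of' (hf : N 0 f ≼ d2f * 𝒟) (hg : N 0 g ≼ 𝒟) : Ab (g * f) := mul_comm f g ▸ Ab.of hf hg
end Ab

/-! third order transport -/
section transport
def tang (i : Fin 3) : Prop := i = 1 ∨ i = 2
variable {i j : Fin 3} {f : Fld P} {k : ℕ} {B : Fn P}
lemma Nle_Dt (hi : tang i) (h : N (k + 1) f ≼ B) : N k (D i f) ≼ B := by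
  rcases hi with rfl | rfl
  exacts [Nle_D1 h, Nle_D2 h]
lemma sDV1 (hi : tang i) : SM (D i (V1 : Fld P)) := by
  rw [V1, D_eemul, D_add]
  rcases hi with rfl | rfl
  · rw [D1X]; exact SM_ee.mulB (Bm_zero.add (smB s3Ψ1).bm)
  · rw [D2X]; exact SM_ee.mulB (Bm_e.add (smC s3Ψ1).bm)
lemma smD {f : Fld P} (hi : tang i) (h : N 3 f ≼ d2f) : SM (D i f) := by
  rcases hi with rfl | rfl
  exacts [smB h, smC h]
lemma sDV2 (hi : tang i) : SM (D i (V2 : Fld P)) := by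
  rw [V2, D_eemul]; exact SM_ee.mulB (smD hi s3Ψ2).bm
lemma bDs (hi : tang i) : Bm (D i (fs : Fld P)) := by
  rcases hi with rfl | rfl
  · rw [D1s]; exact Bm_zero
  · rw [D2s]; exact (Bm_e.mul (Bm_e.mul ((Bm_s.mul Bm_s).mul Bm_tp))).neg
lemma sDs (hi : tang i) : SM (D i (fs : Fld P)) := by
  rcases hi with rfl | rfl
  · rw [D1s]; exact SM_zero
  · rw [D2s]; exact (SM_ee.mulB (Bm_e.mul ((Bm_s.mul Bm_s).mul Bm_tp))).neg
lemma bDtp (hi : tang i) : Bm (D i (ftp : Fld P)) := by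
  rcases hi with rfl | rfl
  · exact Bm_zero.congr D1tp
  · exact (Bm_B.mul Bm_e).congr D2tp
lemma sDr1 (hi : tang i) : SM (D i (r1 : Fld P)) := by
  rw [r1, D_add, D_sub, D_one, sub_zero, D_eemul]
  exact (sDs hi).add (SM_ee.mulB (smD hi s3Φ).bm)
lemma sDk1 (hi : tang i) : SM (D i (k1 : Fld P)) := by
  rw [k1, D_eemul, D_mul, D_mul]
  exact SM_ee.mulB ((((bDs hi).mul Bm_s).add (Bm_s.mul (bDs hi))).mul Bm_tp |>.add ((Bm_s.mul Bm_s).mul (bDtp hi)))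
lemma mΦt (hi : tang i) : N 2 (D i (fΦ : Fld P)) ≼ 𝒟 := by
  rcases hi with rfl | rfl
  exacts [mΦ1, mΦ2]

lemma tr_id (V h : Fld P) (j) : 2 * (V * D j h * h) = D j (V * (h * h)) - D j V * h * h := by
  rw [D_mul, D_mul]; ring
lemma tr_top {a b c j : Fin 3} (ha : tang a) (hb : tang b) (hc : tang c) (hj : tang j) {V : Fld P}
    (hV : ∀ i, tang i → SM (D i V)) (hz : ∀ f : Fld P, ∀ p, I (D j (V * f)) p = 0) :
    Ab (D a (D b (D c (V * D j fΦ))) * D a (D b (D c fΦ))) := by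
  set h : Fld P := D a (D b (D c fΦ)) with hh
  have e : D a (D b (D c (V * D j fΦ))) = V * D j h + (D a (D b (D c V * D j fΦ))
      + D a (D b V * D c (D j fΦ)) + D a V * D b (D c (D j fΦ))) := by
    rw [hh, D_comm j a, D_comm j b, D_comm j c]
    simp only [D_mul, D_add]; ring
  have hn : N 0 h ≼ 𝒟 := Nle_Dt ha (Nle_Dt hb (mΦt hc))
  rw [e, add_mul]
  refine Ab.add ?_ (Ab.of ?_ hn)
  · have h1 : Ab (D j V * h * h) := Ab.of ((hV j hj).le hn) hn
    refine ((h1.cc (-1/2))).of_eq fun p => ?_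
    have := congrArg (fun f => I f p) (tr_id V h j)
    simp only [I_two, I_sub, hz] at this
    rw [I_cc]; linarith
  · refine Nle_add (Nle_add ?_ ?_) ?_
    · exact Nle_Dt ha (Nle_Dt hb ((hV c hc).le (mΦt hj)))
    · exact Nle_Dt ha ((hV b hb).le (Nle_Dt hc (mΦt hj)))
    · exact (hV a ha).le (Nle_Dt hb (Nle_Dt hc (mΦt hj)))

lemma F0_top {a b c : Fin 3} (ha : tang a) (hb : tang b) (hc : tang c) :
    Ab (D a (D b (D c F0)) * D a (D b (D c (fΦ : Fld P)))) := by
  refine Ab.congr ?_ ((((F0_eq.D c).D b).D a).mul (EQ.refl _))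
  have hn : N 0 (D a (D b (D c (fΦ : Fld P)))) ≼ 𝒟 := Nle_Dt ha (Nle_Dt hb (mΦt hc))
  have t1 : Ab (D a (D b (D c (V1 * D 1 fΦ))) * D a (D b (D c (fΦ : Fld P)))) :=
    tr_top ha hb hc (Or.inl rfl) (fun i hi => sDV1 hi) fun f p => I_D1 _ _
  have t2 : Ab (D a (D b (D c (V2 * D 2 fΦ))) * D a (D b (D c (fΦ : Fld P)))) :=
    tr_top ha hb hc (Or.inr rfl) (fun i hi => sDV2 hi) fun f p =>
      I_D2 ((bdΨ2.mul_left ee).mul_right f) _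
  have hdv : N 3 (dv (fΨ1 : Fld P) fΨ2) ≼ 𝒟 := Nle_add p1.m1 p2.m2
  have n3 : N 0 (D a (D b (D c (r1 * dv (fΨ1 : Fld P) fΨ2)))) ≼ d2f * 𝒟 := by
    refine Nle_Dt ha (Nle_Dt hb ?_)
    rw [D_mul]
    exact Nle_add ((sDr1 hc).le (Nle_down (by norm_num) hdv)) (SM_r1.le (Nle_Dt hc hdv))
  have n4 : N 0 (D a (D b (D c (k1 * (ee * (fΨ2 : Fld P)))))) ≼ d2f * 𝒟 := by
    refine Nle_Dt ha (Nle_Dt hb ?_)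
    rw [D_mul]
    exact Nle_add ((sDk1 hc).le (Nle_down (by norm_num) p2.me3)) (SM_k1.le (Nle_Dt hc p2.me3))
  have e : D a (D b (D c (G0 : Fld P))) = -(D a (D b (D c (V1 * D 1 fΦ))) + D a (D b (D c (V2 * D 2 fΦ))))
    - D a (D b (D c (r1 * dv (fΨ1 : Fld P) fΨ2))) + D a (D b (D c (k1 * (ee * (fΨ2 : Fld P))))) := by
    rw [G0]; simp only [D_add, D_sub, D_neg]
  rw [e, add_mul, sub_mul, neg_mul, add_mul]
  exact ((t1.add t2).neg.sub (Ab.of n3 hn)).add (Ab.of n4 hn)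
end transport

end Pf

set_option linter.unusedVariables false
set_option linter.unusedSimpArgs false
namespace Pf
variable {P : Par}

/-! energy -/
def El : List (Fn P) := [N 3 fΦ, N 0 (D 0 fΦ), N 3 fΨ1, N 3 fΨ2, N 3 fΘ, N 1 (D 0 fΨ1), N 1 (D 0 fΨ2), N 1 (D 0 fΘ)]
def ℰ : Fn P := El.sum
lemma El_nn : ∀ f ∈ (El : List (Fn P)), ∀ p, 0 ≤ f p := by
  intro f hf p
  simp only [El, List.mem_cons, List.not_mem_nil, or_false] at hf
  rcases hf with h | h | h | h | h | h | h | h <;> (rw [h]; exact N_nn _ _ _)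
lemma ℰ_nn (p : Pt P) : 0 ≤ ℰ p := list_nn _ El_nn p
lemma Emem {f : Fn P} (hf : f ∈ (El : List (Fn P))) : f ≼ ℰ := Le.of fun p => list_mem _ El_nn hf p
lemma eΦ : N 3 (fΦ : Fld P) ≼ ℰ := Emem (by simp [El])
lemma eΦ0 : N 0 (D 0 (fΦ : Fld P)) ≼ ℰ := Emem (by simp [El])
lemma Par3.e {a : Fld P} (h : Par3 a) : N 3 a ≼ ℰ := by
  rcases h with rfl | rfl | rfl <;> exact Emem (by simp [El])
lemma Par3.e0 {a : Fld P} (h : Par3 a) : N 1 (D 0 a) ≼ ℰ := by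
  rcases h with rfl | rfl | rfl <;> exact Emem (by simp [El])

/-! Lyapunov calculus -/
def dD (p : Pt P) : ℝ := p.S.δ * 𝒟 p
lemma dD_nn (p : Pt P) : 0 ≤ dD p := mul_nonneg (pd0 p) (𝒟_nn p)
/-- dissipation -/
def Cd (d : Fn P) : Prop := ∃ (q : Fld P) (C : ℝ), 0 ≤ C ∧ ∀ p, 0 ≤ I q p ∧ I q p ≤ C * ℰ p ∧ I (D 0 q) p + d p ≤ C * dD p
/-- controlled energies -/
def Cs (f : Fn P) : Prop := ∃ (q : Fld P) (C : ℝ), 0 ≤ C ∧ ∀ p, f p ≤ I q p ∧ 0 ≤ I q p ∧ I q p ≤ C * ℰ p ∧ I (D 0 q) p ≤ C * dD p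

/-- ideals of functionals -/
structure Id (J : Fn P → Prop) : Prop where
  add : ∀ {a b}, J a → J b → J (a + b)
  mono : ∀ {a b}, a ≼ b → J b → J a

lemma IdD : Id (Cd : Fn P → Prop) where
  add := by
    rintro a b ⟨q, C, hC, h⟩ ⟨q', C', hC', h'⟩
    refine ⟨q + q', C + C', by positivity, fun p => ?_⟩
    obtain ⟨x1, x2, x3⟩ := h p; obtain ⟨y1, y2, y3⟩ := h' p
    rw [D_add, I_add, I_add, add_mul, add_mul, Pi.add_apply]
    exact ⟨by linarith, by linarith, by linarith⟩
  mono := by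
    rintro a b ⟨M, hM, k⟩ ⟨q, C, hC, h⟩
    refine ⟨cc M * q, M * C, by positivity, fun p => ?_⟩
    obtain ⟨x1, x2, x3⟩ := h p
    rw [D_ccmul, I_cc, I_cc, mul_assoc, mul_assoc]
    refine ⟨by positivity, mul_le_mul_of_nonneg_left x2 hM, ?_⟩
    have := mul_le_mul_of_nonneg_left x3 hM
    linarith [k p]
lemma IdS : Id (Cs : Fn P → Prop) where
  add := by
    rintro a b ⟨q, C, hC, h⟩ ⟨q', C', hC', h'⟩
    refine ⟨q + q', C + C', by positivity, fun p => ?_⟩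
    obtain ⟨x1, x2, x3, x4⟩ := h p; obtain ⟨y1, y2, y3, y4⟩ := h' p
    rw [D_add, I_add, I_add, add_mul, add_mul, Pi.add_apply]
    exact ⟨by linarith, by linarith, by linarith, by linarith⟩
  mono := by
    rintro a b ⟨M, hM, k⟩ ⟨q, C, hC, h⟩
    refine ⟨cc M * q, M * C, by positivity, fun p => ?_⟩
    obtain ⟨x1, x2, x3, x4⟩ := h p
    rw [D_ccmul, I_cc, I_cc, mul_assoc, mul_assoc]
    refine ⟨(k p).trans (mul_le_mul_of_nonneg_left x1 hM), by positivity, mul_le_mul_of_nonneg_left x3 hM,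
      mul_le_mul_of_nonneg_left x4 hM⟩
lemma Cd_small : Cd (d2f * 𝒟 : Fn P) := by
  refine ⟨0, 1, zero_le_one, fun p => ?_⟩
  rw [D_zero, I_zero]
  refine ⟨le_rfl, by simpa using ℰ_nn p, ?_⟩
  simp only [Pi.mul_apply, d2f, dD, zero_add, one_mul]
  have := 𝒟_nn p; have h1 := pd0 p; have h2 := p.S.hδ
  have h3 : p.S.δ ^ 2 ≤ p.S.δ := by nlinarith
  exact mul_le_mul_of_nonneg_right h3 this
lemma Cd_zero : Cd (0 : Fn P) := ⟨0, 0, le_rfl, fun p => by rw [D_zero, I_zero]; simp⟩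
lemma Cs_zero : Cs (0 : Fn P) := ⟨0, 0, le_rfl, fun p => by rw [D_zero, I_zero]; simp⟩

lemma step {B d f0 f1 : Fn P} (q1 : Fld P) (hB : Cd B) (h0 : Cs f0) {c C : ℝ} (hc : 0 < c) (hC : 0 ≤ C)
    (hd : ∀ p, 0 ≤ d p) (h1 : ∀ p, I (D 0 q1) p + c * d p ≤ C * (B p + dD p))
    (h2 : ∀ p, I q1 p ≤ C * ℰ p) (h3 : ∀ p, 0 ≤ f1 p) (h4 : ∀ p, f1 p ≤ I q1 p + C * f0 p) :
    Cd d ∧ Cs f1 := by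
  obtain ⟨qB, CB, hCB, kB⟩ := hB
  obtain ⟨qs, Cs', hCs, ks⟩ := h0
  set q : Fld P := q1 + cc C * qB + cc C * qs with hq
  set M := C + C * CB + C * Cs'
  have hM : 0 ≤ M := by positivity
  have E : ∀ p, I q p = I q1 p + C * I qB p + C * I qs p := fun p => by rw [hq, I_add, I_add, I_cc, I_cc]
  have E' : ∀ p, I (D 0 q) p = I (D 0 q1) p + C * I (D 0 qB) p + C * I (D 0 qs) p := fun p => by
    rw [hq, D_add, D_add, D_ccmul, D_ccmul, I_add, I_add, I_cc, I_cc]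
  have key : ∀ p, f1 p ≤ I q p ∧ 0 ≤ I q p ∧ I q p ≤ M * ℰ p ∧ I (D 0 q) p + c * d p ≤ M * dD p := by
    intro p
    obtain ⟨x1, x2, x3⟩ := kB p; obtain ⟨y1, y2, y3, y4⟩ := ks p
    have a1 := mul_le_mul_of_nonneg_left y1 hC
    have a2 := mul_le_mul_of_nonneg_left x3 hC
    have a3 := mul_le_mul_of_nonneg_left y4 hC
    have a4 := mul_le_mul_of_nonneg_left x2 hC
    have a5 := mul_le_mul_of_nonneg_left y3 hC
    have a6 : 0 ≤ C * I qB p := by positivity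
    have b1 := h1 p; have b2 := h2 p; have b4 := h4 p
    rw [E, E']
    refine ⟨by linarith, by linarith [h3 p], ?_, ?_⟩
    · have : M * ℰ p = C * ℰ p + C * (CB * ℰ p) + C * (Cs' * ℰ p) := by simp only [M]; ring
      linarith
    · have : M * dD p = C * dD p + C * (CB * dD p) + C * (Cs' * dD p) := by simp only [M]; ring
      linarith
  constructor
  · have : Cd (fun p => c * d p) := ⟨q, M, hM, fun p => ⟨(key p).2.1, (key p).2.2.1, (key p).2.2.2⟩⟩
    refine IdD.mono (Le.ofC c⁻¹ (by positivity) fun p => ?_) this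
    rw [← mul_assoc, inv_mul_cancel₀ hc.ne', one_mul]
  · exact ⟨q, M, hM, fun p => ⟨(key p).1, (key p).2.1, (key p).2.2.1, by
      have := (key p).2.2.2; have := mul_nonneg hc.le (hd p); linarith⟩⟩

/-! ideals and norms -/
section IdN
variable {J : Fn P → Prop} {k : ℕ} {f g : Fld P}
lemma Id.nadd (hJ : Id J) (hf : J (N k f)) (hg : J (N k g)) : J (N k (f + g)) :=
  hJ.mono (Nle_add (Le.of fun p => by simp only [Pi.add_apply]; linarith [N_nn k g p])
    (Le.of fun p => by simp only [Pi.add_apply]; linarith [N_nn k f p])) (hJ.add hf hg)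
lemma Id.nneg (hJ : Id J) (hf : J (N k f)) : J (N k (-f)) := hJ.mono (Nle_neg Le.rfl) hf
lemma Id.nsub (hJ : Id J) (hf : J (N k f)) (hg : J (N k g)) : J (N k (f - g)) := by
  rw [sub_eq_add_neg]; exact hJ.nadd hf (hJ.nneg hg)
lemma Id.ncc (hJ : Id J) (r : ℝ) (hf : J (N k f)) : J (N k (cc r * f)) := hJ.mono (Nle_cc r Le.rfl) hf
lemma Id.down (hJ : Id J) {l} (h : k ≤ l) (hf : J (N l f)) : J (N k f) := hJ.mono (Nle_down h Le.rfl) hf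
lemma Id.D1 (hJ : Id J) (hf : J (N (k + 1) f)) : J (N k (D 1 f)) := hJ.mono (Nle_D1 Le.rfl) hf
lemma Id.D2 (hJ : Id J) (hf : J (N (k + 1) f)) : J (N k (D 2 f)) := hJ.mono (Nle_D2 Le.rfl) hf
lemma Id.succ (hJ : Id J) (h0 : J (N k f)) (h1 : J (N k (D 1 f))) (h2 : J (N k (D 2 f))) : J (N (k + 1) f) :=
  hJ.mono (Le.of fun p => (N_succ k f p).le) (hJ.add (hJ.add h0 h1) h2)
lemma Id.le (hJ : Id J) {a b : Fn P} (h : J b) (hab : ∀ p, a p ≤ b p) : J a := hJ.mono (Le.of hab) h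
lemma Id.nmul (hJ : Id J) {a : Fld P} (ha : Bm a) (hk : k ≤ 2) (hf : J (N k f)) : J (N k (a * f)) :=
  hJ.mono (ha.le Le.rfl hk) hf
end IdN

/-! linear identities -/
section lin
variable (f a b h : Fld P)
def Gr (a : Fld P) : Fn P := fun p => N 0 (D 1 a) p + N 0 (D 2 a) p
lemma Gr_nn (a : Fld P) (p) : 0 ≤ Gr a p := add_nonneg (N_nn _ _ _) (N_nn _ _ _)

lemma Dcμ (i) : D i (cμ : Fld P) = 0 := D_cc _ _
lemma Dcl (i) : D i (cl : Fld P) = 0 := D_cc _ _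
lemma Dcg (i) : D i (cg : Fld P) = 0 := D_cc _ _
lemma Dcκ (i) : D i (cκ : Fld P) = 0 := D_cc _ _
lemma I_cμ (f : Fld P) (p) : I (cμ * f) p = P.μ * I f p := I_cc _ _ _
lemma I_cl (f : Fld P) (p) : I (cl * f) p = P.lam * I f p := I_cc _ _ _
lemma I_cg (f : Fld P) (p) : I (cg * f) p = P.g * I f p := I_cc _ _ _
lemma I_cκ (f : Fld P) (p) : I (cκ * f) p = P.κ * I f p := I_cc _ _ _

lemma L0 {a b h : Fld P} (ha : BD a) (hb : BD b) (hh : BD h) (p) :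
    I (f * D 0 f) p + I (a * D 0 a) p + I (b * D 0 b) p + P.g * I (h * D 0 h) p
      + P.μ * (Gr a p + Gr b p) + P.lam * N 0 (dv a b) p + P.κ * Gr h p
    = I (R0 f a b * f) p + I (R1 f a b h * a) p + I (R2 f a b h * b) p + I (R3 a b h * h) p := by
  have key : R0 f a b * f + R1 f a b h * a + R2 f a b h * b + R3 a b h * h
    = f * D 0 f + a * D 0 a + b * D 0 b + cg * (h * D 0 h)
      + cμ * (D 1 a * D 1 a + D 2 a * D 2 a + (D 1 b * D 1 b + D 2 b * D 2 b))
      + cl * (dv a b * dv a b) + cκ * (D 1 h * D 1 h + D 2 h * D 2 h)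
      + D 1 (a * f + a * h - cμ * (a * D 1 a + b * D 1 b) - cl * (a * dv a b) - cκ * (h * D 1 h))
      + D 2 (b * f + b * h - cμ * (a * D 2 a + b * D 2 b) - cl * (b * dv a b) - cκ * (h * D 2 h)) := by
    simp only [R0, R1, R2, R3, Lp, D_sub, D_add, D_mul, Dcμ, Dcl, Dcg, Dcκ, D_dv]
    simp only [dv, D_add]; ring
  have hbd : BD (b * f + b * h - cμ * (a * D 2 a + b * D 2 b) - cl * (b * dv a b) - cκ * (h * D 2 h)) :=
    ((((hb.mul_right f).add (hb.mul_right h)).sub (((ha.mul_right _).add (hb.mul_right _)).mul_left _)).sub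
      ((hb.mul_right _).mul_left _)).sub ((hh.mul_right _).mul_left _)
  have := congrArg (fun f => I f p) key
  simp only [I_add, I_cμ, I_cl, I_cg, I_cκ, I_D1, I_D2 hbd] at this
  simp only [Gr, N_zero]
  linarith

def half : Fld P := cc (1/2)
lemma half2 : (half + half : Fld P) = 1 := by unfold half; rw [← cc_add, ← cc_one]; norm_num
lemma Dhalf (i) : D i (half : Fld P) = 0 := D_cc _ _
lemma D_half (i) (f : Fld P) : D i (half * f) = half * D i f := D_ccmul _ _ _
lemma D_sq (i) (f : Fld P) : D i (half * (f * f)) = f * D i f := by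
  rw [D_half, D_mul]; linear_combination (f * D i f) * half2 (P := P)
lemma I_half (f : Fld P) (p) : I (half * f) p = 1/2 * I f p := I_cc _ _ _

lemma dD_le {x : Fld P} (h : Ab x) : ∃ C, 0 ≤ C ∧ ∀ p, |I x p| ≤ C * dD p := h

/-- basic energy step -/
lemma EZ {f a b h : Fld P} (ha : BD a) (hb : BD b) (hh : BD h)
    (h0 : Ab (R0 f a b * f)) (h1 : Ab (R1 f a b h * a)) (h2 : Ab (R2 f a b h * b)) (h3 : Ab (R3 a b h * h))
    (ef : N 0 f ≼ ℰ) (ea : N 0 a ≼ ℰ) (eb : N 0 b ≼ ℰ) (eh : N 0 h ≼ ℰ) :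
    Cd (Gr a + Gr b + Gr h) ∧ Cs (N 0 f + N 0 a + N 0 b + N 0 h) := by
  obtain ⟨C0, hC0, h0⟩ := dD_le h0; obtain ⟨C1, hC1, h1⟩ := dD_le h1
  obtain ⟨C2, hC2, h2⟩ := dD_le h2; obtain ⟨C3, hC3, h3⟩ := dD_le h3
  obtain ⟨B0, hB0, ef⟩ := ef; obtain ⟨B1, hB1, ea⟩ := ea
  obtain ⟨B2, hB2, eb⟩ := eb; obtain ⟨B3, hB3, eh⟩ := eh
  have hg := P.hg; have hμ := P.μ0; have hκ := P.κ0; have hl := P.hlam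
  set m := min P.g 1
  have hm : 0 < m := lt_min hg one_pos
  have key := step (B := 0) (f0 := 0) (d := Gr a + Gr b + Gr h) (f1 := fun p => m / 2 * (N 0 f p + N 0 a p + N 0 b p + N 0 h p))
    (half * (f * f) + half * (a * a) + half * (b * b) + cg * (half * (h * h))) Cd_zero Cs_zero
    (c := min P.μ P.κ) (C := C0 + C1 + C2 + C3 + B0 + B1 + B2 + P.g * B3) (lt_min hμ hκ) (by positivity)
    (fun p => add_nonneg (add_nonneg (Gr_nn _ _) (Gr_nn _ _)) (Gr_nn _ _)) ?_ ?_ ?_ ?_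
  · refine ⟨key.1, IdS.mono (Le.ofC (2 / m) (by positivity) fun p => ?_) key.2⟩
    simp only [Pi.add_apply]
    rw [← mul_assoc]; apply le_of_eq; field_simp
  · intro p
    have L := L0 f ha hb hh p
    simp only [D_add, D_sq, D_cg, I_add, I_cg]
    have i1 : min P.μ P.κ * (Gr a p + Gr b p) ≤ P.μ * (Gr a p + Gr b p) :=
      mul_le_mul_of_nonneg_right (min_le_left _ _) (add_nonneg (Gr_nn _ _) (Gr_nn _ _))
    have i2 : min P.μ P.κ * Gr h p ≤ P.κ * Gr h p := mul_le_mul_of_nonneg_right (min_le_right _ _) (Gr_nn _ _)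
    have i3 : 0 ≤ P.lam * N 0 (dv a b) p := mul_nonneg hl.le (N_nn _ _ _)
    have j0 := le_of_abs_le (h0 p); have j1 := le_of_abs_le (h1 p)
    have j2 := le_of_abs_le (h2 p); have j3 := le_of_abs_le (h3 p)
    have := dD_nn p
    have jj : 0 ≤ (B0 + B1 + B2 + P.g * B3) * dD p := by positivity
    simp only [Pi.zero_apply, zero_add, Pi.add_apply]
    linarith
  · intro p
    simp only [I_add, I_cg, I_half]
    have := ℰ_nn p
    have j0 := ef p; have j1 := ea p; have j2 := eb p; have j3 := mul_le_mul_of_nonneg_left (eh p) hg.le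
    simp only [N_zero] at j0 j1 j2 j3
    have jj : 0 ≤ (C0 + C1 + C2 + C3) * ℰ p := by positivity
    have k0 : 0 ≤ B0 * ℰ p := by positivity
    have k1 : 0 ≤ B1 * ℰ p := by positivity
    have k2 : 0 ≤ B2 * ℰ p := by positivity
    have k3 : 0 ≤ P.g * (B3 * ℰ p) := by positivity
    linarith
  · intro p
    have := N_nn 0 f p; have := N_nn 0 a p; have := N_nn 0 b p; have := N_nn 0 h p
    positivity
  · intro p
    simp only [I_add, I_cg, I_half, ← N_zero]
    have m1 : m ≤ 1 := min_le_right _ _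
    have m2 : m ≤ P.g := min_le_left _ _
    have i1 := mul_le_mul_of_nonneg_right m1 (N_nn 0 f p)
    have i2 := mul_le_mul_of_nonneg_right m1 (N_nn 0 a p)
    have i3 := mul_le_mul_of_nonneg_right m1 (N_nn 0 b p)
    have i4 := mul_le_mul_of_nonneg_right m2 (N_nn 0 h p)
    simp only [Pi.zero_apply, mul_zero]
    linarith

/-- time-derivative identity -/
lemma E1id {a b h : Fld P} (ha : BD a) (hb : BD b) (hh : BD h) (p) :
    I (D 0 (half * (cμ * (D 1 a * D 1 a + D 2 a * D 2 a + (D 1 b * D 1 b + D 2 b * D 2 b))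
        + cl * (dv a b * dv a b) + cκ * (D 1 h * D 1 h + D 2 h * D 2 h)) - (f + h) * dv a b)) p
      + (N 0 (D 0 a) p + N 0 (D 0 b) p + P.g * N 0 (D 0 h) p)
    = I (R1 f a b h * D 0 a) p + I (R2 f a b h * D 0 b) p + I (R3 a b h * D 0 h) p
      - I (R0 f a b * dv a b) p + N 0 (dv a b) p - 2 * I (dv a b * D 0 h) p := by
  have key : D 0 (half * (cμ * (D 1 a * D 1 a + D 2 a * D 2 a + (D 1 b * D 1 b + D 2 b * D 2 b))
        + cl * (dv a b * dv a b) + cκ * (D 1 h * D 1 h + D 2 h * D 2 h)) - (f + h) * dv a b)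
      + (D 0 a * D 0 a + D 0 b * D 0 b + cg * (D 0 h * D 0 h))
    = R1 f a b h * D 0 a + R2 f a b h * D 0 b + R3 a b h * D 0 h
      - R0 f a b * dv a b + dv a b * dv a b - 2 * (dv a b * D 0 h)
      + D 1 (cμ * (D 1 a * D 0 a + D 1 b * D 0 b) + cl * (dv a b * D 0 a) + cκ * (D 1 h * D 0 h) - (f + h) * D 0 a)
      + D 2 (cμ * (D 2 a * D 0 a + D 2 b * D 0 b) + cl * (dv a b * D 0 b) + cκ * (D 2 h * D 0 h) - (f + h) * D 0 b) := by
    simp only [R0, R1, R2, R3, Lp, D_sub, D_add, D_mul, Dhalf, Dcμ, Dcl, Dcg, Dcκ, D_dv, D10, D20]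
    simp only [dv, D_add, D_mul, D10, D20, D21]
    linear_combination ((cμ * (D 1 a * D 0 (D 1 a) + D 2 a * D 0 (D 2 a) + D 1 b * D 0 (D 1 b) + D 2 b * D 0 (D 2 b))
      + cl * (D 1 a + D 2 b) * (D 0 (D 1 a) + D 0 (D 2 b)) + cκ * (D 1 h * D 0 (D 1 h) + D 2 h * D 0 (D 2 h))) : Fld P) * half2 (P := P)
  have hbd : BD (cμ * (D 2 a * D 0 a + D 2 b * D 0 b) + cl * (dv a b * D 0 b) + cκ * (D 2 h * D 0 h) - (f + h) * D 0 b) :=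
    (((((ha.D0.mul_left _).add (hb.D0.mul_left _)).mul_left _).add ((hb.D0.mul_left _).mul_left _)).add
      ((hh.D0.mul_left _).mul_left _)).sub (hb.D0.mul_left _)
  have := congrArg (fun f => I f p) key
  simp only [I_add, I_sub, I_cg, I_D1, I_D2 hbd, I_two] at this
  simp only [N_zero]
  linarith

lemma n_dv (a b : Fld P) (p) : N 0 (dv a b) p ≤ 2 * (Gr a p + Gr b p) := by
  have := N_add 0 (D 1 a) (D 2 b) p
  unfold dv Gr; linarith [N_nn 0 (D 2 a) p, N_nn 0 (D 1 b) p]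

/-- time-derivative step -/
lemma E1Z {f a b h : Fld P} (ha : BD a) (hb : BD b) (hh : BD h)
    (h0 : Ab (R0 f a b * dv a b)) (h1 : Ab (R1 f a b h * D 0 a)) (h2 : Ab (R2 f a b h * D 0 b)) (h3 : Ab (R3 a b h * D 0 h))
    (hB : Cd (Gr a + Gr b + Gr h)) (hs : Cs (N 0 f + N 0 a + N 0 b + N 0 h))
    (ef : N 0 f ≼ ℰ) (ea : Gr a ≼ ℰ) (eb : Gr b ≼ ℰ) (eh : Gr h ≼ ℰ) (eh' : N 0 h ≼ ℰ) :
    Cd (N 0 (D 0 a) + N 0 (D 0 b) + N 0 (D 0 h)) ∧ Cs (Gr a + Gr b + Gr h) := by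
  obtain ⟨C0, hC0, h0⟩ := dD_le h0; obtain ⟨C1, hC1, h1⟩ := dD_le h1
  obtain ⟨C2, hC2, h2⟩ := dD_le h2; obtain ⟨C3, hC3, h3⟩ := dD_le h3
  obtain ⟨B0, hB0, ef⟩ := ef; obtain ⟨B1, hB1, ea⟩ := ea
  obtain ⟨B2, hB2, eb⟩ := eb; obtain ⟨B3, hB3, eh⟩ := eh; obtain ⟨B4, hB4, eh'⟩ := eh'
  have hg := P.hg; have hμ := P.μ0; have hκ := P.κ0; have hl := P.hlam
  set c := min (P.g / 2) 1
  have hc : 0 < c := lt_min (by linarith) one_pos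
  set m := min (P.μ / 4) (P.κ / 2)
  have hm : 0 < m := lt_min (by linarith) (by linarith)
  set M1 := C0 + C1 + C2 + C3 + (2 + 4 / P.g)
  set M2 := (P.μ / 2 + P.lam + 1 + P.κ / 2) * (B1 + B2 + B3) + (B0 + B4)
  set M3 := 4 / P.μ
  have hM1 : 0 ≤ M1 := by positivity
  have hM2 : 0 ≤ M2 := by positivity
  have hM3 : 0 ≤ M3 := by positivity
  have key := step (B := Gr a + Gr b + Gr h) (f0 := N 0 f + N 0 a + N 0 b + N 0 h) (d := N 0 (D 0 a) + N 0 (D 0 b) + N 0 (D 0 h))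
    (f1 := fun p => m * (Gr a p + Gr b p + Gr h p))
    (half * (cμ * (D 1 a * D 1 a + D 2 a * D 2 a + (D 1 b * D 1 b + D 2 b * D 2 b))
        + cl * (dv a b * dv a b) + cκ * (D 1 h * D 1 h + D 2 h * D 2 h)) - (f + h) * dv a b) hB hs
    (c := c) (C := M1 + M2 + M3) hc (by positivity)
    (fun p => add_nonneg (add_nonneg (N_nn _ _ _) (N_nn _ _ _)) (N_nn _ _ _)) ?_ ?_ ?_ ?_
  · refine ⟨key.1, IdS.mono (Le.ofC (m⁻¹) (by positivity) fun p => ?_) key.2⟩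
    simp only [Pi.add_apply]
    rw [← mul_assoc, inv_mul_cancel₀ hm.ne', one_mul]
  · intro p
    have L := E1id f ha hb hh p
    have j0 := neg_le_of_abs_le (h0 p); have j1 := le_of_abs_le (h1 p)
    have j2 := le_of_abs_le (h2 p); have j3 := le_of_abs_le (h3 p)
    have nd := n_dv a b p
    have y := neg_le_of_abs_le (young_abs (dv a b) (D 0 h) p (η := P.g⁻¹) (by positivity))
    have y2 : (4 * P.g⁻¹)⁻¹ * N 0 (D 0 h) p = P.g / 4 * N 0 (D 0 h) p := by rw [mul_inv, inv_inv]; ring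
    rw [y2] at y
    have g1 := Gr_nn a p; have g2 := Gr_nn b p; have g3 := Gr_nn h p
    have n1 := N_nn 0 (D 0 a) p; have n2 := N_nn 0 (D 0 b) p; have n3 := N_nn 0 (D 0 h) p
    have i1 := mul_le_mul_of_nonneg_right (min_le_right (P.g / 2) 1) (add_nonneg n1 n2)
    have i2 := mul_le_mul_of_nonneg_right (min_le_left (P.g / 2) 1) n3
    have dn := dD_nn p
    have x1 : P.g⁻¹ * N 0 (dv a b) p ≤ P.g⁻¹ * (2 * (Gr a p + Gr b p)) := mul_le_mul_of_nonneg_left nd (by positivity)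
    have x2 : 0 ≤ M2 * (Gr a p + Gr b p + Gr h p + dD p) := by positivity
    have x3 : 0 ≤ M3 * (Gr a p + Gr b p + Gr h p + dD p) := by positivity
    have x4 : 0 ≤ (C0 + C1 + C2 + C3) * (Gr a p + Gr b p + Gr h p) := by positivity
    have x5 : 0 ≤ (2 + 4 / P.g) * (Gr h p + dD p) := by positivity
    have e5 : (2 + 4 / P.g) * (Gr a p + Gr b p) = 2 * (Gr a p + Gr b p) + 2 * (P.g⁻¹ * (2 * (Gr a p + Gr b p))) := by
      rw [div_eq_mul_inv]; ring
    simp only [Pi.add_apply]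
    have e6 : (M1 + M2 + M3) * (Gr a p + Gr b p + Gr h p + dD p) = (C0 + C1 + C2 + C3) * dD p
      + (C0 + C1 + C2 + C3) * (Gr a p + Gr b p + Gr h p) + (2 + 4 / P.g) * (Gr h p + dD p)
      + (2 + 4 / P.g) * (Gr a p + Gr b p) + M2 * (Gr a p + Gr b p + Gr h p + dD p)
      + M3 * (Gr a p + Gr b p + Gr h p + dD p) := by simp only [M1]; ring
    rw [e6, e5]
    have e7 : c * (N 0 (D 0 a) p + N 0 (D 0 b) p + N 0 (D 0 h) p)
      = c * (N 0 (D 0 a) p + N 0 (D 0 b) p) + c * N 0 (D 0 h) p := by ring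
    rw [e7]
    linarith
  · intro p
    rw [I_sub, I_half, I_add, I_add, I_cμ, I_cl, I_cκ, I_add, I_add, I_add, I_add]
    simp only [← N_zero]
    have nd := n_dv a b p
    have y := neg_le_of_abs_le (young_abs (f + h) (dv a b) p (η := 1/2) (by norm_num))
    have na := N_add 0 f h p
    have g1 := Gr_nn a p; have g2 := Gr_nn b p; have g3 := Gr_nn h p
    have e1 := ea p; have e2 := eb p; have e3 := eh p; have e4 := ef p; have e5 := eh' p
    have en := ℰ_nn p
    have s1 : Gr a p + Gr b p ≤ (B1 + B2 + B3) * ℰ p := by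
      have : 0 ≤ B3 * ℰ p := by positivity
      linarith
    have s3 : Gr h p ≤ (B1 + B2 + B3) * ℰ p := by
      have : 0 ≤ (B1 + B2) * ℰ p := by positivity
      linarith
    have t1 := mul_le_mul_of_nonneg_left s1 (by positivity : 0 ≤ P.μ / 2 + P.lam + 1)
    have t3 := mul_le_mul_of_nonneg_left s3 (by positivity : 0 ≤ P.κ / 2)
    have t4 := mul_le_mul_of_nonneg_left nd (by positivity : 0 ≤ P.lam / 2)
    have x2 : 0 ≤ M1 * ℰ p := by positivity
    have x3 : 0 ≤ M3 * ℰ p := by positivity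
    have e6 : (M1 + M2 + M3) * ℰ p = M1 * ℰ p + M3 * ℰ p + (P.μ / 2 + P.lam + 1) * ((B1 + B2 + B3) * ℰ p)
      + P.κ / 2 * ((B1 + B2 + B3) * ℰ p) + B0 * ℰ p + B4 * ℰ p := by simp only [M2]; ring
    rw [e6]
    simp only [Gr] at *
    norm_num at y
    linarith
  · intro p
    have := Gr_nn a p; have := Gr_nn b p; have := Gr_nn h p
    positivity
  · intro p
    rw [I_sub, I_half, I_add, I_add, I_cμ, I_cl, I_cκ, I_add, I_add, I_add, I_add]
    simp only [← N_zero]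
    have nd := n_dv a b p
    have y := le_of_abs_le (young_abs (dv a b) (f + h) p (η := P.μ / 8) (by positivity))
    rw [mul_comm (dv a b)] at y
    have y2 : (4 * (P.μ / 8))⁻¹ = 2 / P.μ := by field_simp; ring
    rw [y2] at y
    have na := mul_le_mul_of_nonneg_left (N_add 0 f h p) (by positivity : 0 ≤ 2 / P.μ)
    have g1 := Gr_nn a p; have g2 := Gr_nn b p; have g3 := Gr_nn h p
    have nn := mul_nonneg hl.le (N_nn 0 (dv a b) p)
    have t4 := mul_le_mul_of_nonneg_left nd (by positivity : 0 ≤ P.μ / 8)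
    have i1 := mul_le_mul_of_nonneg_right (min_le_left (P.μ / 4) (P.κ / 2)) (add_nonneg g1 g2)
    have i2 := mul_le_mul_of_nonneg_right (min_le_right (P.μ / 4) (P.κ / 2)) g3
    have n1 := N_nn 0 f p; have n2 := N_nn 0 a p; have n3 := N_nn 0 b p; have n4 := N_nn 0 h p
    have x1 : 0 ≤ (M1 + M2) * (N 0 f p + N 0 a p + N 0 b p + N 0 h p) := by positivity
    have x2 : 0 ≤ M3 * (N 0 a p + N 0 b p) := by positivity
    simp only [Pi.add_apply]
    have e6 : (M1 + M2 + M3) * (N 0 f p + N 0 a p + N 0 b p + N 0 h p)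
      = (M1 + M2) * (N 0 f p + N 0 a p + N 0 b p + N 0 h p) + M3 * (N 0 a p + N 0 b p)
        + 2 / P.μ * (2 * N 0 f p + 2 * N 0 h p) := by simp only [M3]; ring
    rw [e6]
    have e7 : m * (Gr a p + Gr b p + Gr h p) = m * (Gr a p + Gr b p) + m * Gr h p := by ring
    rw [e7]
    simp only [Gr] at *
    linarith
end lin

end Pf

set_option linter.unusedVariables false
set_option linter.unusedSimpArgs false
namespace Pf
variable {P : Par}

/-! effective flux: control of the normal derivative of the density -/
lemma L3id (f a b h : Fld P) : cμ * (D 2 f * D 0 (D 2 f)) + cl * (D 2 f * D 0 (D 2 f)) + D 2 f * D 2 f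
    = cμ * (D 2 (R0 f a b) * D 2 f) + cl * (D 2 (R0 f a b) * D 2 f) + R2 f a b h * D 2 f
      - (D 0 b + D 2 h + cμ * (D 1 (D 2 a) - D 1 (D 1 b))) * D 2 f := by
  simp only [R0, R2, Lp, dv, D_add, D20, D21]; ring
lemma L3 {f a b h : Fld P} (h0 : Ab (D 2 (R0 f a b) * D 2 f)) (h2 : Ab (R2 f a b h * D 2 f))
    (k1 : Cd (N 0 (D 0 b))) (k2 : Cd (N 0 (D 2 h))) (k3 : Cd (N 0 (D 1 (D 2 a)))) (k4 : Cd (N 0 (D 1 (D 1 b))))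
    (ef : N 0 (D 2 f) ≼ ℰ) : Cd (N 0 (D 2 f)) ∧ Cs (N 0 (D 2 f)) := by
  set g := D 0 b + D 2 h + cμ * (D 1 (D 2 a) - D 1 (D 1 b)) with hg
  have kB : Cd (N 0 g) := IdD.nadd (IdD.nadd k1 k2) (IdD.ncc _ (IdD.nsub k3 k4))
  obtain ⟨C0, hC0, h0⟩ := dD_le h0; obtain ⟨C2, hC2, h2⟩ := dD_le h2
  obtain ⟨B0, hB0, ef⟩ := ef
  have hμ := P.μ0; have hl := P.hlam
  set m := (P.μ + P.lam) / 2
  have hm : 0 < m := by positivity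
  have key := step (B := N 0 g) (f0 := 0) (d := N 0 (D 2 f)) (f1 := fun p => m * N 0 (D 2 f) p)
    (cμ * (half * (D 2 f * D 2 f)) + cl * (half * (D 2 f * D 2 f))) kB Cs_zero
    (c := 1/2) (C := (P.μ + P.lam) * C0 + C2 + 1 + m * B0) (by norm_num) (by positivity)
    (fun p => N_nn _ _ _) ?_ ?_ ?_ ?_
  · refine ⟨key.1, IdS.mono (Le.ofC (m⁻¹) (by positivity) fun p => ?_) key.2⟩
    rw [← mul_assoc, inv_mul_cancel₀ hm.ne', one_mul]
  · intro p
    have L := congrArg (fun f => I f p) (L3id f a b h)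
    rw [← hg] at L
    simp only [I_add, I_sub, I_cμ, I_cl] at L
    simp only [D_add, D_cμ, D_cl, D_sq, I_add, I_cμ, I_cl]
    have j0 := le_of_abs_le (h0 p); have j2 := le_of_abs_le (h2 p)
    have y := neg_le_of_abs_le (young_abs g (D 2 f) p (η := 1/2) (by norm_num))
    norm_num at y
    have x0 := mul_le_mul_of_nonneg_left j0 hμ.le
    have x1 := mul_le_mul_of_nonneg_left j0 hl.le
    have n1 := N_nn 0 g p; have dn := dD_nn p
    have z : 0 ≤ ((P.μ + P.lam) * C0 + C2 + m * B0) * N 0 g p + (1 + m * B0) * dD p := by positivity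
    rw [← N_zero (D 2 f)] at L
    linarith
  · intro p
    simp only [I_add, I_cμ, I_cl, I_half, ← N_zero]
    have := mul_le_mul_of_nonneg_left (ef p) hm.le
    have e0 := ℰ_nn p
    have z : 0 ≤ ((P.μ + P.lam) * C0 + C2 + 1) * ℰ p := by positivity
    have : P.μ * (1 / 2 * N 0 (D 2 f) p) + P.lam * (1 / 2 * N 0 (D 2 f) p) = m * N 0 (D 2 f) p := by simp only [m]; ring
    linarith
  · intro p; exact mul_nonneg hm.le (N_nn _ _ _)
  · intro p
    simp only [I_add, I_cμ, I_cl, I_half, ← N_zero, Pi.zero_apply, mul_zero, add_zero]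
    simp only [m]; apply le_of_eq; ring

/-! Necas type inequality -/
section necas
def Dl' (a l : ℝ) (f : Fld P) : Fld P := fun S => dil a l (f S)
lemma Dl_n (a l : ℝ) (ha : 0 ≤ a) (hl : 0 < l) (hal : a + l ≤ 1) (f : Fld P) (p) :
    N 0 (Dl' a l f) p ≤ l⁻¹ * N 0 f p := dil_n _ _ _ _ _ ha hl hal
lemma Dl_D1 (a l : ℝ) (f : Fld P) : D 1 (Dl' a l f) = Dl' a l (D 1 f) := by
  funext S; show Dm _ 1 (dil a l (f S)) = dil a l (Dm _ 1 _)
  rw [Dm1, Dm1, dil_dd1]; rfl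
lemma Dl_D2 (a l : ℝ) (f : Fld P) : D 2 (Dl' a l f) = cc l * Dl' a l (D 2 f) := by
  funext S; show Dm _ 2 (dil a l (f S)) = ca l * dil a l (Dm _ 2 _)
  rw [Dm2, Dm2, dil_dd2, ← Algebra.smul_def, smul_comm]; rfl
lemma nec1 (Z Q w g : Fld P) (a : ℝ) (ha : 0 ≤ a) (ha' : a + 1/16 ≤ 1) (h : D 1 Q - D 2 w = g)
    (hZ : D 1 Z = 0) (hZ2 : ∀ p : Pt P, ∀ q ∈ Ω, ev (D 2 Z p.S) (p.t, q) ^ 2 ≤ 1)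
    (hZ0 : ∀ p : Pt P, ∀ q ∈ Ω, ev (Z p.S) (p.t, q) ^ 2 ≤ 1)
    (hb : BD (Z * (w - Dl' a (1/16) w))) (p : Pt P) :
    I (Z * (D 1 Q * D 1 Q)) p ≤ 3/8 * N 0 (D 1 Q) p + 200 * (N 0 (D 2 Q) p + N 0 (D 1 w) p + N 0 g p + N 0 w p) := by
  set l : ℝ := 1/16
  set u := w - Dl' a l w with hu
  have hl : (0:ℝ) < l := by norm_num [l]
  have nd : ∀ f : Fld P, N 0 (Dl' a l f) p ≤ 16 * N 0 f p := fun f => by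
    have := Dl_n a l ha hl ha' f p; norm_num [l] at this ⊢; exact this
  have id : Z * (D 1 Q * D 1 Q) = Z * g * D 1 Q - cc l * (Z * Dl' a l g * D 1 Q) + cc l * (Z * Dl' a l (D 1 Q) * D 1 Q)
      - D 2 Z * u * D 1 Q + Z * D 1 u * D 2 Q + D 2 (Z * u * D 1 Q) - D 1 (Z * u * D 2 Q) := by
    have e1 : Dl' a l g = Dl' a l (D 1 Q) - Dl' a l (D 2 w) := by rw [← h]; rfl
    have e2 : D 2 u = D 2 w - cc l * Dl' a l (D 2 w) := by rw [hu, D_sub, Dl_D2]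
    rw [D_mul 2 (Z * u), D_mul 2 Z, e2, D_mul 1 (Z * u), D_mul 1 Z, hZ, D21, e1, ← h]; ring
  have hI := congrArg (fun f => I f p) id
  have hbd : BD (Z * u * D 1 Q) := hb.mul_right _
  simp only [I_add, I_sub, I_cc, I_D1, I_D2 hbd] at hI
  have nZ : ∀ f : Fld P, N 0 (Z * f) p ≤ N 0 f p := fun f => by simpa using mul_sup0 Z f p 1 (hZ0 p)
  have nZ2 : ∀ f : Fld P, N 0 (D 2 Z * f) p ≤ N 0 f p := fun f => by simpa using mul_sup0 _ f p 1 (hZ2 p)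
  have nu : N 0 u p ≤ 34 * N 0 w p := by
    have := N_add 0 w (-Dl' a l w) p
    rw [N_neg, ← sub_eq_add_neg] at this; linarith [nd w]
  have nu1 : N 0 (D 1 u) p ≤ 34 * N 0 (D 1 w) p := by
    have := N_add 0 (D 1 w) (-Dl' a l (D 1 w)) p
    rw [N_neg, ← sub_eq_add_neg] at this
    rw [hu, D_sub, Dl_D1]; linarith [nd (D 1 w)]
  have y1 := le_of_abs_le (young_abs (Z * g) (D 1 Q) p (η := 6) (by norm_num))
  have y2 := neg_le_of_abs_le (young_abs (Z * Dl' a l g) (D 1 Q) p (η := 6) (by norm_num))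
  have y3 := le_of_abs_le (young_abs (Z * Dl' a l (D 1 Q)) (D 1 Q) p (η := 1/8) (by norm_num))
  have y4 := neg_le_of_abs_le (young_abs (D 2 Z * u) (D 1 Q) p (η := 5) (by norm_num))
  have y5 := le_of_abs_le (young_abs (Z * D 1 u) (D 2 Q) p (η := 1) (by norm_num))
  have z1 := nZ g; have z2 := nZ (Dl' a l g); have z3 := nZ (Dl' a l (D 1 Q)); have z4 := nZ2 u; have z5 := nZ (D 1 u)
  have v1 := nd g; have v2 := nd (D 1 Q)
  have n1 := N_nn 0 g p; have n2 := N_nn 0 w p; have n3 := N_nn 0 (D 1 w) p; have n4 := N_nn 0 (D 2 Q) p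
  have n5 := N_nn 0 (D 1 Q) p
  norm_num at y1 y2 y3 y4 y5
  simp only [l] at hI
  linarith
lemma nec {J : Fn P → Prop} (hJ : Id J) {Q w g : Fld P} (h : D 1 Q - D 2 w = g) (h1 : J (N 0 (D 2 Q)))
    (h2 : J (N 0 (D 1 w))) (h3 : J (N 0 g)) (h4 : J (N 0 w)) : J (N 0 (D 1 Q)) := by
  have e : ∀ p : Pt P, N 0 (D 1 Q) p = I ((1 - fX) * (D 1 Q * D 1 Q)) p + I (fX * (D 1 Q * D 1 Q)) p := fun p => by
    rw [← I_add, N_zero]; congr 1; ring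
  have z2 : ∀ p : Pt P, ∀ q ∈ Ω, ev (ee p.S : Alg) (p.t, q) ^ 2 ≤ 1 := fun p q hq => by
    have := p.S.he; have := pe1 p
    have : ev (ee p.S : Alg) (p.t, q) = p.S.e := rfl
    rw [this]; nlinarith
  refine hJ.mono (Le.ofC 1600 (by norm_num) fun p => ?_) (hJ.add (hJ.add (hJ.add h1 h2) h3) h4)
  have a1 := nec1 (1 - fX) Q w g 0 le_rfl (by norm_num) h (by rw [D_sub, D_one, D1X, sub_zero])
    (by intro p q hq; rw [D_sub, D_one, D2X, zero_sub, F_neg]; simpa using z2 p q hq)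
    (by
      intro p q hq
      have : ev ((1 - fX : Fld P) p.S) (p.t, q) = 1 - q.2 := by simp [fX, X]
      rw [this]; have := hq.2; nlinarith [this.1, this.2])
    (by
      intro S t ht x
      constructor
      · have : ev (((1 - fX : Fld P) * (w - Dl' 0 (1/16) w)) S) (t, x, 0) = 0 := by simp [Dl', dil]
        exact this
      · have : ev (((1 - fX : Fld P) * (w - Dl' 0 (1/16) w)) S) (t, x, 1) = 0 := by simp [fX, X]
        exact this) p
  have a2 := nec1 fX Q w g (15/16) (by norm_num) (by norm_num) h D1X
    (by intro p q hq; rw [D2X]; exact z2 p q hq)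
    (by
      intro p q hq
      have : ev ((fX : Fld P) p.S) (p.t, q) = q.2 := rfl
      rw [this]; have := hq.2; nlinarith [this.1, this.2])
    (by
      intro S t ht x
      constructor
      · have : ev (((fX : Fld P) * (w - Dl' (15/16) (1/16) w)) S) (t, x, 0) = 0 := by simp [fX, X]
        exact this
      · have : ev (((fX : Fld P) * (w - Dl' (15/16) (1/16) w)) S) (t, x, 1) = 0 := by simp [Dl', dil]; norm_num
        exact this) p
  have := e p
  simp only [Pi.add_apply]
  linarith
end necas

end Pf

set_option linter.unusedVariables false
set_option linter.unusedSimpArgs false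
namespace Pf
variable {P : Par}

section regs
variable {J : Fn P → Prop} {k : ℕ} {f a b h : Fld P}
lemma Id.ninv (hJ : Id J) {r : ℝ} (hr : r ≠ 0) (hf : J (N k (cc r * f))) : J (N k f) := by
  have := hJ.ncc r⁻¹ hf
  rwa [← mul_assoc, ← cc_mul, inv_mul_cancel₀ hr, cc_one, one_mul] at this
lemma Reg1 (hJ : Id J) (r : J (N k (R1 f a b h))) (h1 : J (N k (D 0 a))) (h2 : J (N k (D 1 f))) (h3 : J (N k (D 1 h)))
    (h4 : J (N k (D 1 (D 1 a)))) (h5 : J (N k (D 1 (D 2 b)))) : J (N k (D 2 (D 2 a))) := by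
  refine hJ.ninv P.μ0.ne' (f := D 2 (D 2 a)) ?_
  have e : cc P.μ * D 2 (D 2 a) = D 0 a + D 1 f + D 1 h - cμ * D 1 (D 1 a) - cl * (D 1 (D 1 a) + D 1 (D 2 b)) - R1 f a b h := by
    simp only [R1, Lp, dv, D_add, cμ]; ring
  rw [e]
  exact hJ.nsub (hJ.nsub (hJ.nsub (hJ.nadd (hJ.nadd h1 h2) h3) (hJ.ncc _ h4)) (hJ.ncc _ (hJ.nadd h4 h5))) r
lemma Reg2 (hJ : Id J) (r : J (N k (R2 f a b h))) (h1 : J (N k (D 0 b))) (h2 : J (N k (D 2 f))) (h3 : J (N k (D 2 h)))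
    (h4 : J (N k (D 1 (D 1 b)))) (h5 : J (N k (D 1 (D 2 a)))) : J (N k (D 2 (D 2 b))) := by
  refine hJ.ninv (r := P.μ + P.lam) (by have := P.μ0; have := P.hlam; positivity) (f := D 2 (D 2 b)) ?_
  have e : cc (P.μ + P.lam) * D 2 (D 2 b) = D 0 b + D 2 f + D 2 h - cμ * D 1 (D 1 b) - cl * (D 1 (D 2 a)) - R2 f a b h := by
    simp only [R2, Lp, dv, D_add, cμ, cl, cc_add, D21]; ring
  rw [e]
  exact hJ.nsub (hJ.nsub (hJ.nsub (hJ.nadd (hJ.nadd h1 h2) h3) (hJ.ncc _ h4)) (hJ.ncc _ h5)) r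
lemma Reg3 (hJ : Id J) (r : J (N k (R3 a b h))) (h1 : J (N k (D 0 h))) (h2 : J (N k (D 1 a))) (h3 : J (N k (D 2 b)))
    (h4 : J (N k (D 1 (D 1 h)))) : J (N k (D 2 (D 2 h))) := by
  refine hJ.ninv P.κ0.ne' (f := D 2 (D 2 h)) ?_
  have e : cc P.κ * D 2 (D 2 h) = cg * D 0 h + (D 1 a + D 2 b) - cκ * D 1 (D 1 h) - R3 a b h := by
    simp only [R3, Lp, dv, D_add, cκ]; ring
  rw [e]
  exact hJ.nsub (hJ.nsub (hJ.nadd (hJ.ncc _ h1) (hJ.nadd h2 h3)) (hJ.ncc _ h4)) r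

/-- tangential second derivatives, scalar case -/
lemma Ell3 (hJ : Id J) (hb : BD h) (hf : J (N 0 (Lp h))) : J (N 0 (D 1 (D 1 h))) ∧ J (N 0 (D 1 (D 2 h))) := by
  have id : Lp h * D 1 (D 1 h) = D 1 (D 1 h) * D 1 (D 1 h) + D 1 (D 2 h) * D 1 (D 2 h)
      + D 2 (D 2 h * D 1 (D 1 h)) - D 1 (D 2 h * D 1 (D 2 h)) := by
    simp only [Lp, D_mul, D21]; ring
  have key : ∀ p, N 0 (D 1 (D 1 h)) p + N 0 (D 1 (D 2 h)) p ≤ 1 * N 0 (Lp h) p := fun p => by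
    have hI := congrArg (fun f => I f p) id
    simp only [I_add, I_sub, I_D1, I_D2 (hb.D1.D1.mul_left _), ← N_zero] at hI
    have y := le_of_abs_le (young_abs (Lp h) (D 1 (D 1 h)) p (η := 1/2) (by norm_num))
    norm_num at y
    linarith [N_nn 0 (D 1 (D 2 h)) p]
  exact ⟨hJ.mono (Le.ofC 1 (by norm_num) fun p => by linarith [key p, N_nn 0 (D 1 (D 2 h)) p]) hf,
    hJ.mono (Le.ofC 1 (by norm_num) fun p => by linarith [key p, N_nn 0 (D 1 (D 1 h)) p]) hf⟩

/-- tangential second derivatives, elasticity system -/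
lemma Ell12 (hJ : Id J) (ha : BD a) (hb : BD b) (h1 : J (N 0 (cμ * Lp a + cl * D 1 (dv a b))))
    (h2 : J (N 0 (cμ * Lp b + cl * D 2 (dv a b)))) :
    (J (N 0 (D 1 (D 1 a))) ∧ J (N 0 (D 1 (D 2 a)))) ∧ (J (N 0 (D 1 (D 1 b))) ∧ J (N 0 (D 1 (D 2 b)))) := by
  set u := cμ * Lp a + cl * D 1 (dv a b) with hu
  set v := cμ * Lp b + cl * D 2 (dv a b) with hv
  have id : u * D 1 (D 1 a) + v * D 1 (D 1 b)
     = cμ * (D 1 (D 1 a) * D 1 (D 1 a) + D 1 (D 2 a) * D 1 (D 2 a) + (D 1 (D 1 b) * D 1 (D 1 b) + D 1 (D 2 b) * D 1 (D 2 b)))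
      + cl * (D 1 (dv a b) * D 1 (dv a b))
      + D 2 (cμ * (D 2 a * D 1 (D 1 a) + D 2 b * D 1 (D 1 b)) + cl * (dv a b * D 1 (D 1 b)))
      + D 1 (cl * (dv a b * D 1 (D 1 a) - dv a b * D 1 (dv a b)) - cμ * (D 2 a * D 1 (D 2 a) + D 2 b * D 1 (D 2 b))) := by
    simp only [hu, hv, Lp, dv, D_mul, D_add, D_sub, Dcμ, Dcl, D21]; ring
  have hμ := P.μ0
  have hbd : BD (cμ * (D 2 a * D 1 (D 1 a) + D 2 b * D 1 (D 1 b)) + cl * (dv a b * D 1 (D 1 b))) :=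
    (((ha.D1.D1.mul_left _).add (hb.D1.D1.mul_left _)).mul_left _).add ((hb.D1.D1.mul_left _).mul_left _)
  set M := 1 / P.μ ^ 2
  have key : ∀ p, N 0 (D 1 (D 1 a)) p + N 0 (D 1 (D 2 a)) p + (N 0 (D 1 (D 1 b)) p + N 0 (D 1 (D 2 b)) p) ≤ M * (N 0 u + N 0 v) p := fun p => by
    have hI := congrArg (fun f => I f p) id
    simp only [I_add, I_sub, I_D1, I_D2 hbd, I_cμ, I_cl, ← N_zero] at hI
    have y1 := le_of_abs_le (young_abs u (D 1 (D 1 a)) p (η := 1 / (2 * P.μ)) (by positivity))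
    have y2 := le_of_abs_le (young_abs v (D 1 (D 1 b)) p (η := 1 / (2 * P.μ)) (by positivity))
    have e1 : (4 * (1 / (2 * P.μ)))⁻¹ = P.μ / 2 := by field_simp; ring
    rw [e1] at y1 y2
    have l0 := mul_nonneg P.hlam.le (N_nn 0 (D 1 (dv a b)) p)
    have := mul_nonneg hμ.le (N_nn 0 (D 1 (D 2 a)) p)
    have := mul_nonneg hμ.le (N_nn 0 (D 1 (D 2 b)) p)
    have e2 : M * (N 0 u + N 0 v) p = 2 / P.μ * (1 / (2 * P.μ) * N 0 u p + 1 / (2 * P.μ) * N 0 v p) := by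
      simp only [M, Pi.add_apply]; field_simp
    rw [e2]
    have e3 : P.μ / 2 * (N 0 (D 1 (D 1 a)) p + N 0 (D 1 (D 2 a)) p + (N 0 (D 1 (D 1 b)) p + N 0 (D 1 (D 2 b)) p))
      ≤ (1 / (2 * P.μ) * N 0 u p + 1 / (2 * P.μ) * N 0 v p) := by linarith
    calc _ = 2 / P.μ * (P.μ / 2 * (N 0 (D 1 (D 1 a)) p + N 0 (D 1 (D 2 a)) p + (N 0 (D 1 (D 1 b)) p + N 0 (D 1 (D 2 b)) p))) := by field_simp
      _ ≤ _ := mul_le_mul_of_nonneg_left e3 (by positivity)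
  have hM : 0 ≤ M := by positivity
  have hh := hJ.add h1 h2
  have q1 := N_nn 0 (D 1 (D 1 a)); have q2 := N_nn 0 (D 1 (D 2 a)); have q3 := N_nn 0 (D 1 (D 1 b)); have q4 := N_nn 0 (D 1 (D 2 b))
  exact ⟨⟨hJ.mono (Le.ofC M hM fun p => by linarith [key p, q1 p, q2 p, q3 p, q4 p]) hh,
    hJ.mono (Le.ofC M hM fun p => by linarith [key p, q1 p, q2 p, q3 p, q4 p]) hh⟩,
    ⟨hJ.mono (Le.ofC M hM fun p => by linarith [key p, q1 p, q2 p, q3 p, q4 p]) hh,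
    hJ.mono (Le.ofC M hM fun p => by linarith [key p, q1 p, q2 p, q3 p, q4 p]) hh⟩⟩
end regs

/-! derivative words -/
inductive Op : (Fld P → Fld P) → Prop
  | id : Op fun f => f
  | D {L} (i) : Op L → Op fun f => D i (L f)
/-- tangential words -/
inductive Ot : (Fld P → Fld P) → Prop
  | id : Ot fun f => f
  | D1 {L} : Ot L → Ot fun f => D 1 (L f)
  | D0 {L} : Ot L → Ot fun f => D 0 (L f)
section ops
variable {L : Fld P → Fld P}
lemma Ot.op (h : Ot L) : Op L := by
  induction h with
  | id => exact .id
  | D1 _ ih => exact .D 1 ih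
  | D0 _ ih => exact .D 0 ih
lemma Ot.bd (h : Ot L) {a} (ha : BD a) : BD (L a) := by
  induction h with
  | id => exact ha
  | D1 _ ih => exact ih.D1
  | D0 _ ih => exact ih.D0
lemma Op.r0 (h : Op L) (f a b) : R0 (L f) (L a) (L b) = L (R0 f a b) := by
  induction h with
  | id => rfl
  | D i _ ih => rw [← D_R0, ih]
lemma Op.r1 (h : Op L) (f a b k) : R1 (L f) (L a) (L b) (L k) = L (R1 f a b k) := by
  induction h with
  | id => rfl
  | D i _ ih => rw [← D_R1, ih]
lemma Op.r2 (h : Op L) (f a b k) : R2 (L f) (L a) (L b) (L k) = L (R2 f a b k) := by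
  induction h with
  | id => rfl
  | D i _ ih => rw [← D_R2, ih]
lemma Op.r3 (h : Op L) (a b k) : R3 (L a) (L b) (L k) = L (R3 a b k) := by
  induction h with
  | id => rfl
  | D i _ ih => rw [← D_R3, ih]
lemma Op.dv (h : Op L) (a b) : dv (L a) (L b) = L (dv a b) := by
  induction h with
  | id => rfl
  | D i _ ih => rw [← D_dv, ih]

/-- residual pairs -/
def Rp (F a : Fld P) : Prop := (F = F1 ∧ a = fΨ1) ∨ (F = F2 ∧ a = fΨ2) ∨ (F = F3 ∧ a = fΘ)
def IsF (F : Fld P) : Prop := F = F1 ∨ F = F2 ∨ F = F3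
lemma Rp.F {F a : Fld P} (h : Rp F a) : IsF F := by
  rcases h with h | h | h
  exacts [Or.inl h.1, Or.inr (Or.inl h.1), Or.inr (Or.inr h.1)]
lemma Rp.a {F a : Fld P} (h : Rp F a) : Par3 a := by
  rcases h with h | h | h
  exacts [Or.inl h.2, Or.inr (Or.inl h.2), Or.inr (Or.inr h.2)]
lemma IsF.le {F : Fld P} (h : IsF F) : N 2 F ≼ d2f * 𝒟 := by
  rcases h with rfl | rfl | rfl
  exacts [F1_le, F2_le, F3_le]
lemma IsF.le0 {F : Fld P} (h : IsF F) : N 0 (D 0 F) ≼ d2f * 𝒟 := by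
  rcases h with rfl | rfl | rfl
  exacts [D0F1_le, D0F2_le, D0F3_le]
lemma i1 : IsF (F1 : Fld P) := Or.inl rfl
lemma i2 : IsF (F2 : Fld P) := Or.inr (Or.inl rfl)
lemma i3 : IsF (F3 : Fld P) := Or.inr (Or.inr rfl)
lemma rp1 : Rp (F1 : Fld P) fΨ1 := Or.inl ⟨rfl, rfl⟩
lemma rp2 : Rp (F2 : Fld P) fΨ2 := Or.inr (Or.inl ⟨rfl, rfl⟩)
lemma rp3 : Rp (F3 : Fld P) fΘ := Or.inr (Or.inr ⟨rfl, rfl⟩)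

lemma EZL (h : Ot L) (h0 : Ab (L F0 * L fΦ)) (h1 : ∀ F a, Rp F a → Ab (L F * L a))
    (e0 : N 0 (L fΦ) ≼ ℰ) (e1 : ∀ a, Par3 a → N 0 (L a) ≼ ℰ) :
    (∀ a, Par3 a → Cd (N 0 (D 1 (L a))) ∧ Cd (N 0 (D 2 (L a))) ∧ Cs (N 0 (L a))) ∧ Cs (N 0 (L fΦ)) := by
  have o := h.op
  obtain ⟨k1, k2⟩ := EZ (f := L fΦ) (h.bd bdΨ1) (h.bd bdΨ2) (h.bd bdΘ) (by rw [o.r0]; exact h0)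
    (by rw [o.r1]; exact h1 _ _ rp1) (by rw [o.r2]; exact h1 _ _ rp2) (by rw [o.r3]; exact h1 _ _ rp3)
    e0 (e1 _ p1) (e1 _ p2) (e1 _ p3)
  have n0 := N_nn 0 (L (fΦ : Fld P))
  have n1 := N_nn 0 (L (fΨ1 : Fld P)); have n2 := N_nn 0 (L (fΨ2 : Fld P)); have n3 := N_nn 0 (L (fΘ : Fld P))
  refine ⟨?_, IdS.le k2 fun p => by simp only [Pi.add_apply]; linarith [n1 p, n2 p, n3 p]⟩
  have g : ∀ (a : Fld P) i, tang i → ∀ p, N 0 (D i a) p ≤ Gr a p := fun a i hi p => by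
    rcases hi with rfl | rfl <;> simp only [Gr] <;> linarith [N_nn 0 (D 1 a) p, N_nn 0 (D 2 a) p]
  have gg : ∀ (a : Fld P), Par3 a → ∀ i, tang i → Cd (N 0 (D i (L a))) := by
    intro a ha i hi
    refine IdD.le k1 fun p => ?_
    have := g (L a) i hi p
    simp only [Pi.add_apply]
    have := Gr_nn (L (fΨ1 : Fld P)) p; have := Gr_nn (L (fΨ2 : Fld P)) p; have := Gr_nn (L (fΘ : Fld P)) p
    rcases ha with rfl | rfl | rfl <;> linarith
  intro a ha
  refine ⟨gg a ha 1 (Or.inl rfl), gg a ha 2 (Or.inr rfl), IdS.le k2 fun p => ?_⟩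
  simp only [Pi.add_apply]
  rcases ha with rfl | rfl | rfl <;> linarith [n0 p, n1 p, n2 p, n3 p]

lemma Gr_le (a : Fld P) {B : Fn P} (h1 : N 0 (D 1 a) ≼ B) (h2 : N 0 (D 2 a) ≼ B) : Gr a ≼ B :=
  (Le.of fun p => le_rfl : Gr a ≼ N 0 (D 1 a) + N 0 (D 2 a)).trans (h1.add h2)

lemma E1L (h : Ot L) (h0 : N 0 (L F0) ≼ d2f * 𝒟) (h1 : ∀ F, IsF F → N 0 (L F) ≼ d2f * 𝒟)
    (m1 : ∀ a, Par3 a → N 0 (D 1 (L a)) ≼ 𝒟 ∧ N 0 (D 2 (L a)) ≼ 𝒟 ∧ N 0 (D 0 (L a)) ≼ 𝒟)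
    (e0 : N 0 (L fΦ) ≼ ℰ) (e1 : ∀ a, Par3 a → N 1 (L a) ≼ ℰ)
    (c : ∀ a, Par3 a → Cd (N 0 (D 1 (L a))) ∧ Cd (N 0 (D 2 (L a))) ∧ Cs (N 0 (L a))) (c0 : Cs (N 0 (L fΦ))) :
    ∀ a, Par3 a → Cd (N 0 (D 0 (L a))) ∧ Cs (N 0 (D 1 (L a))) ∧ Cs (N 0 (D 2 (L a))) := by
  have o := h.op
  have hdv : N 0 (dv (L fΨ1) (L fΨ2)) ≼ 𝒟 := Nle_add (m1 _ p1).1 (m1 _ p2).2.1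
  have G : ∀ a, Par3 a → Gr (L a) ≼ ℰ := fun a ha => Gr_le _ (Nle_D1 (e1 a ha)) (Nle_D2 (e1 a ha))
  have cG : ∀ a, Par3 a → Cd (Gr (L a)) := fun a ha => IdD.le (IdD.add (c a ha).1 (c a ha).2.1) fun p => le_rfl
  obtain ⟨k1, k2⟩ := E1Z (f := L fΦ) (h.bd bdΨ1) (h.bd bdΨ2) (h.bd bdΘ)
    (by rw [o.r0]; exact Ab.of h0 hdv)
    (by rw [o.r1]; exact Ab.of (h1 _ i1) (m1 _ p1).2.2) (by rw [o.r2]; exact Ab.of (h1 _ i2) (m1 _ p2).2.2)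
    (by rw [o.r3]; exact Ab.of (h1 _ i3) (m1 _ p3).2.2)
    (IdD.add (IdD.add (cG _ p1) (cG _ p2)) (cG _ p3))
    (IdS.add (IdS.add (IdS.add c0 (c _ p1).2.2) (c _ p2).2.2) (c _ p3).2.2)
    e0 (G _ p1) (G _ p2) (G _ p3) (Nle_down (by norm_num) (e1 _ p3))
  intro a ha
  have n1 := N_nn 0 (D 0 (L (fΨ1 : Fld P))); have n2 := N_nn 0 (D 0 (L (fΨ2 : Fld P))); have n3 := N_nn 0 (D 0 (L (fΘ : Fld P)))
  have u1 := Gr_nn (L (fΨ1 : Fld P)); have u2 := Gr_nn (L (fΨ2 : Fld P)); have u3 := Gr_nn (L (fΘ : Fld P))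
  have v1 := N_nn 0 (D 1 (L a)); have v2 := N_nn 0 (D 2 (L a))
  have kk : Cs (Gr (L a)) := by
    refine IdS.le k2 fun p => ?_
    simp only [Pi.add_apply]; rcases ha with rfl | rfl | rfl <;> linarith [u1 p, u2 p, u3 p]
  refine ⟨IdD.le k1 fun p => ?_, IdS.le kk fun p => ?_, IdS.le kk fun p => ?_⟩
  · simp only [Pi.add_apply]; rcases ha with rfl | rfl | rfl <;> linarith [n1 p, n2 p, n3 p]
  · simp only [Gr]; linarith [v1 p, v2 p]
  · simp only [Gr]; linarith [v1 p, v2 p]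

lemma L3L (o : Op L) (h0 : Ab (D 2 (L F0) * D 2 (L fΦ))) (h2 : Ab (L F2 * D 2 (L fΦ)))
    (k : ∀ a, Par3 a → Cd (N 0 (D 0 (L a))) ∧ Cd (N 0 (D 2 (L a))) ∧ Cd (N 0 (D 1 (D 2 (L a)))) ∧ Cd (N 0 (D 1 (D 1 (L a)))))
    (ef : N 0 (D 2 (L fΦ)) ≼ ℰ) : Cd (N 0 (D 2 (L fΦ))) ∧ Cs (N 0 (D 2 (L fΦ))) :=
  L3 (f := L fΦ) (a := L fΨ1) (b := L fΨ2) (h := L fΘ) (by rw [o.r0]; exact h0) (by rw [o.r2]; exact h2)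
    (k _ p2).1 (k _ p3).2.1 (k _ p1).2.2.1 (k _ p2).2.2.2 ef

section J
variable {J : Fn P → Prop} {k : ℕ}
lemma NecL (hJ : Id J) (o : Op L) (hF : J (N 0 (L F1)))
    (c : ∀ a, Par3 a → J (N 0 (D 0 (L a))) ∧ J (N 0 (D 1 (L a))) ∧ J (N 0 (D 2 (L a))) ∧ J (N 0 (D 1 (D 2 (L a)))) ∧ J (N 0 (D 1 (D 1 (L a)))))
    (h2 : J (N 0 (D 2 (L fΦ)))) : J (N 0 (D 1 (L fΦ))) := by
  refine nec hJ (w := cμ * D 2 (L fΨ1)) (g := L F1 - D 0 (L fΨ1) - D 1 (L fΘ) + cμ * D 1 (D 1 (L fΨ1))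
      + cl * (D 1 (D 1 (L fΨ1)) + D 1 (D 2 (L fΨ2)))) ?_ h2 ?_ ?_ ?_
  · rw [F1, ← o.r1, D_cμ]; simp only [R1, Lp, Pf.dv, D_add]; ring
  · rw [D_cμ]; exact hJ.ncc _ (c _ p1).2.2.2.1
  · exact hJ.nadd (hJ.nadd (hJ.nsub (hJ.nsub hF (c _ p1).1) (c _ p3).2.1) (hJ.ncc _ (c _ p1).2.2.2.2))
      (hJ.ncc _ (hJ.nadd (c _ p1).2.2.2.2 (c _ p2).2.2.2.1))
  · exact hJ.ncc _ (c _ p1).2.2.1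

lemma RegL (hJ : Id J) (o : Op L) (hF : ∀ F, IsF F → J (N k (L F)))
    (c0 : ∀ a, Par3 a → J (N k (D 0 (L a)))) (c1 : ∀ a, Par3 a → J (N k (D 1 (L a)))) (c2 : ∀ a, Par3 a → J (N k (D 2 (L a))))
    (c12 : ∀ a, Par3 a → J (N k (D 1 (D 2 (L a))))) (c11 : ∀ a, Par3 a → J (N k (D 1 (D 1 (L a)))))
    (f1 : J (N k (D 1 (L fΦ)))) (f2 : J (N k (D 2 (L fΦ)))) :
    ∀ a, Par3 a → J (N k (D 2 (D 2 (L a)))) := by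
  intro a ha
  rcases ha with rfl | rfl | rfl
  · exact Reg1 hJ (f := L fΦ) (b := L fΨ2) (h := L fΘ) (by rw [o.r1]; exact hF _ i1) (c0 _ p1) f1 (c1 _ p3) (c11 _ p1) (c12 _ p2)
  · exact Reg2 hJ (f := L fΦ) (a := L fΨ1) (h := L fΘ) (by rw [o.r2]; exact hF _ i2) (c0 _ p2) f2 (c2 _ p3) (c11 _ p2) (c12 _ p1)
  · exact Reg3 hJ (a := L fΨ1) (b := L fΨ2) (by rw [o.r3]; exact hF _ i3) (c0 _ p3) (c1 _ p1) (c2 _ p2) (c11 _ p3)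

lemma EllL (hJ : Id J) (h : Ot L) (hF : ∀ F, IsF F → J (N 0 (L F)))
    (c0 : ∀ a, Par3 a → J (N 0 (D 0 (L a)))) (c1 : ∀ a, Par3 a → J (N 0 (D 1 (L a)))) (c2 : ∀ a, Par3 a → J (N 0 (D 2 (L a))))
    (f1 : J (N 0 (D 1 (L fΦ)))) (f2 : J (N 0 (D 2 (L fΦ)))) :
    ∀ a, Par3 a → J (N 0 (D 1 (D 1 (L a)))) ∧ J (N 0 (D 1 (D 2 (L a)))) ∧ J (N 0 (D 2 (D 2 (L a)))) := by
  have o := h.op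
  have e3 : J (N 0 (Lp (L fΘ))) := by
    refine hJ.ninv P.κ0.ne' ?_
    rw [show cc P.κ * Lp (L fΘ) = cg * D 0 (L fΘ) + (D 1 (L fΨ1) + D 2 (L fΨ2)) - L F3 by
      rw [F3, ← o.r3]; simp only [R3, Pf.dv, cκ]; ring]
    exact hJ.nsub (hJ.nadd (hJ.ncc _ (c0 _ p3)) (hJ.nadd (c1 _ p1) (c2 _ p2))) (hF _ i3)
  have e1 : J (N 0 (cμ * Lp (L fΨ1) + cl * D 1 (Pf.dv (L fΨ1) (L fΨ2)))) := by
    rw [show cμ * Lp (L fΨ1) + cl * D 1 (Pf.dv (L fΨ1) (L fΨ2)) = D 0 (L fΨ1) + D 1 (L fΦ) + D 1 (L fΘ) - L F1 by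
      rw [F1, ← o.r1]; simp only [R1]; ring]
    exact hJ.nsub (hJ.nadd (hJ.nadd (c0 _ p1) f1) (c1 _ p3)) (hF _ i1)
  have e2 : J (N 0 (cμ * Lp (L fΨ2) + cl * D 2 (Pf.dv (L fΨ1) (L fΨ2)))) := by
    rw [show cμ * Lp (L fΨ2) + cl * D 2 (Pf.dv (L fΨ1) (L fΨ2)) = D 0 (L fΨ2) + D 2 (L fΦ) + D 2 (L fΘ) - L F2 by
      rw [F2, ← o.r2]; simp only [R2]; ring]
    exact hJ.nsub (hJ.nadd (hJ.nadd (c0 _ p2) f2) (c2 _ p3)) (hF _ i2)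
  obtain ⟨x1, x2⟩ := Ell12 hJ (h.bd bdΨ1) (h.bd bdΨ2) e1 e2
  have x3 := Ell3 hJ (h.bd bdΘ) e3
  have t : ∀ a, Par3 a → J (N 0 (D 1 (D 1 (L a)))) ∧ J (N 0 (D 1 (D 2 (L a)))) := by
    intro a ha; rcases ha with rfl | rfl | rfl
    exacts [x1, x2, x3]
  have := RegL hJ o hF c0 c1 c2 (fun a ha => (t a ha).2) (fun a ha => (t a ha).1) f1 f2
  exact fun a ha => ⟨(t a ha).1, (t a ha).2, this a ha⟩
end J
end ops

end Pf

set_option linter.unusedVariables false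
set_option linter.unusedSimpArgs false
namespace Pf
variable {P : Par}

/-! basic weighted energy estimate -/
lemma Ab3 {c A B : Fld P} (hc : SM c) (hA : N 0 A ≼ 𝒟) (hB : N 0 B ≼ 𝒟) : Ab (c * A * B) :=
  Ab.of (hc.le hA) hB

def E0q : Fld P := half * (fτ * (fΦ * fΦ) + fs * fs * (fΨ1 * fΨ1) + fs * fs * (fΨ2 * fΨ2) + cg * (fs * fs * fs * (fΘ * fΘ)))

/-- transport remainder -/
def tr0 (a : Fld P) : Fld P := (fs * fΦ) * D 0 a * (ee * a)
  + (fs * fs * fΨ1 + fs * fΦ * (ee * (fX + fΨ1))) * D 1 a * (ee * a)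
  + (fs * (fs + ee * fΦ) * fΨ2) * D 2 a * (ee * a)
def vs0 (c : Fld P) (k : Fld P) (a : Fld P) : Fld P := (c * D 1 a * D 1 a + c * D 2 a * D 2 a) - k * (ee * a) * D 2 a
def E0m : Fld P := (fτ * fΨ1) * D 1 fΦ * (ee * fΦ) + (fτ * fΨ2) * D 2 fΦ * (ee * fΦ) + (fτ * fΦ) * dv fΨ1 fΨ2 * (ee * fΦ)
def E0p : Fld P := (fs * fs - 1 + fs * (ee * fΦ)) * (ee * fΨ2) * (ee * fΨ1)
  + ((fs * fΨ1) * D 1 fΦ * (ee * fΘ) + (fs * fΨ1) * D 1 fΘ * (ee * fΦ))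
  + ((fs * fΨ2) * D 2 fΦ * (ee * fΘ) + (fs * fΨ2) * D 2 fΘ * (ee * fΦ))
  + cμ * (vs0 (fs - 1) k1 fΨ1 + vs0 (fs - 1) k1 fΨ2)
  + cl * ((fs - 1) * dv fΨ1 fΨ2 * dv fΨ1 fΨ2 - k1 * (ee * fΨ2) * dv fΨ1 fΨ2)
def E0h : Fld P := cg * (fs * (tr0 fΘ)) + cg * ((fs * fs * fΦ * (ee * ftp)) * (ee * fΨ2) * (ee * fΘ))
  + ((fs * fs * fΘ * fτ) * dv fΨ1 fΨ2 * (ee * fΦ) + (fs * fs * fs * fΘ) * dv fΨ1 fΨ2 * (ee * fΘ)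
      + (fs * fs * fΘ * (ee * fΦ)) * dv fΨ1 fΨ2 * (ee * fΘ))
  + cκ * (vs0 (fs * fs - 1) (fs * (k1 + k1)) fΘ)
  - (cc (2 * P.μ) * ((fs * fs * D 1 fΨ1) * D 1 fΨ1 * (ee * fΘ) + (fs * fs * D 2 fΨ2) * D 2 fΨ2 * (ee * fΘ))
    + cμ * ((fs * fs * (D 1 fΨ2 + D 2 fΨ1)) * (D 1 fΨ2 + D 2 fΨ1) * (ee * fΘ))
    + cc (P.lam - P.μ) * ((fs * fs * dv fΨ1 fΨ2) * dv fΨ1 fΨ2 * (ee * fΘ))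
    + cc (2 * P.μ) * ((fs * fs * ee) * (D 1 fΨ2 + D 2 fΨ1) * (ee * fΘ)))
def E0c : Fld P := (1 + cg) * ((fs * fs * fs - 1) * ftp * (ee * fΨ2) * (ee * fΘ))
def E0l : Fld P := (ee * fΨ1) * (ee * fΨ2) + (1 + cg) * (ftp * ((ee * fΨ2) * (ee * fΘ)))

set_option maxHeartbeats 4000000 in
lemma E0id : (F0 - G0) * (fτ * fΦ) + (F1 - G1) * (fs * fΨ1) + (F2 - G2) * (fs * fΨ2) + (F3 - G3) * (fs * fs * fΘ)
  = D 0 E0q + cμ * (D 1 fΨ1 * D 1 fΨ1 + D 2 fΨ1 * D 2 fΨ1 + (D 1 fΨ2 * D 1 fΨ2 + D 2 fΨ2 * D 2 fΨ2))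
      + cl * (dv fΨ1 fΨ2 * dv fΨ1 fΨ2) + cκ * (D 1 fΘ * D 1 fΘ + D 2 fΘ * D 2 fΘ)
      + E0l + E0m + E0p + (tr0 fΨ1 + tr0 fΨ2) + E0h + E0c
    + D 1 (half * (ee * fX * (fτ * (fΦ * fΦ) + fs * fs * (fΨ1 * fΨ1) + fs * fs * (fΨ2 * fΨ2) + cg * (fs * fs * fs * (fΘ * fΘ))))
      + fs * fΨ1 * (fτ * fΦ) + fs * fs * fΨ1 * fΘ - cμ * (fs * (fΨ1 * D 1 fΨ1 + fΨ2 * D 1 fΨ2)) - cl * (fs * fΨ1 * dv fΨ1 fΨ2)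
        - cκ * (fs * fs * (fΘ * D 1 fΘ)))
    + D 2 (fs * fΨ2 * (fτ * fΦ) + fs * fs * fΨ2 * fΘ - cμ * (fs * (fΨ1 * D 2 fΨ1 + fΨ2 * D 2 fΨ2)) - cl * (fs * fΨ2 * dv fΨ1 fΨ2)
        - cκ * (fs * fs * (fΘ * D 2 fΘ)) : Fld P) := by
  simp only [E0q, E0l, E0m, E0p, E0h, E0c, tr0, vs0, F0, F1, F2, F3, G0, G1, G2, G3, R0, R1, R2, R3, Lp, T1, T2, T3, V1, V2, r1, r2, q1, k1, k2, D_sub, D_add, D_mul,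
    Dcμ, Dcl, Dcg, Dcκ, Dhalf, D_ee, D0s, D1s, D2s, D0τ, D1τ, D2τ, D1X, D2X, D_dv, ← cμ.eq_def]
  simp only [dv, D_add]
  have hh := half2 (P := P)
  linear_combination (-(fτ * fΦ * D 0 fΦ + fs * fs * (fΨ1 * D 0 fΨ1 + fΨ2 * D 0 fΨ2) + cg * (fs * fs * fs * (fΘ * D 0 fΘ))
    + ee * fX * (fτ * fΦ * D 1 fΦ + fs * fs * (fΨ1 * D 1 fΨ1 + fΨ2 * D 1 fΨ2) + cg * (fs * fs * fs * (fΘ * D 1 fΘ)))) : Fld P) * hh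

lemma nd1 {a : Fld P} (h : Par3 a) : N 0 (D 1 a) ≼ 𝒟 := Nle_down (by norm_num) h.m1
lemma nd2 {a : Fld P} (h : Par3 a) : N 0 (D 2 a) ≼ 𝒟 := Nle_down (by norm_num) h.m2
lemma nΦ1 : N 0 (D 1 (fΦ : Fld P)) ≼ 𝒟 := Nle_down (by norm_num) mΦ1
lemma nΦ2 : N 0 (D 2 (fΦ : Fld P)) ≼ 𝒟 := Nle_down (by norm_num) mΦ2
lemma ndv : N 0 (dv fΨ1 fΨ2 : Fld P) ≼ 𝒟 := Nle_add (nd1 p1) (nd2 p2)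
lemma Par3.sm {a : Fld P} (h : Par3 a) : SM a := smA h.s
lemma SM_ss : SM (fs * fs - 1 : Fld P) := by
  rw [show (fs * fs - 1 : Fld P) = (fs - 1) * (fs + 1) by ring]; exact SM_s1.mulB (Bm_s.add Bm_one)
lemma SM_sss : SM (fs * fs * fs - 1 : Fld P) := by
  rw [show (fs * fs * fs - 1 : Fld P) = (fs - 1) * (fs * fs + fs + 1) by ring]
  exact SM_s1.mulB (((Bm_s.mul Bm_s).add Bm_s).add Bm_one)
lemma Bm_ss : Bm (fs * fs : Fld P) := Bm_s.mul Bm_s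
lemma Ab_tr0 {a c : Fld P} (hc : Bm c) (h : Par3 a) : Ab (c * tr0 a) := by
  rw [show c * tr0 a = (c * (fs * fΦ)) * D 0 a * (ee * a)
  + (c * (fs * fs * fΨ1 + fs * fΦ * (ee * (fX + fΨ1)))) * D 1 a * (ee * a)
  + (c * (fs * (fs + ee * fΦ) * fΨ2)) * D 2 a * (ee * a) by unfold tr0; ring]
  refine ((Ab3 ?_ (nD0 h) h.me).add (Ab3 ?_ (nd1 h) h.me)).add (Ab3 ?_ (nd2 h) h.me)
  · exact (SM_Φ.Bmul Bm_s).Bmul hc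
  · exact ((SM_Ψ1.Bmul Bm_ss).add ((SM_Φ.Bmul Bm_s).mulB (Bm_e.mul (Bm_X.add SM_Ψ1.bm)))).Bmul hc
  · exact (SM_Ψ2.Bmul (Bm_s.mul (Bm_s.add (Bm_e.mul SM_Φ.bm)))).Bmul hc
lemma Ab_vs0 {a c k : Fld P} (hc : SM c) (hk : SM k) (h : Par3 a) : Ab (vs0 c k a) :=
  ((Ab3 hc (nd1 h) (nd1 h)).add (Ab3 hc (nd2 h) (nd2 h))).sub (Ab3 hk h.me (nd2 h))
lemma Ab_E0m : Ab (E0m : Fld P) :=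
  ((Ab3 (SM_Ψ1.Bmul Bm_τ) nΦ1 mΦe).add (Ab3 (SM_Ψ2.Bmul Bm_τ) nΦ2 mΦe)).add (Ab3 (SM_Φ.Bmul Bm_τ) ndv mΦe)
lemma Ab_E0p : Ab (E0p : Fld P) := by
  have sΦ : SM (fs * (ee * fΦ) : Fld P) := (SM_ee.mulB SM_Φ.bm).Bmul Bm_s
  refine ((((Ab3 (SM_ss.add sΦ) p2.me p1.me).add ?_).add ?_).add (Ab.cc _ ?_)).add (Ab.cc _ ?_)
  · exact (Ab3 (SM_Ψ1.Bmul Bm_s) nΦ1 p3.me).add (Ab3 (SM_Ψ1.Bmul Bm_s) (nd1 p3) mΦe)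
  · exact (Ab3 (SM_Ψ2.Bmul Bm_s) nΦ2 p3.me).add (Ab3 (SM_Ψ2.Bmul Bm_s) (nd2 p3) mΦe)
  · exact (Ab_vs0 SM_s1 SM_k1 p1).add (Ab_vs0 SM_s1 SM_k1 p2)
  · exact (Ab3 SM_s1 ndv ndv).sub (Ab3 SM_k1 p2.me ndv)
lemma Ab_E0h : Ab (E0h : Fld P) := by
  have c12 : N 0 (D 1 fΨ2 + D 2 fΨ1 : Fld P) ≼ 𝒟 := Nle_add (nd1 p2) (nd2 p1)
  refine ((((Ab.cc _ (Ab_tr0 Bm_s p3)).add (Ab.cc _ (Ab3 ?_ p2.me p3.me))).add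
    (((Ab3 ?_ ndv mΦe).add (Ab3 ?_ ndv p3.me)).add (Ab3 ?_ ndv p3.me))).add (Ab.cc _ ?_)).sub
    ((((Ab.cc _ ((Ab3 ?_ (nd1 p1) p3.me).add (Ab3 ?_ (nd2 p2) p3.me))).add (Ab.cc _ (Ab3 ?_ c12 p3.me))).add
      (Ab.cc _ (Ab3 ?_ ndv p3.me))).add (Ab.cc _ (Ab3 ?_ c12 p3.me)))
  · exact (SM_Φ.Bmul Bm_ss).mulB (Bm_e.mul Bm_tp)
  · exact (SM_Θ.Bmul Bm_ss).mulB Bm_τ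
  · exact SM_Θ.Bmul (Bm_ss.mul Bm_s)
  · exact (SM_Θ.Bmul Bm_ss).mulB (Bm_e.mul SM_Φ.bm)
  · exact Ab_vs0 SM_ss ((SM_k1.add SM_k1).Bmul Bm_s) p3
  · exact (smB s3Ψ1).Bmul Bm_ss
  · exact (smC s3Ψ2).Bmul Bm_ss
  · exact ((smB s3Ψ2).add (smC s3Ψ1)).Bmul Bm_ss
  · exact SM_dv.Bmul Bm_ss
  · exact SM_ee.Bmul Bm_ss
lemma Ab_E0c : Ab (E0c : Fld P) := by
  rw [show (E0c : Fld P) = ((1 + cg) * ((fs * fs * fs - 1) * ftp)) * (ee * fΨ2) * (ee * fΘ) by unfold E0c; ring]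
  exact Ab3 ((SM_sss.mulB Bm_tp).Bmul (Bm_one.add (Bm_cc _))) p2.me p3.me

lemma BD.zero0 {f : Fld P} (h : BD f) (p : Pt P) : N 0 (ee * f) p ≤ N 0 (D 2 f) p := by
  have := poinA (f p.S) p.S.he (t := p.t) fun x => (h p.S p.t p.ht x).1
  rw [Algebra.smul_def] at this; exact this
lemma poinΦ (p : Pt P) : N 0 (ee * fΦ) p ≤ 40 * (N 0 (D 1 fΦ) p + N 0 (D 2 fΦ) p) := by
  have := poinM (p.S.Φ) p.S.he (p.S.mean p.t p.ht)
  rw [Algebra.smul_def] at this; exact this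

lemma ev_ca (c : ℝ) (f : Alg) (x) : ev (ca c * f) x = c * ev f x := by
  rw [show ca c * f = c • f from (Algebra.smul_def _ _).symm]; simp

lemma tp_bd (A B : Fld P) (p : Pt P) : -(P.K / 2 * (N 0 A p + N 0 B p)) ≤ I (ftp * (A * B)) p := by
  have h : I (-(ftp * (A * B))) p ≤ I (cc (P.K / 2) * (A * A + B * B)) p := by
    apply I_le
    intro q hq
    have e : ev ((cc (P.K / 2) * (A * A + B * B) : Fld P) p.S) (p.t, q) = P.K / 2 * ev ((A * A + B * B : Fld P) p.S) (p.t, q) :=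
      ev_ca _ _ _
    rw [e]
    have ht := abs_le.1 (p.S.tpB p.t p.ht q hq)
    simp only [F_mul, F_neg, F_add, ev_mul, ev_add, ev_neg]
    set x := ev (A p.S) (p.t, q); set y := ev (B p.S) (p.t, q)
    have : ftp p.S = p.S.tp := rfl
    rw [this]
    set z := ev p.S.tp (p.t, q)
    nlinarith [mul_nonneg (by linarith : 0 ≤ P.K - z) (sq_nonneg (x - y)), mul_nonneg (by linarith : 0 ≤ P.K + z) (sq_nonneg (x + y))]
  rw [I_neg, I_cc, I_add, ← N_zero, ← N_zero] at h; linarith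

lemma wt_low (w f : Fld P) (p : Pt P) (m : ℝ) (h : ∀ q ∈ Ω, m ≤ ev (w p.S) (p.t, q)) :
    m * N 0 f p ≤ I (w * (f * f)) p := by
  rw [N_zero, ← I_cc]
  apply I_le
  intro q hq
  have e : ev ((cc m * (f * f) : Fld P) p.S) (p.t, q) = m * ev ((f * f : Fld P) p.S) (p.t, q) := ev_ca _ _ _
  rw [e]
  simp only [F_mul, ev_mul]
  exact mul_le_mul_of_nonneg_right (h q hq) (mul_self_nonneg _)
lemma wt_up {w f : Fld P} (hw : Bm w) (hf : N 0 f ≼ ℰ) : ∃ C, 0 ≤ C ∧ ∀ p, I (w * (f * f)) p ≤ C * ℰ p := by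
  obtain ⟨C1, h1, k1⟩ := hw.le hf (hk := by norm_num)
  obtain ⟨C2, h2, k2⟩ := hf
  refine ⟨C1 + C2, by positivity, fun p => ?_⟩
  have := young (w * f) f p one_pos
  rw [mul_assoc] at this
  have := k1 p; have := k2 p; have := N_nn 0 (w*f) p; have := N_nn 0 f p
  linarith

lemma s_low (p : Pt P) {q} (hq : q ∈ Ω) : (1 + P.K)⁻¹ ≤ ev (fs p.S) (p.t, q) ∧ 1 / 2 ≤ ev (fτ p.S) (p.t, q) := by
  have hs : 0 < ev (fs p.S) (p.t, q) := p.S.sP p.t p.ht q hq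
  have hs2 : ev (fs p.S) (p.t, q) ≤ 2 := le_of_abs_le (p.S.sB p.t p.ht q hq)
  have h1 : ev (fs p.S) (p.t, q) * ev (fτ p.S) (p.t, q) = 1 := by
    have := congrArg (fun f : Fld P => ev (f p.S) (p.t, q)) (sτ (P := P))
    simpa using this
  have hτ : ev (fτ p.S) (p.t, q) = 1 + p.S.e * ev p.S.ϑ (p.t, q) := by
    have := congrArg (fun f : Fld P => ev (f p.S) (p.t, q)) (τeq (P := P))
    simp only [F_add, F_one, ev_add, ev_one] at this
    rw [this]; congr 1
  have hϑ := abs_le.1 (p.S.ϑB p.t p.ht q hq)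
  have hK := P.hK; have he := p.S.he; have he1 := pe1 p
  have hτp : 0 < ev (fτ p.S) (p.t, q) := by
    by_contra hh; push Not at hh; nlinarith
  have hτ2 : ev (fτ p.S) (p.t, q) ≤ 1 + P.K := by rw [hτ]; nlinarith
  constructor
  · rw [inv_le_iff_one_le_mul₀ (by positivity)]; nlinarith
  · nlinarith

lemma E0q_I (p : Pt P) : I E0q p = 1/2 * (I (fτ * (fΦ * fΦ)) p + I (fs * fs * (fΨ1 * fΨ1)) p + I (fs * fs * (fΨ2 * fΨ2)) p
    + P.g * I (fs * fs * fs * (fΘ * fΘ)) p) := by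
  rw [E0q, I_half, I_add, I_add, I_add, I_cg]

lemma E0bal : ∃ C, 0 ≤ C ∧ ∀ p : Pt P, I (D 0 E0q) p + 1/2 * (Gr fΨ1 p + Gr fΨ2 p + Gr fΘ p) ≤ C * dD p := by
  have hA := ((((Ab_E0m (P := P)).add Ab_E0p).add ((Ab_tr0 Bm_one p1).add (Ab_tr0 Bm_one p2))).add Ab_E0h).add Ab_E0c
  obtain ⟨C, hC, h⟩ := dD_le hA
  refine ⟨C, hC, fun p => ?_⟩
  have key := congrArg (fun f => I f p) (E0id (P := P))
  have z : ∀ {f g : Fld P} (hfg : EQ f g) (h : Fld P), I ((f - g) * h) p = 0 := fun {f g} hfg h => by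
    rw [← I_zero p, ← zero_mul h]
    apply I_congr
    refine EQ.mul ?_ (EQ.refl h)
    intro S t ht q hq
    have := hfg S t ht q hq
    simp [this]
  have hbd : BD (fs * fΨ2 * (fτ * fΦ) + fs * fs * fΨ2 * fΘ - cμ * (fs * (fΨ1 * D 2 fΨ1 + fΨ2 * D 2 fΨ2)) - cl * (fs * fΨ2 * dv fΨ1 fΨ2)
        - cκ * (fs * fs * (fΘ * D 2 fΘ)) : Fld P) :=
    (((((bdΨ2.mul_left _).mul_right _).add ((bdΨ2.mul_left _).mul_right _)).sub
      ((((bdΨ1.mul_right _).add (bdΨ2.mul_right _)).mul_left _).mul_left _)).sub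
      (((bdΨ2.mul_left _).mul_right _).mul_left _)).sub (((bdΘ.mul_right _).mul_left _).mul_left _)
  have hp := neg_le_of_abs_le (h p)
  simp only [I_add, z F0_eq, z F1_eq, z F2_eq, z F3_eq, I_D1, I_D2 hbd, I_cμ, I_cl, I_cκ, one_mul] at key hp
  have e1 : I E0l p = I ((ee * fΨ1) * (ee * fΨ2)) p + (1 + P.g) * I (ftp * ((ee * fΨ2) * (ee * fΘ))) p := by
    rw [E0l, add_mul, one_mul, I_add, I_add, I_cg]; ring
  have e2 := neg_le_of_abs_le (young_abs (ee * fΨ1) (ee * fΨ2) p (η := 1/2) (by norm_num))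
  have e3 := tp_bd (ee * fΨ2) (ee * fΘ) p
  have b1 := (bdΨ1 (P := P)).zero0 p; have b2 := (bdΨ2 (P := P)).zero0 p; have b3 := (bdΘ (P := P)).zero0 p
  have g1 : Gr fΨ1 p = N 0 (D 1 fΨ1) p + N 0 (D 2 fΨ1) p := rfl
  have g2 : Gr fΨ2 p = N 0 (D 1 fΨ2) p + N 0 (D 2 fΨ2) p := rfl
  have g3 : Gr fΘ p = N 0 (D 1 fΘ) p + N 0 (D 2 fΘ) p := rfl
  simp only [← N_zero] at key
  have hμ := P.hμ; have hκ := P.hκ; have hg := P.hg; have hK := P.hK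
  have hgK : 0 ≤ (1 + P.g) * P.K := by positivity
  have n1 := N_nn 0 (D 1 fΨ1) p; have n2 := N_nn 0 (D 2 fΨ1) p; have n3 := N_nn 0 (D 1 fΨ2) p
  have n4 := N_nn 0 (D 2 fΨ2) p; have n5 := N_nn 0 (D 1 fΘ) p; have n6 := N_nn 0 (D 2 fΘ) p
  have n7 := mul_nonneg P.hlam.le (N_nn 0 (dv fΨ1 fΨ2) p)
  have m1 : (1 + (1 + P.g) * P.K) * (Gr fΨ1 p + Gr fΨ2 p) ≤ P.μ * (Gr fΨ1 p + Gr fΨ2 p) :=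
    mul_le_mul_of_nonneg_right hμ (add_nonneg (Gr_nn _ _) (Gr_nn _ _))
  have m2 : (1 + (1 + P.g) * P.K) * (Gr fΘ p) ≤ P.κ * (Gr fΘ p) :=
    mul_le_mul_of_nonneg_right hκ (Gr_nn _ _)
  have m3 := mul_le_mul_of_nonneg_left e3 (by linarith : 0 ≤ 1 + P.g)
  have m4 : (1 + P.g) * P.K * (N 0 (ee * fΨ2) p + N 0 (ee * fΘ) p) ≤ (1 + P.g) * P.K * (Gr fΨ2 p + Gr fΘ p) :=
    mul_le_mul_of_nonneg_left (by linarith) hgK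
  have m5 : 0 ≤ (1 + P.g) * P.K * (Gr fΨ2 p) := mul_nonneg hgK (Gr_nn _ _)
  have m6 : 0 ≤ (1 + P.g) * P.K * (Gr fΘ p) := mul_nonneg hgK (Gr_nn _ _)
  have m7 : 0 ≤ (1 + P.g) * P.K * (Gr fΨ1 p) := mul_nonneg hgK (Gr_nn _ _)
  simp only [g1, g2, g3] at m1 m2 m4 m5 m6 m7
  rw [g1, g2, g3]
  linarith

lemma E0 : (∀ a : Fld P, Par3 a → Cd (N 0 (D 1 a)) ∧ Cd (N 0 (D 2 a)) ∧ Cs (N 0 a)) ∧ Cs (N 0 (fΦ : Fld P)) := by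
  obtain ⟨C, hC, hb⟩ := E0bal (P := P)
  have hg := P.hg; have hK := P.hK
  obtain ⟨B0, hB0, k0⟩ := wt_up Bm_τ (Nle_down (by norm_num) eΦ : N 0 (fΦ : Fld P) ≼ ℰ)
  obtain ⟨B1, hB1, k1⟩ := wt_up Bm_ss (Nle_down (by norm_num) p1.e : N 0 (fΨ1 : Fld P) ≼ ℰ)
  obtain ⟨B2, hB2, k2⟩ := wt_up Bm_ss (Nle_down (by norm_num) p2.e : N 0 (fΨ2 : Fld P) ≼ ℰ)
  obtain ⟨B3, hB3, k3⟩ := wt_up (Bm_ss.mul Bm_s) (Nle_down (by norm_num) p3.e : N 0 (fΘ : Fld P) ≼ ℰ)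
  set m := (1 + P.K)⁻¹ with hm
  have m0 : 0 < m := by positivity
  set c := min (1/4) (min (m * m / 2) (P.g * (m * m * m) / 2))
  have c0 : 0 < c := by positivity
  have c1 : c ≤ 1/4 := min_le_left _ _
  have c2 : c ≤ m * m / 2 := (min_le_right _ _).trans (min_le_left _ _)
  have c3 : c ≤ P.g * (m * m * m) / 2 := (min_le_right _ _).trans (min_le_right _ _)
  have key := step (B := 0) (f0 := 0) (d := Gr fΨ1 + Gr fΨ2 + Gr fΘ)
    (f1 := fun p => c * (N 0 fΦ p + N 0 fΨ1 p + N 0 fΨ2 p + N 0 fΘ p)) (P := P)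
    E0q Cd_zero Cs_zero (c := 1/2) (C := C + B0 + B1 + B2 + P.g * B3) (by norm_num) (by positivity)
    (fun p => add_nonneg (add_nonneg (Gr_nn _ _) (Gr_nn _ _)) (Gr_nn _ _)) ?_ ?_ ?_ ?_
  · obtain ⟨d, s⟩ := key
    have s' : Cs (fun p : Pt P => N 0 fΦ p + N 0 fΨ1 p + N 0 fΨ2 p + N 0 fΘ p) :=
      IdS.mono (Le.ofC c⁻¹ (by positivity) fun p => by rw [← mul_assoc, inv_mul_cancel₀ c0.ne', one_mul]) s
    refine ⟨?_, IdS.le s' fun p => by linarith [N_nn 0 fΨ1 p, N_nn 0 fΨ2 p, N_nn 0 fΘ p]⟩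
    rintro a (rfl | rfl | rfl)
    all_goals refine ⟨IdD.le d fun p => ?_, IdD.le d fun p => ?_, IdS.le s' fun p => ?_⟩
    all_goals first
      | (simp only [Pi.add_apply, Gr]
         linarith [N_nn 0 (D 1 fΨ1) p, N_nn 0 (D 2 fΨ1) p, N_nn 0 (D 1 fΨ2) p, N_nn 0 (D 2 fΨ2) p, N_nn 0 (D 1 fΘ) p, N_nn 0 (D 2 fΘ) p])
      | linarith [N_nn 0 fΨ1 p, N_nn 0 fΨ2 p, N_nn 0 fΘ p, N_nn 0 fΦ p]
  · intro p
    have := hb p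
    have h1 := dD_nn p
    have : 0 ≤ (B0 + B1 + B2 + P.g * B3) * dD p := by positivity
    simp only [Pi.add_apply, Pi.zero_apply, zero_add]; linarith
  · intro p
    rw [E0q_I]
    have := ℰ_nn p
    have q0 := k0 p; have q1 := k1 p; have q2 := k2 p; have q3 := mul_le_mul_of_nonneg_left (k3 p) hg.le
    have a0 : 0 ≤ C * ℰ p := by positivity
    have a1 : 0 ≤ B0 * ℰ p := by positivity
    have a2 : 0 ≤ B1 * ℰ p := by positivity
    have a3 : 0 ≤ B2 * ℰ p := by positivity
    have a4 : 0 ≤ P.g * (B3 * ℰ p) := by positivity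
    linarith
  · intro p
    have := N_nn 0 fΦ p; have := N_nn 0 fΨ1 p; have := N_nn 0 fΨ2 p; have := N_nn 0 fΘ p
    positivity
  · intro p
    rw [E0q_I]
    have w0 := wt_low fτ fΦ p (1/2) fun q hq => (s_low p hq).2
    have w2 : ∀ q ∈ Ω, m * m ≤ ev ((fs * fs : Fld P) p.S) (p.t, q) := fun q hq => by
      have := (s_low p hq).1
      simp only [F_mul, ev_mul]; exact mul_le_mul this this m0.le (m0.le.trans this)
    have w3 : ∀ q ∈ Ω, m * m * m ≤ ev ((fs * fs * fs : Fld P) p.S) (p.t, q) := fun q hq => by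
      have := (s_low p hq).1
      have h2 := w2 q hq
      rw [F_mul, ev_mul]; exact mul_le_mul h2 this m0.le ((mul_nonneg m0.le m0.le).trans h2)
    have a1 := wt_low _ fΨ1 p _ w2
    have a2 := wt_low _ fΨ2 p _ w2
    have a3 := mul_le_mul_of_nonneg_left (wt_low _ fΘ p _ w3) hg.le
    have i0 := mul_le_mul_of_nonneg_right c1 (N_nn 0 fΦ p)
    have i1 := mul_le_mul_of_nonneg_right c2 (N_nn 0 fΨ1 p)
    have i2 := mul_le_mul_of_nonneg_right c2 (N_nn 0 fΨ2 p)
    have i3 := mul_le_mul_of_nonneg_right c3 (N_nn 0 fΘ p)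
    simp only [Pi.zero_apply, mul_zero]
    linarith

end Pf

set_option linter.unusedVariables false
set_option linter.unusedSimpArgs false
namespace Pf
variable {P : Par}

/-! the chain of estimates -/
lemma CdF {k : ℕ} {f : Fld P} (h : N k f ≼ d2f * 𝒟) : Cd (N k f) := IdD.mono h Cd_small
lemma F0D1 : N 1 (D 1 (F0 : Fld P)) ≼ d2f * 𝒟 := Nle_D1 F0_le
lemma F0D2 : N 1 (D 2 (F0 : Fld P)) ≼ d2f * 𝒟 := Nle_D2 F0_le

structure Wd (P : Par) : Prop where
  w1 : ∀ a : Fld P, Par3 a → Cd (N 0 (D 1 a))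
  w2 : ∀ a : Fld P, Par3 a → Cd (N 0 (D 2 a))
  w0 : ∀ a : Fld P, Par3 a → Cd (N 0 (D 0 a))
  w11 : ∀ a : Fld P, Par3 a → Cd (N 0 (D 1 (D 1 a)))
  w12 : ∀ a : Fld P, Par3 a → Cd (N 0 (D 1 (D 2 a)))
  s : ∀ a : Fld P, Par3 a → Cs (N 0 a) ∧ Cs (N 0 (D 1 a)) ∧ Cs (N 0 (D 2 a))
  φs : Cs (N 0 (fΦ : Fld P)) ∧ Cs (N 0 (D 1 (fΦ : Fld P))) ∧ Cs (N 0 (D 2 (fΦ : Fld P)))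
  φ1 : Cd (N 0 (D 1 (fΦ : Fld P)))
  φ2 : Cd (N 0 (D 2 (fΦ : Fld P)))
  w22 : ∀ a : Fld P, Par3 a → Cd (N 0 (D 2 (D 2 a)))

lemma wd : Wd P := by
  obtain ⟨e0, e0Φ⟩ := E0 (P := P)
  have s1 := E1L (P := P) (L := fun f => f) .id (Nle_down (by norm_num) F0_le) (fun F h => Nle_down (by norm_num) h.le)
    (fun a h => ⟨Nle_down (by norm_num) h.m1, Nle_down (by norm_num) h.m2, Nle_down (by norm_num) h.m0⟩)
    (Nle_down (by norm_num) eΦ) (fun a h => Nle_down (by norm_num) h.e) e0 e0Φ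
  have s2 := EZL (P := P) (L := fun f => D 1 f) (.D1 .id) (Ab.of (Nle_down (by norm_num) F0D1) (Nle_down (by norm_num) mΦ1))
    (fun F a h => Ab.of (Nle_D1 (Nle_down (by norm_num) h.F.le)) (Nle_down (by norm_num) h.a.m1))
    (Nle_D1 (Nle_down (by norm_num) eΦ)) (fun a h => Nle_D1 (Nle_down (by norm_num) h.e))
  have w12 : ∀ a : Fld P, Par3 a → Cd (N 0 (D 1 (D 2 a))) := fun a h => by
    have := (s2.1 a h).2.1; simpa only [D21] using this
  have s3 := L3L (P := P) (L := fun f => f) .id (Ab.of (Nle_down (by norm_num) F0D2) (Nle_down (by norm_num) mΦ2))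
    (Ab.of (Nle_down (by norm_num) F2_le) (Nle_down (by norm_num) mΦ2))
    (fun a h => ⟨(s1 a h).1, (e0 a h).2.1, w12 a h, (s2.1 a h).1⟩) (Nle_D2 (Nle_down (by norm_num) eΦ))
  have s4 := NecL (P := P) IdD (L := fun f => f) .id (CdF (Nle_down (by norm_num) F1_le))
    (fun a h => ⟨(s1 a h).1, (e0 a h).1, (e0 a h).2.1, w12 a h, (s2.1 a h).1⟩) s3.1
  have s5 := RegL (P := P) IdD (L := fun f => f) (k := 0) .id (fun F h => CdF (Nle_down (by norm_num) h.le))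
    (fun a h => (s1 a h).1) (fun a h => (e0 a h).1) (fun a h => (e0 a h).2.1) w12 (fun a h => (s2.1 a h).1) s4 s3.1
  exact ⟨fun a h => (e0 a h).1, fun a h => (e0 a h).2.1, fun a h => (s1 a h).1, fun a h => (s2.1 a h).1, w12,
    fun a h => ⟨(e0 a h).2.2, (s1 a h).2⟩, ⟨e0Φ, s2.2, s3.2⟩, s4, s3.1, s5⟩

structure Wd2 (P : Par) : Prop extends Wd P where
  w01 : ∀ a : Fld P, Par3 a → Cd (N 0 (D 0 (D 1 a)))
  w02 : ∀ a : Fld P, Par3 a → Cd (N 0 (D 0 (D 2 a)))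
  w00 : ∀ a : Fld P, Par3 a → Cd (N 0 (D 0 (D 0 a)))
  s0 : ∀ a : Fld P, Par3 a → Cs (N 0 (D 0 a)) ∧ Cs (N 0 (D 0 (D 1 a))) ∧ Cs (N 0 (D 0 (D 2 a)))
  φs0 : Cs (N 0 (D 0 (fΦ : Fld P)))
  w111 : ∀ a : Fld P, Par3 a → Cd (N 0 (D 1 (D 1 (D 1 a))))
  w112 : ∀ a : Fld P, Par3 a → Cd (N 0 (D 1 (D 1 (D 2 a))))
  w122 : ∀ a : Fld P, Par3 a → Cd (N 0 (D 1 (D 2 (D 2 a))))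
  φ11 : Cd (N 0 (D 1 (D 1 (fΦ : Fld P))))
  φ12 : Cd (N 0 (D 1 (D 2 (fΦ : Fld P))))
  φ22 : Cd (N 0 (D 2 (D 2 (fΦ : Fld P))))
  φs11 : Cs (N 0 (D 1 (D 1 (fΦ : Fld P))))
  φs12 : Cs (N 0 (D 1 (D 2 (fΦ : Fld P))))
  φs22 : Cs (N 0 (D 2 (D 2 (fΦ : Fld P))))
  w222 : ∀ a : Fld P, Par3 a → Cd (N 1 (D 2 (D 2 a)))
  z0 : ∀ a : Fld P, Par3 a → Cd (N 2 (D 0 a))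
  z1 : ∀ a : Fld P, Par3 a → Cd (N 2 (D 1 a))
  z2 : ∀ a : Fld P, Par3 a → Cd (N 2 (D 2 a))
  zφ : Cd (N 2 (D 0 (fΦ : Fld P)))

lemma wd2 : Wd2 P := by
  have w := wd (P := P)
  have s6 := EZL (P := P) (L := fun f => D 0 f) (.D0 .id) (Ab.of D0F0_le (Nle_down (by norm_num) mΦ0))
    (fun F a h => Ab.of h.F.le0 (Nle_down (by norm_num) h.a.m0)) eΦ0 (fun a h => Nle_down (by norm_num) h.e0)
  have s7 := E1L (P := P) (L := fun f => D 0 f) (.D0 .id) D0F0_le (fun F h => h.le0)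
    (fun a h => ⟨Nle_D1 (Nle_down (by norm_num) h.m0), Nle_D2 (Nle_down (by norm_num) h.m0), h.m00⟩)
    eΦ0 (fun a h => h.e0) s6.1 s6.2
  have w01 : ∀ a : Fld P, Par3 a → Cd (N 0 (D 0 (D 1 a))) := fun a h => by simpa only [D10] using (s6.1 a h).1
  have w02 : ∀ a : Fld P, Par3 a → Cd (N 0 (D 0 (D 2 a))) := fun a h => by simpa only [D20] using (s6.1 a h).2.1
  have s8 := EZL (P := P) (L := fun f => D 1 (D 1 f)) (.D1 (.D1 .id))
    (Ab.of (Nle_D1 F0D1) (Nle_D1 (Nle_down (by norm_num) mΦ1)))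
    (fun F a h => Ab.of (Nle_D1 (Nle_D1 h.F.le)) (Nle_D1 (Nle_down (by norm_num) h.a.m1)))
    (Nle_D1 (Nle_D1 (Nle_down (by norm_num) eΦ))) (fun a h => Nle_D1 (Nle_D1 (Nle_down (by norm_num) h.e)))
  have w112 : ∀ a : Fld P, Par3 a → Cd (N 0 (D 1 (D 1 (D 2 a)))) := fun a h => by
    simpa only [D21] using (s8.1 a h).2.1
  have w121 : ∀ a : Fld P, Par3 a → Cd (N 0 (D 1 (D 2 (D 1 a)))) := fun a h => by
    simpa only [D21] using (s8.1 a h).2.1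
  have w21 : ∀ a : Fld P, Par3 a → Cd (N 0 (D 2 (D 1 a))) := fun a h => by simpa only [D21] using w.w12 a h
  have s9 := L3L (P := P) (L := fun f => D 1 f) (.D 1 .id)
    (Ab.of (Nle_D2 F0D1) (Nle_D2 (Nle_down (by norm_num) mΦ1)))
    (Ab.of (Nle_D1 (Nle_down (by norm_num) F2_le)) (Nle_D2 (Nle_down (by norm_num) mΦ1)))
    (fun a h => ⟨w01 a h, w21 a h, w121 a h, (s8.1 a h).1⟩) (Nle_D2 (Nle_D1 (Nle_down (by norm_num) eΦ)))
  have s10 := NecL (P := P) IdD (L := fun f => D 1 f) (.D 1 .id) (CdF (Nle_D1 (Nle_down (by norm_num) F1_le)))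
    (fun a h => ⟨w01 a h, w.w11 a h, w21 a h, w121 a h, (s8.1 a h).1⟩) s9.1
  have s11 := RegL (P := P) IdD (L := fun f => D 1 f) (k := 0) (.D 1 .id)
    (fun F h => CdF (Nle_D1 (Nle_down (by norm_num) h.le))) w01 w.w11 w21 w121 (fun a h => (s8.1 a h).1) s10 s9.1
  have w122 : ∀ a : Fld P, Par3 a → Cd (N 0 (D 1 (D 2 (D 2 a)))) := fun a h => by
    simpa only [D21] using s11 a h
  have s12 := L3L (P := P) (L := fun f => D 2 f) (.D 2 .id)
    (Ab.of (Nle_D2 F0D2) (Nle_D2 (Nle_down (by norm_num) mΦ2)))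
    (Ab.of (Nle_D2 (Nle_down (by norm_num) F2_le)) (Nle_D2 (Nle_down (by norm_num) mΦ2)))
    (fun a h => ⟨w02 a h, w.w22 a h, w122 a h, w112 a h⟩) (Nle_D2 (Nle_D2 (Nle_down (by norm_num) eΦ)))
  have φ12 : Cd (N 0 (D 1 (D 2 (fΦ : Fld P)))) := by simpa only [D21] using s9.1
  have φ21 := s9.1
  have c12 : ∀ a : Fld P, Par3 a → Cd (N 1 (D 1 (D 2 a))) := fun a h =>
    IdD.succ (w.w12 a h) (w112 a h) (by simpa only [D21] using w122 a h)
  have c11 : ∀ a : Fld P, Par3 a → Cd (N 1 (D 1 (D 1 a))) := fun a h =>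
    IdD.succ (w.w11 a h) (s8.1 a h).1 (s8.1 a h).2.1
  have c1 : ∀ a : Fld P, Par3 a → Cd (N 1 (D 1 a)) := fun a h => IdD.succ (w.w1 a h) (w.w11 a h) (w21 a h)
  have c2 : ∀ a : Fld P, Par3 a → Cd (N 1 (D 2 a)) := fun a h => IdD.succ (w.w2 a h) (w.w12 a h) (w.w22 a h)
  have s13 := RegL (P := P) IdD (L := fun f => f) (k := 1) .id (fun F h => CdF (Nle_down (by norm_num) h.le))
    (fun a h => IdD.succ (w.w0 a h) (s6.1 a h).1 (s6.1 a h).2.1) c1 c2 c12 c11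
    (IdD.succ w.φ1 s10 φ21) (IdD.succ w.φ2 φ12 s12.1)
  have z1 : ∀ a : Fld P, Par3 a → Cd (N 2 (D 1 a)) := fun a h =>
    IdD.succ (c1 a h) (c11 a h) (by have := c12 a h; simpa only [D21] using this)
  have z2 : ∀ a : Fld P, Par3 a → Cd (N 2 (D 2 a)) := fun a h => IdD.succ (c2 a h) (c12 a h) (s13 a h)
  have zφ : Cd (N 2 (D 0 (fΦ : Fld P))) := by
    have e : D 0 (fΦ : Fld P) = F0 - (D 1 fΨ1 + D 2 fΨ2) := by simp only [F0, R0, dv]; ring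
    rw [e]; exact IdD.nsub (CdF F0_le) (IdD.nadd (z1 _ p1) (z2 _ p2))
  have s15 := EllL (P := P) IdD (L := fun f => D 0 f) (.D0 .id) (fun F h => CdF h.le0) (fun a h => (s7 a h).1)
    (fun a h => (s6.1 a h).1) (fun a h => (s6.1 a h).2.1) (IdD.D1 (IdD.down (by norm_num) zφ)) (IdD.D2 (IdD.down (by norm_num) zφ))
  have z0 : ∀ a : Fld P, Par3 a → Cd (N 2 (D 0 a)) := fun a h => by
    have h1 := (s6.1 a h).1
    have h2 := (s6.1 a h).2.1
    obtain ⟨k1, k2, k3⟩ := s15 a h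
    exact IdD.succ (IdD.succ (w.w0 a h) h1 h2) (IdD.succ h1 k1 (by simpa only [D21] using k2)) (IdD.succ h2 k2 k3)
  exact { w with
    w01, w02, w00 := fun a h => (s7 a h).1
    s0 := fun a h => ⟨(s6.1 a h).2.2, by simpa only [D10] using (s7 a h).2.1, by simpa only [D20] using (s7 a h).2.2⟩
    φs0 := s6.2, w111 := fun a h => (s8.1 a h).1, w112, w122, φ11 := s10, φ12, φ22 := s12.1, φs11 := s8.2
    φs12 := by simpa only [D21] using s9.2
    φs22 := s12.2, w222 := s13, z0, z1, z2, zφ }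

structure Wd3 (P : Par) : Prop extends Wd2 P where
  y1 : ∀ a : Fld P, Par3 a → Cd (N 3 (D 1 a))
  y2 : ∀ a : Fld P, Par3 a → Cd (N 3 (D 2 a))
  yφ1 : Cd (N 2 (D 1 (fΦ : Fld P)))
  yφ2 : Cd (N 2 (D 2 (fΦ : Fld P)))
  xφ : Cs (N 3 (fΦ : Fld P))

lemma top_par {F a : Fld P} (h : Rp F a) : Ab (D 1 (D 1 (D 1 F)) * D 1 (D 1 (D 1 a))) := by
  have h1 : Ab (-(D 1 (D 1 F) * D 1 (D 1 (D 1 (D 1 a))))) :=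
    (Ab.of (Nle_D1 (Nle_D1 h.F.le)) (Nle_D1 (Nle_D1 (Nle_D1 h.a.m1)))).neg
  refine h1.of_eq fun p => ?_
  have := I_D1 (D 1 (D 1 F) * D 1 (D 1 (D 1 a))) p
  rw [D_mul, I_add] at this
  rw [I_neg]; linarith

lemma wd3 : Wd3 P := by
  have w := wd2 (P := P)
  have t1 : tang 1 := Or.inl rfl
  have t2 : tang 2 := Or.inr rfl
  have s16 := EZL (P := P) (L := fun f => D 1 (D 1 (D 1 f))) (.D1 (.D1 (.D1 .id))) (F0_top t1 t1 t1)
    (fun F a h => top_par h) (Nle_D1 (Nle_D1 (Nle_D1 eΦ))) (fun a h => Nle_D1 (Nle_D1 (Nle_D1 h.e)))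
  have w1112 : ∀ a : Fld P, Par3 a → Cd (N 0 (D 1 (D 1 (D 1 (D 2 a))))) := fun a h => by
    simpa only [D21] using (s16.1 a h).2.1
  have w1121 : ∀ a : Fld P, Par3 a → Cd (N 0 (D 1 (D 2 (D 1 (D 1 a))))) := fun a h => by
    simpa only [D21] using w1112 a h
  have w011 : ∀ a : Fld P, Par3 a → Cd (N 0 (D 0 (D 1 (D 1 a)))) := fun a h => by
    have := IdD.D1 (IdD.D1 (w.z0 a h)); simpa only [D10] using this
  have w012 : ∀ a : Fld P, Par3 a → Cd (N 0 (D 0 (D 1 (D 2 a)))) := fun a h => by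
    have := IdD.D1 (IdD.D2 (w.z0 a h)); simpa only [D10, D20] using this
  have w022 : ∀ a : Fld P, Par3 a → Cd (N 0 (D 0 (D 2 (D 2 a)))) := fun a h => by
    have := IdD.D2 (IdD.D2 (w.z0 a h)); simpa only [D20] using this
  have w211 : ∀ a : Fld P, Par3 a → Cd (N 0 (D 2 (D 1 (D 1 a)))) := fun a h => by
    simpa only [D21] using w.w112 a h
  have s17 := L3L (P := P) (L := fun f => D 1 (D 1 f)) (.D 1 (.D 1 .id)) (F0_top t2 t1 t1)
    (Ab.of (Nle_D1 (Nle_D1 F2_le)) (Nle_D2 (Nle_D1 mΦ1)))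
    (fun a h => ⟨w011 a h, w211 a h, w1121 a h, (s16.1 a h).1⟩) (Nle_D2 (Nle_D1 (Nle_D1 eΦ)))
  have s18 := NecL (P := P) IdD (L := fun f => D 1 (D 1 f)) (.D 1 (.D 1 .id)) (CdF (Nle_D1 (Nle_D1 F1_le)))
    (fun a h => ⟨w011 a h, w.w111 a h, w211 a h, w1121 a h, (s16.1 a h).1⟩) s17.1
  have s19 := RegL (P := P) IdD (L := fun f => D 1 (D 1 f)) (k := 0) (.D 1 (.D 1 .id))
    (fun F h => CdF (Nle_D1 (Nle_D1 h.le))) w011 w.w111 w211 w1121 (fun a h => (s16.1 a h).1) s18 s17.1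
  have s20 := L3L (P := P) (L := fun f => D 1 (D 2 f)) (.D 1 (.D 2 .id)) (F0_top t2 t1 t2)
    (Ab.of (Nle_D1 (Nle_D2 F2_le)) (Nle_D2 (Nle_D1 mΦ2)))
    (fun a h => ⟨w012 a h, by simpa only [D21] using w.w122 a h, by simpa only [D21] using s19 a h, w1112 a h⟩)
    (Nle_D2 (Nle_D1 (Nle_D2 eΦ)))
  have c1 : ∀ a : Fld P, Par3 a → Cd (N 1 (D 1 (D 1 a))) := fun a h => IdD.D1 (w.z1 a h)
  have c2 : ∀ a : Fld P, Par3 a → Cd (N 1 (D 2 (D 1 a))) := fun a h => IdD.D2 (w.z1 a h)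
  have c12 : ∀ a : Fld P, Par3 a → Cd (N 1 (D 1 (D 2 (D 1 a)))) := fun a h =>
    IdD.succ (by simpa only [D21] using w.w112 a h) (by simpa only [D21] using w1112 a h) (by simpa only [D21] using s19 a h)
  have c11 : ∀ a : Fld P, Par3 a → Cd (N 1 (D 1 (D 1 (D 1 a)))) := fun a h =>
    IdD.succ (w.w111 a h) (s16.1 a h).1 (s16.1 a h).2.1
  have φ112 : Cd (N 0 (D 1 (D 1 (D 2 (fΦ : Fld P))))) := by simpa only [D21] using s17.1
  have φ122 : Cd (N 0 (D 1 (D 2 (D 2 (fΦ : Fld P))))) := by simpa only [D21] using s20.1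
  have f11 : Cd (N 1 (D 1 (D 1 (fΦ : Fld P)))) := IdD.succ w.φ11 s18 s17.1
  have f12 : Cd (N 1 (D 1 (D 2 (fΦ : Fld P)))) := IdD.succ w.φ12 φ112 s20.1
  have f21 : Cd (N 1 (D 2 (D 1 (fΦ : Fld P)))) := by simpa only [D21] using f12
  have s21 := RegL (P := P) IdD (L := fun f => D 1 f) (k := 1) (.D 1 .id) (fun F h => CdF (Nle_D1 h.le))
    (fun a h => by have := IdD.D1 (w.z0 a h); simpa only [D10] using this) c1 c2 c12 c11 f11 f21
  have s22 := L3L (P := P) (L := fun f => D 2 (D 2 f)) (.D 2 (.D 2 .id)) (F0_top t2 t2 t2)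
    (Ab.of (Nle_D2 (Nle_D2 F2_le)) (Nle_D2 (Nle_D2 mΦ2)))
    (fun a h => ⟨w022 a h, IdD.D2 (w.w222 a h), by simpa only [D21] using IdD.D2 (s21 a h), by simpa only [D21] using s19 a h⟩)
    (Nle_D2 (Nle_D2 (Nle_D2 eΦ)))
  have f22 : Cd (N 1 (D 2 (D 2 (fΦ : Fld P)))) := IdD.succ w.φ22 φ122 s22.1
  have yφ1 : Cd (N 2 (D 1 (fΦ : Fld P))) := IdD.succ (IdD.succ w.φ1 w.φ11 (by simpa only [D21] using w.φ12)) f11 f21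
  have yφ2 : Cd (N 2 (D 2 (fΦ : Fld P))) := IdD.succ (IdD.succ w.φ2 w.φ12 w.φ22) f12 f22
  have k12 : ∀ a : Fld P, Par3 a → Cd (N 2 (D 1 (D 2 a))) := fun a h =>
    IdD.succ (IdD.D1 (w.z2 a h)) (by have := c12 a h; simpa only [D21] using this) (by have := s21 a h; simpa only [D21] using this)
  have k11 : ∀ a : Fld P, Par3 a → Cd (N 2 (D 1 (D 1 a))) := fun a h =>
    IdD.succ (c1 a h) (c11 a h) (by have := c12 a h; simpa only [D21] using this)
  have s23 := RegL (P := P) IdD (L := fun f => f) (k := 2) .id (fun F h => CdF h.le) w.z0 w.z1 w.z2 k12 k11 yφ1 yφ2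
  have x112 : Cs (N 0 (D 1 (D 1 (D 2 (fΦ : Fld P))))) := by simpa only [D21] using s17.2
  have x122 : Cs (N 0 (D 1 (D 2 (D 2 (fΦ : Fld P))))) := by simpa only [D21] using s20.2
  have x1 : Cs (N 1 (fΦ : Fld P)) := IdS.succ w.φs.1 w.φs.2.1 w.φs.2.2
  have x11 : Cs (N 1 (D 1 (fΦ : Fld P))) := IdS.succ w.φs.2.1 w.φs11 (by simpa only [D21] using w.φs12)
  have x12 : Cs (N 1 (D 2 (fΦ : Fld P))) := IdS.succ w.φs.2.2 w.φs12 w.φs22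
  have x21 : Cs (N 1 (D 1 (D 1 (fΦ : Fld P)))) := IdS.succ w.φs11 s16.2 s17.2
  have x22 : Cs (N 1 (D 1 (D 2 (fΦ : Fld P)))) := IdS.succ w.φs12 x112 s20.2
  have x23 : Cs (N 1 (D 2 (D 2 (fΦ : Fld P)))) := IdS.succ w.φs22 x122 s22.2
  exact { w with
    y1 := fun a h => IdD.succ (w.z1 a h) (k11 a h) (by have := k12 a h; simpa only [D21] using this)
    y2 := fun a h => IdD.succ (w.z2 a h) (k12 a h) (s23 a h)
    yφ1, yφ2
    xφ := IdS.succ (IdS.succ x1 x11 x12) (IdS.succ x11 x21 (by simpa only [D21] using x22)) (IdS.succ x12 x22 x23) }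

lemma Cd𝒟 : Cd (𝒟 : Fn P) := by
  have w := wd3 (P := P)
  have e : ∀ a : Fld P, Par3 a → Cd (N 0 (ee * a)) := fun a h => IdD.le (w.w2 a h) h.bd.zero0
  have eφ : Cd (N 0 (ee * fΦ : Fld P)) := IdD.mono (Le.ofC 40 (by norm_num) poinΦ) (IdD.add w.φ1 w.φ2)
  have lst : ∀ l : List (Fn P), (∀ f ∈ l, Cd f) → Cd l.sum := by
    intro l
    induction l with
    | nil => intro _; exact Cd_zero
    | cons f l ih => intro h; rw [List.sum_cons]; exact IdD.add (h f (by simp)) (ih fun g hg => h g (by simp [hg]))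
  refine lst _ fun f hf => ?_
  simp only [Dl, List.mem_cons, List.not_mem_nil, or_false] at hf
  rcases hf with rfl | rfl | rfl | rfl | rfl | rfl | rfl | rfl | rfl | rfl | rfl | rfl | rfl | rfl | rfl | rfl | rfl | rfl | rfl
  exacts [w.yφ1, w.yφ2, w.zφ, eφ, w.y1 _ p1, w.y2 _ p1, w.z0 _ p1, w.w00 _ p1, e _ p1,
    w.y1 _ p2, w.y2 _ p2, w.z0 _ p2, w.w00 _ p2, e _ p2, w.y1 _ p3, w.y2 _ p3, w.z0 _ p3, w.w00 _ p3, e _ p3]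

lemma d2_le (B : Fn P) (hB : ∀ p, 0 ≤ B p) : d2f * B ≼ B := Le.of fun p => by
  have h1 := p.S.hδ; have h2 := pd0 p
  have : p.S.δ ^ 2 ≤ 1 := pow_le_one₀ h2 h1
  show p.S.δ ^ 2 * B p ≤ B p
  nlinarith [hB p]

/-- sums used for the static elliptic estimates -/
def Sl (k : ℕ) : List (Fn P) := [N k (D 1 fΦ), N k (D 2 fΦ), N k (ee * fΦ),
  N k (D 1 fΨ1), N k (D 2 fΨ1), N k (D 0 fΨ1), N k (ee * fΨ1),
  N k (D 1 fΨ2), N k (D 2 fΨ2), N k (D 0 fΨ2), N k (ee * fΨ2),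
  N k (D 1 fΘ), N k (D 2 fΘ), N k (D 0 fΘ), N k (ee * fΘ)]

lemma Sl_nn (k) : ∀ f ∈ (Sl k : List (Fn P)), ∀ p, 0 ≤ f p := by
  intro f hf p
  simp only [Sl, List.mem_cons, List.not_mem_nil, or_false] at hf
  rcases hf with rfl | rfl | rfl | rfl | rfl | rfl | rfl | rfl | rfl | rfl | rfl | rfl | rfl | rfl | rfl <;> exact N_nn _ _ _

lemma Bs_S (k) : Bs k ((Sl k).sum : Fn P) := by
  have m : ∀ {f : Fn P}, f ∈ (Sl k : List (Fn P)) → f ≼ (Sl k).sum := fun hf => Le.of fun p => list_mem _ (Sl_nn k) hf p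
  constructor <;> exact m (by simp [Sl])

lemma CsF {k} (hk : k ≤ 2) (hf1 : Cs (N k (D 1 fΦ : Fld P))) (hf2 : Cs (N k (D 2 fΦ : Fld P))) (hf : Cs (N k (fΦ : Fld P)))
    (h : ∀ a : Fld P, Par3 a → Cs (N k (D 1 a)) ∧ Cs (N k (D 2 a)) ∧ Cs (N k (D 0 a)) ∧ Cs (N k a)) (F) (i : IsF F) :
    Cs (N k (F : Fld P)) := by
  have lst : ∀ l : List (Fn P), (∀ f ∈ l, Cs f) → Cs l.sum := by
    intro l
    induction l with
    | nil => intro _; exact Cs_zero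
    | cons f l ih => intro h; rw [List.sum_cons]; exact IdS.add (h f (by simp)) (ih fun g hg => h g (by simp [hg]))
  have e : ∀ a : Fld P, Cs (N k a) → Cs (N k (ee * a)) := fun a h => IdS.nmul Bm_e hk h
  have hS : Cs ((Sl k).sum : Fn P) := by
    refine lst _ fun f hf => ?_
    simp only [Sl, List.mem_cons, List.not_mem_nil, or_false] at hf
    rcases hf with rfl | rfl | rfl | rfl | rfl | rfl | rfl | rfl | rfl | rfl | rfl | rfl | rfl | rfl | rfl
    exacts [hf1, hf2, e _ ‹_›, (h _ p1).1, (h _ p1).2.1, (h _ p1).2.2.1, e _ (h _ p1).2.2.2, (h _ p2).1, (h _ p2).2.1,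
      (h _ p2).2.2.1, e _ (h _ p2).2.2.2, (h _ p3).1, (h _ p3).2.1, (h _ p3).2.2.1, e _ (h _ p3).2.2.2]
  have hd := d2_le _ (list_nn _ (Sl_nn (P := P) k))
  rcases i with rfl | rfl | rfl
  exacts [IdS.mono ((G1_le hk (Bs_S k)).trans hd) hS, IdS.mono ((G2_le hk (Bs_S k)).trans hd) hS,
    IdS.mono ((G3_le hk (Bs_S k)).trans hd) hS]

lemma Csℰ : Cs (ℰ : Fn P) := by
  have w := wd3 (P := P)
  have d : ∀ {k l : ℕ} {f : Fld P}, k ≤ l → Cs (N l f) → Cs (N k f) := fun h => IdS.down h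
  have f1 : Cs (N 1 (D 1 fΦ : Fld P)) := d (by norm_num) (IdS.D1 w.xφ)
  have f2 : Cs (N 1 (D 2 fΦ : Fld P)) := d (by norm_num) (IdS.D2 w.xφ)
  have F0 := CsF (P := P) (k := 0) (by norm_num) (d (by norm_num) f1) (d (by norm_num) f2) w.φs.1
    fun a h => ⟨(w.s a h).2.1, (w.s a h).2.2, (w.s0 a h).1, (w.s a h).1⟩
  have e1 := EllL (P := P) IdS (L := fun f => f) .id F0 (fun a h => (w.s0 a h).1) (fun a h => (w.s a h).2.1)
    (fun a h => (w.s a h).2.2) (d (by norm_num) f1) (d (by norm_num) f2)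
  have h21 : ∀ a : Fld P, Par3 a → Cs (N 0 (D 2 (D 1 a))) := fun a h => by simpa only [D21] using (e1 a h).2.1
  have h1 : ∀ a : Fld P, Par3 a → Cs (N 1 (D 1 a)) := fun a h => IdS.succ (w.s a h).2.1 (e1 a h).1 (h21 a h)
  have h2 : ∀ a : Fld P, Par3 a → Cs (N 1 (D 2 a)) := fun a h => IdS.succ (w.s a h).2.2 (e1 a h).2.1 (e1 a h).2.2
  have h0 : ∀ a : Fld P, Par3 a → Cs (N 1 (D 0 a)) := fun a h =>
    IdS.succ (w.s0 a h).1 (by simpa only [D10] using (w.s0 a h).2.1) (by simpa only [D20] using (w.s0 a h).2.2)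
  have ha : ∀ a : Fld P, Par3 a → Cs (N 1 a) := fun a h => IdS.succ (w.s a h).1 (w.s a h).2.1 (w.s a h).2.2
  have F1 := CsF (P := P) (k := 1) (by norm_num) f1 f2 (d (by norm_num) w.xφ)
    fun a h => ⟨h1 a h, h2 a h, h0 a h, ha a h⟩
  have e2 := EllL (P := P) IdS (L := fun f => D 1 f) (.D1 .id) (fun F h => IdS.D1 (F1 F h)) (fun a h => (w.s0 a h).2.1)
    (fun a h => (e1 a h).1) h21 (IdS.D1 f1) (IdS.D2 f1)
  have k11 : ∀ a : Fld P, Par3 a → Cs (N 1 (D 1 (D 1 a))) := fun a h =>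
    IdS.succ (e1 a h).1 (e2 a h).1 (by simpa only [D21] using (e2 a h).2.1)
  have k12 : ∀ a : Fld P, Par3 a → Cs (N 1 (D 1 (D 2 a))) := fun a h =>
    IdS.succ (e1 a h).2.1 (by simpa only [D21] using (e2 a h).2.1) (by simpa only [D21] using (e2 a h).2.2)
  have e3 := RegL (P := P) IdS (L := fun f => f) (k := 1) .id F1 h0 h1 h2 k12 k11 f1 f2
  have h3 : ∀ a : Fld P, Par3 a → Cs (N 3 a) := fun a h =>
    IdS.succ (IdS.succ (ha a h) (h1 a h) (h2 a h)) (IdS.succ (h1 a h) (k11 a h) (by simpa only [D21] using k12 a h))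
      (IdS.succ (h2 a h) (k12 a h) (e3 a h))
  have lst : ∀ l : List (Fn P), (∀ f ∈ l, Cs f) → Cs l.sum := by
    intro l
    induction l with
    | nil => intro _; exact Cs_zero
    | cons f l ih => intro h; rw [List.sum_cons]; exact IdS.add (h f (by simp)) (ih fun g hg => h g (by simp [hg]))
  refine lst _ fun f hf => ?_
  simp only [El, List.mem_cons, List.not_mem_nil, or_false] at hf
  rcases hf with rfl | rfl | rfl | rfl | rfl | rfl | rfl | rfl
  exacts [w.xφ, w.φs0, h3 _ p1, h3 _ p2, h3 _ p3, h0 _ p1, h0 _ p2, h0 _ p3]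
end Pf

set_option linter.unusedVariables false
set_option linter.unusedSimpArgs false
namespace Pf
variable {P : Par}

lemma In_dt (e : ℝ) (he : 0 < e) (f : Alg) (t : ℝ) :
    HasDerivAt (fun t => In e t f) ((e ^ 2)⁻¹ * In e t (Dm e 0 f)) t := by
  have := (J_dt f t).const_mul ((e ^ 2)⁻¹)
  have e1 : (e ^ 2)⁻¹ * In e t (Dm e 0 f) = (e ^ 2)⁻¹ * J t (dd (1, 0, 0) f) := by
    rw [Dm0]; unfold In; rw [J_smul]; field_simp
  rw [e1]; exact this
lemma In_cont (e : ℝ) (f : Alg) : Continuous fun t => In e t f :=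
  continuous_iff_continuousAt.2 fun t => ((J_dt f t).const_mul ((e ^ 2)⁻¹)).continuousAt
lemma Nm_cont (e : ℝ) (k) (f : Alg) : Continuous fun t => Nm e t k f := by
  induction k generalizing f with
  | zero => exact In_cont e _
  | succ k ih => exact ((ih f).add (ih _)).add (ih _)

def Ef (S : Setup P) (t : ℝ) : ℝ := Nm S.e t 3 S.Φ + Nm S.e t 0 (Dm S.e 0 S.Φ) + Nm S.e t 3 S.Ψ1 + Nm S.e t 3 S.Ψ2
  + Nm S.e t 3 S.Θ + Nm S.e t 1 (Dm S.e 0 S.Ψ1) + Nm S.e t 1 (Dm S.e 0 S.Ψ2) + Nm S.e t 1 (Dm S.e 0 S.Θ)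
def Df (S : Setup P) (t : ℝ) : ℝ := Nm S.e t 0 (Dm S.e 0 (Dm S.e 0 S.Ψ1)) + Nm S.e t 0 (Dm S.e 0 (Dm S.e 0 S.Ψ2))
  + Nm S.e t 0 (Dm S.e 0 (Dm S.e 0 S.Θ))

lemma Ef_cont (S : Setup P) : Continuous (Ef S) := by
  have := Nm_cont S.e
  unfold Ef; fun_prop (disch := assumption)
lemma Df_cont (S : Setup P) : Continuous (Df S) := by
  have := Nm_cont S.e
  unfold Df; fun_prop (disch := assumption)
lemma Ef_eq (p : Pt P) : ℰ p = Ef p.S p.t := by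
  show (El.sum : Fn P) p = _
  simp only [El, List.sum_cons, List.sum_nil, Pi.add_apply, Pi.zero_apply, add_zero, Ef]
  show Nm p.S.e p.t 3 p.S.Φ + (Nm p.S.e p.t 0 (Dm p.S.e 0 p.S.Φ) + (Nm p.S.e p.t 3 p.S.Ψ1 + (Nm p.S.e p.t 3 p.S.Ψ2
    + (Nm p.S.e p.t 3 p.S.Θ + (Nm p.S.e p.t 1 (Dm p.S.e 0 p.S.Ψ1) + (Nm p.S.e p.t 1 (Dm p.S.e 0 p.S.Ψ2)
    + Nm p.S.e p.t 1 (Dm p.S.e 0 p.S.Θ))))))) = _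
  ring
lemma Df_le (p : Pt P) : Df p.S p.t ≤ 𝒟 p := by
  show _ ≤ (Dl.sum : Fn P) p
  have h : Df p.S p.t = N 0 (D 0 (D 0 fΨ1)) p + N 0 (D 0 (D 0 fΨ2)) p + N 0 (D 0 (D 0 fΘ)) p := rfl
  rw [h]
  simp only [Dl, List.sum_cons, List.sum_nil, Pi.add_apply, Pi.zero_apply, add_zero]
  have := fun k f => N_nn (P := P) k f p
  have := this 2 (D 1 fΦ); have := N_nn 2 (D 2 fΦ) p; have := N_nn 2 (D 0 fΦ) p; have := N_nn 0 (ee * fΦ) p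
  have := N_nn 3 (D 1 fΨ1) p; have := N_nn 3 (D 2 fΨ1) p; have := N_nn 2 (D 0 fΨ1) p; have := N_nn 0 (ee * fΨ1) p
  have := N_nn 3 (D 1 fΨ2) p; have := N_nn 3 (D 2 fΨ2) p; have := N_nn 2 (D 0 fΨ2) p; have := N_nn 0 (ee * fΨ2) p
  have := N_nn 3 (D 1 fΘ) p; have := N_nn 3 (D 2 fΘ) p; have := N_nn 2 (D 0 fΘ) p; have := N_nn 0 (ee * fΘ) p
  linarith

lemma le_Icc {T : ℝ} (hT : 0 < T) {f g : ℝ → ℝ} (hf : Continuous f) (hg : Continuous g)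
    (h : ∀ t ∈ Set.Ioo 0 T, f t ≤ g t) : ∀ t ∈ Set.Icc 0 T, f t ≤ g t := by
  intro t ht
  rw [← closure_Ioo hT.ne] at ht
  exact le_on_closure h hf.continuousOn hg.continuousOn ht

theorem closure_est (P : Par) : ∃ δ0 C : ℝ, 0 < δ0 ∧ 0 ≤ C ∧ ∀ S : Setup P, S.δ ≤ δ0 → 0 < S.T → ∀ t ∈ Set.Icc 0 S.T,
    Ef S t ≤ C * Ef S 0 ∧ (S.e ^ 2)⁻¹ * ∫ s in (0:ℝ)..t, Df S s ≤ C * Ef S 0 := by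
  obtain ⟨q, C, hC, hq⟩ := Cd𝒟 (P := P)
  obtain ⟨q', C', hC', hq'⟩ := Csℰ (P := P)
  refine ⟨1 / (2 * (C + 1)), C' + 2 * C' * C + 2 * C, by positivity, by positivity, fun S hS hT t ht => ?_⟩
  have hδ : C * S.δ ≤ 1 / 2 := by
    have h1 : 0 < S.δ := S.he.trans_le S.heδ
    rw [le_div_iff₀ (by positivity)] at hS
    nlinarith
  have h1 : 0 < S.δ := S.he.trans_le S.heδ
  have he2 : 0 < (S.e ^ 2)⁻¹ := by have := S.he; positivity
  have dq : ∀ t (ht : t ∈ Set.Ioo 0 S.T), In S.e t (Dm S.e 0 (q S)) ≤ -(1/2) * 𝒟 ⟨S, t, ht⟩ := fun t ht => by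
    have h := (hq ⟨S, t, ht⟩).2.2
    have h0 := 𝒟_nn ⟨S, t, ht⟩
    change In S.e t (Dm S.e 0 (q S)) + 𝒟 ⟨S, t, ht⟩ ≤ C * (S.δ * 𝒟 ⟨S, t, ht⟩) at h
    nlinarith
  have a1 : AntitoneOn (fun t => In S.e t (q' S) + 2 * C' * In S.e t (q S)) (Set.Icc 0 S.T) := by
    refine antitoneOn_of_deriv_nonpos (convex_Icc _ _)
      ((In_cont _ _).add ((In_cont _ _).const_mul _ |> fun h => h)).continuousOn ?_ ?_
    · exact fun t _ => ((In_dt _ S.he _ t).add ((In_dt _ S.he _ t).const_mul _)).differentiableAt.differentiableWithinAt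
    · intro t ht
      rw [interior_Icc] at ht
      refine le_of_eq_of_le ((In_dt _ S.he (q' S) t).add ((In_dt _ S.he (q S) t).const_mul (2 * C'))).deriv ?_
      have h := (hq' ⟨S, t, ht⟩).2.2.2
      change In S.e t (Dm S.e 0 (q' S)) ≤ C' * (S.δ * 𝒟 ⟨S, t, ht⟩) at h
      have h0 := 𝒟_nn ⟨S, t, ht⟩
      have := dq t ht
      have := mul_le_mul_of_nonneg_left this hC'
      have hh : S.δ * 𝒟 ⟨S, t, ht⟩ ≤ 𝒟 ⟨S, t, ht⟩ := by have := S.hδ; nlinarith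
      have := mul_le_mul_of_nonneg_left hh hC'
      have k : In S.e t (Dm S.e 0 (q' S)) + 2 * C' * In S.e t (Dm S.e 0 (q S)) ≤ 0 := by linarith
      have := mul_le_mul_of_nonneg_left k he2.le
      linarith
  have a2 : AntitoneOn (fun t => In S.e t (q S) + (1/2) * ((S.e ^ 2)⁻¹ * ∫ s in (0:ℝ)..t, Df S s)) (Set.Icc 0 S.T) := by
    have hd : ∀ t, HasDerivAt (fun t => ∫ s in (0:ℝ)..t, Df S s) (Df S t) t := fun t =>
      intervalIntegral.integral_hasDerivAt_right ((Df_cont S).intervalIntegrable _ _)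
        ((Df_cont S).stronglyMeasurableAtFilter _ _) (Df_cont S).continuousAt
    have hh := fun t => (In_dt _ S.he (q S) t).add (((hd t).const_mul ((S.e ^ 2)⁻¹)).const_mul (1/2))
    refine antitoneOn_of_deriv_nonpos (convex_Icc _ _) (fun t _ => (hh t).continuousAt.continuousWithinAt)
      (fun t _ => (hh t).differentiableAt.differentiableWithinAt) ?_
    intro t ht
    rw [interior_Icc] at ht
    refine le_of_eq_of_le (hh t).deriv ?_
    have := dq t ht
    have k := Df_le ⟨S, t, ht⟩
    change Df S t ≤ _ at k
    have := mul_le_mul_of_nonneg_left (show In S.e t (Dm S.e 0 (q S)) + 1/2 * Df S t ≤ 0 by linarith) he2.le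
    linarith
  have b1 : ∀ t ∈ Set.Icc 0 S.T, Ef S t ≤ In S.e t (q' S) := le_Icc hT (Ef_cont S) (In_cont _ _) fun t ht => by
    have := (hq' ⟨S, t, ht⟩).1; rw [Ef_eq] at this; exact this
  have b2 : ∀ t ∈ Set.Icc 0 S.T, In S.e t (q' S) ≤ C' * Ef S t := le_Icc hT (In_cont _ _) ((Ef_cont S).const_mul _) fun t ht => by
    have := (hq' ⟨S, t, ht⟩).2.2.1; rw [Ef_eq] at this; exact this
  have b3 : ∀ t ∈ Set.Icc 0 S.T, 0 ≤ In S.e t (q S) := le_Icc hT continuous_const (In_cont _ _) fun t ht => (hq ⟨S, t, ht⟩).1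
  have b4 : ∀ t ∈ Set.Icc 0 S.T, In S.e t (q S) ≤ C * Ef S t := le_Icc hT (In_cont _ _) ((Ef_cont S).const_mul _) fun t ht => by
    have := (hq ⟨S, t, ht⟩).2.1; rw [Ef_eq] at this; exact this
  have b5 : ∀ t ∈ Set.Icc 0 S.T, 0 ≤ Ef S t := le_Icc hT continuous_const (Ef_cont S) fun t ht => by
    have := ℰ_nn ⟨S, t, ht⟩; rw [Ef_eq] at this; exact this
  have z : (0:ℝ) ∈ Set.Icc 0 S.T := ⟨le_rfl, hT.le⟩
  have k1 := a1 z ht ht.1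
  have k2 := a2 z ht ht.1
  simp only [intervalIntegral.integral_same, mul_zero, add_zero] at k1 k2
  have e0 := b5 0 z
  have m1 := mul_le_mul_of_nonneg_left (b4 0 z) hC'
  have m2 := mul_nonneg hC' (b3 t ht)
  have m3 := mul_nonneg hC' e0
  have m4 := mul_nonneg hC e0
  have m5 := mul_nonneg hC' m4
  have := b1 t ht; have := b2 0 z; have := b3 t ht; have := b4 0 z
  constructor <;> nlinarith
end Pf

set_option linter.unusedVariables false
set_option linter.unusedSimpArgs false
namespace Tr
open Pf (Alg ev dd mkA J Dm In Nm)

section gen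
variable {F : Type*} [NormedAddCommGroup F] [NormedSpace ℝ F]

lemma it_comp {G : Type*} [NormedAddCommGroup G] [NormedSpace ℝ G] (L : F →L[ℝ] G) (hL : ‖L‖ ≤ 1)
    {f : ℝ × ℝ → F} (hf : ContDiff ℝ (⊤ : ℕ∞) f) (j : ℕ) (x) :
    ‖iteratedFDeriv ℝ j (fun y => L (f y)) x‖ ≤ ‖iteratedFDeriv ℝ j f x‖ := by
  have h := L.norm_iteratedFDeriv_comp_left (x := x) (n := j) (N := (⊤ : ℕ∞)) hf.contDiffAt
    (by exact_mod_cast le_top)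
  refine h.trans ?_
  exact mul_le_of_le_one_left (norm_nonneg _) hL

lemma fd_smooth {f : ℝ × ℝ → F} (hf : ContDiff ℝ (⊤ : ℕ∞) f) : ContDiff ℝ (⊤ : ℕ∞) (fderiv ℝ f) :=
  hf.fderiv_right (m := (⊤ : ℕ∞)) (by simp)

lemma d1_smooth {f : ℝ × ℝ → F} (hf : ContDiff ℝ (⊤ : ℕ∞) f) : ContDiff ℝ (⊤ : ℕ∞) (d1 f) :=
  (fd_smooth hf).clm_apply contDiff_const
lemma d2_smooth {f : ℝ × ℝ → F} (hf : ContDiff ℝ (⊤ : ℕ∞) f) : ContDiff ℝ (⊤ : ℕ∞) (d2 f) :=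
  (fd_smooth hf).clm_apply contDiff_const

lemma it_d1 {f : ℝ × ℝ → F} (hf : ContDiff ℝ (⊤ : ℕ∞) f) (j x) :
    ‖iteratedFDeriv ℝ j (d1 f) x‖ ≤ ‖iteratedFDeriv ℝ (j+1) f x‖ := by
  rw [← norm_iteratedFDeriv_fderiv]
  refine it_comp (ContinuousLinearMap.apply ℝ F ((1:ℝ),(0:ℝ))) ?_ (fd_smooth hf) j x
  refine ContinuousLinearMap.opNorm_le_bound _ zero_le_one fun L => ?_
  refine (L.le_opNorm _).trans ?_
  simp [Prod.norm_def]

lemma it_d2 {f : ℝ × ℝ → F} (hf : ContDiff ℝ (⊤ : ℕ∞) f) (j x) :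
    ‖iteratedFDeriv ℝ j (d2 f) x‖ ≤ ‖iteratedFDeriv ℝ (j+1) f x‖ := by
  rw [← norm_iteratedFDeriv_fderiv]
  refine it_comp (ContinuousLinearMap.apply ℝ F ((0:ℝ),(1:ℝ))) ?_ (fd_smooth hf) j x
  refine ContinuousLinearMap.opNorm_le_bound _ zero_le_one fun L => ?_
  refine (L.le_opNorm _).trans ?_
  simp [Prod.norm_def]

lemma it_succ {f : ℝ × ℝ → F} (hf : ContDiff ℝ (⊤ : ℕ∞) f) (j x) :
    ‖iteratedFDeriv ℝ (j+1) f x‖ ≤ ‖iteratedFDeriv ℝ j (d1 f) x‖ + ‖iteratedFDeriv ℝ j (d2 f) x‖ := by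
  rw [← norm_iteratedFDeriv_fderiv]
  set L1 : F →L[ℝ] (ℝ × ℝ →L[ℝ] F) :=
    ContinuousLinearMap.smulRightL ℝ (ℝ × ℝ) F (ContinuousLinearMap.fst ℝ ℝ ℝ) with hL1
  set L2 : F →L[ℝ] (ℝ × ℝ →L[ℝ] F) :=
    ContinuousLinearMap.smulRightL ℝ (ℝ × ℝ) F (ContinuousLinearMap.snd ℝ ℝ ℝ) with hL2
  have n1 : ‖L1‖ ≤ 1 := by
    refine ContinuousLinearMap.opNorm_le_bound _ zero_le_one fun c => ?_
    refine ContinuousLinearMap.opNorm_le_bound _ (by positivity) fun v => ?_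
    simp only [hL1, ContinuousLinearMap.smulRightL_apply_apply, ContinuousLinearMap.smulRight_apply, norm_smul, one_mul]
    rw [mul_comm]
    exact mul_le_mul_of_nonneg_left (norm_fst_le v) (norm_nonneg _)
  have n2 : ‖L2‖ ≤ 1 := by
    refine ContinuousLinearMap.opNorm_le_bound _ zero_le_one fun c => ?_
    refine ContinuousLinearMap.opNorm_le_bound _ (by positivity) fun v => ?_
    simp only [hL2, ContinuousLinearMap.smulRightL_apply_apply, ContinuousLinearMap.smulRight_apply, norm_smul, one_mul]
    rw [mul_comm]
    exact mul_le_mul_of_nonneg_left (norm_snd_le v) (norm_nonneg _)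
  have hfd : fderiv ℝ f = (fun y => L1 (d1 f y)) + fun y => L2 (d2 f y) := by
    funext y
    refine ContinuousLinearMap.ext fun v => ?_
    have : v = v.1 • ((1:ℝ),(0:ℝ)) + v.2 • ((0:ℝ),(1:ℝ)) := by ext <;> simp
    conv_lhs => rw [this]
    simp only [map_add, map_smul, Pi.add_apply, add_apply, hL1, hL2,
      ContinuousLinearMap.smulRightL_apply_apply, ContinuousLinearMap.smulRight_apply]
    rfl
  have s1 : ContDiff ℝ j (fun y => L1 (d1 f y)) :=
    (L1.contDiff.comp (d1_smooth hf)).of_le (by exact_mod_cast le_top)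
  have s2 : ContDiff ℝ j (fun y => L2 (d2 f y)) :=
    (L2.contDiff.comp (d2_smooth hf)).of_le (by exact_mod_cast le_top)
  rw [hfd, iteratedFDeriv_add_apply s1.contDiffAt s2.contDiffAt]
  exact (norm_add_le _ _).trans
    (add_le_add (it_comp L1 n1 (d1_smooth hf) j x) (it_comp L2 n2 (d2_smooth hf) j x))

lemma it_int {f : ℝ × ℝ → F} (hf : ContDiff ℝ (⊤ : ℕ∞) f) (j : ℕ) :
    IntegrableOn (fun x => ‖iteratedFDeriv ℝ j f x‖ ^ 2) Ω :=
  Pf.intOn (((hf.continuous_iteratedFDeriv (m := j) (by exact_mod_cast le_top)).norm).pow 2)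

lemma dSq_nonneg (j : ℕ) (f : ℝ × ℝ → F) : 0 ≤ dSq j f := integral_nonneg fun x => by positivity

lemma dSq_mono {G : Type*} [NormedAddCommGroup G] [NormedSpace ℝ G] {f : ℝ × ℝ → F} {g : ℝ × ℝ → G}
    (hg : ContDiff ℝ (⊤ : ℕ∞) g) {j k : ℕ}
    (h : ∀ x, ‖iteratedFDeriv ℝ j f x‖ ≤ ‖iteratedFDeriv ℝ k g x‖) : dSq j f ≤ dSq k g := by
  refine integral_mono_of_nonneg (Eventually.of_forall fun x => by positivity) (it_int hg k)
    (Eventually.of_forall fun x => ?_)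
  exact pow_le_pow_left₀ (norm_nonneg _) (h x) 2

lemma dSq_mono2 {G : Type*} [NormedAddCommGroup G] [NormedSpace ℝ G] {f : ℝ × ℝ → F} {g g' : ℝ × ℝ → G}
    (hg : ContDiff ℝ (⊤ : ℕ∞) g) (hg' : ContDiff ℝ (⊤ : ℕ∞) g') {j k : ℕ}
    (h : ∀ x, ‖iteratedFDeriv ℝ j f x‖ ≤ ‖iteratedFDeriv ℝ k g x‖ + ‖iteratedFDeriv ℝ k g' x‖) :
    dSq j f ≤ 2 * (dSq k g + dSq k g') := by
  unfold dSq
  rw [← integral_add (it_int hg k) (it_int hg' k), ← integral_const_mul]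
  refine integral_mono_of_nonneg (Eventually.of_forall fun x => by positivity)
    (((it_int hg k).add (it_int hg' k)).const_mul 2)
    (Eventually.of_forall fun x => ?_)
  have := pow_le_pow_left₀ (norm_nonneg _) (h x) 2
  simp only [Pi.add_apply]
  nlinarith [sq_nonneg (‖iteratedFDeriv ℝ k g x‖ - ‖iteratedFDeriv ℝ k g' x‖)]

lemma dSq_smul (c : ℝ) {f : ℝ × ℝ → F} (hf : ContDiff ℝ (⊤ : ℕ∞) f) (j : ℕ) :
    dSq j (fun x => c • f x) = c ^ 2 * dSq j f := by
  unfold dSq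
  rw [← integral_const_mul]
  refine integral_congr_ae (Eventually.of_forall fun x => ?_)
  have : ContDiff ℝ j f := hf.of_le (by exact_mod_cast le_top)
  have h := iteratedFDeriv_const_smul_apply (a := c) (x := x) (𝕜 := ℝ) (i := j) (f := f) this.contDiffAt
  have h' : iteratedFDeriv ℝ j (fun x => c • f x) x = c • iteratedFDeriv ℝ j f x := h
  simp only [h', norm_smul, mul_pow, Real.norm_eq_abs, sq_abs]
end gen

/-- slices -/
def sl (f : Alg) (t : ℝ) : ℝ × ℝ → ℝ := fun x => ev f (t, x)

lemma sl_smooth (f t) : ContDiff ℝ (⊤ : ℕ∞) (sl f t) :=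
  (Pf.ev_smooth f).comp (contDiff_const.prodMk contDiff_id)

lemma sl_fd (f : Alg) (t : ℝ) (x v : ℝ × ℝ) : fderiv ℝ (sl f t) x v = ev (dd (0, v) f) (t, x) := by
  have h : HasFDerivAt (fun x : ℝ × ℝ => ((t, x) : ℝ × ℝ × ℝ)) (ContinuousLinearMap.inr ℝ ℝ (ℝ × ℝ)) x :=
    hasFDerivAt_prodMk_right t x
  have h2 := ((Pf.ev_diff f (t, x)).hasFDerivAt).comp x h
  rw [Pf.ev_dd]
  have h3 : fderiv ℝ (sl f t) x = _ := h2.fderiv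
  rw [h3]; rfl

lemma d1_sl (f t) : d1 (sl f t) = sl (dd (0,1,0) f) t := funext fun x => sl_fd f t x (1, 0)
lemma d2_sl (f t) : d2 (sl f t) = sl (dd (0,0,1) f) t := funext fun x => sl_fd f t x (0, 1)
lemma dt_sl (f : Alg) : dt (sl f) = sl (dd (1,0,0) f) := by
  funext t x; obtain ⟨x, y⟩ := x
  exact (Pf.hasDeriv_t f t x y).deriv

/-- `j`-th derivative seminorms of slices -/
def Sq (j : ℕ) (f : Alg) (t : ℝ) : ℝ := dSq j (sl f t)

lemma Sq_nn (j f t) : 0 ≤ Sq j f t := dSq_nonneg _ _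
lemma Sq_zero (f t) : Sq 0 f t = J t (f * f) := by
  unfold Sq dSq J
  refine integral_congr_ae (Eventually.of_forall fun x => ?_)
  simp [sl, sq]
lemma Sq_d1 (j f t) : Sq j (dd (0,1,0) f) t ≤ Sq (j+1) f t := by
  unfold Sq; rw [← d1_sl]; exact dSq_mono (sl_smooth f t) fun x => it_d1 (sl_smooth f t) j x
lemma Sq_d2 (j f t) : Sq j (dd (0,0,1) f) t ≤ Sq (j+1) f t := by
  unfold Sq; rw [← d2_sl]; exact dSq_mono (sl_smooth f t) fun x => it_d2 (sl_smooth f t) j x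
lemma Sq_succ (j f t) : Sq (j+1) f t ≤ 2 * (Sq j (dd (0,1,0) f) t + Sq j (dd (0,0,1) f) t) := by
  unfold Sq; rw [← d2_sl, ← d1_sl]
  exact dSq_mono2 (d1_smooth (sl_smooth f t)) (d2_smooth (sl_smooth f t)) fun x => it_succ (sl_smooth f t) j x
lemma Sq_smul (c : ℝ) (j f t) : Sq j (c • f) t = c ^ 2 * Sq j f t := dSq_smul c (sl_smooth f t) j
lemma Nm_nn (e t : ℝ) : ∀ (k) (f : Alg), 0 ≤ Nm e t k f
  | 0, f => mul_nonneg (by positivity) (Pf.J_nonneg fun p _ => by simpa using mul_self_nonneg _)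
  | k+1, f => add_nonneg (add_nonneg (Nm_nn e t k f) (Nm_nn e t k _)) (Nm_nn e t k _)

lemma Nm_le (e t : ℝ) (k : ℕ) (f : Alg) :
    Nm e t k f ≤ 3 ^ k * ((e^2)⁻¹ * ∑ j ∈ Finset.range (k+1), e ^ (2*j) * Sq j f t) := by
  induction k generalizing f with
  | zero => simp [Nm, In, Sq_zero]
  | succ k ih =>
    have key : ∀ g : Alg, (∀ j, Sq j g t ≤ e ^ 2 * Sq (j+1) f t) →
        ∑ j ∈ Finset.range (k+1), e ^ (2*j) * Sq j g t
          ≤ ∑ j ∈ Finset.range (k+1+1), e ^ (2*j) * Sq j f t := by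
      intro g hg
      rw [Finset.sum_range_succ' _ (k+1)]
      have h0 : 0 ≤ e ^ (2*0) * Sq 0 f t := by simpa using Sq_nn 0 f t
      refine le_add_of_le_of_nonneg (Finset.sum_le_sum fun j _ => ?_) h0
      calc e ^ (2*j) * Sq j g t ≤ e ^ (2*j) * (e ^ 2 * Sq (j+1) f t) :=
            mul_le_mul_of_nonneg_left (hg j) (by rw [pow_mul]; positivity)
        _ = _ := by ring
    have h1 := key (Dm e 1 f) fun j => by
      rw [Pf.Dm1, Sq_smul]; exact mul_le_mul_of_nonneg_left (Sq_d1 j f t) (by positivity)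
    have h2 := key (Dm e 2 f) fun j => by
      rw [Pf.Dm2, Sq_smul]; exact mul_le_mul_of_nonneg_left (Sq_d2 j f t) (by positivity)
    have h0 : ∑ j ∈ Finset.range (k+1), e ^ (2*j) * Sq j f t
          ≤ ∑ j ∈ Finset.range (k+1+1), e ^ (2*j) * Sq j f t := by
      rw [Finset.sum_range_succ _ (k+1)]
      exact le_add_of_nonneg_right (mul_nonneg (by rw [pow_mul]; positivity) (Sq_nn _ _ _))
    have c : (0:ℝ) ≤ 3 ^ k * (e^2)⁻¹ := by positivity
    have i0 := ih f; have i1 := ih (Dm e 1 f); have i2 := ih (Dm e 2 f)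
    have m0 := mul_le_mul_of_nonneg_left h0 c
    have m1 := mul_le_mul_of_nonneg_left h1 c
    have m2 := mul_le_mul_of_nonneg_left h2 c
    simp only [Nm]
    rw [pow_succ]
    linarith

lemma Sq_le {e : ℝ} (he : 0 < e) (t : ℝ) (k : ℕ) (f : Alg) :
    e ^ (2*k) * Sq k f t ≤ 2 ^ k * (e ^ 2 * Nm e t k f) := by
  induction k generalizing f with
  | zero =>
    simp only [Nm, In, Sq_zero]
    have : e ^ 2 ≠ 0 := by positivity
    simp [this]
  | succ k ih =>
    have h1 : e ^ 2 * Sq k (dd (0,1,0) f) t = Sq k (Dm e 1 f) t := by rw [Pf.Dm1, Sq_smul]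
    have h2 : e ^ 2 * Sq k (dd (0,0,1) f) t = Sq k (Dm e 2 f) t := by rw [Pf.Dm2, Sq_smul]
    have i1 := ih (Dm e 1 f); have i2 := ih (Dm e 2 f)
    have n := mul_nonneg (mul_nonneg (pow_nonneg zero_le_two k) (sq_nonneg e)) (Nm_nn e t k f)
    calc e ^ (2*(k+1)) * Sq (k+1) f t
        ≤ e ^ (2*(k+1)) * (2 * (Sq k (dd (0,1,0) f) t + Sq k (dd (0,0,1) f) t)) :=
          mul_le_mul_of_nonneg_left (Sq_succ k f t) (by positivity)
      _ = 2 * (e ^ (2*k) * (e ^ 2 * Sq k (dd (0,1,0) f) t) + e ^ (2*k) * (e ^ 2 * Sq k (dd (0,0,1) f) t)) := by ring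
      _ ≤ 2 ^ (k+1) * (e ^ 2 * Nm e t (k+1) f) := by
          rw [h1, h2]; simp only [Nm]; rw [pow_succ]; linarith

end Tr

set_option linter.unusedVariables false
set_option linter.unusedSimpArgs false
namespace Tr
open Pf (Alg ev dd mkA J Dm In Nm)

def pr (b c : Alg) (t : ℝ) : ℝ × ℝ → ℝ × ℝ := fun x => (sl b t x, sl c t x)
lemma pr_smooth (b c t) : ContDiff ℝ (⊤ : ℕ∞) (pr b c t) := (sl_smooth b t).prodMk (sl_smooth c t)
lemma dt_pr (b c : Alg) : dt (pr b c) = pr (dd (1,0,0) b) (dd (1,0,0) c) := by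
  funext t x; obtain ⟨x, y⟩ := x
  exact ((Pf.hasDeriv_t b t x y).prodMk (Pf.hasDeriv_t c t x y)).deriv

lemma Sq_le_pr1 (j b c t) : Sq j b t ≤ dSq j (pr b c t) :=
  dSq_mono (pr_smooth b c t) fun x =>
    it_comp (ContinuousLinearMap.fst ℝ ℝ ℝ) (ContinuousLinearMap.norm_fst_le ..) (pr_smooth b c t) j x
lemma Sq_le_pr2 (j b c t) : Sq j c t ≤ dSq j (pr b c t) :=
  dSq_mono (pr_smooth b c t) fun x =>
    it_comp (ContinuousLinearMap.snd ℝ ℝ ℝ) (ContinuousLinearMap.norm_snd_le ..) (pr_smooth b c t) j x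
lemma it_pr {b c : ℝ × ℝ → ℝ} (hb : ContDiff ℝ (⊤ : ℕ∞) b) (hc : ContDiff ℝ (⊤ : ℕ∞) c) (j : ℕ) (x) :
    ‖iteratedFDeriv ℝ j (fun y => (b y, c y)) x‖ ≤ ‖iteratedFDeriv ℝ j b x‖ + ‖iteratedFDeriv ℝ j c x‖ := by
  have s1 : ContDiff ℝ j (fun y => ContinuousLinearMap.inl ℝ ℝ ℝ (b y)) :=
    ((ContinuousLinearMap.inl ℝ ℝ ℝ).contDiff.comp hb).of_le (by exact_mod_cast le_top)
  have s2 : ContDiff ℝ j (fun y => ContinuousLinearMap.inr ℝ ℝ ℝ (c y)) :=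
    ((ContinuousLinearMap.inr ℝ ℝ ℝ).contDiff.comp hc).of_le (by exact_mod_cast le_top)
  have : (fun y => (b y, c y)) = (fun y => ContinuousLinearMap.inl ℝ ℝ ℝ (b y))
      + fun y => ContinuousLinearMap.inr ℝ ℝ ℝ (c y) := by
    funext y; simp
  rw [this, iteratedFDeriv_add_apply s1.contDiffAt s2.contDiffAt]
  have m1 := it_comp (ContinuousLinearMap.inl ℝ ℝ ℝ) (ContinuousLinearMap.norm_inl_le_one ..) hb j x
  have m2 := it_comp (ContinuousLinearMap.inr ℝ ℝ ℝ) (ContinuousLinearMap.norm_inr_le_one ..) hc j x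
  exact (norm_add_le _ _).trans (add_le_add m1 m2)
lemma pr_le_Sq (j b c t) : dSq j (pr b c t) ≤ 2 * (Sq j b t + Sq j c t) := by
  unfold Sq
  exact dSq_mono2 (f := pr b c t) (g := sl b t) (g' := sl c t) (j := j) (k := j)
    (sl_smooth b t) (sl_smooth c t) (it_pr (sl_smooth b t) (sl_smooth c t) j)

/-! boundedness on compact time intervals -/
def BdC (F : ℝ → ℝ) : Prop := (∀ s, 0 ≤ F s) ∧ ∀ t, ∃ M, ∀ s ∈ Set.Icc 0 t, F s ≤ M

lemma BdC.add {F G : ℝ → ℝ} (hF : BdC F) (hG : BdC G) : BdC fun s => F s + G s :=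
  ⟨fun s => add_nonneg (hF.1 s) (hG.1 s), fun t => by
    obtain ⟨M, hM⟩ := hF.2 t; obtain ⟨M', hM'⟩ := hG.2 t
    exact ⟨M + M', fun s hs => add_le_add (hM s hs) (hM' s hs)⟩⟩
lemma BdC.mul {F : ℝ → ℝ} (hF : BdC F) {c : ℝ} (hc : 0 ≤ c) : BdC fun s => c * F s :=
  ⟨fun s => mul_nonneg hc (hF.1 s), fun t => by
    obtain ⟨M, hM⟩ := hF.2 t
    exact ⟨c * M, fun s hs => mul_le_mul_of_nonneg_left (hM s hs) hc⟩⟩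
lemma BdC.of_le {F G : ℝ → ℝ} (hG : BdC G) (h0 : ∀ s, 0 ≤ F s) (h : ∀ s, F s ≤ G s) : BdC F :=
  ⟨h0, fun t => by
    obtain ⟨M, hM⟩ := hG.2 t
    exact ⟨M, fun s hs => (h s).trans (hM s hs)⟩⟩
lemma BdC.Sq (j f) : BdC (Sq j f) := by
  refine ⟨Sq_nn j f, fun t => ?_⟩
  obtain ⟨M, hM⟩ := (isCompact_Icc (a := (0:ℝ)) (b := t)).bddAbove_image
    ((Pf.Nm_cont 1 j f).continuousOn)
  refine ⟨2 ^ j * M, fun s hs => ?_⟩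
  have h1 := Sq_le one_pos s j f
  have h2 : Nm 1 s j f ≤ M := hM ⟨s, hs, rfl⟩
  simp only [one_pow, one_mul] at h1
  exact h1.trans (mul_le_mul_of_nonneg_left h2 (by positivity))
lemma BdC.pr (j b c) : BdC (fun s => dSq j (pr b c s)) :=
  (((BdC.Sq j b).add (BdC.Sq j c)).mul zero_le_two).of_le (fun s => dSq_nonneg _ _)
    (fun s => pr_le_Sq j b c s)
lemma BdC.le_sup {F : ℝ → ℝ} (h : BdC F) {s t : ℝ} (hs : s ∈ Set.Icc 0 t) :
    F s ≤ ⨆ s ∈ Set.Icc (0:ℝ) t, F s := by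
  obtain ⟨M, hM⟩ := h.2 t
  have e : ∀ s ∈ Set.Icc (0:ℝ) t, (⨆ _ : s ∈ Set.Icc (0:ℝ) t, F s) = F s := fun s hs => ciSup_pos hs
  have hb : BddAbove (Set.range fun s => ⨆ _ : s ∈ Set.Icc (0:ℝ) t, F s) := by
    refine ⟨max M 0, ?_⟩
    rintro _ ⟨u, rfl⟩
    by_cases hu : u ∈ Set.Icc (0:ℝ) t
    · simp only [e u hu]; exact (hM u hu).trans (le_max_left _ _)
    · refine le_trans (Real.iSup_le (fun h => absurd h hu) le_rfl) (le_max_right _ _)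
  have := le_ciSup hb s
  rwa [e s hs] at this

/-- slice energies -/
def E0 (ε : ℝ) (φ : ℝ → ℝ × ℝ → ℝ) (ψ : ℝ → ℝ × ℝ → ℝ × ℝ) (θ : ℝ → ℝ × ℝ → ℝ) (s : ℝ) : ℝ :=
  L2Sq (ψ s) + (ε ^ 2)⁻¹ * L2Sq (φ s) + (ε ^ 2)⁻¹ * L2Sq (θ s)
def E1 (ε : ℝ) (φ : ℝ → ℝ × ℝ → ℝ) (ψ : ℝ → ℝ × ℝ → ℝ × ℝ) (θ : ℝ → ℝ × ℝ → ℝ) (s : ℝ) : ℝ :=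
  dSq 1 (ψ s) + (ε ^ 2)⁻¹ * dSq 1 (θ s)
def E3 (ε : ℝ) (φ : ℝ → ℝ × ℝ → ℝ) (ψ : ℝ → ℝ × ℝ → ℝ × ℝ) (θ : ℝ → ℝ × ℝ → ℝ) (s : ℝ) : ℝ :=
  (ε ^ 2)⁻¹ * L2Sq (dt φ s) + L2Sq (dt ψ s) + (ε ^ 2)⁻¹ * L2Sq (dt θ s)
def E4 (ε : ℝ) (φ : ℝ → ℝ × ℝ → ℝ) (ψ : ℝ → ℝ × ℝ → ℝ × ℝ) (θ : ℝ → ℝ × ℝ → ℝ) (s : ℝ) : ℝ :=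
  (ε ^ 2)⁻¹ * dSq 2 (φ s) + dSq 2 (ψ s) + (ε ^ 2)⁻¹ * dSq 2 (θ s)
def E5 (ε : ℝ) (φ : ℝ → ℝ × ℝ → ℝ) (ψ : ℝ → ℝ × ℝ → ℝ × ℝ) (θ : ℝ → ℝ × ℝ → ℝ) (s : ℝ) : ℝ :=
  (ε ^ 2)⁻¹ * dSq 3 (φ s) + (dSq 3 (ψ s) + dSq 1 (dt ψ s))
        + (ε ^ 2)⁻¹ * (dSq 3 (θ s) + dSq 1 (dt θ s))
def En (ε : ℝ) (φ : ℝ → ℝ × ℝ → ℝ) (ψ : ℝ → ℝ × ℝ → ℝ × ℝ) (θ : ℝ → ℝ × ℝ → ℝ) (s : ℝ) : ℝ :=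
  (ε ^ 2)⁻¹ * E0 ε φ ψ θ s + E1 ε φ ψ θ s + (ε ^ 2)⁻¹ * dSq 1 (φ s) + ε ^ 2 * E3 ε φ ψ θ s
    + ε ^ 2 * E4 ε φ ψ θ s + ε ^ 4 * E5 ε φ ψ θ s

section nn
variable {F : Type*} [NormedAddCommGroup F] [NormedSpace ℝ F]
lemma L2_nn (f : ℝ × ℝ → F) : 0 ≤ L2Sq f := dSq_nonneg 0 f
lemma HSq_nn (k) (f : ℝ × ℝ → F) : 0 ≤ HSq k f := Finset.sum_nonneg fun j _ => dSq_nonneg j f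
end nn

lemma En_le (ε : ℝ) (a b c d : Alg) {s t : ℝ} (hs : s ∈ Set.Icc 0 t) :
    En ε (sl a) (pr b c) (sl d) s ≤ Nfun ε (sl a) (pr b c) (sl d) t := by
  have i0 : 0 ≤ (ε ^ 2)⁻¹ := by positivity
  have i4 : 0 ≤ (ε ^ 4)⁻¹ := by positivity
  have ht : (0:ℝ) ≤ t := hs.1.trans hs.2
  have a0 : E0 ε (sl a) (pr b c) (sl d) s ≤ A0 ε (sl a) (pr b c) (sl d) t := by
    refine le_add_of_le_of_nonneg (BdC.le_sup (F := E0 ε (sl a) (pr b c) (sl d)) ?_ hs) ?_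
    · exact ((BdC.pr 0 b c).add ((BdC.Sq 0 a).mul i0)).add ((BdC.Sq 0 d).mul i0)
    · exact intervalIntegral.integral_nonneg ht fun u _ => add_nonneg (HSq_nn _ _) (mul_nonneg i0 (HSq_nn _ _))
  have a1 : E1 ε (sl a) (pr b c) (sl d) s ≤ A1 ε (sl a) (pr b c) (sl d) t := by
    refine le_add_of_le_of_nonneg (BdC.le_sup (F := E1 ε (sl a) (pr b c) (sl d)) ?_ hs) ?_
    · exact (BdC.pr 1 b c).add ((BdC.Sq 1 d).mul i0)
    · exact intervalIntegral.integral_nonneg ht fun u _ => add_nonneg (L2_nn _) (mul_nonneg i0 (L2_nn _))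
  have a2 : (ε ^ 2)⁻¹ * dSq 1 (sl a s) ≤ A2 ε (sl a) (pr b c) (sl d) t := by
    refine le_add_of_le_of_nonneg (le_add_of_le_of_nonneg
      (mul_le_mul_of_nonneg_left (BdC.le_sup (F := Sq 1 a) (BdC.Sq 1 a) hs) i0) ?_) ?_
    · exact intervalIntegral.integral_nonneg ht fun u _ =>
        add_nonneg (mul_nonneg i4 (HSq_nn _ _)) (mul_nonneg i0 (L2_nn _))
    · exact intervalIntegral.integral_nonneg ht fun u _ => add_nonneg (HSq_nn _ _) (mul_nonneg i0 (HSq_nn _ _))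
  have a3 : E3 ε (sl a) (pr b c) (sl d) s ≤ A3 ε (sl a) (pr b c) (sl d) t := by
    refine le_add_of_le_of_nonneg (BdC.le_sup (F := E3 ε (sl a) (pr b c) (sl d)) ?_ hs) ?_
    · unfold E3; rw [dt_sl, dt_sl, dt_pr]
      exact (((BdC.Sq 0 _).mul i0).add (BdC.pr 0 _ _)).add ((BdC.Sq 0 _).mul i0)
    · exact intervalIntegral.integral_nonneg ht fun u _ => add_nonneg (dSq_nonneg _ _) (mul_nonneg i0 (dSq_nonneg _ _))
  have a4 : E4 ε (sl a) (pr b c) (sl d) s ≤ A4 ε (sl a) (pr b c) (sl d) t := by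
    refine le_add_of_le_of_nonneg (BdC.le_sup (F := E4 ε (sl a) (pr b c) (sl d)) ?_ hs) ?_
    · exact (((BdC.Sq 2 _).mul i0).add (BdC.pr 2 _ _)).add ((BdC.Sq 2 _).mul i0)
    · exact intervalIntegral.integral_nonneg ht fun u _ =>
        add_nonneg (add_nonneg (mul_nonneg i4 (HSq_nn _ _)) (HSq_nn _ _)) (mul_nonneg i0 (HSq_nn _ _))
  have a5 : E5 ε (sl a) (pr b c) (sl d) s ≤ A5 ε (sl a) (pr b c) (sl d) t := by
    refine le_add_of_le_of_nonneg (BdC.le_sup (F := E5 ε (sl a) (pr b c) (sl d)) ?_ hs) ?_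
    · unfold E5; rw [dt_sl, dt_pr]
      exact (((BdC.Sq 3 _).mul i0).add ((BdC.pr 3 _ _).add (BdC.pr 1 _ _))).add
        (((BdC.Sq 3 _).add (BdC.Sq 1 _)).mul i0)
    · exact intervalIntegral.integral_nonneg ht fun u _ => add_nonneg (L2_nn _) (mul_nonneg i0 (L2_nn _))
  unfold En Nfun
  have q2 : 0 ≤ ε ^ 2 := by positivity
  have q4 : 0 ≤ ε ^ 4 := by positivity
  have := mul_le_mul_of_nonneg_left a0 i0
  have := mul_le_mul_of_nonneg_left a3 q2
  have := mul_le_mul_of_nonneg_left a4 q2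
  have := mul_le_mul_of_nonneg_left a5 q4
  linarith

/-- scaled energy -/
def Ex (e : ℝ) (Φ b c Θ : Alg) (t : ℝ) : ℝ := Nm e t 3 Φ + Nm e t 0 (Dm e 0 Φ) + Nm e t 3 b + Nm e t 3 c
  + Nm e t 3 Θ + Nm e t 1 (Dm e 0 b) + Nm e t 1 (Dm e 0 c) + Nm e t 1 (Dm e 0 Θ)

lemma Nm0 (e t) (f : Alg) : Nm e t 0 f = (e^2)⁻¹ * Sq 0 f t := by rw [Sq_zero]; rfl

lemma dd_sm (v) (r : ℝ) (f : Alg) : dd v (r • f) = r • dd v f := Pf.dd_smul v r f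

lemma Ex_le {e : ℝ} (he : 0 < e) (a b c d : Alg) (t : ℝ) :
    Ex e (e⁻¹ • a) b c (e⁻¹ • d) t ≤ 54 * En e (sl a) (pr b c) (sl d) t := by
  have P0 := Sq_le_pr1 0 b c t
  have P1 := Sq_le_pr1 1 b c t
  have P2 := Sq_le_pr1 2 b c t
  have P3 := Sq_le_pr1 3 b c t
  have Q0 := Sq_le_pr2 0 b c t
  have Q1 := Sq_le_pr2 1 b c t
  have Q2 := Sq_le_pr2 2 b c t
  have Q3 := Sq_le_pr2 3 b c t
  have P0' := Sq_le_pr1 0 (dd (1,0,0) b) (dd (1,0,0) c) t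
  have P1' := Sq_le_pr1 1 (dd (1,0,0) b) (dd (1,0,0) c) t
  have Q0' := Sq_le_pr2 0 (dd (1,0,0) b) (dd (1,0,0) c) t
  have Q1' := Sq_le_pr2 1 (dd (1,0,0) b) (dd (1,0,0) c) t
  have n1 := Nm_le e t 3 (e⁻¹ • a)
  have n2 := Nm0 e t (Dm e 0 (e⁻¹ • a))
  have n3 := Nm_le e t 3 b
  have n4 := Nm_le e t 3 c
  have n5 := Nm_le e t 3 (e⁻¹ • d)
  have n6 := Nm_le e t 1 (Dm e 0 b)
  have n7 := Nm_le e t 1 (Dm e 0 c)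
  have n8 := Nm_le e t 1 (Dm e 0 (e⁻¹ • d))
  simp only [Finset.sum_range_succ, Finset.sum_range_zero, Pf.Dm0, dd_sm, Sq_smul] at n1 n2 n3 n4 n5 n6 n7 n8
  unfold Ex En E0 E1 E3 E4 E5 L2Sq
  simp only [Pf.Dm0, dd_sm] at *
  rw [dt_sl, dt_sl, dt_pr]
  simp only [show ∀ j f, dSq j (sl f t) = Sq j f t from fun _ _ => rfl]
  generalize dSq 0 (pr b c t) = p0 at *
  generalize dSq 1 (pr b c t) = p1 at *
  generalize dSq 2 (pr b c t) = p2 at *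
  generalize dSq 3 (pr b c t) = p3 at *
  generalize dSq 0 (pr (dd (1,0,0) b) (dd (1,0,0) c) t) = p0' at *
  generalize dSq 1 (pr (dd (1,0,0) b) (dd (1,0,0) c) t) = p1' at *
  have f1 := Sq_nn 0 a t
  have f2 := Sq_nn 1 a t
  have f3 := Sq_nn 2 a t
  have f4 := Sq_nn 3 a t
  have g1 := Sq_nn 0 d t
  have g2 := Sq_nn 1 d t
  have g3 := Sq_nn 2 d t
  have g4 := Sq_nn 3 d t
  have k1 := Sq_nn 0 (dd (1,0,0) a) t
  have k2 := Sq_nn 0 (dd (1,0,0) d) t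
  have k3 := Sq_nn 1 (dd (1,0,0) d) t
  have b0 := (Sq_nn 0 (dd (1,0,0) b) t).trans P0'
  have b1 := (Sq_nn 1 (dd (1,0,0) b) t).trans P1'
  generalize Sq 0 a t = x0 at *
  generalize Sq 1 a t = x1 at *
  generalize Sq 2 a t = x2 at *
  generalize Sq 3 a t = x3 at *
  generalize Sq 0 d t = y0 at *
  generalize Sq 1 d t = y1 at *
  generalize Sq 2 d t = y2 at *
  generalize Sq 3 d t = y3 at *
  generalize Sq 0 (dd (1,0,0) a) t = z0 at *
  generalize Sq 0 (dd (1,0,0) d) t = w0 at *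
  generalize Sq 1 (dd (1,0,0) d) t = w1 at *
  have m1 : Nm e t 3 (e⁻¹ • a) ≤ 27 * ((e^2)⁻¹*((e^2)⁻¹*x0) + (e^2)⁻¹*x1 + x2 + e^2*x3) := by
    refine n1.trans (le_of_eq ?_); field_simp; ring
  have m2 : Nm e t 0 (e ^ 2 • e⁻¹ • dd (1, 0, 0) a) = z0 := by
    rw [n2]; field_simp
  have m5 : Nm e t 3 (e⁻¹ • d) ≤ 27 * ((e^2)⁻¹*((e^2)⁻¹*y0) + (e^2)⁻¹*y1 + y2 + e^2*y3) := by
    refine n5.trans (le_of_eq ?_); field_simp; ring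
  have ii : 0 ≤ (e^2)⁻¹ := by positivity
  have q2 : 0 ≤ e^2 := by positivity
  have q4 : 0 ≤ e^4 := by positivity
  have m3 : Nm e t 3 b ≤ 27 * ((e^2)⁻¹*p0 + p1 + e^2*p2 + e^4*p3) := by
    refine n3.trans (le_trans (le_of_eq ?_) (mul_le_mul_of_nonneg_left (add_le_add (add_le_add (add_le_add
      (mul_le_mul_of_nonneg_left P0 ii) P1) (mul_le_mul_of_nonneg_left P2 q2))
      (mul_le_mul_of_nonneg_left P3 q4)) (by norm_num)))
    field_simp; ring
  have m4 : Nm e t 3 c ≤ 27 * ((e^2)⁻¹*p0 + p1 + e^2*p2 + e^4*p3) := by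
    refine n4.trans (le_trans (le_of_eq ?_) (mul_le_mul_of_nonneg_left (add_le_add (add_le_add (add_le_add
      (mul_le_mul_of_nonneg_left Q0 ii) Q1) (mul_le_mul_of_nonneg_left Q2 q2))
      (mul_le_mul_of_nonneg_left Q3 q4)) (by norm_num)))
    field_simp; ring
  have m6 : Nm e t 1 (e ^ 2 • dd (1, 0, 0) b) ≤ 3 * (e^2*p0' + e^4*p1') := by
    refine n6.trans (le_trans (le_of_eq ?_) (mul_le_mul_of_nonneg_left (add_le_add
      (mul_le_mul_of_nonneg_left P0' q2)
      (mul_le_mul_of_nonneg_left P1' q4)) (by norm_num)))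
    field_simp; ring
  have m7 : Nm e t 1 (e ^ 2 • dd (1, 0, 0) c) ≤ 3 * (e^2*p0' + e^4*p1') := by
    refine n7.trans (le_trans (le_of_eq ?_) (mul_le_mul_of_nonneg_left (add_le_add
      (mul_le_mul_of_nonneg_left Q0' q2)
      (mul_le_mul_of_nonneg_left Q1' q4)) (by norm_num)))
    field_simp; ring
  have m8 : Nm e t 1 (e ^ 2 • e⁻¹ • dd (1, 0, 0) d) ≤ 3 * (w0 + e^2*w1) := by
    refine n8.trans (le_of_eq ?_); field_simp; ring
  have r1 : e ^ 2 * (e ^ 2)⁻¹ = 1 := by field_simp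
  have r2 : e ^ 4 * (e ^ 2)⁻¹ = e ^ 2 := by field_simp
  have T : (e^2)⁻¹ * (p0 + (e^2)⁻¹ * x0 + (e^2)⁻¹ * y0) + (p1 + (e^2)⁻¹ * y1) + (e^2)⁻¹ * x1
      + e^2 * ((e^2)⁻¹ * z0 + p0' + (e^2)⁻¹ * w0) + e^2 * ((e^2)⁻¹ * x2 + p2 + (e^2)⁻¹ * y2)
      + e^4 * ((e^2)⁻¹ * x3 + (p3 + p1') + (e^2)⁻¹ * (y3 + w1))
      = ((e^2)⁻¹*((e^2)⁻¹*x0) + (e^2)⁻¹*x1 + x2 + e^2*x3)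
        + ((e^2)⁻¹*((e^2)⁻¹*y0) + (e^2)⁻¹*y1 + y2 + e^2*y3)
        + ((e^2)⁻¹*p0 + p1 + e^2*p2 + e^4*p3) + (e^2*p0' + e^4*p1') + (w0 + e^2*w1) + z0 := by
    linear_combination (z0 + w0 + x2 + y2) * r1 + (x3 + y3 + w1) * r2
  rw [T]
  have s1 : 0 ≤ (e^2)⁻¹*((e^2)⁻¹*x0) + (e^2)⁻¹*x1 + x2 + e^2*x3 := by positivity
  have s2 : 0 ≤ (e^2)⁻¹*((e^2)⁻¹*y0) + (e^2)⁻¹*y1 + y2 + e^2*y3 := by positivity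
  have s3 : 0 ≤ e^2*p0' + e^4*p1' := by positivity
  have s4 : 0 ≤ w0 + e^2*w1 := by positivity
  linarith

lemma E5_le {e : ℝ} (he : 0 < e) (a b c d : Alg) (t : ℝ) :
    e ^ 4 * E5 e (sl a) (pr b c) (sl d) t ≤ 16 * Ex e (e⁻¹ • a) b c (e⁻¹ • d) t := by
  have n1 := Sq_le he t 3 (e⁻¹ • a)
  have n2 := Nm_nn e t 0 (Dm e 0 (e⁻¹ • a))
  have n3 := Sq_le he t 3 b
  have n4 := Sq_le he t 3 c
  have n5 := Sq_le he t 3 (e⁻¹ • d)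
  have n6 := Sq_le he t 1 (Dm e 0 b)
  have n7 := Sq_le he t 1 (Dm e 0 c)
  have n8 := Sq_le he t 1 (Dm e 0 (e⁻¹ • d))
  have P3 := pr_le_Sq 3 b c t
  have P1' := pr_le_Sq 1 (dd (1,0,0) b) (dd (1,0,0) c) t
  have k1 := Nm_nn e t 3 (e⁻¹ • a)
  have k2 := Nm_nn e t 3 (e⁻¹ • d)
  have k3 := Nm_nn e t 1 (Dm e 0 (e⁻¹ • d))
  have k6 := Nm_nn e t 1 (Dm e 0 b)
  have k7 := Nm_nn e t 1 (Dm e 0 c)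
  unfold E5 Ex
  rw [dt_sl, dt_pr]
  simp only [show ∀ j f, dSq j (sl f t) = Sq j f t from fun _ _ => rfl]
  simp only [Pf.Dm0, dd_sm, Sq_smul] at *
  have e2 : 0 < e ^ 2 := by positivity
  have m1 : e ^ 4 * ((e^2)⁻¹ * Sq 3 a t) ≤ 8 * Nm e t 3 (e⁻¹ • a) := by
    rw [← mul_le_mul_iff_right₀ e2]; refine le_trans (le_of_eq ?_) (n1.trans (le_of_eq ?_)) <;> (field_simp; try ring)
  have m5 : e ^ 4 * ((e^2)⁻¹ * Sq 3 d t) ≤ 8 * Nm e t 3 (e⁻¹ • d) := by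
    rw [← mul_le_mul_iff_right₀ e2]; refine le_trans (le_of_eq ?_) (n5.trans (le_of_eq ?_)) <;> (field_simp; try ring)
  have m8 : e ^ 4 * ((e^2)⁻¹ * Sq 1 (dd (1,0,0) d) t) ≤ 2 * Nm e t 1 (e ^ 2 • e⁻¹ • dd (1, 0, 0) d) := by
    rw [← mul_le_mul_iff_right₀ e2]; refine le_trans (le_of_eq ?_) (n8.trans (le_of_eq ?_)) <;> (field_simp; try ring)
  have m3 : e ^ 4 * Sq 3 b t ≤ 8 * Nm e t 3 b := by
    rw [← mul_le_mul_iff_right₀ e2]; refine le_trans (le_of_eq ?_) (n3.trans (le_of_eq ?_)) <;> ring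
  have m4 : e ^ 4 * Sq 3 c t ≤ 8 * Nm e t 3 c := by
    rw [← mul_le_mul_iff_right₀ e2]; refine le_trans (le_of_eq ?_) (n4.trans (le_of_eq ?_)) <;> ring
  have m6 : e ^ 4 * Sq 1 (dd (1,0,0) b) t ≤ 2 * Nm e t 1 (e ^ 2 • dd (1, 0, 0) b) := by
    rw [← mul_le_mul_iff_right₀ e2]; refine le_trans (le_of_eq ?_) (n6.trans (le_of_eq ?_)) <;> ring
  have m7 : e ^ 4 * Sq 1 (dd (1,0,0) c) t ≤ 2 * Nm e t 1 (e ^ 2 • dd (1, 0, 0) c) := by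
    rw [← mul_le_mul_iff_right₀ e2]; refine le_trans (le_of_eq ?_) (n7.trans (le_of_eq ?_)) <;> ring
  have e4 : 0 ≤ e ^ 4 := by positivity
  have l1 := mul_le_mul_of_nonneg_left P3 e4
  have l2 := mul_le_mul_of_nonneg_left P1' e4
  linarith

def Dx (e : ℝ) (b c Θ : Alg) (t : ℝ) : ℝ := Nm e t 0 (Dm e 0 (Dm e 0 b)) + Nm e t 0 (Dm e 0 (Dm e 0 c))
  + Nm e t 0 (Dm e 0 (Dm e 0 Θ))

lemma D5_le {e : ℝ} (he : 0 < e) (a b c d : Alg) (t : ℝ) :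
    e ^ 4 * (L2Sq (dt (dt (pr b c)) t) + (e ^ 2)⁻¹ * L2Sq (dt (dt (sl d)) t))
      ≤ 2 * ((e ^ 2)⁻¹ * Dx e b c (e⁻¹ • d) t) := by
  rw [dt_sl, dt_sl, dt_pr, dt_pr]
  have h := pr_le_Sq 0 (dd (1,0,0) (dd (1,0,0) b)) (dd (1,0,0) (dd (1,0,0) c)) t
  have hd := Sq_nn 0 (dd (1,0,0) (dd (1,0,0) d)) t
  unfold Dx L2Sq
  simp only [Nm0, Pf.Dm0, dd_sm, Sq_smul]
  simp only [show ∀ j f, dSq j (sl f t) = Sq j f t from fun _ _ => rfl]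
  have e4 : 0 ≤ e ^ 4 := by positivity
  have l := mul_le_mul_of_nonneg_left h e4
  generalize Sq 0 (dd (1,0,0) (dd (1,0,0) d)) t = y at *
  generalize Sq 0 (dd (1,0,0) (dd (1,0,0) b)) t = x at *
  generalize Sq 0 (dd (1,0,0) (dd (1,0,0) c)) t = z at *
  have : 2 * ((e ^ 2)⁻¹ * ((e ^ 2)⁻¹ * ((e ^ 2) ^ 2 * ((e ^ 2) ^ 2 * x))
      + (e ^ 2)⁻¹ * ((e ^ 2) ^ 2 * ((e ^ 2) ^ 2 * z))
      + (e ^ 2)⁻¹ * ((e ^ 2) ^ 2 * ((e ^ 2) ^ 2 * (e⁻¹ ^ 2 * y)))))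
      = e ^ 4 * (2 * (x + z)) + 2 * (e ^ 2 * y) := by field_simp
  have r2 : e ^ 4 * ((e ^ 2)⁻¹ * y) = e ^ 2 * y := by field_simp
  have : 0 ≤ e ^ 2 * y := by positivity
  linarith

end Tr

set_option linter.unusedVariables false
set_option linter.unusedSimpArgs false
namespace Tr
open Pf (Alg ev dd mkA J Dm In Nm ca)

/-- functions of the vertical variable -/
def yA (h : ℝ → ℝ) (hh : ContDiff ℝ (⊤ : ℕ∞) h) : Alg :=
  mkA (fun p => h p.2.2) (hh.comp (by fun_prop)) (fun _ _ _ => rfl)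

lemma ev_dd_y {f : Alg} {h : ℝ → ℝ} (hh : ContDiff ℝ (⊤ : ℕ∞) h) (hf : ∀ p, ev f p = h p.2.2) (v p) :
    ev (dd v f) p = v.2.2 * deriv h p.2.2 := by
  have : ev f = h ∘ fun p : ℝ × ℝ × ℝ => p.2.2 := funext hf
  rw [Pf.ev_dd, this]
  have h1 : HasDerivAt h (deriv h p.2.2) p.2.2 := ((hh.differentiable (by simp)) _).hasDerivAt
  have h2 : HasFDerivAt (fun p : ℝ × ℝ × ℝ => p.2.2)
      ((ContinuousLinearMap.snd ℝ ℝ ℝ).comp (ContinuousLinearMap.snd ℝ ℝ (ℝ × ℝ))) p :=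
    ((ContinuousLinearMap.snd ℝ ℝ ℝ).comp (ContinuousLinearMap.snd ℝ ℝ (ℝ × ℝ))).hasFDerivAt
  have h3 := h1.hasFDerivAt.comp p h2
  rw [h3.fderiv]
  simp

/-- cut-off -/
def bump : ContDiffBump (1/2 : ℝ) := ⟨1, 3/2, by norm_num, by norm_num⟩
def q (α β : ℝ) (y : ℝ) : ℝ := α * (y - 1) - β * (y ^ 2 - y)
def ϑf (α β : ℝ) (y : ℝ) : ℝ := bump y * q α β y
lemma ϑf_smooth (α β) : ContDiff ℝ (⊤ : ℕ∞) (ϑf α β) := by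
  unfold ϑf
  refine ContDiff.mul bump.contDiff ?_
  unfold q; fun_prop
lemma ϑf_eq (α β) {y : ℝ} (hy : y ∈ Set.Ioo 0 1) : ϑf α β y = q α β y := by
  unfold ϑf
  rw [bump.one_of_mem_closedBall, one_mul]
  rw [Metric.mem_closedBall, Real.dist_eq, abs_le]
  show -1 ≤ _ ∧ _ ≤ (1:ℝ)
  constructor <;> linarith [hy.1, hy.2]
lemma ϑf_bd (α β) (hβ : 0 ≤ β) (y : ℝ) : |ϑf α β y| ≤ 2 * |α| + 2 * β := by
  unfold ϑf
  by_cases hy : y ∈ Metric.ball (1/2:ℝ) (3/2)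
  · rw [Metric.mem_ball, Real.dist_eq, abs_lt] at hy
    rw [abs_mul, abs_of_nonneg bump.nonneg]
    refine (mul_le_of_le_one_left (abs_nonneg _) bump.le_one).trans ?_
    unfold q
    have h1 : |y - 1| ≤ 2 := by rw [abs_le]; constructor <;> linarith
    have h2 : |y ^ 2 - y| ≤ 2 := by rw [abs_le]; constructor <;> nlinarith
    calc _ ≤ |α * (y - 1)| + |β * (y ^ 2 - y)| := abs_sub _ _
      _ = |α| * |y - 1| + β * |y ^ 2 - y| := by rw [abs_mul, abs_mul, abs_of_nonneg hβ]
      _ ≤ |α| * 2 + β * 2 := by gcongr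
      _ = _ := by ring
  · have : bump y = 0 := bump.zero_of_le_dist (by
      rw [Metric.mem_ball, not_lt] at hy; exact hy)
    rw [this]; simp; positivity
lemma ϑf_deriv (α β) {y : ℝ} (hy : y ∈ Set.Ioo 0 1) : deriv (ϑf α β) y = α - β * (2 * y - 1) := by
  have : ϑf α β =ᶠ[𝓝 y] q α β := by
    filter_upwards [isOpen_Ioo.mem_nhds hy] with z hz using ϑf_eq α β hz
  rw [this.deriv_eq]
  have h : HasDerivAt (q α β) (α * 1 - β * ((2:ℕ) * y ^ (2-1) - 1)) y :=
    (((hasDerivAt_id y).sub_const 1).const_mul α).sub (((hasDerivAt_pow 2 y).sub (hasDerivAt_id y)).const_mul β)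
  rw [h.deriv]; push_cast; ring

structure Bg (e α β : ℝ) where
  he : 0 < e
  hβ : 0 ≤ β
  hsm : e * (2 * |α| + 2 * β) ≤ 1 / 2

variable {e α β : ℝ}
lemma Bg.lo (h : Bg e α β) (y : ℝ) : 1/2 ≤ 1 + e * ϑf α β y := by
  have h1 := neg_abs_le (ϑf α β y)
  have h2 := ϑf_bd α β h.hβ y
  have h3 := h.hsm
  have : e * (-(2 * |α| + 2 * β)) ≤ e * ϑf α β y := mul_le_mul_of_nonneg_left (by linarith) h.he.le
  linarith

def ϑA (α β : ℝ) : Alg := yA (ϑf α β) (ϑf_smooth α β)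
def τA (e α β : ℝ) : Alg := 1 + ca e * ϑA α β
def sf (e α β : ℝ) (y : ℝ) : ℝ := (1 + e * ϑf α β y)⁻¹
lemma sf_smooth (h : Bg e α β) : ContDiff ℝ (⊤ : ℕ∞) (sf e α β) := by
  unfold sf
  exact (contDiff_const.add (contDiff_const.mul (ϑf_smooth α β))).inv fun y => by
    have := h.lo y; exact ne_of_gt (by linarith)
def sA (h : Bg e α β) : Alg := yA (sf e α β) (sf_smooth h)

lemma ev_ϑA (p) : ev (ϑA α β) p = ϑf α β p.2.2 := rfl
lemma ev_τA (p) : ev (τA e α β) p = 1 + e * ϑf α β p.2.2 := by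
  unfold τA; rw [Pf.ev_add, Pf.ev_ca, Pf.ev_one, ev_ϑA]
lemma ev_sA (h : Bg e α β) (p) : ev (sA h) p = (1 + e * ϑf α β p.2.2)⁻¹ := rfl
lemma sτ (h : Bg e α β) : sA h * τA e α β = 1 := Pf.ev_ext fun p => by
  rw [Pf.ev_mul, ev_sA, ev_τA, Pf.ev_one, inv_mul_cancel₀]
  have := h.lo p.2.2; exact ne_of_gt (by linarith)
lemma sA_pos (h : Bg e α β) (p) : 0 < ev (sA h) p := by
  rw [ev_sA]; have := h.lo p.2.2; exact inv_pos.2 (by linarith)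
lemma sA_le (h : Bg e α β) (p) : |ev (sA h) p| ≤ 2 := by
  rw [abs_of_pos (sA_pos h p), ev_sA]; have := h.lo p.2.2
  exact inv_le_of_inv_le₀ (by norm_num) (by linarith)
lemma ϑA0 : Dm e 0 (ϑA α β) = 0 := by
  rw [Pf.Dm0]; refine Pf.ev_ext fun p => ?_
  rw [Pf.ev_smul, ev_dd_y (ϑf_smooth α β) (ev_ϑA)]; simp
lemma ϑA1 : Dm e 1 (ϑA α β) = 0 := by
  rw [Pf.Dm1]; refine Pf.ev_ext fun p => ?_
  rw [Pf.ev_smul, ev_dd_y (ϑf_smooth α β) (ev_ϑA)]; simp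
lemma ϑA2 : Dm e 2 (ϑA α β) = ca e * dd (0,0,1) (ϑA α β) := by
  rw [Pf.Dm2, Algebra.smul_def]
lemma ev_tp {t : ℝ} {p : ℝ × ℝ} (hp : p ∈ Ω) : ev (dd (0,0,1) (ϑA α β)) (t, p) = α - β * (2 * p.2 - 1) := by
  rw [ev_dd_y (ϑf_smooth α β) (ev_ϑA)]
  simp only [one_mul]
  exact ϑf_deriv α β hp.2
lemma sA1 (h : Bg e α β) : dd (0,1,0) (sA h) = 0 := by
  refine Pf.ev_ext fun p => ?_
  rw [ev_dd_y (sf_smooth h) (fun p => rfl)]; simp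
lemma τA1 : dd (0,1,0) (τA e α β) = 0 := by
  unfold τA
  rw [Pf.dd_add, Pf.dd_mul, Pf.dd_alg]
  have h1 : dd (0,1,0) (1 : Alg) = 0 := by rw [← map_one (algebraMap ℝ Alg)]; exact Pf.dd_alg _ _
  have h2 : dd (0,1,0) (ϑA α β) = 0 := by
    refine Pf.ev_ext fun p => ?_
    rw [ev_dd_y (ϑf_smooth α β) (ev_ϑA)]; simp
  rw [h1, h2]; simp

end Tr

set_option linter.unusedVariables false
set_option linter.unusedSimpArgs false
namespace Tr
open Pf (Alg ev dd mkA J Dm In Nm ca)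

section cg
variable {F : Type*} [NormedAddCommGroup F] [NormedSpace ℝ F]
lemma fd_congr {f g : ℝ × ℝ → F} (h : ∀ x ∈ Ω, f x = g x) {x} (hx : x ∈ Ω) : fderiv ℝ f x = fderiv ℝ g x := by
  refine Filter.EventuallyEq.fderiv_eq ?_
  filter_upwards [Pf.Ω_open.mem_nhds hx] with y hy using h y hy
lemma d1_congr {f g : ℝ × ℝ → F} (h : ∀ x ∈ Ω, f x = g x) {x} (hx : x ∈ Ω) : d1 f x = d1 g x := by
  unfold d1; rw [fd_congr h hx]
lemma d2_congr {f g : ℝ × ℝ → F} (h : ∀ x ∈ Ω, f x = g x) {x} (hx : x ∈ Ω) : d2 f x = d2 g x := by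
  unfold d2; rw [fd_congr h hx]
end cg

variable {γ Pr r Re ε χ T : ℝ} {S : PerturbSol γ Pr r Re ε χ T}

def aφ (hS : SmoothSol S) : Alg := mkA (Function.uncurry S.φ) hS.1 (fun t x y => S.periodic_φ t (x, y))
def aθ (hS : SmoothSol S) : Alg := mkA (Function.uncurry S.θ) hS.2.2 (fun t x y => S.periodic_θ t (x, y))
def aψ1 (hS : SmoothSol S) : Alg := mkA (fun p => (Function.uncurry S.ψ p).1) hS.2.1.fst
  (fun t x y => congrArg Prod.fst (S.periodic_ψ t (x, y)))
def aψ2 (hS : SmoothSol S) : Alg := mkA (fun p => (Function.uncurry S.ψ p).2) hS.2.1.snd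
  (fun t x y => congrArg Prod.snd (S.periodic_ψ t (x, y)))

lemma φ_eq (hS : SmoothSol S) : S.φ = sl (aφ hS) := rfl
lemma θ_eq (hS : SmoothSol S) : S.θ = sl (aθ hS) := rfl
lemma ψ_eq (hS : SmoothSol S) : S.ψ = pr (aψ1 hS) (aψ2 hS) := rfl

/-- profile parameters -/
def al (ε χ : ℝ) : ℝ := (1 - χ) / ε
def be (γ Pr ε : ℝ) : ℝ := ε * (Pr / (2 * (γ / (γ - 1))))

lemma tT_eq (hε : 0 < ε) (t : ℝ) : ∀ x ∈ Ω, tT γ Pr ε χ x = sl (τA ε (al ε χ) (be γ Pr ε)) t x := by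
  intro x hx
  have : sl (τA ε (al ε χ) (be γ Pr ε)) t x = 1 + ε * ϑf (al ε χ) (be γ Pr ε) x.2 := ev_τA (t, x)
  rw [this, ϑf_eq _ _ hx.2]
  unfold tT q al be
  have : ε * ((1 - χ) / ε * (x.2 - 1) - ε * (Pr / (2 * (γ / (γ - 1)))) * (x.2 ^ 2 - x.2))
    = (1 - χ) * (x.2 - 1) - ε ^ 2 * Pr / (2 * (γ / (γ - 1))) * (x.2 ^ 2 - x.2) := by
    have : ε * ((1 - χ) / ε) = 1 - χ := by field_simp
    linear_combination (x.2 - 1) * this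
  rw [this]; ring
lemma tρ_eq (hε : 0 < ε) (h : Bg ε (al ε χ) (be γ Pr ε)) (t : ℝ) :
    ∀ x ∈ Ω, tρ γ Pr ε χ x = sl (sA h) t x := by
  intro x hx
  unfold tρ
  rw [tT_eq hε t x hx]
  have h1 : sl (τA ε (al ε χ) (be γ Pr ε)) t x = 1 + ε * ϑf (al ε χ) (be γ Pr ε) x.2 := ev_τA (t, x)
  rw [h1]; rfl

lemma divv_eq (b c : Alg) (t : ℝ) : divv (pr b c t) = sl (dd (0,1,0) b + dd (0,0,1) c) t := by
  funext x
  have h1 : d1 (sl b t) x = sl (dd (0,1,0) b) t x := by rw [d1_sl]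
  have h2 : d2 (sl c t) x = sl (dd (0,0,1) c) t x := by rw [d2_sl]
  show d1 (sl b t) x + d2 (sl c t) x = _
  rw [h1, h2]; rfl
lemma lap_eq (f : Alg) (t : ℝ) (x) : lap (sl f t) x
    = ev (dd (0,1,0) (dd (0,1,0) f)) (t, x) + ev (dd (0,0,1) (dd (0,0,1) f)) (t, x) := by
  unfold lap; rw [d1_sl, d1_sl, d2_sl, d2_sl]; rfl
lemma grad_eq (f : Alg) (t : ℝ) (x) : grad (sl f t) x = (ev (dd (0,1,0) f) (t, x), ev (dd (0,0,1) f) (t, x)) := by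
  unfold grad; rw [d1_sl, d2_sl]; rfl
lemma d1_eq (f : Alg) (t : ℝ) (x) : d1 (sl f t) x = ev (dd (0,1,0) f) (t, x) := by rw [d1_sl]; rfl
lemma d2_eq (f : Alg) (t : ℝ) (x) : d2 (sl f t) x = ev (dd (0,0,1) f) (t, x) := by rw [d2_sl]; rfl

lemma grad_congr {f g : ℝ × ℝ → ℝ} (h : ∀ x ∈ Ω, f x = g x) {x} (hx : x ∈ Ω) : grad f x = grad g x := by
  unfold grad; rw [d1_congr h hx, d2_congr h hx]

lemma d1_snd (x : ℝ × ℝ) : d1 (fun y : ℝ × ℝ => y.2) x = 0 := by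
  unfold d1; rw [fderiv_snd]; rfl
lemma d2_snd (x : ℝ × ℝ) : d2 (fun y : ℝ × ℝ => y.2) x = 1 := by
  unfold d2; rw [fderiv_snd]; rfl
lemma d1_c0 (x : ℝ × ℝ) : d1 (fun y : ℝ × ℝ => (0:ℝ)) x = 0 := by
  unfold d1; rw [fderiv_const_apply]; rfl
lemma d2_c0 (x : ℝ × ℝ) : d2 (fun y : ℝ × ℝ => (0:ℝ)) x = 0 := by
  unfold d2; rw [fderiv_const_apply]; rfl

section eqs
variable (hS : SmoothSol S) (hε : 0 < ε) (h : Bg ε (al ε χ) (be γ Pr ε)) {t : ℝ} (ht : t ∈ Set.Icc (0:ℝ) T)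
  {x : ℝ × ℝ} (hx : x ∈ Ω)

lemma mass' (hS : SmoothSol S) (hε : 0 < ε) (h : Bg ε (al ε χ) (be γ Pr ε)) {t : ℝ} (ht : t ∈ Set.Icc (0:ℝ) T)
  {x : ℝ × ℝ} (hx : x ∈ Ω) : ev (dd (1,0,0) (aφ hS)) (t,x)
    + ((x.2 + ev (aψ1 hS) (t,x)) * ev (dd (0,1,0) (aφ hS)) (t,x) + ev (aψ2 hS) (t,x) * ev (dd (0,0,1) (aφ hS)) (t,x))
    + (ev (sA h) (t,x) + ev (aφ hS) (t,x)) * (ev (dd (0,1,0) (aψ1 hS)) (t,x) + ev (dd (0,0,1) (aψ2 hS)) (t,x))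
    + ev (aψ2 hS) (t,x) * ev (dd (0,0,1) (sA h)) (t,x) = 0 := by
  have m := S.mass_eq t ht x hx
  rw [grad_congr (tρ_eq hε h t) hx, pρ, tρ_eq hε h t x hx, φ_eq hS, ψ_eq hS, dt_sl, divv_eq, grad_eq, grad_eq,
    sA1 h] at m
  simp only [dot, pu, tu, pr, sl, Pf.ev_add, Pf.ev_zero, Prod.mk_add_mk] at m
  linear_combination m

lemma mom1' (hS : SmoothSol S) (hε : 0 < ε) (h : Bg ε (al ε χ) (be γ Pr ε)) {t : ℝ} (ht : t ∈ Set.Icc (0:ℝ) T)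
  {x : ℝ × ℝ} (hx : x ∈ Ω) :
    (ev (sA h) (t,x) + ev (aφ hS) (t,x)) * (ev (dd (1,0,0) (aψ1 hS)) (t,x)
      + ((x.2 + ev (aψ1 hS) (t,x)) * ev (dd (0,1,0) (aψ1 hS)) (t,x) + ev (aψ2 hS) (t,x) * ev (dd (0,0,1) (aψ1 hS)) (t,x))
      + ev (aψ2 hS) (t,x))
    + (ε ^ 2)⁻¹ * ev (dd (0,1,0) ((sA h + aφ hS) * (τA ε (al ε χ) (be γ Pr ε) + aθ hS))) (t,x)
    - Re⁻¹ * (ev (dd (0,1,0) (dd (0,1,0) (aψ1 hS))) (t,x) + ev (dd (0,0,1) (dd (0,0,1) (aψ1 hS))) (t,x))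
    - (Re⁻¹ + r * Re⁻¹) * ev (dd (0,1,0) (dd (0,1,0) (aψ1 hS) + dd (0,0,1) (aψ2 hS))) (t,x) = 0 := by
  have m := S.mom_eq1 t ht x hx
  have hp : ∀ y ∈ Ω, pρ γ Pr ε χ S.φ t y * pT γ Pr ε χ S.θ t y
      = sl ((sA h + aφ hS) * (τA ε (al ε χ) (be γ Pr ε) + aθ hS)) t y := by
    intro y hy
    rw [pρ, pT, tρ_eq hε h t y hy, tT_eq hε t y hy]; rfl
  rw [d1_congr hp hx, d1_eq, pρ, tρ_eq hε h t x hx, φ_eq hS, ψ_eq hS, dt_pr, divv_eq, d1_eq] at m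
  have e1 : (fun y => (pr (aψ1 hS) (aψ2 hS) t y).1) = sl (aψ1 hS) t := rfl
  have e2 : (fun y => (tu y).1) = fun y : ℝ × ℝ => y.2 := rfl
  rw [e1, e2, grad_eq, lap_eq, grad, d1_snd, d2_snd] at m
  simp only [dot, pu, tu, pr, sl, Pf.ev_add, Pf.ev_zero, Prod.mk_add_mk] at m
  linear_combination m

lemma mom2' (hS : SmoothSol S) (hε : 0 < ε) (h : Bg ε (al ε χ) (be γ Pr ε)) {t : ℝ} (ht : t ∈ Set.Icc (0:ℝ) T)
  {x : ℝ × ℝ} (hx : x ∈ Ω) :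
    (ev (sA h) (t,x) + ev (aφ hS) (t,x)) * (ev (dd (1,0,0) (aψ2 hS)) (t,x)
      + ((x.2 + ev (aψ1 hS) (t,x)) * ev (dd (0,1,0) (aψ2 hS)) (t,x) + ev (aψ2 hS) (t,x) * ev (dd (0,0,1) (aψ2 hS)) (t,x)))
    + (ε ^ 2)⁻¹ * ev (dd (0,0,1) ((sA h + aφ hS) * (τA ε (al ε χ) (be γ Pr ε) + aθ hS))) (t,x)
    - Re⁻¹ * (ev (dd (0,1,0) (dd (0,1,0) (aψ2 hS))) (t,x) + ev (dd (0,0,1) (dd (0,0,1) (aψ2 hS))) (t,x))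
    - (Re⁻¹ + r * Re⁻¹) * ev (dd (0,0,1) (dd (0,1,0) (aψ1 hS) + dd (0,0,1) (aψ2 hS))) (t,x) = 0 := by
  have m := S.mom_eq2 t ht x hx
  have hp : ∀ y ∈ Ω, pρ γ Pr ε χ S.φ t y * pT γ Pr ε χ S.θ t y
      = sl ((sA h + aφ hS) * (τA ε (al ε χ) (be γ Pr ε) + aθ hS)) t y := by
    intro y hy
    rw [pρ, pT, tρ_eq hε h t y hy, tT_eq hε t y hy]; rfl
  rw [d2_congr hp hx, d2_eq, pρ, tρ_eq hε h t x hx, φ_eq hS, ψ_eq hS, dt_pr, divv_eq, d2_eq] at m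
  have e1 : (fun y => (pr (aψ1 hS) (aψ2 hS) t y).2) = sl (aψ2 hS) t := rfl
  have e2 : (fun y => (tu y).2) = fun y : ℝ × ℝ => 0 := rfl
  rw [e1, e2, grad_eq, lap_eq, grad, d1_c0, d2_c0] at m
  simp only [dot, pu, tu, pr, sl, Pf.ev_add, Pf.ev_zero, Prod.mk_add_mk] at m
  linear_combination m

lemma energy' (hS : SmoothSol S) (hε : 0 < ε) (h : Bg ε (al ε χ) (be γ Pr ε)) {t : ℝ} (ht : t ∈ Set.Icc (0:ℝ) T)
  {x : ℝ × ℝ} (hx : x ∈ Ω) :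
    (ev (sA h) (t,x) + ev (aφ hS) (t,x)) * (γ - 1)⁻¹ * (ev (dd (1,0,0) (aθ hS)) (t,x)
      + ((x.2 + ev (aψ1 hS) (t,x)) * ev (dd (0,1,0) (aθ hS)) (t,x) + ev (aψ2 hS) (t,x) * ev (dd (0,0,1) (aθ hS)) (t,x))
      + ev (aψ2 hS) (t,x) * ev (dd (0,0,1) (τA ε (al ε χ) (be γ Pr ε))) (t,x))
    + (ev (sA h) (t,x) + ev (aφ hS) (t,x)) * (ev (τA ε (al ε χ) (be γ Pr ε)) (t,x) + ev (aθ hS) (t,x))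
      * (ev (dd (0,1,0) (aψ1 hS)) (t,x) + ev (dd (0,0,1) (aψ2 hS)) (t,x))
    - γ / (γ - 1) / (Re * Pr) * (ev (dd (0,1,0) (dd (0,1,0) (aθ hS))) (t,x) + ev (dd (0,0,1) (dd (0,0,1) (aθ hS))) (t,x))
    - ε ^ 2 * (2 * Re⁻¹ * (ev (dd (0,1,0) (aψ1 hS)) (t,x) ^ 2 + ev (dd (0,0,1) (aψ2 hS)) (t,x) ^ 2)
        + Re⁻¹ * (ev (dd (0,1,0) (aψ2 hS)) (t,x) + ev (dd (0,0,1) (aψ1 hS)) (t,x)) ^ 2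
        + 2 * Re⁻¹ * (ev (dd (0,1,0) (aψ2 hS)) (t,x) + ev (dd (0,0,1) (aψ1 hS)) (t,x))
        + r * Re⁻¹ * (ev (dd (0,1,0) (aψ1 hS)) (t,x) + ev (dd (0,0,1) (aψ2 hS)) (t,x)) ^ 2) = 0 := by
  have m := S.energy_eq t ht x hx
  rw [grad_congr (tT_eq hε t) hx, pT, tT_eq hε t x hx, pρ, tρ_eq hε h t x hx, φ_eq hS, ψ_eq hS, θ_eq hS,
    dt_sl, divv_eq, grad_eq, grad_eq, lap_eq, τA1] at m
  have e1 : (fun y => (pr (aψ1 hS) (aψ2 hS) t y).1) = sl (aψ1 hS) t := rfl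
  have e1' : (fun y => (pr (aψ1 hS) (aψ2 hS) t y).2) = sl (aψ2 hS) t := rfl
  have e2 : (fun y => (tu y).1) = fun y : ℝ × ℝ => y.2 := rfl
  have e3 : (fun y => (tu y).2) = fun y : ℝ × ℝ => 0 := rfl
  simp only [defContract, e1, e1', e2, e3, d1_snd, d2_snd, d1_c0, d2_c0, d1_eq, d2_eq] at m
  simp only [dot, pu, tu, pr, sl, Pf.ev_add, Pf.ev_zero, Prod.mk_add_mk, div_eq_mul_inv] at m
  simp only [div_eq_mul_inv]
  linear_combination m

end eqs

lemma J_const (hS : SmoothSol S) (hH : StdHyp S) (hε : 0 < ε) (h : Bg ε (al ε χ) (be γ Pr ε)) :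
    ∀ t ∈ Set.Icc (0:ℝ) T, J t (aφ hS) = 0 := by
  have h0 : J 0 (aφ hS) = 0 := hH.2.2.2.1
  have hd : ∀ t ∈ Set.Icc (0:ℝ) T, J t (dd (1,0,0) (aφ hS)) = 0 := by
    intro t ht
    set R : Alg := sA h + aφ hS with hR
    have k1 : J t (dd (0,1,0) (R * (Pf.X + aψ1 hS))) = 0 := Pf.J_dx _ _
    have k2 : J t (dd (0,0,1) (R * aψ2 hS)) = 0 := by
      refine Pf.J_dy _ _ (fun x => ?_) (fun x => ?_)
      · have : ev (aψ2 hS) (t, x, 0) = 0 := congrArg Prod.snd (S.bc_ψ t ht (x, 0) (Or.inl rfl))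
        rw [Pf.ev_mul, this, mul_zero]
      · have : ev (aψ2 hS) (t, x, 1) = 0 := congrArg Prod.snd (S.bc_ψ t ht (x, 1) (Or.inr rfl))
        rw [Pf.ev_mul, this, mul_zero]
    have k3 : J t (dd (1,0,0) (aφ hS) + dd (0,1,0) (R * (Pf.X + aψ1 hS)) + dd (0,0,1) (R * aψ2 hS)) = J t 0 := by
      refine Pf.J_congr fun p hp => ?_
      have m := mass' hS hε h ht hp
      have x1 : dd (0,1,0) Pf.X = 0 := by
        refine Pf.ev_ext fun p => ?_
        rw [ev_dd_y (h := id) contDiff_id (fun p => rfl)]; simp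
      have xe : ev Pf.X (t, p) = p.2 := rfl
      simp only [hR, Pf.dd_mul, Pf.dd_add, sA1, x1, Pf.ev_add, Pf.ev_mul, Pf.ev_zero, xe]
      linear_combination m
    have k4 : J t (0 : Alg) = 0 := by unfold J; simp
    rw [Pf.J_add, Pf.J_add, k1, k2, k4] at k3
    linarith
  intro t ht
  rw [← h0]
  refine constant_of_has_deriv_right_zero (f := fun t => J t (aφ hS)) (a := 0) (b := T) ?_ ?_ t ht
  · exact fun t _ => (Pf.J_dt (aφ hS) t).continuousAt.continuousWithinAt
  · intro u hu
    have := Pf.J_dt (aφ hS) u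
    rw [hd u ⟨hu.1, hu.2.le⟩] at this
    exact this.hasDerivWithinAt

end Tr

set_option linter.unusedVariables false
set_option linter.unusedSimpArgs false
namespace Tr
open Pf (Alg ev dd mkA J Dm In Nm ca Eqv Bd X Par Setup)

variable {γ Pr r Re ε χ T : ℝ} {S : PerturbSol γ Pr r Re ε χ T}

lemma ev_c (c : ℝ) (p) : ev (ca c) p = c := by
  have := Pf.ev_ca c 1 p
  rwa [mul_one, Pf.ev_one, mul_one] at this

lemma evX (t : ℝ) (p : ℝ × ℝ) : ev X (t, p) = p.2 := rfl

lemma mass2 (hS : SmoothSol S) (hε : 0 < ε) (h : Bg ε (al ε χ) (be γ Pr ε)) {Φ : Alg} (hΦ : aφ hS = ε • Φ) :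
    Eqv T (Dm ε 0 Φ + (ca ε * (X + aψ1 hS) * Dm ε 1 Φ + ca ε * aψ2 hS * Dm ε 2 Φ)
    + (sA h + ca ε * Φ) * (Dm ε 1 (aψ1 hS) + Dm ε 2 (aψ2 hS)) + aψ2 hS * Dm ε 2 (sA h)) 0 := by
  intro t ht p hp
  have m := mass' hS hε h ⟨ht.1.le, ht.2.le⟩ hp
  rw [hΦ] at m
  simp only [Pf.dd_smul, Pf.ev_smul] at m
  simp only [Pf.Dm0, Pf.Dm1, Pf.Dm2, Pf.dd_smul, Pf.ev_smul, Pf.ev_add, Pf.ev_mul, Pf.ev_zero, ev_c, evX]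
  linear_combination ε * m

lemma press (h : Bg ε (al ε χ) (be γ Pr ε)) (Φ Θ : Alg) (v) :
    dd v ((sA h + ε • Φ) * (τA ε (al ε χ) (be γ Pr ε) + ε • Θ))
      = ε • dd v (sA h * Θ + τA ε (al ε χ) (be γ Pr ε) * Φ + ca ε * Φ * Θ) := by
  have : (sA h + ε • Φ) * (τA ε (al ε χ) (be γ Pr ε) + ε • Θ)
      = ca 1 + ε • (sA h * Θ + τA ε (al ε χ) (be γ Pr ε) * Φ + ca ε * Φ * Θ) := by
    have k := sτ h
    simp only [Algebra.smul_def, map_one]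
    linear_combination k
  rw [this, Pf.dd_add, Pf.dd_alg, Pf.dd_smul, zero_add]

lemma mom12 (hS : SmoothSol S) (hε : 0 < ε) (h : Bg ε (al ε χ) (be γ Pr ε)) {Φ Θ : Alg} (hΦ : aφ hS = ε • Φ)
    (hΘ : aθ hS = ε • Θ) :
  Eqv T ((sA h + ca ε * Φ) * (Dm ε 0 (aψ1 hS) + (ca ε * (X + aψ1 hS) * Dm ε 1 (aψ1 hS) + ca ε * aψ2 hS * Dm ε 2 (aψ1 hS))
      + ca ε * (ca ε * aψ2 hS)) + Dm ε 1 (sA h * Θ + τA ε (al ε χ) (be γ Pr ε) * Φ + ca ε * Φ * Θ)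
      - ca Re⁻¹ * (Dm ε 1 (Dm ε 1 (aψ1 hS)) + Dm ε 2 (Dm ε 2 (aψ1 hS)))
      - ca (Re⁻¹ + r * Re⁻¹) * Dm ε 1 (Dm ε 1 (aψ1 hS) + Dm ε 2 (aψ2 hS))) 0 := by
  intro t ht p hp
  have m := mom1' hS hε h ⟨ht.1.le, ht.2.le⟩ hp
  rw [hΦ, hΘ, press] at m
  have k : ε ^ 2 * (ε ^ 2)⁻¹ = 1 := by field_simp
  simp only [Pf.ev_smul] at m
  simp only [Pf.Dm0, Pf.Dm1, Pf.Dm2, Pf.dd_smul, Pf.ev_smul, Pf.ev_add, Pf.ev_sub, Pf.ev_mul, Pf.ev_zero, ev_c, evX]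
  rw [Pf.dd_add (0,1,0) (ε • _) (ε • _)]
  rw [Pf.dd_add (0,1,0) (dd (0,1,0) (aψ1 hS))] at m
  simp only [Pf.dd_smul, Pf.ev_smul, Pf.ev_add] at m ⊢
  linear_combination ε ^ 2 * m -
    ε * ev (dd (0,1,0) (sA h * Θ + τA ε (al ε χ) (be γ Pr ε) * Φ + ca ε * Φ * Θ)) (t, p) * k

lemma mom22 (hS : SmoothSol S) (hε : 0 < ε) (h : Bg ε (al ε χ) (be γ Pr ε)) {Φ Θ : Alg} (hΦ : aφ hS = ε • Φ)
    (hΘ : aθ hS = ε • Θ) :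
  Eqv T ((sA h + ca ε * Φ) * (Dm ε 0 (aψ2 hS) + (ca ε * (X + aψ1 hS) * Dm ε 1 (aψ2 hS) + ca ε * aψ2 hS * Dm ε 2 (aψ2 hS)))
      + Dm ε 2 (sA h * Θ + τA ε (al ε χ) (be γ Pr ε) * Φ + ca ε * Φ * Θ)
      - ca Re⁻¹ * (Dm ε 1 (Dm ε 1 (aψ2 hS)) + Dm ε 2 (Dm ε 2 (aψ2 hS)))
      - ca (Re⁻¹ + r * Re⁻¹) * Dm ε 2 (Dm ε 1 (aψ1 hS) + Dm ε 2 (aψ2 hS))) 0 := by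
  intro t ht p hp
  have m := mom2' hS hε h ⟨ht.1.le, ht.2.le⟩ hp
  rw [hΦ, hΘ, press] at m
  have k : ε ^ 2 * (ε ^ 2)⁻¹ = 1 := by field_simp
  simp only [Pf.ev_smul] at m
  simp only [Pf.Dm0, Pf.Dm1, Pf.Dm2, Pf.dd_smul, Pf.ev_smul, Pf.ev_add, Pf.ev_sub, Pf.ev_mul, Pf.ev_zero, ev_c, evX]
  rw [Pf.dd_add (0,0,1) (ε • _) (ε • _)]
  rw [Pf.dd_add (0,0,1) (dd (0,1,0) (aψ1 hS))] at m
  simp only [Pf.dd_smul, Pf.ev_smul, Pf.ev_add] at m ⊢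
  linear_combination ε ^ 2 * m -
    ε * ev (dd (0,0,1) (sA h * Θ + τA ε (al ε χ) (be γ Pr ε) * Φ + ca ε * Φ * Θ)) (t, p) * k

lemma energy2 (hS : SmoothSol S) (hε : 0 < ε) (h : Bg ε (al ε χ) (be γ Pr ε)) {Φ Θ : Alg} (hΦ : aφ hS = ε • Φ)
    (hΘ : aθ hS = ε • Θ) :
  Eqv T (ca (γ - 1)⁻¹ * (sA h + ca ε * Φ) * (Dm ε 0 Θ
        + (ca ε * (X + aψ1 hS) * Dm ε 1 Θ + ca ε * aψ2 hS * Dm ε 2 Θ) + aψ2 hS * Dm ε 2 (τA ε (al ε χ) (be γ Pr ε)))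
      + (sA h + ca ε * Φ) * (τA ε (al ε χ) (be γ Pr ε) + ca ε * Θ) * (Dm ε 1 (aψ1 hS) + Dm ε 2 (aψ2 hS))
      - ca (γ / (γ - 1) / (Re * Pr)) * (Dm ε 1 (Dm ε 1 Θ) + Dm ε 2 (Dm ε 2 Θ))
      - (ca ε * (ca (2 * Re⁻¹) * (Dm ε 1 (aψ1 hS) * Dm ε 1 (aψ1 hS) + Dm ε 2 (aψ2 hS) * Dm ε 2 (aψ2 hS))
          + ca Re⁻¹ * ((Dm ε 1 (aψ2 hS) + Dm ε 2 (aψ1 hS)) * (Dm ε 1 (aψ2 hS) + Dm ε 2 (aψ1 hS)))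
          + ca (Re⁻¹ + r * Re⁻¹ - Re⁻¹) * ((Dm ε 1 (aψ1 hS) + Dm ε 2 (aψ2 hS)) * (Dm ε 1 (aψ1 hS) + Dm ε 2 (aψ2 hS))))
        + ca (2 * Re⁻¹) * (ca ε * (ca ε * (Dm ε 1 (aψ2 hS) + Dm ε 2 (aψ1 hS)))))) 0 := by
  intro t ht p hp
  have m := energy' hS hε h ⟨ht.1.le, ht.2.le⟩ hp
  rw [hΦ, hΘ] at m
  simp only [Pf.dd_smul, Pf.ev_smul] at m
  simp only [Pf.Dm0, Pf.Dm1, Pf.Dm2, Pf.dd_smul, Pf.ev_smul, Pf.ev_add, Pf.ev_sub, Pf.ev_mul, Pf.ev_zero, ev_c, evX]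
  linear_combination ε * m

/-- the parameters -/
def c0 (γ Pr : ℝ) : ℝ := Pr / (2 * (γ / (γ - 1)))
def K0 (γ Pr Kχ : ℝ) : ℝ := 2 * Kχ + 2 * c0 γ Pr
def M0 (γ Pr Kχ : ℝ) : ℝ := 1 + (1 + (γ - 1)⁻¹) * K0 γ Pr Kχ

lemma c0_pos {γ Pr : ℝ} (hγ : 1 < γ) (hPr : 0 < Pr) : 0 < c0 γ Pr := by
  have : 0 < γ - 1 := by linarith
  have : 0 < γ := by linarith
  unfold c0; positivity
lemma M0_pos {γ Pr Kχ : ℝ} (hγ : 1 < γ) (hPr : 0 < Pr) (hK : 0 < Kχ) : 0 < M0 γ Pr Kχ := by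
  have := c0_pos hγ hPr
  have : 0 < γ - 1 := by linarith
  unfold M0 K0; positivity

def mkPar {γ Pr r Kχ Re : ℝ} (hγ : 1 < γ) (hPr : 0 < Pr) (hr : 0 < 1 + r) (hK : 0 < Kχ) (hRe : 0 < Re)
    (h1 : M0 γ Pr Kχ ≤ Re⁻¹) (h2 : M0 γ Pr Kχ ≤ γ / (γ - 1) / (Re * Pr)) : Par where
  μ := Re⁻¹
  lam := Re⁻¹ + r * Re⁻¹
  κ := γ / (γ - 1) / (Re * Pr)
  g := (γ - 1)⁻¹
  K := K0 γ Pr Kχ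
  hlam := by
    have : Re⁻¹ + r * Re⁻¹ = (1 + r) * Re⁻¹ := by ring
    rw [this]; positivity
  hg := inv_pos.2 (by linarith)
  hK := by have := c0_pos hγ hPr; unfold K0; positivity
  hμ := h1
  hκ := h2

lemma al_le {Kχ : ℝ} (hε : 0 < ε) (hχ : |1 - χ| ≤ Kχ * ε) : |al ε χ| ≤ Kχ := by
  unfold al; rw [abs_div, abs_of_pos hε, div_le_iff₀ hε]; exact hχ
lemma be_eq : be γ Pr ε = ε * c0 γ Pr := rfl
lemma be_nn (hγ : 1 < γ) (hPr : 0 < Pr) (hε : 0 < ε) : 0 ≤ be γ Pr ε :=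
  mul_nonneg hε.le (c0_pos hγ hPr).le
lemma be_le (hγ : 1 < γ) (hPr : 0 < Pr) (hε1 : ε ≤ 1) : be γ Pr ε ≤ c0 γ Pr :=
  mul_le_of_le_one_left (c0_pos hγ hPr).le hε1

lemma mkBg {Kχ : ℝ} (hγ : 1 < γ) (hPr : 0 < Pr) (hK : 0 < Kχ) (hε : 0 < ε) (hε1 : ε ≤ 1)
    (hs : ε < (2 * K0 γ Pr Kχ)⁻¹) (hχ : |1 - χ| ≤ Kχ * ε) : Bg ε (al ε χ) (be γ Pr ε) where
  he := hε
  hβ := be_nn hγ hPr hε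
  hsm := by
    have h1 := al_le hε hχ
    have h2 := be_le hγ hPr hε1
    have hp : 0 < K0 γ Pr Kχ := by have := c0_pos hγ hPr; unfold K0; positivity
    have h3 : ε * K0 γ Pr Kχ ≤ 1/2 := by
      have := mul_le_mul_of_nonneg_right hs.le hp.le
      refine this.trans (le_of_eq ?_); field_simp
    refine le_trans (mul_le_mul_of_nonneg_left ?_ hε.le) h3
    unfold K0; linarith

lemma sm_inv (hε : 0 < ε) (f : Alg) : f = ε • (ε⁻¹ • f) := by
  rw [smul_smul, mul_inv_cancel₀ hε.ne', one_smul]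

def mkSetup {Kχ δ : ℝ} (hγ : 1 < γ) (hPr : 0 < Pr) (hr : 0 < 1 + r) (hK : 0 < Kχ) (hRe : 0 < Re)
    (h1 : M0 γ Pr Kχ ≤ Re⁻¹) (h2 : M0 γ Pr Kχ ≤ γ / (γ - 1) / (Re * Pr))
    (hε : 0 < ε) (hε1 : ε ≤ 1) (hεδ : ε ≤ δ) (hδ : δ ≤ 1)
    (hs : ε < (2 * K0 γ Pr Kχ)⁻¹) (hχ : |1 - χ| ≤ Kχ * ε) (hS : SmoothSol S) (hH : StdHyp S)
    (hN : 54 * Nfun ε S.φ S.ψ S.θ T ≤ δ ^ 2) :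
    Setup (mkPar (r := r) hγ hPr hr hK hRe h1 h2) where
  e := ε
  δ := δ
  T := T
  he := hε
  heδ := hεδ
  hδ := hδ
  Φ := ε⁻¹ • aφ hS
  Ψ1 := aψ1 hS
  Ψ2 := aψ2 hS
  Θ := ε⁻¹ • aθ hS
  s := sA (mkBg hγ hPr hK hε hε1 hs hχ)
  τ := τA ε (al ε χ) (be γ Pr ε)
  ϑ := ϑA (al ε χ) (be γ Pr ε)
  tp := dd (0,0,1) (ϑA (al ε χ) (be γ Pr ε))
  A := al ε χ + be γ Pr ε
  B := - 2 * be γ Pr ε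
  hA := by
    have a := al_le hε hχ
    have b := be_le hγ hPr hε1
    have b' := be_nn hγ hPr hε
    refine (abs_add_le _ _).trans ?_
    rw [abs_of_nonneg b']
    show _ ≤ 2 * Kχ + 2 * c0 γ Pr
    linarith
  hB := by
    have b := be_le hγ hPr hε1
    have b' := be_nn hγ hPr hε
    rw [abs_mul, abs_of_nonneg b']
    show |(-2:ℝ)| * _ ≤ 2 * Kχ + 2 * c0 γ Pr
    rw [abs_neg, abs_two]
    linarith
  hsτ := sτ _
  hτ := rfl
  hϑ0 := ϑA0
  hϑ1 := ϑA1
  hϑ2 := ϑA2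
  htp := by
    intro t ht p hp
    rw [ev_tp hp, Pf.ev_add, Pf.ev_mul, ev_c, ev_c, evX]; ring
  sB := fun t _ p _ => sA_le _ _
  sP := fun t _ p _ => sA_pos _ _
  ϑB := fun t _ p _ => by
    have a := al_le hε hχ
    have b := be_le hγ hPr hε1
    refine (ϑf_bd _ _ (be_nn hγ hPr hε) _).trans ?_
    show _ ≤ 2 * Kχ + 2 * c0 γ Pr
    linarith
  tpB := fun t _ p hp => by
    have a := al_le hε hχ
    have b := be_le hγ hPr hε1
    have b' := be_nn hγ hPr hε
    rw [ev_tp hp]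
    refine (abs_sub _ _).trans ?_
    rw [abs_mul, abs_of_nonneg b']
    have : |2 * p.2 - 1| ≤ 1 := by
      rw [abs_le]; constructor <;> linarith [hp.2.1, hp.2.2]
    have := mul_le_of_le_one_right b' this
    show _ ≤ 2 * Kχ + 2 * c0 γ Pr
    linarith
  bΨ1 := fun t ht x => ⟨congrArg Prod.fst (S.bc_ψ t ⟨ht.1.le, ht.2.le⟩ (x, 0) (Or.inl rfl)),
    congrArg Prod.fst (S.bc_ψ t ⟨ht.1.le, ht.2.le⟩ (x, 1) (Or.inr rfl))⟩
  bΨ2 := fun t ht x => ⟨congrArg Prod.snd (S.bc_ψ t ⟨ht.1.le, ht.2.le⟩ (x, 0) (Or.inl rfl)),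
    congrArg Prod.snd (S.bc_ψ t ⟨ht.1.le, ht.2.le⟩ (x, 1) (Or.inr rfl))⟩
  bΘ := fun t ht x => by
    have q0 : ev (aθ hS) (t, x, 0) = 0 := S.bc_θ t ⟨ht.1.le, ht.2.le⟩ (x, 0) (Or.inl rfl)
    have q1 : ev (aθ hS) (t, x, 1) = 0 := S.bc_θ t ⟨ht.1.le, ht.2.le⟩ (x, 1) (Or.inr rfl)
    rw [Pf.ev_smul, Pf.ev_smul, q0, q1, mul_zero]; exact ⟨rfl, rfl⟩
  mean := fun t ht => by
    rw [Pf.J_smul, J_const hS hH hε (mkBg hγ hPr hK hε hε1 hs hχ) t ⟨ht.1.le, ht.2.le⟩, mul_zero]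
  small := fun t ht => by
    have a := Ex_le hε (aφ hS) (aψ1 hS) (aψ2 hS) (aθ hS) t
    have b := En_le ε (aφ hS) (aψ1 hS) (aψ2 hS) (aθ hS) (s := t) (t := T) ⟨ht.1.le, ht.2.le⟩
    rw [← φ_eq hS, ← ψ_eq hS, ← θ_eq hS] at a b
    unfold Ex at a
    have n1 := Nm_nn ε t 0 (Dm ε 0 (ε⁻¹ • aφ hS))
    have n2 := Nm_nn ε t 1 (Dm ε 0 (aψ1 hS))
    have n3 := Nm_nn ε t 1 (Dm ε 0 (aψ2 hS))
    have n4 := Nm_nn ε t 1 (Dm ε 0 (ε⁻¹ • aθ hS))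
    linarith
  mass := mass2 hS hε _ (sm_inv hε _)
  mom1 := mom12 hS hε _ (sm_inv hε _) (sm_inv hε _)
  mom2 := mom22 hS hε _ (sm_inv hε _) (sm_inv hε _)
  energy := energy2 hS hε _ (sm_inv hε _) (sm_inv hε _)

end Tr

set_option linter.unusedVariables false
set_option linter.unusedSimpArgs false
namespace Tr
open Pf (Alg ev dd mkA J Dm In Nm ca Eqv Bd X Par Setup)

lemma Dx_cont (e : ℝ) (b c d : Alg) : Continuous (Dx e b c d) := by
  have := Pf.Nm_cont e
  unfold Dx; fun_prop (disch := assumption)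

lemma Ex_nn {e : ℝ} (a b c d : Alg) (t : ℝ) : 0 ≤ Ex e a b c d t := by
  unfold Ex
  have h : ∀ k f, 0 ≤ Nm e t k f := by intro k f; apply Nm_nn
  linarith [h 3 a, h 0 (Dm e 0 a), h 3 b, h 3 c, h 3 d, h 1 (Dm e 0 b), h 1 (Dm e 0 c), h 1 (Dm e 0 d)]

lemma A5_le {e : ℝ} (he : 0 < e) (a b c d : Alg) {t K L : ℝ} (ht : 0 ≤ t)
    (h1 : ∀ s ∈ Set.Icc 0 t, Ex e (e⁻¹ • a) b c (e⁻¹ • d) s ≤ K)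
    (h2 : (e ^ 2)⁻¹ * ∫ s in (0:ℝ)..t, Dx e b c (e⁻¹ • d) s ≤ L) :
    e ^ 4 * A5 e (sl a) (pr b c) (sl d) t ≤ 16 * K + 2 * L := by
  have hK : 0 ≤ K := (Ex_nn _ _ _ _ 0).trans (h1 0 ⟨le_rfl, ht⟩)
  have e4 : 0 < e ^ 4 := by positivity
  have hs : (⨆ s ∈ Set.Icc (0 : ℝ) t, E5 e (sl a) (pr b c) (sl d) s) ≤ 16 * K / e ^ 4 := by
    have hn : 0 ≤ 16 * K / e ^ 4 := by positivity
    refine Real.iSup_le (fun s => Real.iSup_le (fun h => ?_) hn) hn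
    rw [le_div_iff₀ e4, mul_comm]
    linarith [E5_le he a b c d s, h1 s h]
  have hi : e ^ 4 * (∫ s in (0 : ℝ)..t, (L2Sq (dt (dt (pr b c)) s) + (e ^ 2)⁻¹ * L2Sq (dt (dt (sl d)) s)))
      ≤ 2 * L := by
    have : ∫ s in (0:ℝ)..t, e ^ 4 * (L2Sq (dt (dt (pr b c)) s) + (e ^ 2)⁻¹ * L2Sq (dt (dt (sl d)) s))
        ≤ ∫ s in (0:ℝ)..t, 2 * ((e ^ 2)⁻¹ * Dx e b c (e⁻¹ • d) s) := by
      rw [intervalIntegral.integral_of_le ht, intervalIntegral.integral_of_le ht]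
      refine integral_mono_of_nonneg (Eventually.of_forall fun s => ?_) ?_
        (Eventually.of_forall fun s => D5_le he a b c d s)
      · have := L2_nn (dt (dt (pr b c)) s)
        have := L2_nn (dt (dt (sl d)) s)
        show (0:ℝ) ≤ _
        positivity
      · have hc : Continuous fun s => 2 * ((e ^ 2)⁻¹ * Dx e b c (e⁻¹ • d) s) := by
          have := Dx_cont e b c (e⁻¹ • d)
          fun_prop
        exact (hc.intervalIntegrable 0 t).1
    rw [intervalIntegral.integral_const_mul, intervalIntegral.integral_const_mul, intervalIntegral.integral_const_mul] at this
    linarith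
  have hm := mul_le_mul_of_nonneg_left hs e4.le
  rw [mul_div_cancel₀ _ e4.ne'] at hm
  show e ^ 4 * ((⨆ s ∈ Set.Icc (0 : ℝ) t, E5 e (sl a) (pr b c) (sl d) s) + _) ≤ _
  rw [mul_add]
  exact add_le_add hm hi

theorem main (γ Pr r Kχ : ℝ)
    (hγ : 1 < γ) (hPr : 0 < Pr) (hr : 0 < 1 + r) (hK : 0 < Kχ) :
    ∃ Re₀ ε₁ : ℝ, 0 < Re₀ ∧ 0 < ε₁ ∧
      ∀ Re : ℝ, 0 < Re → Re < Re₀ →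
        ∃ ε₂ N₂ C : ℝ, 0 < ε₂ ∧ 0 < N₂ ∧ 0 < C ∧
          ∀ (ε χ T : ℝ) (S : PerturbSol γ Pr r Re ε χ T),
            0 < ε → ε ≤ 1 → ε < ε₁ → ε ≤ ε₂ → 0 < χ → |1 - χ| ≤ Kχ * ε →
            |1 - χ| ≤ 1 / 2 → 0 ≤ T → SmoothSol S → StdHyp S →
            Nfun ε S.φ S.ψ S.θ T ≤ 1 → Nfun ε S.φ S.ψ S.θ T ≤ N₂ →
            ∀ t ∈ Set.Icc (0 : ℝ) T,
              ε ^ 4 * A5 ε S.φ S.ψ S.θ t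
                ≤ C * (ε ^ 4 * A5 ε S.φ S.ψ S.θ 0 + ε ^ 2 * A3 ε S.φ S.ψ S.θ 0
                    + ε ^ 2 * A4 ε S.φ S.ψ S.θ 0 + A1 ε S.φ S.ψ S.θ 0
                    + A2 ε S.φ S.ψ S.θ 0 + (ε ^ 2)⁻¹ * A0 ε S.φ S.ψ S.θ 0) := by
  have hM := M0_pos hγ hPr hK
  have hc0 := c0_pos hγ hPr
  have hg : 0 < γ / (γ - 1) := div_pos (by linarith) (by linarith)
  have hK0 : 0 < K0 γ Pr Kχ := by unfold K0; linarith
  refine ⟨min (M0 γ Pr Kχ)⁻¹ (γ / (γ - 1) / (Pr * M0 γ Pr Kχ)), (2 * K0 γ Pr Kχ)⁻¹,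
    by positivity, by positivity, fun Re hRe hR => ?_⟩
  have h1 : M0 γ Pr Kχ ≤ Re⁻¹ := by
    have := (hR.trans_le (min_le_left _ _)).le
    exact (le_inv_comm₀ hM hRe).2 this
  have h2 : M0 γ Pr Kχ ≤ γ / (γ - 1) / (Re * Pr) := by
    have := (hR.trans_le (min_le_right _ _)).le
    rw [le_div_iff₀ (by positivity)] at this ⊢
    linarith
  obtain ⟨δ0, C, hδ0, hC, H⟩ := Pf.closure_est (mkPar (r := r) hγ hPr hr hK hRe h1 h2)
  have hδ : 0 < min 1 δ0 := by positivity
  refine ⟨min 1 δ0, (min 1 δ0) ^ 2 / 54, 18 * 54 * (C + 1), hδ, by positivity, by positivity, ?_⟩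
  intro ε χ T S hε hε1 hs hε2 hχ hχ1 hχ2 hT hS hH hN1 hN2 t ht
  have hN : 54 * Nfun ε S.φ S.ψ S.θ T ≤ (min 1 δ0) ^ 2 := by linarith
  have hE0 : Ex ε (ε⁻¹ • aφ hS) (aψ1 hS) (aψ2 hS) (ε⁻¹ • aθ hS) 0 ≤ 54 * Nfun ε S.φ S.ψ S.θ 0 := by
    have p := Ex_le hε (aφ hS) (aψ1 hS) (aψ2 hS) (aθ hS) 0
    have q : En ε (sl (aφ hS)) (pr (aψ1 hS) (aψ2 hS)) (sl (aθ hS)) 0 ≤ Nfun ε S.φ S.ψ S.θ 0 :=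
      En_le ε (aφ hS) (aψ1 hS) (aψ2 hS) (aθ hS) (s := 0) (t := 0) ⟨le_rfl, le_rfl⟩
    linarith
  have hE := Ex_nn (e := ε) (ε⁻¹ • aφ hS) (aψ1 hS) (aψ2 hS) (ε⁻¹ • aθ hS) 0
  have hNe : Nfun ε S.φ S.ψ S.θ 0 = ε ^ 4 * A5 ε S.φ S.ψ S.θ 0 + ε ^ 2 * A3 ε S.φ S.ψ S.θ 0
                    + ε ^ 2 * A4 ε S.φ S.ψ S.θ 0 + A1 ε S.φ S.ψ S.θ 0
                    + A2 ε S.φ S.ψ S.θ 0 + (ε ^ 2)⁻¹ * A0 ε S.φ S.ψ S.θ 0 := by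
    unfold Nfun; ring
  rw [← hNe]
  set n := Nfun ε S.φ S.ψ S.θ 0
  have key : ε ^ 4 * A5 ε S.φ S.ψ S.θ t ≤ 16 * ((C + 1) * (54 * n)) + 2 * ((C + 1) * (54 * n)) := by
    rcases hT.eq_or_lt with h | hT
    · have t0 : t = 0 := le_antisymm (by rw [h]; exact ht.2) ht.1
      rw [t0]
      have := hE.trans hE0
      refine A5_le hε (aφ hS) (aψ1 hS) (aψ2 hS) (aθ hS) le_rfl (fun s hs => ?_) ?_
      · have : s = 0 := le_antisymm hs.2 hs.1
        rw [this]; nlinarith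
      · rw [intervalIntegral.integral_same]; nlinarith
    · have G := H (mkSetup hγ hPr hr hK hRe h1 h2 hε hε1 hε2 (min_le_left _ _) hs hχ1 hS hH hN)
        (min_le_right _ _) hT
      have hb : C * Ex ε (ε⁻¹ • aφ hS) (aψ1 hS) (aψ2 hS) (ε⁻¹ • aθ hS) 0 ≤ (C + 1) * (54 * n) :=
        mul_le_mul (by linarith) hE0 hE (by linarith)
      refine A5_le hε (aφ hS) (aψ1 hS) (aψ2 hS) (aθ hS) ht.1 (fun s hs => ?_) ?_
      · exact (G s ⟨hs.1, hs.2.trans ht.2⟩).1.trans hb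
      · exact (G t ht).2.trans hb
  linarith

end Tr

/-- `ε`-weighted `H³`-type estimate `ε⁴A₅`. -/
theorem third_order_weighted_estimate (γ Pr r Kχ : ℝ)
    (hγ : 1 < γ) (hPr : 0 < Pr) (hr : 0 < 1 + r) (hK : 0 < Kχ) :
    ∃ Re₀ ε₁ : ℝ, 0 < Re₀ ∧ 0 < ε₁ ∧
      ∀ Re : ℝ, 0 < Re → Re < Re₀ →
        ∃ ε₂ N₂ C : ℝ, 0 < ε₂ ∧ 0 < N₂ ∧ 0 < C ∧
          ∀ (ε χ T : ℝ) (S : PerturbSol γ Pr r Re ε χ T),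
            0 < ε → ε ≤ 1 → ε < ε₁ → ε ≤ ε₂ → 0 < χ → |1 - χ| ≤ Kχ * ε →
            |1 - χ| ≤ 1 / 2 → 0 ≤ T → SmoothSol S → StdHyp S →
            Nfun ε S.φ S.ψ S.θ T ≤ 1 → Nfun ε S.φ S.ψ S.θ T ≤ N₂ →
            ∀ t ∈ Set.Icc (0 : ℝ) T,
              ε ^ 4 * A5 ε S.φ S.ψ S.θ t
                ≤ C * (ε ^ 4 * A5 ε S.φ S.ψ S.θ 0 + ε ^ 2 * A3 ε S.φ S.ψ S.θ 0
                    + ε ^ 2 * A4 ε S.φ S.ψ S.θ 0 + A1 ε S.φ S.ψ S.θ 0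
                    + A2 ε S.φ S.ψ S.θ 0 + (ε ^ 2)⁻¹ * A0 ε S.φ S.ψ S.θ 0) := by
  exact Tr.main γ Pr r Kχ hγ hPr hr hK
end Couette
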